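/- Let d ≥ 4 and let (X_t)_{t≥0} be a simple random walk from the origin. Then: (i) E^0[cap(X[0,T])] = (1+o(1))·ε_d·T·(1 + log T·1_{d=4})^{-1} as T → ∞; (ii) cap(X[0,T])·T^{-1}·(1 + log T·1_{d=4}) converges to ε_d in probability as T → ∞; (iii) there exists C = C(d) < ∞ such that Var(cap(X[0,T])) < C·T²·log^{-4}T when d = 4 and Var(cap(X[0,T])) < C·T·log T when d ≥ 5; (iv) for all δ > 0, P^0[ |cap(X[0,T]) − E^0[cap(X[0,T])]| > δ·E^0[cap(X[0,T])] ] < C·δ^{-2}·log^{-2}T when d = 4 and < C·δ^{-2}·T^{-1}·log T when d ≥ 5. -/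

import Mathlib

open MeasureTheory ProbabilityTheory Filter Topology
open scoped ENNReal NNReal Classical

noncomputable section

namespace FRIPaper

/-- The lattice `ℤ^d`. -/
abbrev Zd (d : ℕ) := Fin d → ℤ

/-- `x` and `y` are nearest neighbours in `ℤ^d` (`ℓ¹`-distance one). -/
def IsNN {d : ℕ} (x y : Zd d) : Prop := (∑ i, (x i - y i).natAbs) = 1

/-- Event that a one-sided path never visits `A` at a positive time
(i.e. `H̃_A = ∞` for the path started anywhere). -/
def NoReturn {d : ℕ} (A : Set (Zd d)) : Set (ℕ → Zd d) := {ω | ∀ t : ℕ, 0 < t → ω t ∉ A}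

/-- Event that a one-sided path does not visit `A` at a positive time `t ≤ s`
(i.e. `H̃_A > s`). -/
def NoReturnUpTo {d : ℕ} (A : Set (Zd d)) (s : ℝ) : Set (ℕ → Zd d) :=
  {ω | ∀ t : ℕ, 0 < t → (t : ℝ) ≤ s → ω t ∉ A}

/-- Specification of the law `P^x` of the discrete-time simple random walk on `ℤ^d`
started at `x`, as a measure on the path space `ℕ → ℤ^d`: it is the unique probability
measure giving each nearest-neighbour cylinder of length `T` based at `x`
probability `(2d)^{-T}`. -/
def IsSRW (d : ℕ) (x : Zd d) (P : Measure (ℕ → Zd d)) : Prop :=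
  IsProbabilityMeasure P ∧
    ∀ (T : ℕ) (w : ℕ → Zd d),
      P {ω | ∀ t ≤ T, ω t = w t} =
        if w 0 = x ∧ ∀ t < T, IsNN (w t) (w (t + 1)) then
          (((2 * d : ℕ) : ℝ≥0∞))⁻¹ ^ T else 0

/-- A family `P x`, `x ∈ ℤ^d`, of simple random walk laws. -/
def IsSRWFamily (d : ℕ) (P : Zd d → Measure (ℕ → Zd d)) : Prop := ∀ x, IsSRW d x (P x)

/-- Equilibrium measure `e_A(x) = P^x[H̃_A = ∞] 1_{x ∈ A}`. -/
def equil {d : ℕ} (P : Zd d → Measure (ℕ → Zd d)) (A : Set (Zd d)) (x : Zd d) : ℝ :=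
  if x ∈ A then (P x (NoReturn A)).toReal else 0

/-- Capacity `cap(A) = Σ_{x∈A} e_A(x)`. -/
def capacity {d : ℕ} (P : Zd d → Measure (ℕ → Zd d)) (A : Finset (Zd d)) : ℝ :=
  ∑ x ∈ A, equil P (↑A) x

/-- Truncated capacity `cap(A,T) = Σ_{x∈A} P^x[H̃_A > T·(log T)^{-10}]`. -/
def capTrunc {d : ℕ} (P : Zd d → Measure (ℕ → Zd d)) (A : Finset (Zd d)) (T : ℝ) : ℝ :=
  ∑ x ∈ A, (P x (NoReturnUpTo (↑A) (T / (Real.log T) ^ (10 : ℕ)))).toReal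

/-- `X[a,b]`, the set of points visited by the path between times `a` and `b`. -/
def walkRange {d : ℕ} (ω : ℕ → Zd d) (a b : ℕ) : Finset (Zd d) := (Finset.Icc a b).image ω

/-- `E^0[cap(X[0,T])]`. -/
def capExpect {d : ℕ} (P : Zd d → Measure (ℕ → Zd d)) (T : ℕ) : ℝ :=
  ∫ ω, capacity P (walkRange ω 0 T) ∂ (P 0)

/-- `1 + log x · 1_{d = 4}`. -/
def logFour (d : ℕ) (x : ℝ) : ℝ := 1 + if d = 4 then Real.log x else 0

/-- `ε` is the constant `ε_d = lim_{T→∞} E^0[cap(X[0,T])]·T^{-1}·(1 + log T·1_{d=4})`,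
which lies in `(0,∞)`. -/
def IsCapLimit (d : ℕ) (P : Zd d → Measure (ℕ → Zd d)) (ε : ℝ) : Prop :=
  0 < ε ∧ Tendsto (fun T : ℕ => capExpect P T * logFour d T / (T : ℝ)) atTop (𝓝 ε)

/-! ### Distributions on `ℕ` -/

/-- `ρ` is a probability distribution on `ℕ`. -/
def IsDist (ρ : ℕ → ℝ) : Prop := (∀ k, 0 ≤ ρ k) ∧ HasSum ρ 1

/-- `k`-th moment `μ_k(ρ)`. -/
def mu (k : ℕ) (ρ : ℕ → ℝ) : ℝ := ∑' l : ℕ, (l : ℝ) ^ k * ρ l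

/-- Tail `μ_k^{(m)}(ρ) = Σ_{l ≥ m} l^k ρ(l)`. -/
def muTail (k m : ℕ) (ρ : ℕ → ℝ) : ℝ := ∑' l : ℕ, if m ≤ l then (l : ℝ) ^ k * ρ l else 0

/-- An appropriate family of distributions on `ℕ`. -/
def Appropriate (ρ : ℕ → ℕ → ℝ) : Prop :=
  (∀ n, IsDist (ρ n)) ∧
  (∀ n, Summable fun l : ℕ => (l : ℝ) ^ 2 * ρ n l) ∧
  Tendsto (fun n => mu 1 (ρ n)) atTop atTop ∧
  ∀ ε : ℝ, 0 < ε → ∃ C : ℝ,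
    ∀ n, (∑' L : ℕ, if C * mu 1 (ρ n) ≤ (L : ℝ) then (L : ℝ) ^ 2 * ρ n L / mu 2 (ρ n) else 0) ≤ ε

/-- Geometric distribution `Geo(λ)(k) = λ (1-λ)^k`. -/
def geo (lam : ℝ) (k : ℕ) : ℝ := lam * (1 - lam) ^ k

/-! ### Trajectories and finitary random interlacements -/

/-- A finite trajectory in `ℤ^d`, recorded as the list of its positions. -/
abbrev Traj (d : ℕ) := List (Zd d)

/-- A point configuration: the multiplicity of each trajectory. -/
abbrev Config (d : ℕ) := Traj d → ℕ

/-- A valid trajectory: a nonempty nearest-neighbour path. -/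
def ValidTraj {d : ℕ} (η : Traj d) : Prop := η ≠ [] ∧ η.Chain' IsNN

/-- The time length `T(η)` of a trajectory. -/
def len {d : ℕ} (η : Traj d) : ℕ := η.length - 1

/-- The range of a trajectory, as a set. -/
def rangeSet {d : ℕ} (η : Traj d) : Set (Zd d) := {y | y ∈ η}

/-- The trajectory `η` visits the set `A`. -/
def hits {d : ℕ} (η : Traj d) (A : Set (Zd d)) : Prop := ∃ y ∈ η, y ∈ A

/-- Poisson probability mass `e^{-r} r^n / n!`. -/
def poissonProb (r : ℝ) (n : ℕ) : ℝ≥0∞ :=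
  ENNReal.ofReal (Real.exp (-r) * r ^ n / n.factorial)

/-- The intensity `u·π({η})` that FRI with parameters `(u,ρ)` puts on a single
trajectory `η`: trajectories of length `l` from each starting point carry mass
`u·ρ(l)/(μ₁(ρ)+1)·(2d)^{-l}` each. -/
def friIntensity (d : ℕ) (u : ℝ) (ρ : ℕ → ℝ) (η : Traj d) : ℝ :=
  if ValidTraj η then u * ρ (len η) / (mu 1 ρ + 1) * (1 / (2 * (d : ℝ))) ^ (len η) else 0

/-- `P` is the law of a Poisson point process on the countable set of trajectories
with intensity function `ι`: the multiplicities of distinct trajectories are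
independent Poisson random variables. -/
def IsPoissonPP (d : ℕ) (ι : Traj d → ℝ) (P : Measure (Config d)) : Prop :=
  IsProbabilityMeasure P ∧
    ∀ (F : Finset (Traj d)) (k : Traj d → ℕ),
      P {ω | ∀ η ∈ F, ω η = k η} = ∏ η ∈ F, poissonProb (ι η) (k η)

/-- `P` is the law of the finitary random interlacements point process `𝒳^{u,ρ}`. -/
def IsFRI (d : ℕ) (u : ℝ) (ρ : ℕ → ℝ) (P : Measure (Config d)) : Prop :=
  IsPoissonPP d (friIntensity d u ρ) P

/-- `J` is the law of an i.i.d. sequence of copies of `𝒳^{u,ρ}`. -/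
def IsFRIseq (d : ℕ) (u : ℝ) (ρ : ℕ → ℝ) (J : Measure (ℕ → Config d)) : Prop :=
  IsProbabilityMeasure J ∧
    ∀ (F : Finset (ℕ × Traj d)) (k : ℕ × Traj d → ℕ),
      J {j | ∀ p ∈ F, j p.1 p.2 = k p} = ∏ p ∈ F, poissonProb (friIntensity d u ρ p.2) (k p)

/-! ### Percolation -/

/-- The edge `{x,y}` is traversed by some trajectory of the configuration `ω`. -/
def EdgeOpen {d : ℕ} (ω : Config d) (x y : Zd d) : Prop :=
  ∃ η : Traj d, 0 < ω η ∧ ∃ i : ℕ,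
    (η[i]? = some x ∧ η[i + 1]? = some y) ∨ (η[i]? = some y ∧ η[i + 1]? = some x)

/-- The cluster of `x` in the subgraph `ℐ` induced by the configuration `ω`. -/
def Cluster {d : ℕ} (ω : Config d) (x : Zd d) : Set (Zd d) :=
  {y | Relation.ReflTransGen (EdgeOpen ω) x y}

/-- The origin lies in an infinite cluster. -/
def PercEvent (d : ℕ) : Set (Config d) := {ω | (Cluster ω 0).Infinite}

/-- The critical intensity `u_*(ρ)`, given the family `u ↦ 𝒳^{u,ρ}`. -/
def uStar (d : ℕ) (X : ℝ → Measure (Config d)) : ℝ :=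
  sInf {u : ℝ | 0 ≤ u ∧ 0 < X u (PercEvent d)}

/-- The order `u_n = μ₁(ρ)·(1 + log μ₁(ρ)·1_{d=4}) / (ε_d·μ₂(ρ))` of the
critical intensity. -/
def uN (d : ℕ) (εd : ℝ) (ρ : ℕ → ℝ) : ℝ :=
  mu 1 ρ * logFour d (mu 1 ρ) / (εd * mu 2 ρ)

/-! ### `ρ`-capacity, Green function, `κ` and `φ` -/

/-- `e_A^{(ρ)}(x) = Σ_m (μ₀^{(m)}(ρ)/(μ₁(ρ)+1))·P^x[H̃_A > m]`. -/
def equilRho {d : ℕ} (P : Zd d → Measure (ℕ → Zd d)) (ρ : ℕ → ℝ) (A : Set (Zd d))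
    (x : Zd d) : ℝ :=
  ∑' m : ℕ, (muTail 0 m ρ / (mu 1 ρ + 1)) * (P x (NoReturnUpTo A (m : ℝ))).toReal

/-- `cap^{(ρ)}(A) = Σ_{x∈A} e_A^{(ρ)}(x)`. -/
def capRho {d : ℕ} (P : Zd d → Measure (ℕ → Zd d)) (ρ : ℕ → ℝ) (A : Finset (Zd d)) : ℝ :=
  ∑ x ∈ A, equilRho P ρ (↑A) x

/-- Green's function `g(x,y) = Σ_t P^x[X_t = y]`. -/
def green {d : ℕ} (P : Zd d → Measure (ℕ → Zd d)) (x y : Zd d) : ℝ :=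
  ∑' t : ℕ, (P x {ω | ω t = y}).toReal

/-- `φ^{(ρ)}(A,B) = Σ_{x∈A} Σ_{y∈B} e_A^{(ρ)}(x) e_B^{(ρ)}(y) g(x,y)`. -/
def phiRho {d : ℕ} (P : Zd d → Measure (ℕ → Zd d)) (ρ : ℕ → ℝ) (A B : Finset (Zd d)) : ℝ :=
  ∑ x ∈ A, ∑ y ∈ B, equilRho P ρ (↑A) x * equilRho P ρ (↑B) y * green P x y

/-- `κ^{(ρ)}(A) = Σ_{x∈A} Σ_m (μ₁^{(m)}(ρ)/μ₂(ρ))·P^x[H̃_A > m]` (real-valued,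
for finite `A`). -/
def kappa {d : ℕ} (P : Zd d → Measure (ℕ → Zd d)) (ρ : ℕ → ℝ) (A : Finset (Zd d)) : ℝ :=
  ∑ x ∈ A, ∑' m : ℕ, (muTail 1 m ρ / mu 2 ρ) * (P x (NoReturnUpTo (↑A) (m : ℝ))).toReal

/-- `κ^{(ρ)}(A)` as an extended-real valued quantity, for arbitrary `A`. -/
def kappaE {d : ℕ} (P : Zd d → Measure (ℕ → Zd d)) (ρ : ℕ → ℝ) (A : Set (Zd d)) : ℝ≥0∞ :=
  ∑' x : Zd d,
    A.indicator (fun x => ∑' m : ℕ,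
      ENNReal.ofReal (muTail 1 m ρ / mu 2 ρ) * P x (NoReturnUpTo A (m : ℝ))) x

/-! ### Exploration processes -/

/-- First components: the `k`-th layer `L_k` of vertices; second components:
`∪_{i<k} L_i`.  Layer `L_{k+1}` is spanned by the trajectories of `ω` meeting `L_k`
but not `∪_{i<k} L_i`. -/
def exploreSets {d : ℕ} (ω : Config d) : ℕ → Set (Zd d) × Set (Zd d)
  | 0 => ({0}, ∅)
  | k + 1 =>
    ({y | ∃ η : Traj d, 0 < ω η ∧ hits η (exploreSets ω k).1 ∧
        ¬ hits η (exploreSets ω k).2 ∧ y ∈ η},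
      (exploreSets ω k).1 ∪ (exploreSets ω k).2)

/-- The `i`-th layer `𝓛_i` of trajectories of the exploration of the cluster of the
origin, as a sub-configuration of `ω`. -/
def exploreLayer {d : ℕ} (ω : Config d) : ℕ → Config d
  | 0 => fun _ => 0
  | k + 1 => fun η =>
      if hits η (exploreSets ω k).1 ∧ ¬ hits η (exploreSets ω k).2 then ω η else 0

/-- The vertex sets `L'_k` of the dominating exploration driven by the i.i.d.
sequence `j`. -/
def exploreSets' {d : ℕ} (j : ℕ → Config d) : ℕ → Set (Zd d)
  | 0 => {0}
  | k + 1 => {y | ∃ η : Traj d, 0 < j (k + 1) η ∧ hits η (exploreSets' j k) ∧ y ∈ η}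

/-- The trajectory layers `𝓛'_i` of the dominating exploration. -/
def exploreLayer' {d : ℕ} (j : ℕ → Config d) : ℕ → Config d
  | 0 => fun _ => 0
  | k + 1 => fun η => if hits η (exploreSets' j k) then j (k + 1) η else 0

/-- `W_k = 𝔼[κ^{(ρ)}(L'_k)]`. -/
def Wexp {d : ℕ} (P : Zd d → Measure (ℕ → Zd d)) (ρ : ℕ → ℝ)
    (J : Measure (ℕ → Config d)) (k : ℕ) : ℝ≥0∞ :=
  ∫⁻ j, kappaE P ρ (exploreSets' j k) ∂ J

/-- `V_k = 𝔼[|L'_k|]`, multiplied by `(log μ₁(ρ))⁻¹` when `d = 4`. -/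
def Vexp (d : ℕ) (ρ : ℕ → ℝ) (J : Measure (ℕ → Config d)) (k : ℕ) : ℝ≥0∞ :=
  (if d = 4 then ENNReal.ofReal (1 / Real.log (mu 1 ρ)) else 1) *
    ∫⁻ j, ENat.toENNReal (exploreSets' j k).encard ∂ J

/-! ### Two-sided finite random walk trajectories -/

/-- `μ(x,m,l)({η})`: the two-sided path `(X_{-m},…,X_l)` of a doubly infinite walk
with `X_0 = x` equals the list `η` (of length `m+l+1`, with `η[m] = x`)
with probability `(2d)^{-(m+l)}` for every admissible nearest-neighbour list. -/
def twoSidedProb (d : ℕ) (x : Zd d) (m l : ℕ) (η : Traj d) : ℝ :=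
  if η.length = m + l + 1 ∧ η.Chain' IsNN ∧ η[m]? = some x then
    (1 / (2 * (d : ℝ))) ^ (m + l) else 0

/-- The `ℓ^∞`-diameter of the range of `η` is at most `R`. -/
def DiamLE {d : ℕ} (η : Traj d) (R : ℝ) : Prop :=
  ∀ a ∈ η, ∀ b ∈ η, ∀ i, |((a i - b i : ℤ) : ℝ)| ≤ R

/-- `P^x[X[-m,-1] ∩ A = ∅]`: the probability that an `m`-step walk from `x`
avoids `A` at all positive times, written combinatorially. -/
def backAvoidProb (d : ℕ) (A : Set (Zd d)) (x : Zd d) (m : ℕ) : ℝ :=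
  ∑' w : Traj d,
    if w.length = m + 1 ∧ w.Chain' IsNN ∧ w[0]? = some x ∧
        (∀ i : ℕ, 0 < i → ∀ y, w[i]? = some y → y ∉ A) then
      (1 / (2 * (d : ℝ))) ^ m else 0

/-- `μ(x,m,l;A)({η}) = P^x[X[-m,l] = η | X[-m,-1] ∩ A = ∅]`. -/
def condTwoSidedProb (d : ℕ) (A : Set (Zd d)) (x : Zd d) (m l : ℕ) (η : Traj d) : ℝ :=
  (if ∀ i < m, ∀ y, η[i]? = some y → y ∉ A then twoSidedProb d x m l η else 0) /
    backAvoidProb d A x m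

/-- `π_A({η}) = Σ_{x∈A} Σ_{m,l} (ρ(m+l)/(μ₁(ρ)+1))·P^x[H̃_A > m]·μ(x,m,l;A)({η})`. -/
def piA (d : ℕ) (P : Zd d → Measure (ℕ → Zd d)) (ρ : ℕ → ℝ) (A : Finset (Zd d))
    (η : Traj d) : ℝ :=
  ∑ x ∈ A, ∑' m : ℕ, ∑' l : ℕ,
    ρ (m + l) / (mu 1 ρ + 1) * (P x (NoReturnUpTo (↑A) (m : ℝ))).toReal *
      condTwoSidedProb d (↑A) x m l η

/-- The sub-configuration of trajectories meeting `A`, i.e. `𝒳[A]`. -/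
def restrictConfig {d : ℕ} (A : Finset (Zd d)) (ω : Config d) : Config d :=
  fun η => if hits η (↑A) then ω η else 0

/-! ### Products and geometric laws -/

/-- The geometric measure `Geo(1/(T+1))` on `ℕ`. -/
def geoMeasure (T : ℕ) : Measure ℕ :=
  Measure.sum fun k : ℕ => (ENNReal.ofReal (geo (1 / ((T : ℝ) + 1)) k)) • Measure.dirac k

/-- `Q` is the product (independent coupling) of `μ` and `ν`. -/
def IsProdOf {α β : Type*} [MeasurableSpace α] [MeasurableSpace β]
    (Q : Measure (α × β)) (μ : Measure α) (ν : Measure β) : Prop :=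
  IsProbabilityMeasure Q ∧
    ∀ (A : Set α) (B : Set β), MeasurableSet A → MeasurableSet B → Q (A ×ˢ B) = μ A * ν B

/-! ### Coarse graining quantities -/

/-- The constant `c = 0.01`. -/
def cConst : ℝ := 0.01

/-- `R_n = ⌊√(μ₁(ρ_n))⌋`. -/
def Rn (ρ : ℕ → ℕ → ℝ) (n : ℕ) : ℕ := ⌊Real.sqrt (mu 1 (ρ n))⌋₊

/-- The mesoscopic scale `L_n`. -/
def Ln (d : ℕ) (ρ : ℕ → ℕ → ℝ) (n : ℕ) : ℝ :=
  if d = 4 then (Rn ρ n : ℝ) * (Real.log (Rn ρ n)) ^ (-cConst)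
  else (Rn ρ n : ℝ) ^ ((2 + cConst) / ((d : ℝ) - 2))

/-- The slowly growing factor `I_n`. -/
def In (d : ℕ) (ρ : ℕ → ℕ → ℝ) (n : ℕ) : ℝ :=
  if d = 4 then (Real.log (Rn ρ n)) ^ cConst else (Rn ρ n : ℝ) ^ cConst

/-- The scale `T'_n`. -/
def Tn' (d : ℕ) (ρ : ℕ → ℕ → ℝ) (n : ℕ) : ℕ :=
  if d = 4 then ⌊(Rn ρ n : ℝ) ^ (2 : ℕ) / Real.log (mu 1 (ρ n))⌋₊
  else ⌊(Rn ρ n : ℝ) ^ ((2 : ℝ) - cConst / 4)⌋₊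

/-- The scale `l_n`. -/
def lnPar (d : ℕ) (ρ : ℕ → ℕ → ℝ) (n : ℕ) : ℕ :=
  if d = 4 then ⌊(Rn ρ n : ℝ) * (Real.log (Rn ρ n)) ^ (-(2 * cConst))⌋₊
  else ⌊(Rn ρ n : ℝ) ^ ((1 : ℝ) - cConst / 4)⌋₊

/-- The scale `t_n`. -/
def tnPar (d : ℕ) (ρ : ℕ → ℕ → ℝ) (n : ℕ) : ℕ :=
  if d = 4 then ⌊(Rn ρ n : ℝ) ^ (2 : ℕ) / (Real.log (Rn ρ n)) ^ (10 : ℕ)⌋₊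
  else ⌊(Rn ρ n : ℝ) ^ ((2 : ℝ) - cConst)⌋₊

/-- `y` is within `ℓ^∞`-distance `r` of `z`. -/
def InBall {d : ℕ} (y z : Zd d) (r : ℝ) : Prop := ∀ i, |((y i - z i : ℤ) : ℝ)| ≤ r

/-- The `ℓ^∞` `r`-neighbourhood `B(A,r)`. -/
def nbhd {d : ℕ} (A : Set (Zd d)) (r : ℝ) : Set (Zd d) := {y | ∃ z ∈ A, InBall y z r}

/-- The sub-path `η[a, b]` of a trajectory. -/
def segment {d : ℕ} (η : Traj d) (a b : ℕ) : Traj d := (η.drop a).take (b - a + 1)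

/-- `η` is a typical trajectory (the event `𝒯_n = ℰ₁ ∩ ℰ₂ ∩ ℰ₃ ∩ ℰ₄`). -/
def Typical (d : ℕ) (P : Zd d → Measure (ℕ → Zd d)) (εd : ℝ) (ρ : ℕ → ℕ → ℝ)
    (kk KK M θ1 : ℝ) (n : ℕ) (η : Traj d) : Prop :=
  ValidTraj η ∧
  -- ℰ₁
  (kk * (Rn ρ n : ℝ) ^ 2 ≤ (len η : ℝ) ∧ (len η : ℝ) ≤ KK * (Rn ρ n : ℝ) ^ 2 ∧
    ∀ y ∈ η, InBall y η.headI (M * (Rn ρ n : ℝ))) ∧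
  -- ℰ₂
  (if d = 4 then
    (1 - θ1 ^ 2) * (Real.pi ^ 2 / 8) * (len η : ℝ) / Real.log (mu 1 (ρ n)) <
        capacity P η.toFinset ∧
      capTrunc P η.toFinset ((Rn ρ n : ℝ) ^ 2) <
        (1 + θ1 ^ 2) * (Real.pi ^ 2 / 8) * (len η : ℝ) / Real.log (mu 1 (ρ n))
  else
    (1 - θ1 ^ 2) * εd * (len η : ℝ) < capacity P η.toFinset ∧
      capacity P η.toFinset < (1 + θ1 ^ 2) * εd * (len η : ℝ)) ∧
  -- ℰ₃
  ((Set.ncard (nbhd (rangeSet η) (Ln d ρ n)) : ℝ) <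
    (Rn ρ n : ℝ) ^ 2 * (Ln d ρ n) ^ (d - 2) * (In d ρ n) ^ ((1 : ℝ) / 3)) ∧
  -- ℰ₄
  (∀ j : ℕ, j * Tn' d ρ n ≤ len η →
    if d = 4 then
      capacity P (segment η (j * Tn' d ρ n) (min ((j + 1) * Tn' d ρ n) (len η))).toFinset ≤
          (1 + θ1 ^ 2) * (Real.pi ^ 2 / 8) * (Tn' d ρ n : ℝ) / Real.log (mu 1 (ρ n)) ∧
        ∀ a ∈ segment η (j * Tn' d ρ n) (min ((j + 1) * Tn' d ρ n) (len η)),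
          ∀ b ∈ segment η (j * Tn' d ρ n) (min ((j + 1) * Tn' d ρ n) (len η)),
            ∀ i, |((a i - b i : ℤ) : ℝ)| <
              (1 / 2) * Real.sqrt (len η : ℝ) * (Real.log (mu 1 (ρ n))) ^ (-cConst)
    else
      capacity P (segment η (j * Tn' d ρ n) (min ((j + 1) * Tn' d ρ n) (len η))).toFinset ≤
        (1 + θ1 ^ 2) * εd * (Tn' d ρ n : ℝ))

/-- `x` belongs to the `*`-proper part `η̂` of the trajectory `η`. -/
def ProperStar (d : ℕ) (P : Zd d → Measure (ℕ → Zd d)) (ρ : ℕ → ℕ → ℝ)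
    (θ1 θ2 : ℝ) (n : ℕ) (η : Traj d) (x : Zd d) : Prop :=
  x ∈ rangeSet η ∧
    (if d = 4 then
      θ2 / Real.log (mu 1 (ρ n)) ≤ equil P (rangeSet η) x ∧
        (P x (NoReturnUpTo (rangeSet η)
            ((Rn ρ n : ℝ) ^ 2 / (Real.log (Rn ρ n)) ^ (10 : ℕ)))).toReal ≤
          (1 + θ1) * equil P (rangeSet η) x
    else θ2 ≤ equil P (rangeSet η) x)

set_option linter.unusedSimpArgs false
set_option linter.unusedVariables false
set_option linter.unusedSectionVars false

/-! ### Part 1: averages over walks -/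

abbrev Stp (d : ℕ) := Fin d × Bool

def vec {d : ℕ} (e : Stp d) : Zd d := Pi.single e.1 (if e.2 then 1 else -1)

def av {d : ℕ} (f : Stp d → ℝ) : ℝ := (∑ e, f e) / (2 * d)

def Ex {d : ℕ} : ℕ → (List (Stp d) → ℝ) → ℝ
  | 0, f => f []
  | n + 1, f => av fun e => Ex n fun l => f (e :: l)

section av
variable {d : ℕ}

lemma av_add (f g : Stp d → ℝ) : av (fun e => f e + g e) = av f + av g := by
  simp [av, Finset.sum_add_distrib, add_div]

lemma av_sub (f g : Stp d → ℝ) : av (fun e => f e - g e) = av f - av g := by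
  simp [av, Finset.sum_sub_distrib, sub_div]

lemma av_mul_left (c : ℝ) (f : Stp d → ℝ) : av (fun e => c * f e) = c * av f := by
  simp [av, ← Finset.mul_sum, mul_div_assoc]

lemma av_sum {ι : Type*} (s : Finset ι) (f : ι → Stp d → ℝ) :
    av (fun e => ∑ i ∈ s, f i e) = ∑ i ∈ s, av (f i) := by
  simp only [av]; rw [Finset.sum_comm, Finset.sum_div]

lemma av_mono {f g : Stp d → ℝ} (h : ∀ e, f e ≤ g e) : av f ≤ av g := by
  unfold av; gcongr; exact h _

lemma av_const [NeZero d] (c : ℝ) : av (d := d) (fun _ => c) = c := by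
  have : (d : ℝ) ≠ 0 := Nat.cast_ne_zero.mpr (NeZero.ne d)
  simp [av]; field_simp

lemma av_hasSum {ι : Type*} {f : ι → Stp d → ℝ} {g : Stp d → ℝ}
    (h : ∀ e, HasSum (fun i => f i e) (g e)) : HasSum (fun i => av (f i)) (av g) := by
  unfold av
  exact (hasSum_sum fun e _ => h e).div_const _

lemma av_tendsto {ι : Type*} {F : Filter ι} {f : ι → Stp d → ℝ} {g : Stp d → ℝ}
    (h : ∀ e, Tendsto (fun i => f i e) F (𝓝 (g e))) : Tendsto (fun i => av (f i)) F (𝓝 (av g)) := by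
  unfold av
  exact (tendsto_finsetSum _ fun e _ => h e).div_const _

lemma vec_neg (e : Stp d) : vec (e.1, !e.2) = - vec e := by
  obtain ⟨i, b⟩ := e
  cases b <;> simp [vec, ← Pi.single_neg]

def flipE (e : Stp d) : Stp d := (e.1, !e.2)

lemma flipE_flipE (e : Stp d) : flipE (flipE e) = e := by simp [flipE]
lemma vec_flipE (e : Stp d) : vec (flipE e) = - vec e := vec_neg e

def flipEquiv (d : ℕ) : Stp d ≃ Stp d := ⟨flipE, flipE, flipE_flipE, flipE_flipE⟩

lemma av_flip (f : Stp d → ℝ) : av (fun e => f (flipE e)) = av f := by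
  unfold av
  congr 1
  exact Equiv.sum_comp (flipEquiv d) f

end av

section Ex
variable {d : ℕ}

@[simp] lemma Ex_zero (f : List (Stp d) → ℝ) : Ex 0 f = f [] := rfl
lemma Ex_succ (n : ℕ) (f : List (Stp d) → ℝ) :
    Ex (n + 1) f = av fun e => Ex n fun l => f (e :: l) := rfl

lemma Ex_congr {n : ℕ} {f g : List (Stp d) → ℝ} (h : ∀ l, l.length = n → f l = g l) :
    Ex n f = Ex n g := by
  induction n generalizing f g with
  | zero => exact h _ rfl
  | succ n ih =>
    simp only [Ex_succ]; congr 1; funext e; exact ih fun l hl => h _ (by simp [hl])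

lemma Ex_mono {n : ℕ} {f g : List (Stp d) → ℝ} (h : ∀ l, l.length = n → f l ≤ g l) :
    Ex n f ≤ Ex n g := by
  induction n generalizing f g with
  | zero => exact h _ rfl
  | succ n ih =>
    simp only [Ex_succ]; exact av_mono fun e => ih fun l hl => h _ (by simp [hl])

lemma Ex_add (n : ℕ) (f g : List (Stp d) → ℝ) :
    Ex n (fun l => f l + g l) = Ex n f + Ex n g := by
  induction n generalizing f g with
  | zero => rfl
  | succ n ih => simp only [Ex_succ, ih, av_add]

lemma Ex_sub (n : ℕ) (f g : List (Stp d) → ℝ) :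
    Ex n (fun l => f l - g l) = Ex n f - Ex n g := by
  induction n generalizing f g with
  | zero => rfl
  | succ n ih => simp only [Ex_succ, ih, av_sub]

lemma Ex_mul_left (n : ℕ) (c : ℝ) (f : List (Stp d) → ℝ) :
    Ex n (fun l => c * f l) = c * Ex n f := by
  induction n generalizing f with
  | zero => rfl
  | succ n ih => simp only [Ex_succ, ih, av_mul_left]

lemma Ex_mul_right (n : ℕ) (c : ℝ) (f : List (Stp d) → ℝ) :
    Ex n (fun l => f l * c) = Ex n f * c := by
  simp only [mul_comm _ c, Ex_mul_left]

lemma Ex_div (n : ℕ) (c : ℝ) (f : List (Stp d) → ℝ) :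
    Ex n (fun l => f l / c) = Ex n f / c := by
  simp only [div_eq_mul_inv, Ex_mul_right]

lemma Ex_sum {ι : Type*} (n : ℕ) (s : Finset ι) (f : ι → List (Stp d) → ℝ) :
    Ex n (fun l => ∑ i ∈ s, f i l) = ∑ i ∈ s, Ex n (f i) := by
  induction n generalizing f with
  | zero => rfl
  | succ n ih => simp only [Ex_succ, ih, av_sum]

@[simp] lemma Ex_const [NeZero d] (n : ℕ) (c : ℝ) : Ex (d := d) n (fun _ => c) = c := by
  induction n with
  | zero => rfl
  | succ n ih => simp only [Ex_succ, ih, av_const]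

lemma Ex_nonneg {n : ℕ} {f : List (Stp d) → ℝ} (h : ∀ l, l.length = n → 0 ≤ f l) :
    0 ≤ Ex n f := by
  have := Ex_mono (n := n) (f := fun l : List (Stp d) => 0 * f l) (g := f)
    (fun l hl => by simpa using h l hl)
  rw [Ex_mul_left] at this; simpa using this

lemma Ex_le_const [NeZero d] {n : ℕ} {f : List (Stp d) → ℝ} {c : ℝ}
    (h : ∀ l, l.length = n → f l ≤ c) : Ex n f ≤ c := by
  simpa using Ex_mono (g := fun _ => c) h

lemma Ex_ge_const [NeZero d] {n : ℕ} {f : List (Stp d) → ℝ} {c : ℝ}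
    (h : ∀ l, l.length = n → c ≤ f l) : c ≤ Ex n f := by
  simpa using Ex_mono (f := fun _ => c) h

lemma Ex_append (m n : ℕ) (f : List (Stp d) → ℝ) :
    Ex (m + n) f = Ex m fun l1 => Ex n fun l2 => f (l1 ++ l2) := by
  induction m generalizing f with
  | zero => simp
  | succ m ih =>
    rw [show m + 1 + n = (m + n) + 1 by ring]
    simp only [Ex_succ, ih, List.cons_append]

lemma Ex_hasSum {ι : Type*} {n : ℕ} {f : ι → List (Stp d) → ℝ} {g : List (Stp d) → ℝ}
    (h : ∀ l, l.length = n → HasSum (fun i => f i l) (g l)) :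
    HasSum (fun i => Ex n (f i)) (Ex n g) := by
  induction n generalizing f g with
  | zero => exact h _ rfl
  | succ n ih =>
    simp only [Ex_succ]
    exact av_hasSum fun e => ih fun l hl => h _ (by simp [hl])

lemma Ex_tendsto {ι : Type*} {F : Filter ι} {n : ℕ} {f : ι → List (Stp d) → ℝ}
    {g : List (Stp d) → ℝ}
    (h : ∀ l, l.length = n → Tendsto (fun i => f i l) F (𝓝 (g l))) :
    Tendsto (fun i => Ex n (f i)) F (𝓝 (Ex n g)) := by
  induction n generalizing f g with
  | zero => exact h _ rfl
  | succ n ih =>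
    simp only [Ex_succ]
    exact av_tendsto fun e => ih fun l hl => h _ (by simp [hl])

lemma Ex_av (n : ℕ) (f : Stp d → List (Stp d) → ℝ) :
    Ex n (fun l => av fun e => f e l) = av fun e => Ex n fun l => f e l := by
  simp only [av]
  rw [Ex_div, Ex_sum]

lemma Ex_swap (m n : ℕ) (f : List (Stp d) → List (Stp d) → ℝ) :
    Ex m (fun l1 => Ex n fun l2 => f l1 l2) = Ex n fun l2 => Ex m fun l1 => f l1 l2 := by
  induction m generalizing f with
  | zero => rfl
  | succ m ih => simp only [Ex_succ, ih, Ex_av]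

lemma Ex_succ' (n : ℕ) (f : List (Stp d) → ℝ) :
    Ex (n + 1) f = Ex n fun l => av fun e => f (l ++ [e]) := by
  rw [Ex_append]; rfl

lemma Ex_reverse (n : ℕ) (f : List (Stp d) → ℝ) : Ex n (fun l => f l.reverse) = Ex n f := by
  induction n generalizing f with
  | zero => rfl
  | succ n ih =>
    rw [Ex_succ', Ex_succ]
    simp only [List.reverse_append, List.reverse_cons, List.reverse_nil, List.nil_append,
      List.singleton_append, Ex_av]
    congr 1; funext e
    exact ih fun l => f (e :: l)

lemma Ex_flip (n : ℕ) (f : List (Stp d) → ℝ) : Ex n (fun l => f (l.map flipE)) = Ex n f := by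
  induction n generalizing f with
  | zero => rfl
  | succ n ih =>
    simp only [Ex_succ, List.map_cons]
    rw [← av_flip (fun e => Ex n fun l => f (e :: l))]
    congr 1; funext e
    exact ih fun l => f (flipE e :: l)

lemma abs_Ex_le (n : ℕ) (f : List (Stp d) → ℝ) : |Ex n f| ≤ Ex n fun l => |f l| := by
  rw [abs_le]; constructor
  · have := Ex_mono (n := n) (f := fun l : List (Stp d) => (-1) * |f l|) (g := f)
      (fun l _ => by linarith [neg_abs_le (f l)])
    rw [Ex_mul_left] at this; linarith
  · exact Ex_mono fun l _ => le_abs_self _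

lemma Ex_sq_le [NeZero d] (n : ℕ) (f : List (Stp d) → ℝ) :
    (Ex n f) ^ 2 ≤ Ex n fun l => f l ^ 2 := by
  have h : 0 ≤ Ex n fun l => (f l - Ex n f) ^ 2 := Ex_nonneg fun l _ => sq_nonneg _
  have e : (fun l => (f l - Ex n f) ^ 2) =
      fun l => (f l ^ 2 - (2 * Ex n f) * f l) + (Ex n f) ^ 2 := by funext l; ring
  rw [e, Ex_add, Ex_sub, Ex_mul_left, Ex_const] at h
  nlinarith

/-- variance under `Ex` -/
def Vr (n : ℕ) (f : List (Stp d) → ℝ) : ℝ := Ex n (fun l => f l ^ 2) - (Ex n f) ^ 2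

lemma Vr_eq [NeZero d] (n : ℕ) (f : List (Stp d) → ℝ) :
    Vr n f = Ex n fun l => (f l - Ex n f) ^ 2 := by
  have e : (fun l => (f l - Ex n f) ^ 2) =
      fun l => (f l ^ 2 - (2 * Ex n f) * f l) + (Ex n f) ^ 2 := by funext l; ring
  rw [e, Ex_add, Ex_sub, Ex_mul_left, Ex_const, Vr]; ring

lemma Vr_nonneg [NeZero d] (n : ℕ) (f : List (Stp d) → ℝ) : 0 ≤ Vr n f := by
  rw [Vr_eq]; exact Ex_nonneg fun _ _ => sq_nonneg _

lemma Vr_le_sq_sub [NeZero d] (n : ℕ) (f : List (Stp d) → ℝ) (c : ℝ) :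
    Vr n f ≤ Ex n fun l => (f l - c) ^ 2 := by
  have e : (fun l => (f l - c) ^ 2) =
      fun l => (f l ^ 2 - (2 * c) * f l) + c ^ 2 := by funext l; ring
  rw [e, Ex_add, Ex_sub, Ex_mul_left, Ex_const, Vr]
  nlinarith [sq_nonneg (Ex n f - c)]

lemma Ex_exists_eq [NeZero d] (n : ℕ) (f : List (Stp d) → ℝ) (c : ℝ)
    (h : ∀ l, l.length = n → f l = c) : Ex n f = c := by
  rw [Ex_congr h, Ex_const]

end Ex

section walk
variable {d : ℕ}

def endp (l : List (Stp d)) : Zd d := (l.map vec).sum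

@[simp] lemma endp_nil : endp ([] : List (Stp d)) = 0 := rfl
@[simp] lemma endp_cons (e : Stp d) (l : List (Stp d)) : endp (e :: l) = vec e + endp l := by
  simp [endp]
@[simp] lemma endp_append (l l' : List (Stp d)) : endp (l ++ l') = endp l + endp l' := by
  simp [endp]
@[simp] lemma endp_reverse (l : List (Stp d)) : endp l.reverse = endp l := by
  simp [endp, List.sum_reverse]
lemma endp_flip (l : List (Stp d)) : endp (l.map flipE) = - endp l := by
  induction l with
  | nil => simp
  | cons e l ih => simp [ih, vec_flipE]; abel

/-- translate of a finite set -/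
def sh (x : Zd d) (A : Finset (Zd d)) : Finset (Zd d) := A.image (x + ·)

@[simp] lemma mem_sh {x y : Zd d} {A : Finset (Zd d)} : y ∈ sh x A ↔ y - x ∈ A := by
  simp only [sh, Finset.mem_image]
  constructor
  · rintro ⟨a, ha, rfl⟩; simpa using ha
  · intro h; exact ⟨_, h, by abel⟩

lemma sh_sh (x y : Zd d) (A : Finset (Zd d)) : sh x (sh y A) = sh (x + y) A := by
  ext z; simp [sub_sub]
@[simp] lemma sh_zero (A : Finset (Zd d)) : sh 0 A = A := by ext z; simp
lemma sh_union (x : Zd d) (A B : Finset (Zd d)) : sh x (A ∪ B) = sh x A ∪ sh x B := by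
  ext z; simp
lemma sum_sh (x : Zd d) (A : Finset (Zd d)) (f : Zd d → ℝ) :
    ∑ y ∈ sh x A, f y = ∑ y ∈ A, f (x + y) := by
  rw [sh, Finset.sum_image]; intro a _ b _ h; simpa using h
lemma sh_mono (x : Zd d) {A B : Finset (Zd d)} (h : A ⊆ B) : sh x A ⊆ sh x B := by
  intro z; simp only [mem_sh]; exact fun hz => h hz

/-- positions at times `0..length` -/
def rng (l : List (Stp d)) : Finset (Zd d) :=
  (Finset.range (l.length + 1)).image fun k => endp (l.take k)

/-- positions at times `1..length` -/
def trng (l : List (Stp d)) : Finset (Zd d) :=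
  (Finset.Icc 1 l.length).image fun k => endp (l.take k)

lemma mem_rng {l : List (Stp d)} {z : Zd d} :
    z ∈ rng l ↔ ∃ k ≤ l.length, endp (l.take k) = z := by
  simp [rng]
lemma mem_trng {l : List (Stp d)} {z : Zd d} :
    z ∈ trng l ↔ ∃ k, 1 ≤ k ∧ k ≤ l.length ∧ endp (l.take k) = z := by
  simp [trng, and_assoc]

@[simp] lemma rng_nil : rng ([] : List (Stp d)) = {0} := by
  ext z; simp [mem_rng, eq_comm]
lemma zero_mem_rng (l : List (Stp d)) : (0 : Zd d) ∈ rng l := mem_rng.mpr ⟨0, by simp, by simp⟩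
lemma trng_cons (e : Stp d) (l : List (Stp d)) : trng (e :: l) = sh (vec e) (rng l) := by
  ext z
  simp only [mem_trng, mem_sh, mem_rng]
  constructor
  · rintro ⟨k, h1, h2, h3⟩
    obtain ⟨k, rfl⟩ : ∃ j, k = j + 1 := ⟨k - 1, by omega⟩
    exact ⟨k, by simpa using h2, by rw [← h3]; simp⟩
  · rintro ⟨k, h1, h2⟩
    exact ⟨k + 1, by omega, by simpa using h1, by simp [h2]⟩
lemma rng_eq_insert (l : List (Stp d)) : rng l = insert 0 (trng l) := by
  ext z
  simp only [mem_trng, mem_rng, Finset.mem_insert]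
  constructor
  · rintro ⟨k, h1, h2⟩
    rcases Nat.eq_zero_or_pos k with rfl | hk
    · left; simpa using h2.symm
    · right; exact ⟨k, hk, h1, h2⟩
  · rintro (rfl | ⟨k, h0, h1, h2⟩)
    · exact ⟨0, by simp, by simp⟩
    · exact ⟨k, h1, h2⟩
lemma rng_cons (e : Stp d) (l : List (Stp d)) : rng (e :: l) = insert 0 (sh (vec e) (rng l)) := by
  rw [rng_eq_insert, trng_cons]
lemma trng_subset_rng (l : List (Stp d)) : trng l ⊆ rng l := by
  rw [rng_eq_insert]; exact Finset.subset_insert _ _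
lemma rng_append (l l' : List (Stp d)) : rng (l ++ l') = rng l ∪ sh (endp l) (rng l') := by
  induction l with
  | nil => simp [zero_mem_rng]
  | cons e l ih =>
    rw [List.cons_append, rng_cons, rng_cons, ih, sh_union, sh_sh, endp_cons, Finset.insert_union]
lemma trng_append (l l' : List (Stp d)) : trng (l ++ l') = trng l ∪ sh (endp l) (trng l') := by
  cases l with
  | nil => simp [trng]
  | cons e l =>
    rw [List.cons_append, trng_cons, trng_cons, rng_append, sh_union, sh_sh, endp_cons,
      rng_eq_insert l']
    have h : vec e + endp l ∈ sh (vec e) (rng l) := by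
      rw [mem_sh, mem_rng]; exact ⟨l.length, le_rfl, by simp⟩
    ext z
    simp only [Finset.mem_union, mem_sh, Finset.mem_insert] at *
    constructor
    · rintro (h1 | h1 | h1)
      · exact Or.inl h1
      · left; rw [sub_eq_zero] at h1; rw [h1]; exact h
      · exact Or.inr h1
    · rintro (h1 | h1)
      · exact Or.inl h1
      · exact Or.inr (Or.inr h1)
lemma rng_card_le (l : List (Stp d)) : (rng l).card ≤ l.length + 1 :=
  Finset.card_image_le.trans (by simp)
lemma trng_card_le (l : List (Stp d)) : (trng l).card ≤ l.length :=
  Finset.card_image_le.trans (by simp)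

/-- sums over the range are at most sums over times -/
lemma sum_rng_le (l : List (Stp d)) (f : Zd d → ℝ) (hf : ∀ x, 0 ≤ f x) :
    ∑ x ∈ rng l, f x ≤ ∑ k ∈ Finset.range (l.length + 1), f (endp (l.take k)) := by
  unfold rng
  exact Finset.sum_image_le_of_nonneg (fun x _ => hf x)

lemma sum_trng_le (l : List (Stp d)) (f : Zd d → ℝ) (hf : ∀ x, 0 ≤ f x) :
    ∑ x ∈ trng l, f x ≤ ∑ k ∈ Finset.Icc 1 l.length, f (endp (l.take k)) := by
  unfold trng
  exact Finset.sum_image_le_of_nonneg (fun x _ => hf x)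

/-- the reversed path seen from its end -/
def rv (l : List (Stp d)) : List (Stp d) := (l.map flipE).reverse

lemma Ex_rv (n : ℕ) (f : List (Stp d) → ℝ) : Ex n (fun l => f (rv l)) = Ex n f := by
  unfold rv
  rw [Ex_flip n (fun l => f l.reverse), Ex_reverse]

@[simp] lemma length_rv (l : List (Stp d)) : (rv l).length = l.length := by simp [rv]
lemma rv_rv (l : List (Stp d)) : rv (rv l) = l := by
  simp only [rv, List.map_reverse, List.reverse_reverse, List.map_map]
  conv_rhs => rw [← List.map_id l]
  congr 1; funext e; exact flipE_flipE e
lemma endp_rv (l : List (Stp d)) : endp (rv l) = - endp l := by simp [rv, endp_flip]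
lemma rv_cons (e : Stp d) (l : List (Stp d)) : rv (e :: l) = rv l ++ [flipE e] := by simp [rv]
lemma rv_append (l l' : List (Stp d)) : rv (l ++ l') = rv l' ++ rv l := by simp [rv]

lemma rng_rv (l : List (Stp d)) : rng l = sh (endp l) (rng (rv l)) := by
  induction l with
  | nil => simp [rv]
  | cons e l ih =>
    rw [rng_cons, rv_cons, rng_append, ih]
    ext z
    simp only [Finset.mem_insert, mem_sh, endp_cons, Finset.mem_union, rng_cons, endp_rv, vec_flipE,
      rng_nil, Finset.mem_singleton, sub_neg_eq_add, endp_nil]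
    have e1 : z - vec e - endp l = z - (vec e + endp l) := by abel
    have e2 : z - (vec e + endp l) + endp l = z - vec e := by abel
    rw [e1, e2]
    have h0 : (0 : Zd d) ∈ rng (rv l) ↔ True := by simp [zero_mem_rng]
    have h1 : - endp l ∈ rng (rv l) := by
      rw [← endp_rv, mem_rng]; exact ⟨(rv l).length, le_rfl, by rw [List.take_length]⟩
    constructor
    · rintro (rfl | h)
      · right; right; simp
      · exact Or.inl h
    · rintro (h | h | h)
      · exact Or.inr h
      · right
        have : z - (vec e + endp l) = - endp l := by
          rw [← sub_eq_zero, ← h]; abel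
        rw [this]; exact h1
      · left
        simpa using h

lemma endp_take_append_left (l l' : List (Stp d)) (k : ℕ) (h : k ≤ l.length) :
    endp ((l ++ l').take k) = endp (l.take k) := by
  rw [List.take_append_of_le_length h]

/-- marginal at time `k` -/
lemma Ex_take [NeZero d] {n k : ℕ} (h : k ≤ n) (f : List (Stp d) → ℝ) :
    Ex n (fun l => f (l.take k)) = Ex k f := by
  obtain ⟨m, rfl⟩ := Nat.exists_eq_add_of_le h
  rw [Ex_append]
  apply Ex_congr
  intro l hl
  have : ∀ l2 : List (Stp d), (l ++ l2).take k = l := fun l2 => by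
    rw [List.take_append_of_le_length hl.ge, List.take_of_length_le hl.le]
  simp [this]

end walk


/-! ### Part 2: heat kernel and its Fourier representation -/
section kernel
variable {d : ℕ}

def pk (t : ℕ) (x : Zd d) : ℝ := Ex t fun l => if endp l = x then 1 else 0

lemma pk_nonneg (t : ℕ) (x : Zd d) : 0 ≤ pk t x := Ex_nonneg fun l _ => by split_ifs <;> norm_num

lemma pk_zero (x : Zd d) : pk 0 x = if x = 0 then 1 else 0 := by
  simp only [pk, Ex_zero, endp_nil, eq_comm (a := (0 : Zd d))]

lemma pk_succ (t : ℕ) (x : Zd d) : pk (t + 1) x = av fun e => pk t (x - vec e) := by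
  unfold pk
  rw [Ex_succ]
  congr 1; funext e
  congr 1; funext l
  simp [eq_sub_iff_add_eq, add_comm]

lemma pk_neg (t : ℕ) (x : Zd d) : pk t (-x) = pk t x := by
  unfold pk
  rw [← Ex_flip]
  simp only [endp_flip, neg_inj]

lemma pk_CK (s t : ℕ) (x : Zd d) : Ex s (fun l => pk t (x + endp l)) = pk (s + t) x := by
  have h1 := Ex_flip s (fun l : List (Stp d) => pk t (x + endp l))
  rw [← h1]
  simp only [endp_flip]
  unfold pk
  rw [Ex_append]
  congr 1; funext l; congr 1; funext l'
  congr 1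
  simp only [endp_append, eq_iff_iff]
  constructor
  · intro h; rw [h]; abel
  · intro h; rw [← h]; abel

/-- expectation of a finitely supported function of the end point -/
lemma Ex_endp_eq_sum (t : ℕ) (A : Finset (Zd d)) (g : Zd d → ℝ) (hg : ∀ y, y ∉ A → g y = 0)
    (y : Zd d) : Ex t (fun l => g (y + endp l)) = ∑ a ∈ A, pk t (a - y) * g a := by
  have : ∀ l : List (Stp d), g (y + endp l) = ∑ a ∈ A, (if endp l = a - y then 1 else 0) * g a := by
    intro l
    have e : ∀ a, (endp l = a - y) = (a = y + endp l) := by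
      intro a; rw [eq_iff_iff]
      constructor
      · intro h; rw [h]; abel
      · intro h; rw [h]; abel
    simp only [e, ite_mul, one_mul, zero_mul, Finset.sum_ite_eq']
    split_ifs with h
    · rfl
    · exact hg _ h
  simp only [this, Ex_sum, Ex_mul_right]
  rfl

end kernel

section fourier
variable {d : ℕ}

def box (d : ℕ) : Set (Fin d → ℝ) := Set.pi Set.univ fun _ => Set.Ioc (-Real.pi) Real.pi

def ph (θ : Fin d → ℝ) : ℝ := (∑ i, Real.cos (θ i)) / d

def dt (θ : Fin d → ℝ) (x : Zd d) : ℝ := ∑ i, θ i * (x i : ℝ)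

def FI (f : (Fin d → ℝ) → ℝ) : ℝ := (∫ θ in box d, f θ) / (2 * Real.pi) ^ d

lemma box_meas : MeasurableSet (box d) := MeasurableSet.univ_pi fun _ => measurableSet_Ioc

lemma box_integrable {E : Type*} [NormedAddCommGroup E] {f : (Fin d → ℝ) → E} (hf : Continuous f) :
    IntegrableOn f (box d) := by
  have : IntegrableOn f (Set.Icc (fun _ : Fin d => -Real.pi) (fun _ => Real.pi)) :=
    hf.continuousOn.integrableOn_compact isCompact_Icc
  refine this.mono_set ?_
  intro θ hθ
  simp only [box, Set.mem_pi, Set.mem_univ, true_imp_iff, Set.mem_Ioc] at hθ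
  exact ⟨fun i => (hθ i).1.le, fun i => (hθ i).2⟩

@[fun_prop] lemma ph_cont : Continuous (ph (d := d)) := by unfold ph; fun_prop
@[fun_prop] lemma dt_cont (x : Zd d) : Continuous (fun θ => dt θ x) := by unfold dt; fun_prop

lemma FI_add {f g : (Fin d → ℝ) → ℝ} (hf : Continuous f) (hg : Continuous g) :
    FI (fun θ => f θ + g θ) = FI f + FI g := by
  unfold FI; rw [integral_add (box_integrable hf) (box_integrable hg), add_div]
lemma FI_sub {f g : (Fin d → ℝ) → ℝ} (hf : Continuous f) (hg : Continuous g) :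
    FI (fun θ => f θ - g θ) = FI f - FI g := by
  unfold FI; rw [integral_sub (box_integrable hf) (box_integrable hg), sub_div]
lemma FI_mul_left (c : ℝ) (f : (Fin d → ℝ) → ℝ) : FI (fun θ => c * f θ) = c * FI f := by
  unfold FI; rw [integral_const_mul, mul_div_assoc]
lemma FI_sum {ι : Type*} (s : Finset ι) {f : ι → (Fin d → ℝ) → ℝ} (hf : ∀ i, Continuous (f i)) :
    FI (fun θ => ∑ i ∈ s, f i θ) = ∑ i ∈ s, FI (f i) := by
  unfold FI; rw [integral_finsetSum _ fun i _ => box_integrable (hf i), Finset.sum_div]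
lemma FI_mono {f g : (Fin d → ℝ) → ℝ} (hf : Continuous f) (hg : Continuous g)
    (h : ∀ θ, f θ ≤ g θ) : FI f ≤ FI g := by
  unfold FI
  have := Real.pi_pos
  have := integral_mono (box_integrable hf) (box_integrable hg) h
  gcongr
lemma FI_nonneg {f : (Fin d → ℝ) → ℝ} (h : ∀ θ, 0 ≤ f θ) : 0 ≤ FI f := by
  unfold FI
  have := Real.pi_pos
  have := integral_nonneg (μ := volume.restrict (box d)) (f := f) h
  positivity

lemma abs_ph_le [NeZero d] (θ : Fin d → ℝ) : |ph θ| ≤ 1 := by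
  have hd : (0 : ℝ) < d := Nat.cast_pos.mpr (NeZero.pos d)
  unfold ph
  rw [abs_div, abs_of_pos hd, div_le_one hd]
  calc _ ≤ ∑ i : Fin d, |Real.cos (θ i)| := Finset.abs_sum_le_sum_abs _ _
    _ ≤ ∑ i : Fin d, (1 : ℝ) := Finset.sum_le_sum fun i _ => Real.abs_cos_le_one _
    _ = d := by simp

lemma int_exp (n : ℤ) : ∫ θ in Set.Ioc (-Real.pi) Real.pi, Complex.exp (Complex.I * (θ * n)) =
    if n = 0 then 2 * (Real.pi : ℂ) else 0 := by
  rw [← intervalIntegral.integral_of_le (by linarith [Real.pi_pos])]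
  split_ifs with h
  · subst h; simp; ring
  · have hc : (Complex.I * n : ℂ) ≠ 0 := by simp [h]
    have := integral_exp_mul_complex (a := -Real.pi) (b := Real.pi) hc
    have e : ∀ θ : ℝ, Complex.exp (Complex.I * (θ * n)) = Complex.exp (Complex.I * n * θ) := by
      intro θ; congr 1; ring
    simp only [e]
    rw [this, div_eq_zero_iff]
    left
    rw [sub_eq_zero, Complex.exp_eq_exp_iff_exists_int]
    exact ⟨n, by push_cast; ring⟩

lemma pk_zero_fourier (x : Zd d) : pk 0 x = FI fun θ => Real.cos (dt θ x) := by
  have key : ∫ θ in box d, Complex.exp (Complex.I * (dt θ x : ℝ)) =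
      ∏ i, if x i = 0 then 2 * (Real.pi : ℂ) else 0 := by
    have e : ∀ θ : Fin d → ℝ, Complex.exp (Complex.I * (dt θ x : ℝ)) =
        ∏ i, Complex.exp (Complex.I * (θ i * (x i : ℤ))) := by
      intro θ; rw [← Complex.exp_sum]; unfold dt; push_cast; rw [Finset.mul_sum]
    simp only [e]
    have := integral_fintype_prod_eq_prod (𝕜 := ℂ) (ι := Fin d)
      (μ := fun _ => (volume : Measure ℝ).restrict (Set.Ioc (-Real.pi) Real.pi))
      (fun i (θ : ℝ) => Complex.exp (Complex.I * ((θ : ℂ) * (x i : ℤ))))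
    rw [← Measure.restrict_pi_pi] at this
    simp only [int_exp] at this
    exact this
  have key2 : ∫ θ in box d, Real.cos (dt θ x) = if x = 0 then (2 * Real.pi) ^ d else 0 := by
    have : ∀ θ : Fin d → ℝ, Real.cos (dt θ x) = (Complex.exp (Complex.I * (dt θ x : ℝ))).re := by
      intro θ; rw [mul_comm, Complex.exp_ofReal_mul_I_re]
    simp only [this]
    have h2 := integral_re (𝕜 := ℂ) (μ := (volume : Measure (Fin d → ℝ)).restrict (box d))
      (f := fun θ => Complex.exp (Complex.I * (dt θ x : ℝ)))
      (box_integrable (by fun_prop))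
    refine h2.trans ?_
    rw [key]
    split_ifs with h
    · subst h; simp; norm_cast
    · obtain ⟨i, hi⟩ : ∃ i, x i ≠ 0 := by
        by_contra hh; push Not at hh; exact h (funext hh)
      rw [Finset.prod_eq_zero (Finset.mem_univ i) (by simp [hi])]; simp
  rw [pk_zero, FI, key2]
  have := Real.pi_pos
  split_ifs
  · field_simp
  · simp

lemma dt_sub_vec (θ : Fin d → ℝ) (x : Zd d) (e : Stp d) :
    dt θ (x - vec e) = dt θ x - (if e.2 then θ e.1 else - θ e.1) := by
  unfold dt
  have : ∀ i, θ i * (((x - vec e) i : ℤ) : ℝ) = θ i * x i - (if i = e.1 then (if e.2 then θ e.1 else - θ e.1) else 0) := by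
    intro i
    by_cases h : i = e.1
    · subst h; simp only [vec, Pi.sub_apply, Pi.single_eq_same]; split_ifs <;> push_cast <;> ring
    · simp [vec, h]
  simp only [this, Finset.sum_sub_distrib, Finset.sum_ite_eq', Finset.mem_univ, if_true]

lemma av_cos (θ : Fin d → ℝ) (x : Zd d) :
    av (fun e => Real.cos (dt θ (x - vec e))) = ph θ * Real.cos (dt θ x) := by
  simp only [dt_sub_vec, av, ph, Fintype.sum_prod_type, Fintype.sum_bool, if_true,
    sub_neg_eq_add, Bool.false_eq_true, if_false]
  have : ∀ i : Fin d, Real.cos (dt θ x - θ i) + Real.cos (dt θ x + θ i) =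
      Real.cos (θ i) * (2 * Real.cos (dt θ x)) := by
    intro i; rw [Real.cos_sub, Real.cos_add]; ring
  simp only [this, ← Finset.sum_mul]
  rcases eq_or_ne (d : ℝ) 0 with h | h
  · simp [h]
  · field_simp

lemma pk_fourier (t : ℕ) (x : Zd d) : pk t x = FI fun θ => ph θ ^ t * Real.cos (dt θ x) := by
  induction t generalizing x with
  | zero => simp [pk_zero_fourier]
  | succ t ih =>
    rw [pk_succ]
    simp only [ih]
    unfold av
    rw [← FI_sum _ (fun i => by fun_prop)]
    rw [div_eq_inv_mul, ← FI_mul_left]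
    congr 1; funext θ
    rw [← Finset.mul_sum, pow_succ, mul_assoc (ph θ ^ t), ← av_cos, av]
    ring

lemma pk_le_even [NeZero d] (k : ℕ) (x : Zd d) : pk (2 * k) x ≤ pk (2 * k) (0 : Zd d) := by
  rw [pk_fourier, pk_fourier]
  refine FI_mono (by fun_prop) (by fun_prop) fun θ => ?_
  have h0 : dt θ (0 : Zd d) = 0 := by simp [dt]
  rw [h0, Real.cos_zero, mul_one]
  exact mul_le_of_le_one_right (by rw [pow_mul]; positivity) (Real.cos_le_one _)

lemma pk_odd_le [NeZero d] (k : ℕ) (x : Zd d) : pk (2 * k + 1) x ≤ pk (2 * k) (0 : Zd d) := by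
  rw [pk_fourier, pk_fourier]
  refine FI_mono (by fun_prop) (by fun_prop) fun θ => ?_
  have h0 : dt θ (0 : Zd d) = 0 := by simp [dt]
  rw [h0, Real.cos_zero, mul_one, pow_succ, mul_assoc]
  refine mul_le_of_le_one_right (by rw [pow_mul]; positivity) ?_
  refine (le_abs_self _).trans ?_
  rw [abs_mul]
  exact mul_le_one₀ (abs_ph_le θ) (abs_nonneg _) (Real.abs_cos_le_one _)

lemma pair_le [NeZero d] (k : ℕ) (x : Zd d) :
    pk (2 * k) x + pk (2 * k + 1) x ≤ pk (2 * k) (0 : Zd d) + pk (2 * k + 1) (0 : Zd d) := by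
  simp only [pk_fourier]
  rw [← FI_add (by fun_prop) (by fun_prop), ← FI_add (by fun_prop) (by fun_prop)]
  refine FI_mono (by fun_prop) (by fun_prop) fun θ => ?_
  have h0 : dt θ (0 : Zd d) = 0 := by simp [dt]
  rw [h0, Real.cos_zero]
  have h1 : 0 ≤ ph θ ^ (2 * k) * (1 + ph θ) :=
    mul_nonneg (by rw [pow_mul]; positivity) (by linarith [neg_abs_le (ph θ), abs_ph_le θ])
  have h2 : ph θ ^ (2 * k) * (1 + ph θ) = ph θ ^ (2 * k) + ph θ ^ (2 * k + 1) := by ring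
  rw [h2] at h1
  rw [← add_mul]
  nlinarith [Real.cos_le_one (dt θ x)]

/-- one–dimensional Gaussian bound -/
lemma int_exp_sin_le {c : ℝ} (hc : 0 < c) :
    ∫ θ in Set.Ioc (-Real.pi) Real.pi, Real.exp (-(c * (1 - |Real.cos θ|))) ≤
      3 * √(Real.pi / (2 * c / Real.pi ^ 2)) := by
  have hpi := Real.pi_pos
  set b := 2 * c / Real.pi ^ 2 with hb
  have hb0 : 0 < b := by positivity
  have hg : ∀ m : ℝ, Integrable (fun θ : ℝ => Real.exp (-b * (θ - m) ^ 2)) := fun m =>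
    (integrable_exp_neg_mul_sq hb0).comp_sub_right m
  have hgi : ∀ m : ℝ, ∫ θ : ℝ, Real.exp (-b * (θ - m) ^ 2) = √(Real.pi / b) := fun m => by
    rw [integral_sub_right_eq_self (fun θ : ℝ => Real.exp (-b * θ ^ 2)) m, integral_gaussian]
  have key : ∀ θ ∈ Set.Ioc (-Real.pi) Real.pi, Real.exp (-(c * (1 - |Real.cos θ|))) ≤
      (Real.exp (-b * (θ - Real.pi) ^ 2) + Real.exp (-b * (θ - 0) ^ 2)) +
        Real.exp (-b * (θ - (-Real.pi)) ^ 2) := by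
    intro θ hθ
    have red : ∀ m : ℝ, |θ - m| ≤ Real.pi / 2 → Real.sin (θ - m) ^ 2 = Real.sin θ ^ 2 →
        Real.exp (-(c * (1 - |Real.cos θ|))) ≤ Real.exp (-b * (θ - m) ^ 2) := by
      intro m hm hs
      apply Real.exp_le_exp.mpr
      have h1 := Real.mul_abs_le_abs_sin hm
      have h2 : (2 / Real.pi * |θ - m|) ^ 2 ≤ |Real.sin (θ - m)| ^ 2 := by gcongr
      rw [sq_abs, hs, mul_pow, sq_abs] at h2
      have h3 : Real.sin θ ^ 2 = 1 - |Real.cos θ| ^ 2 := by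
        rw [sq_abs]; linarith [Real.sin_sq_add_cos_sq θ]
      have h4 : (2 / Real.pi) ^ 2 * (θ - m) ^ 2 ≤ 2 * (1 - |Real.cos θ|) := by
        have := Real.abs_cos_le_one θ
        have := abs_nonneg (Real.cos θ)
        nlinarith
      have h5 : b = c / 2 * (2 / Real.pi) ^ 2 := by rw [hb]; field_simp
      rw [h5]
      nlinarith
    have p1 := Real.exp_pos (-b * (θ - Real.pi) ^ 2)
    have p2 := Real.exp_pos (-b * (θ - 0) ^ 2)
    have p3 := Real.exp_pos (-b * (θ - (-Real.pi)) ^ 2)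
    by_cases h1 : Real.pi / 2 < θ
    · have := red Real.pi (by rw [abs_le]; constructor <;> linarith [hθ.2])
        (by rw [Real.sin_sub_pi]; ring)
      linarith
    · by_cases h2 : θ < - (Real.pi / 2)
      · have := red (-Real.pi) (by rw [abs_le]; constructor <;> linarith [hθ.1])
          (by rw [sub_neg_eq_add, Real.sin_add_pi]; ring)
        linarith
      · have := red 0 (by rw [sub_zero, abs_le]; constructor <;> linarith) (by simp)
        linarith
  have hI := (((hg Real.pi).add (hg 0)).add (hg (-Real.pi)))
  have h1 : ∫ θ in Set.Ioc (-Real.pi) Real.pi, Real.exp (-(c * (1 - |Real.cos θ|))) ≤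
      ∫ θ in Set.Ioc (-Real.pi) Real.pi, ((Real.exp (-b * (θ - Real.pi) ^ 2) + Real.exp (-b * (θ - 0) ^ 2)) +
        Real.exp (-b * (θ - (-Real.pi)) ^ 2)) := by
    refine setIntegral_mono_on ?_ hI.integrableOn measurableSet_Ioc key
    exact (Continuous.integrableOn_Icc (by fun_prop)).mono_set Set.Ioc_subset_Icc_self
  refine h1.trans ((setIntegral_le_integral hI (Filter.Eventually.of_forall fun θ => by
    simp only [Pi.add_apply]; positivity)).trans ?_)
  have h2 : ∫ θ, ((Real.exp (-b * (θ - Real.pi) ^ 2) + Real.exp (-b * (θ - 0) ^ 2)) +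
        Real.exp (-b * (θ - (-Real.pi)) ^ 2)) = 3 * √(Real.pi / b) := by
    have e1 := integral_add ((hg Real.pi).add (hg 0)) (hg (-Real.pi))
    have e2 := integral_add (hg Real.pi) (hg 0)
    simp only [Pi.add_apply] at e1
    rw [e1, e2, hgi, hgi, hgi]; ring
  exact h2.le

lemma abs_ph_pow_le [NeZero d] (θ : Fin d → ℝ) (n : ℕ) :
    |ph θ| ^ n ≤ ∏ i, Real.exp (-((n / d : ℝ) * (1 - |Real.cos (θ i)|))) := by
  have hd : (0 : ℝ) < d := Nat.cast_pos.mpr (NeZero.pos d)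
  have h1 : |ph θ| ≤ Real.exp (∑ i : Fin d, -((1 / d : ℝ) * (1 - |Real.cos (θ i)|))) := by
    have h2 : |ph θ| ≤ (∑ i : Fin d, |Real.cos (θ i)|) / d := by
      unfold ph; rw [abs_div, abs_of_pos hd]; gcongr; exact Finset.abs_sum_le_sum_abs _ _
    have h3 : ∑ i : Fin d, -((1 / d : ℝ) * (1 - |Real.cos (θ i)|)) =
        (∑ i : Fin d, |Real.cos (θ i)|) / d - 1 := by
      rw [Finset.sum_neg_distrib, ← Finset.mul_sum, Finset.sum_sub_distrib]
      simp; field_simp; ring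
    rw [h3]
    have := Real.add_one_le_exp ((∑ i : Fin d, |Real.cos (θ i)|) / d - 1)
    linarith
  calc |ph θ| ^ n ≤ Real.exp (∑ i : Fin d, -((1 / d : ℝ) * (1 - |Real.cos (θ i)|))) ^ n := by gcongr
    _ = _ := by
      rw [← Real.exp_nat_mul, ← Real.exp_sum, Finset.mul_sum]
      congr 1; apply Finset.sum_congr rfl; intro i _; ring

/-- Fourier moment bound -/
lemma FI_pow_le (d : ℕ) [NeZero d] : ∃ C : ℝ, 0 < C ∧ ∀ n : ℕ,
    FI (d := d) (fun θ => |ph θ| ^ n) ≤ C * ((n : ℝ) + 1) ^ (-(d / 2 : ℝ)) := by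
  have hd : (0 : ℝ) < d := Nat.cast_pos.mpr (NeZero.pos d)
  have hpi := Real.pi_pos
  set K : ℝ := 3 * √(Real.pi ^ 3 * d) with hK
  have hK0 : 0 < K := by positivity
  refine ⟨K ^ d / (2 * Real.pi) ^ d + 1, by positivity, fun n => ?_⟩
  have hFI0 : FI (d := d) (fun θ => |ph θ| ^ 0) = 1 := by
    have := pk_zero_fourier (0 : Zd d)
    rw [pk_zero, if_pos rfl] at this
    rw [this]; congr 1; funext θ; simp [dt]
  rcases Nat.eq_zero_or_pos n with rfl | hn
  · rw [hFI0]
    simp; positivity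
  have hn' : (1 : ℝ) ≤ n := by exact_mod_cast hn
  have h1 : ∫ θ in box d, |ph θ| ^ n ≤ (K / √(n + 1)) ^ d := by
    have h2 : ∫ θ in box d, |ph θ| ^ n ≤
        ∫ θ in box d, ∏ i, Real.exp (-((n / d : ℝ) * (1 - |Real.cos (θ i)|))) :=
      integral_mono (box_integrable (by fun_prop)) (box_integrable (by fun_prop))
        (fun θ => abs_ph_pow_le θ n)
    refine h2.trans ?_
    have := integral_fintype_prod_eq_pow (𝕜 := ℝ) (ι := Fin d)
      (μ := (volume : Measure ℝ).restrict (Set.Ioc (-Real.pi) Real.pi))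
      (fun θ => Real.exp (-((n / d : ℝ) * (1 - |Real.cos θ|))))
    rw [← Measure.restrict_pi_pi] at this
    refine (le_of_eq this).trans ?_
    rw [Fintype.card_fin]
    have h3 := int_exp_sin_le (c := (n / d : ℝ)) (by positivity)
    refine pow_le_pow_left₀ (integral_nonneg fun θ : ℝ => (Real.exp_pos _).le) (h3.trans ?_) d
    rw [hK, mul_div_assoc 3 (√(Real.pi ^ 3 * d)), ← Real.sqrt_div (by positivity)]
    refine mul_le_mul_of_nonneg_left (Real.sqrt_le_sqrt ?_) (by norm_num)
    rw [div_le_div_iff₀ (by positivity) (by positivity)]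
    have : Real.pi * (n + 1) ≤ Real.pi * (2 * n) := by gcongr; linarith
    calc Real.pi * (n + 1) ≤ Real.pi * (2 * n) := this
      _ = Real.pi ^ 3 * d * (2 * (n / d) / Real.pi ^ 2) := by field_simp
  have h4 : (K / √((n : ℝ) + 1)) ^ d = K ^ d * ((n : ℝ) + 1) ^ (-(d / 2 : ℝ)) := by
    rw [div_pow, div_eq_mul_inv, Real.sqrt_eq_rpow, ← Real.rpow_natCast, ← Real.rpow_natCast,
      ← Real.rpow_mul (by positivity), ← Real.rpow_neg (by positivity)]
    congr 2; ring
  unfold FI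
  rw [h4] at h1
  have hp : 0 < ((n : ℝ) + 1) ^ (-(d / 2 : ℝ)) := by positivity
  calc (∫ θ in box d, |ph θ| ^ n) / (2 * Real.pi) ^ d
      ≤ (K ^ d * ((n : ℝ) + 1) ^ (-(d / 2 : ℝ))) / (2 * Real.pi) ^ d := by gcongr
    _ = K ^ d / (2 * Real.pi) ^ d * ((n : ℝ) + 1) ^ (-(d / 2 : ℝ)) := by ring
    _ ≤ _ := by nlinarith

lemma pk_even_eq_FI (k : ℕ) : pk (2 * k) (0 : Zd d) = FI (d := d) fun θ => |ph θ| ^ (2 * k) := by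
  rw [pk_fourier]; congr 1; funext θ
  have h0 : dt θ (0 : Zd d) = 0 := by simp [dt]
  rw [h0, Real.cos_zero, mul_one, pow_mul, pow_mul, sq_abs]

/-- main heat kernel bound, with any exponent `s ≤ d/2` -/
lemma pk_le (d : ℕ) [NeZero d] (s : ℝ) (hs0 : 0 ≤ s) (hs : s ≤ d / 2) : ∃ C : ℝ, 0 < C ∧
    ∀ (t : ℕ) (x : Zd d), pk t x ≤ C * ((t : ℝ) + 1) ^ (-s) := by
  obtain ⟨C, hC, h⟩ := FI_pow_le d
  refine ⟨C * 2 ^ s, by positivity, fun t x => ?_⟩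
  obtain ⟨k, rfl | rfl⟩ := Nat.even_or_odd' t
  · have h1 := (pk_le_even k x).trans ((pk_even_eq_FI k).le.trans (h (2 * k)))
    refine h1.trans ?_
    have : (((2 * k : ℕ) : ℝ) + 1) ^ (-(d / 2 : ℝ)) ≤ (((2 * k : ℕ) : ℝ) + 1) ^ (-s) :=
      Real.rpow_le_rpow_of_exponent_le (by simp) (by linarith)
    have h2 : (1 : ℝ) ≤ 2 ^ s := Real.one_le_rpow (by norm_num) hs0
    have h3 : 0 ≤ C * (((2 * k : ℕ) : ℝ) + 1) ^ (-s) := by positivity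
    calc _ ≤ C * (((2 * k : ℕ) : ℝ) + 1) ^ (-s) := by gcongr
      _ ≤ _ := by nlinarith
  · have h1 := (pk_odd_le k x).trans ((pk_even_eq_FI k).le.trans (h (2 * k)))
    refine h1.trans ?_
    have : (((2 * k : ℕ) : ℝ) + 1) ^ (-(d / 2 : ℝ)) ≤ (((2 * k : ℕ) : ℝ) + 1) ^ (-s) :=
      Real.rpow_le_rpow_of_exponent_le (by simp) (by linarith)
    have h4 : (((2 * k : ℕ) : ℝ) + 1) ^ (-s) ≤ 2 ^ s * (((2 * k + 1 : ℕ) : ℝ) + 1) ^ (-s) := by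
      rw [Real.rpow_neg (by positivity), Real.rpow_neg (by positivity), ← div_eq_mul_inv,
        ← Real.div_rpow (by positivity) (by positivity), ← Real.inv_rpow (by positivity)]
      apply Real.rpow_le_rpow (by positivity) _ hs0
      rw [inv_eq_one_div, div_le_div_iff₀ (by positivity) (by positivity)]
      push_cast; linarith
    calc _ ≤ C * (((2 * k : ℕ) : ℝ) + 1) ^ (-s) := by gcongr
      _ ≤ C * (2 ^ s * (((2 * k + 1 : ℕ) : ℝ) + 1) ^ (-s)) := by gcongr
      _ = _ := by ring

/-- positive definiteness -/
lemma cos_quad (A : Finset (Zd d)) (f : Zd d → ℝ) (x : Zd d) (θ : Fin d → ℝ) :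
    ∑ a ∈ A, ∑ b ∈ A, f a * f b * Real.cos (dt θ (a - b - x)) =
      Real.cos (dt θ x) * ((∑ a ∈ A, f a * Real.cos (dt θ a)) ^ 2 +
        (∑ a ∈ A, f a * Real.sin (dt θ a)) ^ 2) := by
  have hdt : ∀ y z : Zd d, dt θ (y - z) = dt θ y - dt θ z := by
    intro y z; simp [dt, mul_sub, Finset.sum_sub_distrib]
  have e : ∀ a b : Zd d, f a * f b * Real.cos (dt θ (a - b - x)) =
      Real.cos (dt θ x) * ((f a * Real.cos (dt θ a)) * (f b * Real.cos (dt θ b))) +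
      Real.cos (dt θ x) * ((f a * Real.sin (dt θ a)) * (f b * Real.sin (dt θ b))) +
      Real.sin (dt θ x) * ((f a * Real.sin (dt θ a)) * (f b * Real.cos (dt θ b))) -
      Real.sin (dt θ x) * ((f a * Real.cos (dt θ a)) * (f b * Real.sin (dt θ b))) := by
    intro a b
    rw [hdt, hdt, Real.cos_sub, Real.cos_sub, Real.sin_sub]; ring
  simp only [e, Finset.sum_sub_distrib, Finset.sum_add_distrib, ← Finset.mul_sum,
    ← Finset.sum_mul]
  ring

lemma pk_quad (A : Finset (Zd d)) (f : Zd d → ℝ) (x : Zd d) (t : ℕ) :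
    ∑ a ∈ A, ∑ b ∈ A, f a * f b * pk t (a - b - x) =
      FI fun θ => ph θ ^ t * (Real.cos (dt θ x) * ((∑ a ∈ A, f a * Real.cos (dt θ a)) ^ 2 +
        (∑ a ∈ A, f a * Real.sin (dt θ a)) ^ 2)) := by
  simp only [← cos_quad, pk_fourier, ← FI_mul_left, Finset.mul_sum]
  rw [FI_sum _ fun a => by fun_prop]
  apply Finset.sum_congr rfl; intro a _
  rw [FI_sum _ fun a => by fun_prop]
  apply Finset.sum_congr rfl; intro b _
  congr 1; funext θ; ring

lemma pair_quad_nonneg [NeZero d] (A : Finset (Zd d)) (f : Zd d → ℝ) (k : ℕ) :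
    0 ≤ ∑ a ∈ A, ∑ b ∈ A, f a * f b * (pk (2 * k) (a - b) + pk (2 * k + 1) (a - b)) := by
  have h := pk_quad A f 0 (2 * k)
  have h' := pk_quad A f 0 (2 * k + 1)
  simp only [sub_zero] at h h'
  simp only [mul_add, Finset.sum_add_distrib]
  rw [h, h', ← FI_add (by fun_prop) (by fun_prop)]
  refine FI_nonneg fun θ => ?_
  have h0 : dt θ (0 : Zd d) = 0 := by simp [dt]
  rw [h0, Real.cos_zero, ← add_mul]
  have h1 : 0 ≤ ph θ ^ (2 * k) * (1 + ph θ) :=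
    mul_nonneg (by rw [pow_mul]; positivity) (by linarith [neg_abs_le (ph θ), abs_ph_le θ])
  have h2 : ph θ ^ (2 * k) * (1 + ph θ) = ph θ ^ (2 * k) + ph θ ^ (2 * k + 1) := by ring
  rw [h2] at h1
  exact mul_nonneg h1 (by positivity)

lemma pair_quad_shift [NeZero d] (A : Finset (Zd d)) (f : Zd d → ℝ) (k : ℕ) (x : Zd d) :
    ∑ a ∈ A, ∑ b ∈ A, f a * f b * (pk (2 * k) (a - b - x) + pk (2 * k + 1) (a - b - x)) ≤
    ∑ a ∈ A, ∑ b ∈ A, f a * f b * (pk (2 * k) (a - b) + pk (2 * k + 1) (a - b)) := by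
  have h := pk_quad A f 0 (2 * k)
  have h' := pk_quad A f 0 (2 * k + 1)
  simp only [sub_zero] at h h'
  simp only [mul_add, Finset.sum_add_distrib]
  rw [h, h', pk_quad, pk_quad, ← FI_add (by fun_prop) (by fun_prop), ← FI_add (by fun_prop) (by fun_prop)]
  refine FI_mono (by fun_prop) (by fun_prop) fun θ => ?_
  have h0 : dt θ (0 : Zd d) = 0 := by simp [dt]
  rw [h0, Real.cos_zero, ← add_mul, ← add_mul]
  have h1 : 0 ≤ ph θ ^ (2 * k) * (1 + ph θ) :=
    mul_nonneg (by rw [pow_mul]; positivity) (by linarith [neg_abs_le (ph θ), abs_ph_le θ])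
  have h2 : ph θ ^ (2 * k) * (1 + ph θ) = ph θ ^ (2 * k) + ph θ ^ (2 * k + 1) := by ring
  rw [h2] at h1
  have h3 : 0 ≤ (∑ a ∈ A, f a * Real.cos (dt θ a)) ^ 2 +
        (∑ a ∈ A, f a * Real.sin (dt θ a)) ^ 2 := by positivity
  gcongr
  exact Real.cos_le_one _

end fourier


set_option linter.unusedSectionVars false
set_option linter.unusedSimpArgs false
set_option linter.unusedVariables false
/-! ### Part 3: the Green function -/
section powers

lemma rpow_telescope {x p : ℝ} (hx : 0 < x) (hp : 0 < p) :
    p * (x + 1) ^ (-p - 1) ≤ x ^ (-p) - (x + 1) ^ (-p) := by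
  have hx1 : 0 < x + 1 := by linarith
  have h1 : 1 + p / (x + 1) ≤ ((x + 1) / x) ^ p := by
    rw [Real.rpow_def_of_pos (by positivity)]
    have h2 := Real.one_sub_inv_le_log_of_pos (x := (x + 1) / x) (by positivity)
    have h3 := Real.add_one_le_exp (Real.log ((x + 1) / x) * p)
    have h4 : 1 - ((x + 1) / x)⁻¹ = 1 / (x + 1) := by field_simp; ring
    rw [h4] at h2
    have h5 : 1 / (x + 1) * p ≤ Real.log ((x + 1) / x) * p := by gcongr
    have h6 : p / (x + 1) = 1 / (x + 1) * p := by ring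
    linarith
  have h7 : x ^ (-p) = (x + 1) ^ (-p) * ((x + 1) / x) ^ p := by
    rw [Real.div_rpow hx1.le hx.le, Real.rpow_neg hx.le, Real.rpow_neg hx1.le]
    have := (Real.rpow_pos_of_pos hx1 p).ne'
    field_simp
  have h8 : (x + 1) ^ (-p - 1) = (x + 1) ^ (-p) / (x + 1) := by
    rw [Real.rpow_sub hx1, Real.rpow_one]
  rw [h7, h8]
  have h9 := Real.rpow_pos_of_pos hx1 (-p)
  have h10 := mul_le_mul_of_nonneg_left h1 h9.le
  have e : p * ((x + 1) ^ (-p) / (x + 1)) = (x + 1) ^ (-p) * (p / (x + 1)) := by ring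
  rw [e]; nlinarith

/-- tails of `∑ (t+1)^{-s}` -/
lemma tail_sum_le (s : ℝ) (hs : 1 < s) : ∃ C : ℝ, 0 < C ∧ ∀ n w : ℕ,
    ∑ t ∈ Finset.range n, (((w + t : ℕ) : ℝ) + 1) ^ (-s) ≤ C * ((w : ℝ) + 1) ^ (1 - s) := by
  refine ⟨2 ^ s / (s - 1), div_pos (by positivity) (by linarith), fun n w => ?_⟩
  have hs1 : 0 < s - 1 := by linarith
  have step : ∀ t : ℕ, (((w + t : ℕ) : ℝ) + 1) ^ (-s) ≤ 2 ^ s / (s - 1) *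
      ((((w + t : ℕ) : ℝ) + 1) ^ (1 - s) - (((w + (t + 1) : ℕ) : ℝ) + 1) ^ (1 - s)) := by
    intro t
    set x : ℝ := ((w + t : ℕ) : ℝ) + 1 with hx
    have hx1 : 1 ≤ x := by rw [hx]; simp; positivity
    have e : (((w + (t + 1) : ℕ) : ℝ) + 1) = x + 1 := by rw [hx]; push_cast; ring
    rw [e]
    have h := rpow_telescope (x := x) (p := s - 1) (by linarith) hs1
    rw [show -(s - 1) - 1 = -s by ring, show -(s - 1) = 1 - s by ring] at h
    have h2 : x ^ (-s) ≤ 2 ^ s * (x + 1) ^ (-s) := by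
      rw [Real.rpow_neg (by linarith), Real.rpow_neg (by linarith), ← div_eq_mul_inv,
        ← Real.div_rpow (by norm_num) (by linarith), ← Real.inv_rpow (by linarith)]
      apply Real.rpow_le_rpow (by positivity) _ (by linarith)
      rw [inv_eq_one_div, div_le_div_iff₀ (by linarith) (by linarith)]; linarith
    have h3 : (x + 1) ^ (-s) ≤ (x ^ (1 - s) - (x + 1) ^ (1 - s)) / (s - 1) := by
      rw [le_div_iff₀ hs1]; linarith
    calc x ^ (-s) ≤ 2 ^ s * (x + 1) ^ (-s) := h2
      _ ≤ 2 ^ s * ((x ^ (1 - s) - (x + 1) ^ (1 - s)) / (s - 1)) := by gcongr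
      _ = _ := by ring
  calc _ ≤ ∑ t ∈ Finset.range n, 2 ^ s / (s - 1) *
      ((((w + t : ℕ) : ℝ) + 1) ^ (1 - s) - (((w + (t + 1) : ℕ) : ℝ) + 1) ^ (1 - s)) :=
        Finset.sum_le_sum fun t _ => step t
    _ = 2 ^ s / (s - 1) * (((w : ℝ) + 1) ^ (1 - s) - (((w + n : ℕ) : ℝ) + 1) ^ (1 - s)) := by
      rw [← Finset.mul_sum, Finset.sum_range_sub' (fun t => (((w + t : ℕ) : ℝ) + 1) ^ (1 - s))]
      simp
    _ ≤ _ := by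
      have : 0 ≤ (((w + n : ℕ) : ℝ) + 1) ^ (1 - s) := by positivity
      gcongr
      linarith

end powers

section green
variable {d : ℕ}

instance neZero_of_fact [h : Fact (4 ≤ d)] : NeZero d := ⟨by have := h.out; omega⟩

variable [Fact (4 ≤ d)]

lemma pk_summable (x : Zd d) : Summable fun t => pk t x := by
  have hd : 4 ≤ d := Fact.out
  have hd' : (4 : ℝ) ≤ d := by exact_mod_cast hd
  obtain ⟨C, hC, h⟩ := pk_le d 2 (by norm_num) (by linarith)
  obtain ⟨C', hC', h'⟩ := tail_sum_le 2 (by norm_num)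
  refine summable_of_sum_range_le (c := C * (C' * 1)) (fun t => pk_nonneg t x) fun n => ?_
  calc _ ≤ ∑ t ∈ Finset.range n, C * (((t : ℕ) : ℝ) + 1) ^ (-(2 : ℝ)) :=
        Finset.sum_le_sum fun t _ => h t x
    _ ≤ _ := by
      rw [← Finset.mul_sum]; gcongr
      have := h' n 0
      simpa using this

/-- tail Green function -/
def Gt (w : ℕ) (x : Zd d) : ℝ := ∑' t, pk (w + t) x

lemma Gt_hasSum (w : ℕ) (x : Zd d) : HasSum (fun t => pk (w + t) x) (Gt w x) := by
  have := (summable_nat_add_iff w).mpr (pk_summable x)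
  simp only [add_comm _ w] at this
  exact this.hasSum

lemma Gt_nonneg (w : ℕ) (x : Zd d) : 0 ≤ Gt w x := tsum_nonneg fun _ => pk_nonneg _ _

lemma Gt_neg (w : ℕ) (x : Zd d) : Gt w (-x) = Gt w x := by simp only [Gt, pk_neg]

lemma Gt_sub_comm (w : ℕ) (x y : Zd d) : Gt w (x - y) = Gt w (y - x) := by
  rw [← Gt_neg, neg_sub]

lemma Gt_split (w n : ℕ) (x : Zd d) :
    Gt w x = ∑ t ∈ Finset.range n, pk (w + t) x + Gt (w + n) x := by
  have := (Gt_hasSum w x).summable.sum_add_tsum_nat_add n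
  rw [Gt, ← this, Gt]
  congr 2; funext t; rw [show w + (t + n) = w + n + t by ring]

lemma Gt_succ (w : ℕ) (x : Zd d) : Gt w x = pk w x + Gt (w + 1) x := by
  rw [Gt_split w 1]; simp

lemma Gt_anti {w w' : ℕ} (h : w ≤ w') (x : Zd d) : Gt w' x ≤ Gt w x := by
  obtain ⟨n, rfl⟩ := Nat.exists_eq_add_of_le h
  rw [Gt_split w n]
  linarith [Finset.sum_nonneg fun t (_ : t ∈ Finset.range n) => pk_nonneg (w + t) x]

lemma Ex_Gt (u w : ℕ) (x : Zd d) : Ex u (fun l => Gt w (x + endp l)) = Gt (w + u) x := by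
  have h := Ex_hasSum (n := u) (f := fun t (l : List (Stp d)) => pk (w + t) (x + endp l))
    (g := fun l => Gt w (x + endp l)) fun l _ => Gt_hasSum w _
  refine h.unique ?_
  have h2 := Gt_hasSum (w + u) x
  convert h2 using 2 with t
  rw [pk_CK]; congr 1; ring

lemma Ex_Gt' (u w : ℕ) (x : Zd d) : Ex u (fun l => Gt w (x - endp l)) = Gt (w + u) x := by
  rw [← Ex_Gt, ← Ex_flip]
  simp only [endp_flip, sub_neg_eq_add]

lemma Ex_Gt'' (u w : ℕ) (x : Zd d) : Ex u (fun l => Gt w (endp l - x)) = Gt (w + u) x := by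
  simp only [Gt_sub_comm w _ x]; exact Ex_Gt' u w x

lemma Gt_even_le (k : ℕ) (x : Zd d) : Gt (2 * k) x ≤ Gt (2 * k) (0 : Zd d) := by
  have H : ∀ y : Zd d, Tendsto (fun n => ∑ j ∈ Finset.range n,
      (pk (2 * (k + j)) y + pk (2 * (k + j) + 1) y)) atTop (𝓝 (Gt (2 * k) y)) := by
    intro y
    have h := (Gt_hasSum (2 * k) y).tendsto_sum_nat.comp
      (tendsto_id.const_mul_atTop' (by norm_num : 0 < 2) : Tendsto (fun n : ℕ => 2 * n) atTop atTop)
    refine h.congr fun n => ?_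
    simp only [Function.comp]
    induction n with
    | zero => simp
    | succ n ih =>
      rw [Finset.sum_range_succ, ← ih, show 2 * (n + 1) = 2 * n + 1 + 1 by ring,
        Finset.sum_range_succ, Finset.sum_range_succ, add_assoc, mul_add, add_assoc]
  exact le_of_tendsto_of_tendsto' (H x) (H 0) fun n => Finset.sum_le_sum fun j _ => pair_le _ _

lemma Gt_succ_le (a : ℕ) (x : Zd d) : Gt (a + 1) x ≤ Gt a (0 : Zd d) := by
  obtain ⟨k, rfl | rfl⟩ := Nat.even_or_odd' a
  · exact (Gt_anti (by omega) x).trans (Gt_even_le k x)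
  · rw [show 2 * k + 1 + 1 = 2 * (k + 1) by ring]
    exact (Gt_even_le (k + 1) x).trans (Gt_anti (by omega) 0)

lemma Gt_bound (d : ℕ) [Fact (4 ≤ d)] (s : ℝ) (hs : 1 < s) (hs' : s ≤ d / 2) :
    ∃ C : ℝ, 0 < C ∧ ∀ (w : ℕ) (x : Zd d), Gt w x ≤ C * ((w : ℝ) + 1) ^ (1 - s) := by
  obtain ⟨C, hC, h⟩ := pk_le d s (by linarith) hs'
  obtain ⟨C', hC', h'⟩ := tail_sum_le s hs
  refine ⟨C * C', by positivity, fun w x => ?_⟩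
  refine Real.tsum_le_of_sum_range_le (fun t => pk_nonneg _ _) fun n => ?_
  calc _ ≤ ∑ t ∈ Finset.range n, C * (((w + t : ℕ) : ℝ) + 1) ^ (-s) :=
        Finset.sum_le_sum fun t _ => h _ x
    _ ≤ _ := by
      rw [← Finset.mul_sum, mul_assoc]; gcongr
      exact h' n w

lemma Gt_tendsto (x : Zd d) : Tendsto (fun w => Gt w x) atTop (𝓝 0) := by
  have h := tendsto_sum_nat_add (fun t => pk t x)
  refine h.congr fun w => ?_
  simp only [Gt, add_comm]

/-- Green function -/
abbrev G (x : Zd d) : ℝ := Gt 0 x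

lemma G_zero_ge : 1 ≤ G (0 : Zd d) := by
  rw [G, Gt_succ, pk_zero, if_pos rfl]; linarith [Gt_nonneg 1 (0 : Zd d)]

lemma G_le (x : Zd d) : G x ≤ G (0 : Zd d) := Gt_even_le 0 x

lemma quad_tendsto (A : Finset (Zd d)) (f : Zd d → ℝ) (x : Zd d) :
    Tendsto (fun n => ∑ j ∈ Finset.range n, ∑ a ∈ A, ∑ b ∈ A, f a * f b *
      (pk (2 * j) (a - b - x) + pk (2 * j + 1) (a - b - x))) atTop
      (𝓝 (∑ a ∈ A, ∑ b ∈ A, f a * f b * G (a - b - x))) := by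
  have H : ∀ y : Zd d, Tendsto (fun n => ∑ j ∈ Finset.range n,
      (pk (2 * j) y + pk (2 * j + 1) y)) atTop (𝓝 (G y)) := by
    intro y
    have h := (Gt_hasSum 0 y).tendsto_sum_nat.comp
      (tendsto_id.const_mul_atTop' (by norm_num : 0 < 2) : Tendsto (fun n : ℕ => 2 * n) atTop atTop)
    refine h.congr fun n => ?_
    simp only [Function.comp, zero_add]
    induction n with
    | zero => simp
    | succ n ih =>
      rw [Finset.sum_range_succ, ← ih, show 2 * (n + 1) = 2 * n + 1 + 1 by ring,
        Finset.sum_range_succ, Finset.sum_range_succ, add_assoc]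
  have h2 : Tendsto (fun n => ∑ a ∈ A, ∑ b ∈ A, f a * f b * ∑ j ∈ Finset.range n,
      (pk (2 * j) (a - b - x) + pk (2 * j + 1) (a - b - x))) atTop
      (𝓝 (∑ a ∈ A, ∑ b ∈ A, f a * f b * G (a - b - x))) :=
    tendsto_finsetSum _ fun a _ => tendsto_finsetSum _ fun b _ => (H _).const_mul _
  refine h2.congr fun n => ?_
  simp only [Finset.mul_sum]
  symm
  rw [Finset.sum_comm]
  apply Finset.sum_congr rfl; intro a _
  rw [Finset.sum_comm]

lemma G_quad_nonneg (A : Finset (Zd d)) (f : Zd d → ℝ) :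
    0 ≤ ∑ a ∈ A, ∑ b ∈ A, f a * f b * G (a - b) := by
  have h := quad_tendsto A f 0
  simp only [sub_zero] at h
  exact ge_of_tendsto' h fun n => Finset.sum_nonneg fun j _ => pair_quad_nonneg A f j

lemma G_quad_shift (A : Finset (Zd d)) (f : Zd d → ℝ) (x : Zd d) :
    ∑ a ∈ A, ∑ b ∈ A, f a * f b * G (a - b - x) ≤ ∑ a ∈ A, ∑ b ∈ A, f a * f b * G (a - b) := by
  have h := quad_tendsto A f 0
  simp only [sub_zero] at h
  exact le_of_tendsto_of_tendsto' (quad_tendsto A f x) h fun n =>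
    Finset.sum_le_sum fun j _ => pair_quad_shift A f j x

end green


/-! ### Part 4: potential theory -/
section pot
variable {d : ℕ} [Fact (4 ≤ d)]

def PP (f : Zd d → ℝ) (x : Zd d) : ℝ := av fun e => f (x + vec e)

lemma PP_mono {f g : Zd d → ℝ} (h : ∀ x, f x ≤ g x) (x : Zd d) : PP f x ≤ PP g x :=
  av_mono fun _ => h _
lemma PP_nonneg {f : Zd d → ℝ} (h : ∀ x, 0 ≤ f x) (x : Zd d) : 0 ≤ PP f x := by
  have := PP_mono (f := fun _ => (0 : ℝ)) h x
  simpa [PP, av_const] using this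
lemma PP_le_one {f : Zd d → ℝ} (h : ∀ x, f x ≤ 1) (x : Zd d) : PP f x ≤ 1 := by
  have := PP_mono (g := fun _ => (1 : ℝ)) h x
  simpa [PP, av_const] using this
lemma PP_Gt (w : ℕ) (a x : Zd d) : PP (fun y => Gt w (y - a)) x = Gt (w + 1) (x - a) := by
  rw [← Ex_Gt 1 w (x - a), Ex_succ, PP]
  congr 1; funext e
  simp; congr 1; abel

def hitV (A : Finset (Zd d)) (g : Zd d → ℝ) : ℕ → Zd d → ℝ
  | 0, y => if y ∈ A then g y else 0
  | n + 1, y => if y ∈ A then g y else PP (hitV A g n) y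

def Hit (A : Finset (Zd d)) (g : Zd d → ℝ) (y : Zd d) : ℝ := ⨆ n, hitV A g n y

section
variable {A : Finset (Zd d)} {g : Zd d → ℝ} (hg : ∀ x, 0 ≤ g x)
include hg

lemma hitV_nonneg (n : ℕ) (y : Zd d) : 0 ≤ hitV A g n y := by
  induction n generalizing y with
  | zero => simp only [hitV]; split_ifs <;> simp [hg]
  | succ n ih => simp only [hitV]; split_ifs; exacts [hg y, PP_nonneg ih y]

lemma hitV_mono : ∀ y, Monotone fun n => hitV A g n y := by
  have H : ∀ n y, hitV A g n y ≤ hitV A g (n + 1) y := by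
    intro n
    induction n with
    | zero =>
      intro y; simp only [hitV]; split_ifs
      · exact le_rfl
      · exact PP_nonneg (fun x => hitV_nonneg hg 0 x) y
    | succ n ih =>
      intro y
      rw [hitV]
      conv_rhs => rw [hitV]
      split_ifs
      · exact le_rfl
      · exact PP_mono ih y
  exact fun y => monotone_nat_of_le_succ fun n => H n y

lemma hitV_le_G (n : ℕ) (y : Zd d) : hitV A g n y ≤ ∑ a ∈ A, G (y - a) * g a := by
  have h0 : ∀ y, 0 ≤ ∑ a ∈ A, G (y - a) * g a := fun y =>
    Finset.sum_nonneg fun a _ => mul_nonneg (Gt_nonneg _ _) (hg a)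
  have hA : ∀ y ∈ A, g y ≤ ∑ a ∈ A, G (y - a) * g a := by
    intro y hy
    have h1 : G (y - y) * g y ≤ ∑ a ∈ A, G (y - a) * g a :=
      Finset.single_le_sum (f := fun a => G (y - a) * g a)
        (fun a _ => mul_nonneg (Gt_nonneg _ _) (hg a)) hy
    rw [sub_self] at h1
    nlinarith [hg y, G_zero_ge (d := d)]
  induction n generalizing y with
  | zero => simp only [hitV]; split_ifs with h; exacts [hA y h, h0 y]
  | succ n ih =>
    simp only [hitV]; split_ifs with h
    · exact hA y h
    · refine (PP_mono ih y).trans ?_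
      have : PP (fun y => ∑ a ∈ A, G (y - a) * g a) y = ∑ a ∈ A, Gt 1 (y - a) * g a := by
        unfold PP
        rw [av_sum]
        apply Finset.sum_congr rfl; intro a _
        have h2 := PP_Gt 0 a y
        unfold PP at h2
        simp only [mul_comm _ (g a), av_mul_left]
        rw [h2]
      rw [this]
      gcongr with a ha
      · exact hg a
      · exact Gt_anti (by omega) _

lemma hitV_bdd (y : Zd d) : BddAbove (Set.range fun n => hitV A g n y) :=
  ⟨_, by rintro _ ⟨n, rfl⟩; exact hitV_le_G hg n y⟩

lemma Hit_tendsto (y : Zd d) : Tendsto (fun n => hitV A g n y) atTop (𝓝 (Hit A g y)) :=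
  tendsto_atTop_ciSup (hitV_mono hg y) (hitV_bdd hg y)

lemma Hit_nonneg (y : Zd d) : 0 ≤ Hit A g y :=
  ge_of_tendsto' (Hit_tendsto hg y) fun n => hitV_nonneg hg n y

lemma Hit_le_G (y : Zd d) : Hit A g y ≤ ∑ a ∈ A, G (y - a) * g a :=
  le_of_tendsto' (Hit_tendsto hg y) fun n => hitV_le_G hg n y

lemma Hit_on {y : Zd d} (hy : y ∈ A) : Hit A g y = g y := by
  refine tendsto_nhds_unique (Hit_tendsto hg y) (tendsto_const_nhds.congr fun n => ?_)
  cases n <;> simp [hitV, hy]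

lemma Hit_off {y : Zd d} (hy : y ∉ A) : Hit A g y = PP (Hit A g) y := by
  have h1 := (tendsto_add_atTop_iff_nat 1).mpr (Hit_tendsto (A := A) hg y)
  refine tendsto_nhds_unique h1 ?_
  simp only [hitV, hy, if_false]
  exact av_tendsto fun e => Hit_tendsto hg _

end

lemma Hit_le_one {A : Finset (Zd d)} {g : Zd d → ℝ} (hg : ∀ x, 0 ≤ g x) (hg1 : ∀ x, g x ≤ 1)
    (y : Zd d) : Hit A g y ≤ 1 := by
  refine le_of_tendsto' (Hit_tendsto hg y) fun n => ?_
  induction n generalizing y with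
  | zero => simp only [hitV]; split_ifs; exacts [hg1 y, zero_le_one]
  | succ n ih => simp only [hitV]; split_ifs; exacts [hg1 y, PP_le_one ih y]

/-- Representation lemma. -/
lemma rep (A : Finset (Zd d)) (f : Zd d → ℝ) (h0 : ∀ y, 0 ≤ f y)
    (h1 : ∀ y, f y ≤ ∑ a ∈ A, G (y - a)) (h2 : ∀ y, y ∉ A → f y = PP f y) (y : Zd d) :
    f y = ∑ a ∈ A, G (y - a) * (f a - PP f a) := by
  have step : ∀ n, Ex n (fun l => f (y + endp l)) - Ex (n + 1) (fun l => f (y + endp l)) =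
      ∑ a ∈ A, pk n (a - y) * (f a - PP f a) := by
    intro n
    rw [← Ex_endp_eq_sum n A (fun a => f a - PP f a) (fun z hz => by simp [h2 z hz]) y, Ex_sub,
      Ex_succ']
    congr 1
    apply Ex_congr; intro l _
    simp [PP, add_assoc]
  have tel : ∀ n, f y - Ex n (fun l => f (y + endp l)) =
      ∑ t ∈ Finset.range n, ∑ a ∈ A, pk t (a - y) * (f a - PP f a) := by
    intro n
    induction n with
    | zero => simp
    | succ n ih => rw [Finset.sum_range_succ, ← ih, ← step]; ring
  have lim1 : Tendsto (fun n => Ex n (fun l => f (y + endp l))) atTop (𝓝 0) := by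
    have lim2 : Tendsto (fun n => ∑ a ∈ A, Gt n (y - a)) atTop (𝓝 0) := by
      have := tendsto_finsetSum A fun a _ => Gt_tendsto (y - a)
      simpa using this
    refine squeeze_zero (fun n => Ex_nonneg fun l _ => h0 _) (fun n => ?_) lim2
    calc Ex n (fun l => f (y + endp l)) ≤ Ex n (fun l => ∑ a ∈ A, G (y - a + endp l)) :=
          Ex_mono fun l _ => by
            refine (h1 _).trans (le_of_eq (Finset.sum_congr rfl fun a _ => ?_))
            congr 1; abel
      _ = _ := by
          rw [Ex_sum]; apply Finset.sum_congr rfl; intro a _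
          rw [Ex_Gt, zero_add]
  have lim3 : Tendsto (fun n => ∑ t ∈ Finset.range n, ∑ a ∈ A, pk t (a - y) * (f a - PP f a)) atTop
      (𝓝 (∑ a ∈ A, G (y - a) * (f a - PP f a))) := by
    have : HasSum (fun t => ∑ a ∈ A, pk t (a - y) * (f a - PP f a))
        (∑ a ∈ A, G (y - a) * (f a - PP f a)) := by
      apply hasSum_sum; intro a _
      have h3 := (Gt_hasSum 0 (a - y)).mul_right (f a - PP f a)
      simp only [zero_add] at h3
      rw [G, Gt_sub_comm]
      exact h3
    exact this.tendsto_sum_nat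
  have lim4 : Tendsto (fun n => f y - Ex n (fun l => f (y + endp l))) atTop (𝓝 (f y - 0)) :=
    tendsto_const_nhds.sub lim1
  simp only [tel] at lim4
  rw [sub_zero] at lim4
  exact tendsto_nhds_unique lim4 lim3

/-- hitting probability, equilibrium measure, capacity -/
def hh (A : Finset (Zd d)) (y : Zd d) : ℝ := Hit A (fun _ => 1) y
def ee (A : Finset (Zd d)) (a : Zd d) : ℝ := if a ∈ A then 1 - PP (hh A) a else 0
def cp (A : Finset (Zd d)) : ℝ := ∑ a ∈ A, ee A a

lemma hh_nonneg (A : Finset (Zd d)) (y : Zd d) : 0 ≤ hh A y := Hit_nonneg (fun _ => zero_le_one) y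
lemma hh_le_one (A : Finset (Zd d)) (y : Zd d) : hh A y ≤ 1 :=
  Hit_le_one (fun _ => zero_le_one) (fun _ => le_rfl) y
lemma hh_on {A : Finset (Zd d)} {y : Zd d} (h : y ∈ A) : hh A y = 1 :=
  Hit_on (fun _ => zero_le_one) h
lemma hh_le_G (A : Finset (Zd d)) (y : Zd d) : hh A y ≤ ∑ a ∈ A, G (y - a) := by
  have := Hit_le_G (A := A) (g := fun _ => (1 : ℝ)) (fun _ => zero_le_one) y
  simpa [hh] using this

lemma Hit_le_sumG {A : Finset (Zd d)} {g : Zd d → ℝ} (hg : ∀ x, 0 ≤ g x) (hg1 : ∀ x, g x ≤ 1)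
    (y : Zd d) : Hit A g y ≤ ∑ a ∈ A, G (y - a) :=
  (Hit_le_G hg y).trans (Finset.sum_le_sum fun a _ =>
    mul_le_of_le_one_right (Gt_nonneg _ _) (hg1 a))

lemma Hit_rep {A : Finset (Zd d)} {g : Zd d → ℝ} (hg : ∀ x, 0 ≤ g x) (hg1 : ∀ x, g x ≤ 1)
    (y : Zd d) : Hit A g y = ∑ a ∈ A, G (y - a) * (Hit A g a - PP (Hit A g) a) :=
  rep A _ (Hit_nonneg hg) (Hit_le_sumG hg hg1) (fun _ h => Hit_off hg h) y

lemma ee_nonneg (A : Finset (Zd d)) (a : Zd d) : 0 ≤ ee A a := by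
  unfold ee; split_ifs
  · linarith [PP_le_one (hh_le_one A) a]
  · exact le_rfl
lemma ee_le_one (A : Finset (Zd d)) (a : Zd d) : ee A a ≤ 1 := by
  unfold ee; split_ifs
  · linarith [PP_nonneg (hh_nonneg A) a]
  · exact zero_le_one
lemma ee_off {A : Finset (Zd d)} {a : Zd d} (h : a ∉ A) : ee A a = 0 := by simp [ee, h]

lemma hh_rep (A : Finset (Zd d)) (y : Zd d) : hh A y = ∑ a ∈ A, G (y - a) * ee A a := by
  rw [hh, Hit_rep (fun _ => zero_le_one) (fun _ => le_rfl)]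
  apply Finset.sum_congr rfl; intro a ha
  congr 1
  rw [ee, if_pos ha]
  congr 1
  exact hh_on ha

lemma mass {A C : Finset (Zd d)} (hAC : A ⊆ C) (ν : Zd d → ℝ) :
    ∑ b ∈ C, ee C b * ∑ a ∈ A, G (b - a) * ν a = ∑ a ∈ A, ν a := by
  simp only [Finset.mul_sum]
  rw [Finset.sum_comm]
  apply Finset.sum_congr rfl; intro a ha
  have h := hh_rep C a
  rw [hh_on (hAC ha)] at h
  have : ∑ b ∈ C, ee C b * (G (b - a) * ν a) = (∑ b ∈ C, G (a - b) * ee C b) * ν a := by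
    rw [Finset.sum_mul]; apply Finset.sum_congr rfl; intro b _
    rw [G, Gt_sub_comm]; ring
  rw [this, ← h, one_mul]

lemma cp_eq {A C : Finset (Zd d)} (hAC : A ⊆ C) : cp A = ∑ b ∈ C, ee C b * hh A b := by
  rw [cp, ← mass hAC]
  simp only [← hh_rep]

lemma cp_nonneg (A : Finset (Zd d)) : 0 ≤ cp A := Finset.sum_nonneg fun a _ => ee_nonneg A a
lemma cp_le_card (A : Finset (Zd d)) : cp A ≤ A.card := by
  unfold cp
  calc _ ≤ ∑ a ∈ A, (1 : ℝ) := Finset.sum_le_sum fun a _ => ee_le_one A a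
    _ = _ := by simp

/-- indicator of hitting -/
def ind (A : Finset (Zd d)) (y : Zd d) (l : List (Stp d)) : ℝ :=
  if ∃ z ∈ rng l, y + z ∈ A then 1 else 0

lemma hitV_eq (A : Finset (Zd d)) (n : ℕ) (y : Zd d) :
    hitV A (fun _ => 1) n y = Ex n (ind A y) := by
  induction n generalizing y with
  | zero => simp [hitV, ind]
  | succ n ih =>
    rw [hitV, Ex_succ]
    split_ifs with h
    · have : ∀ e : Stp d, (fun l => ind A y (e :: l)) = fun _ => (1 : ℝ) := by
        intro e; funext l
        rw [ind, if_pos]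
        exact ⟨0, zero_mem_rng _, by simpa using h⟩
      simp only [this, Ex_const, av_const]
    · unfold PP
      congr 1; funext e
      rw [ih]
      congr 1; funext l
      unfold ind
      congr 1
      rw [eq_iff_iff]
      constructor
      · rintro ⟨z, hz, hz'⟩
        refine ⟨vec e + z, ?_, by rwa [← add_assoc]⟩
        rw [rng_cons]; simp [hz]
      · rintro ⟨z, hz, hz'⟩
        rw [rng_cons, Finset.mem_insert] at hz
        rcases hz with rfl | hz
        · exact absurd (by simpa using hz') h
        · exact ⟨z - vec e, by simpa using hz, by
            rw [show y + vec e + (z - vec e) = y + z by abel]; exact hz'⟩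

lemma hh_tendsto (A : Finset (Zd d)) (y : Zd d) :
    Tendsto (fun n => Ex n (ind A y)) atTop (𝓝 (hh A y)) := by
  simp only [← hitV_eq]; exact Hit_tendsto (fun _ => zero_le_one) y

lemma ind_union (A B : Finset (Zd d)) (y : Zd d) (l : List (Stp d)) :
    ind (A ∪ B) y l = max (ind A y l) (ind B y l) := by
  have : (∃ z ∈ rng l, y + z ∈ A ∪ B) ↔ (∃ z ∈ rng l, y + z ∈ A) ∨ (∃ z ∈ rng l, y + z ∈ B) := by
    simp only [Finset.mem_union]
    constructor
    · rintro ⟨z, hz, h | h⟩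
      exacts [Or.inl ⟨z, hz, h⟩, Or.inr ⟨z, hz, h⟩]
    · rintro (⟨z, hz, h⟩ | ⟨z, hz, h⟩)
      exacts [⟨z, hz, Or.inl h⟩, ⟨z, hz, Or.inr h⟩]
  unfold ind
  by_cases h1 : ∃ z ∈ rng l, y + z ∈ A <;> by_cases h2 : ∃ z ∈ rng l, y + z ∈ B <;>
    simp only [this, h1, h2] <;> norm_num

lemma ind_mem (A : Finset (Zd d)) (y : Zd d) (l : List (Stp d)) : ind A y l = 0 ∨ ind A y l = 1 := by
  unfold ind; split_ifs <;> simp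

lemma ind_mono {A B : Finset (Zd d)} (h : A ⊆ B) (y : Zd d) (l : List (Stp d)) :
    ind A y l ≤ ind B y l := by
  rw [← Finset.union_eq_right.mpr h, ind_union]; exact le_max_left _ _

lemma hh_mono {A B : Finset (Zd d)} (h : A ⊆ B) (y : Zd d) : hh A y ≤ hh B y :=
  le_of_tendsto_of_tendsto' (hh_tendsto A y) (hh_tendsto B y) fun n =>
    Ex_mono fun l _ => ind_mono h y l

lemma hh_union_le (A B : Finset (Zd d)) (y : Zd d) : hh (A ∪ B) y ≤ hh A y + hh B y := by
  refine le_of_tendsto_of_tendsto' (hh_tendsto _ y) ((hh_tendsto A y).add (hh_tendsto B y))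
    fun n => ?_
  rw [← Ex_add]
  refine Ex_mono fun l _ => ?_
  rw [ind_union]
  rcases ind_mem A y l with h | h <;> rcases ind_mem B y l with h' | h' <;> rw [h, h'] <;> norm_num

lemma hh_submod {A A' : Finset (Zd d)} (hA : A ⊆ A') (B : Finset (Zd d)) (y : Zd d) :
    hh A y + hh (A' ∪ B) y ≤ hh A' y + hh (A ∪ B) y := by
  refine le_of_tendsto_of_tendsto' ((hh_tendsto _ y).add (hh_tendsto _ y))
    ((hh_tendsto _ y).add (hh_tendsto _ y)) fun n => ?_
  rw [← Ex_add, ← Ex_add]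
  refine Ex_mono fun l _ => ?_
  have := ind_mono hA y l
  rw [ind_union, ind_union]
  rcases ind_mem A y l with h | h <;> rcases ind_mem B y l with h' | h' <;>
    rcases ind_mem A' y l with h'' | h'' <;> rw [h, h''] at this <;> rw [h, h', h''] <;>
    first
    | (exfalso; linarith)
    | norm_num

lemma hh_three (A A' B : Finset (Zd d)) (y : Zd d) :
    hh (A ∪ A') y + (hh (A ∪ B) y + hh (A' ∪ B) y) ≤
      hh A y + (hh A' y + (hh B y + hh (A ∪ A' ∪ B) y)) := by
  refine le_of_tendsto_of_tendsto' ((hh_tendsto _ y).add ((hh_tendsto _ y).add (hh_tendsto _ y)))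
    ((hh_tendsto _ y).add ((hh_tendsto _ y).add ((hh_tendsto _ y).add (hh_tendsto _ y)))) fun n => ?_
  simp only [← Ex_add]
  refine Ex_mono fun l _ => ?_
  simp only [ind_union]
  rcases ind_mem A y l with h | h <;> rcases ind_mem B y l with h' | h' <;>
    rcases ind_mem A' y l with h'' | h'' <;> rw [h, h', h''] <;> norm_num

lemma ee_anti {A C : Finset (Zd d)} (hAC : A ⊆ C) {a : Zd d} (ha : a ∈ A) : ee C a ≤ ee A a := by
  rw [ee, ee, if_pos ha, if_pos (hAC ha)]
  linarith [PP_mono (hh_mono hAC) a]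

lemma cp_mono {A C : Finset (Zd d)} (hAC : A ⊆ C) : cp A ≤ cp C := by
  rw [cp_eq hAC, cp]
  exact Finset.sum_le_sum fun b _ => mul_le_of_le_one_right (ee_nonneg C b) (hh_le_one A b)

lemma cp_eq' {A C : Finset (Zd d)} (hAC : A ⊆ C) : cp A = ∑ b ∈ C, ee C b * hh A b := cp_eq hAC

/-- cross term -/
def ch (A B : Finset (Zd d)) : ℝ := cp A + cp B - cp (A ∪ B)
def KK (A B : Finset (Zd d)) : ℝ := ∑ a ∈ A, ee A a * hh B a

lemma ch_comm (A B : Finset (Zd d)) : ch A B = ch B A := by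
  unfold ch; rw [Finset.union_comm]; ring

lemma ch_nonneg (A B : Finset (Zd d)) : 0 ≤ ch A B := by
  unfold ch
  rw [cp_eq (Finset.subset_union_left (s₁ := A) (s₂ := B)),
    cp_eq (Finset.subset_union_right (s₁ := A) (s₂ := B)), cp_eq (Finset.Subset.refl (A ∪ B)),
    ← Finset.sum_add_distrib, ← Finset.sum_sub_distrib]
  refine Finset.sum_nonneg fun b _ => ?_
  nlinarith [hh_union_le A B b, ee_nonneg (A ∪ B) b]

lemma ch_mono_left {A A' : Finset (Zd d)} (hA : A ⊆ A') (B : Finset (Zd d)) : ch A B ≤ ch A' B := by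
  have h : cp A + cp (A' ∪ B) ≤ cp A' + cp (A ∪ B) := by
    have s1 : A ⊆ A' ∪ B := hA.trans Finset.subset_union_left
    have s2 : A ∪ B ⊆ A' ∪ B := Finset.union_subset_union_left hA
    rw [cp_eq s1, cp_eq s2, cp_eq (Finset.subset_union_left (s₁ := A') (s₂ := B)),
      cp_eq (Finset.Subset.refl (A' ∪ B)), ← Finset.sum_add_distrib, ← Finset.sum_add_distrib]
    refine Finset.sum_le_sum fun b _ => ?_
    nlinarith [hh_submod hA B b, ee_nonneg (A' ∪ B) b]
  unfold ch; linarith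

lemma ch_mono_right (A : Finset (Zd d)) {B B' : Finset (Zd d)} (hB : B ⊆ B') : ch A B ≤ ch A B' := by
  rw [ch_comm A, ch_comm A]; exact ch_mono_left hB A

lemma ch_union_left (A A' B : Finset (Zd d)) : ch (A ∪ A') B ≤ ch A B + ch A' B := by
  have h : cp (A ∪ A') + cp (A ∪ B) + cp (A' ∪ B) ≤ cp A + cp A' + cp B + cp (A ∪ A' ∪ B) := by
    set C := A ∪ A' ∪ B with hC
    have s1 : A ⊆ C := by rw [hC]; intro x; simp; tauto
    have s2 : A' ⊆ C := by rw [hC]; intro x; simp; tauto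
    have s3 : B ⊆ C := by rw [hC]; intro x; simp; tauto
    rw [cp_eq s1, cp_eq s2, cp_eq s3, cp_eq (Finset.union_subset s1 s2),
      cp_eq (Finset.union_subset s1 s3), cp_eq (Finset.union_subset s2 s3),
      cp_eq (Finset.Subset.refl C)]
    simp only [← Finset.sum_add_distrib]
    refine Finset.sum_le_sum fun b _ => ?_
    have := mul_le_mul_of_nonneg_left (hh_three A A' B b) (ee_nonneg C b)
    rw [← hC] at this
    linarith
  unfold ch; linarith

lemma ch_union_right (A B B' : Finset (Zd d)) : ch A (B ∪ B') ≤ ch A B + ch A B' := by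
  rw [ch_comm A, ch_comm A, ch_comm A]; exact ch_union_left B B' A

lemma KK_eq (A B : Finset (Zd d)) :
    KK A B = ∑ a ∈ A, ∑ b ∈ B, ee A a * ee B b * G (a - b) := by
  unfold KK
  apply Finset.sum_congr rfl; intro a _
  rw [hh_rep, Finset.mul_sum]
  apply Finset.sum_congr rfl; intro b _; ring

lemma KK_comm (A B : Finset (Zd d)) : KK A B = KK B A := by
  rw [KK_eq, KK_eq, Finset.sum_comm]
  apply Finset.sum_congr rfl; intro b _
  apply Finset.sum_congr rfl; intro a _
  rw [G, Gt_sub_comm]; ring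

lemma KK_nonneg (A B : Finset (Zd d)) : 0 ≤ KK A B :=
  Finset.sum_nonneg fun a _ => mul_nonneg (ee_nonneg _ _) (hh_nonneg _ _)

lemma ch_le_two_KK (A B : Finset (Zd d)) : ch A B ≤ 2 * KK A B := by
  have h1 : ch A B = ∑ b ∈ A ∪ B, ee (A ∪ B) b * (hh A b + hh B b - 1) := by
    unfold ch
    rw [cp_eq (Finset.subset_union_left (s₁ := A) (s₂ := B)),
      cp_eq (Finset.subset_union_right (s₁ := A) (s₂ := B)), cp,
      ← Finset.sum_add_distrib, ← Finset.sum_sub_distrib]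
    apply Finset.sum_congr rfl; intro b _; ring
  have h2 : KK A B = ∑ b ∈ A ∪ B, ee A b * hh B b :=
    Finset.sum_subset Finset.subset_union_left fun x _ hx => by rw [ee_off hx, zero_mul]
  have h3 : KK A B = ∑ b ∈ A ∪ B, ee B b * hh A b := by
    rw [KK_comm]
    exact Finset.sum_subset Finset.subset_union_right fun x _ hx => by rw [ee_off hx, zero_mul]
  have h4 : 2 * KK A B = ∑ b ∈ A ∪ B, (ee A b * hh B b + ee B b * hh A b) := by
    rw [Finset.sum_add_distrib, ← h2, ← h3]; ring
  rw [h1, h4]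
  refine Finset.sum_le_sum fun b hb => ?_
  have e0 := ee_nonneg (A ∪ B) b
  have eA := ee_nonneg A b
  have eB := ee_nonneg B b
  have a0 := hh_nonneg A b
  have b0 := hh_nonneg B b
  have a1 := hh_le_one A b
  have b1 := hh_le_one B b
  by_cases hA : b ∈ A
  · have := ee_anti (Finset.subset_union_left (s₁ := A) (s₂ := B)) hA
    rw [hh_on hA]
    have : ee (A ∪ B) b * hh B b ≤ ee A b * hh B b := by gcongr
    nlinarith
  · have hB : b ∈ B := by simpa [hA] using hb
    have := ee_anti (Finset.subset_union_right (s₁ := A) (s₂ := B)) hB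
    rw [hh_on hB]
    have : ee (A ∪ B) b * hh A b ≤ ee B b * hh A b := by gcongr
    nlinarith

def ZZ (A B : Finset (Zd d)) : ℝ :=
  ∑ a ∈ A, ee A a * Hit B (hh A) a + ∑ b ∈ B, ee B b * Hit A (hh B) b

lemma Hit_mass {A C : Finset (Zd d)} (hAC : A ⊆ C) {g : Zd d → ℝ} (hg : ∀ x, 0 ≤ g x)
    (hg1 : ∀ x, g x ≤ 1) : ∑ b ∈ C, ee C b * Hit A g b = ∑ a ∈ A, ee A a * g a := by
  have h := mass hAC (fun a => Hit A g a - PP (Hit A g) a)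
  simp only [← Hit_rep hg hg1] at h
  have h' := mass (Finset.Subset.refl A) (fun a => Hit A g a - PP (Hit A g) a)
  simp only [← Hit_rep hg hg1] at h'
  rw [h, ← h']
  exact Finset.sum_congr rfl fun a ha => by rw [Hit_on hg ha]

lemma ch_ge (A B : Finset (Zd d)) : 2 * KK A B - ZZ A B ≤ ch A B := by
  set C := A ∪ B with hC
  have sA : A ⊆ C := Finset.subset_union_left
  have sB : B ⊆ C := Finset.subset_union_right
  set u := Hit A (hh B) with hu
  set v := Hit B (hh A) with hv
  have u0 : ∀ x, 0 ≤ u x := Hit_nonneg (hh_nonneg B)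
  have v0 : ∀ x, 0 ≤ v x := Hit_nonneg (hh_nonneg A)
  have u1 : ∀ x, u x ≤ 1 := Hit_le_one (hh_nonneg B) (hh_le_one B)
  have v1 : ∀ x, v x ≤ 1 := Hit_le_one (hh_nonneg A) (hh_le_one A)
  have key : ∀ b ∈ C, (1 : ℝ) ≤ hh A b + hh B b - u b - v b + Hit A v b + Hit B u b := by
    intro b hb
    rw [hC, Finset.mem_union] at hb
    rcases hb with h | h
    · rw [hh_on h, hu, Hit_on (hh_nonneg B) h, Hit_on v0 h]
      linarith [Hit_nonneg (A := B) u0 b]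
    · rw [hh_on h, hv, Hit_on (hh_nonneg A) h, Hit_on u0 h]
      linarith [Hit_nonneg (A := A) v0 b]
  have m1 := Hit_mass sA (hh_nonneg B) (hh_le_one B)
  have m2 := Hit_mass sB (hh_nonneg A) (hh_le_one A)
  have m3 := Hit_mass sA v0 v1
  have m4 := Hit_mass sB u0 u1
  have h1 : cp C ≤ ∑ b ∈ C, ee C b * (hh A b + hh B b - u b - v b + Hit A v b + Hit B u b) :=
    Finset.sum_le_sum fun b hb => by nlinarith [key b hb, ee_nonneg C b]
  have h2 : ∑ b ∈ C, ee C b * (hh A b + hh B b - u b - v b + Hit A v b + Hit B u b) =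
      cp A + cp B - KK A B - KK B A + ZZ A B := by
    rw [cp_eq sA, cp_eq sB, ZZ, KK, KK, ← m1, ← m2, ← m3, ← m4]
    simp only [← Finset.sum_add_distrib, ← Finset.sum_sub_distrib]
    apply Finset.sum_congr rfl; intro b _; ring
  rw [KK_comm B A] at h2
  unfold ch
  linarith

lemma Hit_hh_le (A B : Finset (Zd d)) (y : Zd d) :
    Hit A (hh B) y ≤ ∑ a ∈ A, ∑ b ∈ B, G (y - a) * G (a - b) := by
  refine (Hit_le_G (hh_nonneg B) y).trans (Finset.sum_le_sum fun a _ => ?_)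
  rw [← Finset.mul_sum]
  exact mul_le_mul_of_nonneg_left (hh_le_G B a) (Gt_nonneg _ _)

lemma ZZ_le (A B : Finset (Zd d)) : ZZ A B ≤
    ∑ a' ∈ A, ∑ b ∈ B, ∑ a ∈ A, G (a' - b) * G (b - a) +
    ∑ b' ∈ B, ∑ a ∈ A, ∑ b ∈ B, G (b' - a) * G (a - b) := by
  unfold ZZ
  gcongr with a' ha' b' hb'
  · exact (mul_le_of_le_one_left (Hit_nonneg (hh_nonneg _) _) (ee_le_one _ _)).trans (Hit_hh_le B A a')
  · exact (mul_le_of_le_one_left (Hit_nonneg (hh_nonneg _) _) (ee_le_one _ _)).trans (Hit_hh_le A B b')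

lemma cp_union_le (A B : Finset (Zd d)) : cp (A ∪ B) ≤ cp A + cp B := by
  have := ch_nonneg A B; unfold ch at this; linarith

/-- energy bound with a measure given by a family of points -/
lemma cp_energy {ι : Type*} (I : Finset ι) (X : ι → Zd d) (A : Finset (Zd d)) (hX : ∀ i ∈ I, X i ∈ A)
    (r : ℝ) : 2 * r * I.card - r ^ 2 * ∑ i ∈ I, ∑ j ∈ I, G (X i - X j) ≤ cp A := by
  set ν : Zd d → ℝ := fun a => ∑ i ∈ I, if X i = a then r else 0 with hν
  have hsum : ∀ F : Zd d → ℝ, ∑ a ∈ A, ν a * F a = r * ∑ i ∈ I, F (X i) := by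
    intro F
    simp only [hν, Finset.sum_mul]
    rw [Finset.sum_comm, Finset.mul_sum]
    apply Finset.sum_congr rfl; intro i hi
    simp only [ite_mul, zero_mul]
    rw [Finset.sum_ite_eq, if_pos (hX i hi)]
  have h := G_quad_nonneg A (fun a => ν a - ee A a)
  have e : ∑ a ∈ A, ∑ b ∈ A, (ν a - ee A a) * (ν b - ee A b) * G (a - b) =
      r ^ 2 * ∑ i ∈ I, ∑ j ∈ I, G (X i - X j) - 2 * r * I.card + cp A := by
    have t1 : ∀ a ∈ A, ∑ b ∈ A, (ν a - ee A a) * (ν b - ee A b) * G (a - b) =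
        ν a * (r * ∑ j ∈ I, G (a - X j)) - ν a - ee A a * (r * ∑ j ∈ I, G (a - X j)) + ee A a := by
      intro a ha
      have hr := hh_rep A a
      rw [hh_on ha] at hr
      have hs := hsum (fun b => G (a - b))
      have : ∑ b ∈ A, (ν a - ee A a) * (ν b - ee A b) * G (a - b) =
          (ν a - ee A a) * (∑ b ∈ A, ν b * G (a - b) - ∑ b ∈ A, G (a - b) * ee A b) := by
        rw [← Finset.sum_sub_distrib, Finset.mul_sum]
        apply Finset.sum_congr rfl; intro b _; ring
      rw [this, hs, ← hr]; ring
    rw [Finset.sum_congr rfl t1, Finset.sum_add_distrib, Finset.sum_sub_distrib,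
      Finset.sum_sub_distrib]
    have t2 := hsum (fun a => r * ∑ j ∈ I, G (a - X j))
    have t3 := hsum (fun _ => 1)
    simp only [mul_one, Finset.sum_const, nsmul_eq_mul] at t3
    have t4 : ∑ a ∈ A, ee A a * (r * ∑ j ∈ I, G (a - X j)) = r * I.card := by
      have : ∀ a ∈ A, ee A a * (r * ∑ j ∈ I, G (a - X j)) =
          r * ∑ j ∈ I, G (X j - a) * ee A a := by
        intro a _
        simp only [Finset.mul_sum]
        apply Finset.sum_congr rfl; intro j _
        rw [G, Gt_sub_comm]; ring
      rw [Finset.sum_congr rfl this, ← Finset.mul_sum, Finset.sum_comm]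
      have t5 : ∀ j ∈ I, ∑ a ∈ A, G (X j - a) * ee A a = 1 := fun j hj => by
        rw [← hh_rep, hh_on (hX j hj)]
      rw [Finset.sum_congr rfl t5]; simp
    rw [t2, t3, t4, ← Finset.mul_sum]
    unfold cp; ring
  rw [e] at h; linarith

/-- translation invariance -/
lemma hh_sh (x : Zd d) (A : Finset (Zd d)) (y : Zd d) : hh (sh x A) y = hh A (y - x) := by
  refine tendsto_nhds_unique (hh_tendsto _ y) ?_
  refine (hh_tendsto A (y - x)).congr fun n => ?_
  congr 1; funext l
  unfold ind
  simp only [mem_sh, add_sub_right_comm]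

lemma ee_sh (x : Zd d) (A : Finset (Zd d)) (y : Zd d) : ee (sh x A) y = ee A (y - x) := by
  unfold ee
  simp only [mem_sh, PP, hh_sh, add_sub_right_comm]

lemma cp_sh (x : Zd d) (A : Finset (Zd d)) : cp (sh x A) = cp A := by
  unfold cp; rw [sum_sh]; simp only [ee_sh, add_sub_cancel_left]

lemma ch_sh (x : Zd d) (A B : Finset (Zd d)) : ch (sh x A) (sh x B) = ch A B := by
  unfold ch; rw [← sh_union, cp_sh, cp_sh, cp_sh]

end pot


section Layer0
variable {d : ℕ}

lemma Ex_eq_sum : ∀ (n : ℕ) (f : List (Stp d) → ℝ),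
    Ex n f = (∑ v : Fin n → Stp d, f (List.ofFn v)) / (2 * d) ^ n
  | 0, f => by simp [Ex]
  | n + 1, f => by
    rw [Ex_succ, av]
    simp only [Ex_eq_sum n]
    rw [← (Fin.consEquiv (fun _ => Stp d)).sum_comp, ← Finset.sum_div, pow_succ, div_div]
    congr 1
    refine (Fintype.sum_prod_type' (fun (e : Stp d) (v : Fin n → Stp d) => f (e :: List.ofFn v))).symm.trans ?_
    apply Finset.sum_congr rfl
    intro x _
    simp [Fin.consEquiv, List.ofFn_cons]

def pth (x : Zd d) (l : List (Stp d)) (t : ℕ) : Zd d := x + endp (l.take t)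

lemma vec_inj : Function.Injective (vec (d := d)) := by
  rintro ⟨i, b⟩ ⟨j, c⟩ h
  have h1 := congrFun h i
  simp only [vec, Pi.single_apply] at h1
  by_cases hij : i = j
  · subst hij
    cases b <;> cases c <;> simp_all
  · cases b <;> cases c <;> simp_all

lemma IsNN_vec (x : Zd d) (e : Stp d) : IsNN x (x + vec e) := by
  unfold IsNN vec
  rw [Finset.sum_eq_single e.1]
  · rcases e with ⟨i, b⟩; cases b <;> simp
  · intro j _ hj; simp [Pi.single_apply, hj]
  · simp

lemma endp_take_succ (l : List (Stp d)) (t : ℕ) (h : t < l.length) :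
    endp (l.take (t + 1)) = endp (l.take t) + vec (l[t]) := by
  rw [List.take_add_one, endp_append]
  simp [h, endp]

lemma pth_inj (x : Zd d) {l l' : List (Stp d)} {T : ℕ} (hl : l.length = T) (hl' : l'.length = T)
    (h : ∀ t ≤ T, pth x l t = pth x l' t) : l = l' := by
  apply List.ext_getElem (hl.trans hl'.symm)
  intro t h1 h2
  have a := h t (by omega)
  have b := h (t + 1) (by omega)
  simp only [pth, add_right_inj] at a b
  rw [endp_take_succ _ _ h1, endp_take_succ _ _ h2, a] at b
  exact vec_inj (add_left_cancel b)

variable [NeZero d]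

lemma cyl_meas (T : ℕ) (w : ℕ → Zd d) : MeasurableSet {ω : ℕ → Zd d | ∀ t ≤ T, ω t = w t} := by
  have : {ω : ℕ → Zd d | ∀ t ≤ T, ω t = w t} = ⋂ t : ℕ, ⋂ _ : t ≤ T, (fun ω : ℕ → Zd d => ω t) ⁻¹' {w t} := by
    ext ω; simp
  rw [this]
  exact MeasurableSet.iInter fun t => MeasurableSet.iInter fun _ =>
    (measurable_pi_apply t) (measurableSet_singleton _)

lemma int_eq {x : Zd d} {P : Measure (ℕ → Zd d)} (hP : IsSRW d x P) (T : ℕ)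
    (F : (ℕ → Zd d) → ℝ) (hF : ∀ ω ω', (∀ t ≤ T, ω t = ω' t) → F ω = F ω') :
    ∫ ω, F ω ∂P = Ex T fun l => F (pth x l) := by
  have := hP.1
  set C : (Fin T → Stp d) → Set (ℕ → Zd d) := fun v => {ω | ∀ t ≤ T, ω t = pth x (List.ofFn v) t} with hC
  have mC : ∀ v, MeasurableSet (C v) := fun v => cyl_meas T _
  have pC : ∀ v, P (C v) = (((2 * d : ℕ) : ℝ≥0∞))⁻¹ ^ T := by
    intro v
    rw [hP.2 T (pth x (List.ofFn v)), if_pos]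
    refine ⟨by simp [pth], fun t ht => ?_⟩
    have hl : t < (List.ofFn v).length := by simpa using ht
    have : pth x (List.ofFn v) (t + 1) = pth x (List.ofFn v) t + vec ((List.ofFn v)[t]) := by
      simp only [pth]; rw [endp_take_succ _ _ hl, add_assoc]
    rw [this]; exact IsNN_vec _ _
  have dC : Pairwise (Function.onFun Disjoint C) := by
    intro v v' hv
    rw [Function.onFun, Set.disjoint_left]
    intro ω h h'
    apply hv
    have := pth_inj (T := T) x (l := List.ofFn v) (l' := List.ofFn v') (by simp) (by simp)
      (fun t ht => (h t ht).symm.trans (h' t ht))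
    exact List.ofFn_injective this
  have d0 : ((2 * d : ℕ) : ℝ≥0∞) ≠ 0 := by
    have := NeZero.ne d
    exact_mod_cast (by omega : 2 * d ≠ 0)
  have dt : ((2 * d : ℕ) : ℝ≥0∞) ≠ ⊤ := ENNReal.natCast_ne_top _
  have hU : P (⋃ v, C v) = 1 := by
    rw [measure_iUnion dC mC, tsum_fintype]
    simp only [pC, Finset.sum_const, Finset.card_univ, Fintype.card_pi_const, nsmul_eq_mul]
    rw [Fintype.card_prod, Fintype.card_fin, Fintype.card_bool, Nat.cast_pow, mul_comm d 2, ← mul_pow,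
      ENNReal.mul_inv_cancel d0 dt, one_pow]
  have hae : ∀ᵐ ω ∂P, ω ∈ ⋃ v, C v := by
    rw [ae_iff]
    have := prob_compl_eq_zero_iff (μ := P) (MeasurableSet.iUnion mC)
    exact this.mpr hU
  have hr : P.restrict (⋃ v, C v) = P := Measure.restrict_eq_self_of_ae_mem hae
  have hFC : ∀ v, Set.EqOn F (fun _ => F (pth x (List.ofFn v))) (C v) := by
    intro v ω h; exact hF _ _ h
  rw [← hr, integral_iUnion_fintype mC dC, Ex_eq_sum, Finset.sum_div]
  · apply Finset.sum_congr rfl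
    intro v _
    rw [setIntegral_congr_fun (mC v) (hFC v), setIntegral_const, measureReal_def, pC v]
    simp [ENNReal.toReal_pow, ENNReal.toReal_inv, div_eq_inv_mul]
    left; rw [← inv_pow, mul_inv, mul_comm]
  · intro v
    exact (integrableOn_const (hs := measure_ne_top P _)).congr_fun (hFC v).symm (mC v)
end Layer0

section Layer0b
variable {d : ℕ} [Fact (4 ≤ d)]

lemma noRet_eq {x : Zd d} {P : Measure (ℕ → Zd d)} (hP : IsSRW d x P) (A : Finset (Zd d)) :
    (P (NoReturn (A : Set (Zd d)))).toReal = 1 - PP (hh A) x := by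
  have := hP.1
  set S : ℕ → Set (ℕ → Zd d) := fun n => {ω | ∀ t, 0 < t → t ≤ n + 1 → ω t ∉ A} with hS
  have mS : ∀ n, MeasurableSet (S n) := by
    intro n
    have : S n = ⋂ t : ℕ, ⋂ _ : 0 < t, ⋂ _ : t ≤ n + 1, (fun ω : ℕ → Zd d => ω t) ⁻¹' (A : Set (Zd d))ᶜ := by
      ext ω; simp [hS]
    rw [this]
    exact MeasurableSet.iInter fun t => MeasurableSet.iInter fun _ => MeasurableSet.iInter fun _ =>
      (measurable_pi_apply t) (A.measurableSet.compl)
  have hI : NoReturn (A : Set (Zd d)) = ⋂ n, S n := by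
    ext ω
    simp only [NoReturn, hS, Set.mem_ofPred_eq, Set.mem_iInter, Finset.mem_coe]
    exact ⟨fun h n t ht _ => h t ht, fun h t ht => h t t ht (by omega)⟩
  have hanti : Antitone S := fun m n h ω hω t h0 ht => hω t h0 (by omega)
  have h1 : Tendsto (fun n => (P (S n)).toReal) atTop (𝓝 (P (NoReturn (A : Set (Zd d)))).toReal) := by
    rw [hI]
    exact (ENNReal.tendsto_toReal (measure_ne_top _ _)).comp
      (tendsto_measure_iInter_atTop (fun n => (mS n).nullMeasurableSet) hanti ⟨0, measure_ne_top _ _⟩)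
  have h2 : ∀ n, (P (S n)).toReal = 1 - av fun e => Ex n (ind A (x + vec e)) := by
    intro n
    rw [← measureReal_def, ← integral_indicator_one (mS n), int_eq hP (n + 1)]
    · rw [Ex_succ, ← av_const (d := d) 1, ← av_sub]
      congr 1; ext e
      rw [← Ex_const (d := d) n 1, ← Ex_sub]
      apply Ex_congr
      intro l hl
      by_cases h : ∃ z ∈ rng l, x + vec e + z ∈ A
      · rw [ind, if_pos h, Set.indicator_of_notMem]
        · simp
        · obtain ⟨z, hz, h⟩ := h
          obtain ⟨k, hk, rfl⟩ := mem_rng.mp hz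
          intro h'
          refine h' (k + 1) (by omega) (by omega) ?_
          simpa [pth, endp_cons, add_assoc] using h
      · rw [ind, if_neg h, Set.indicator_of_mem]
        · simp
        · intro t h0 ht h'
          obtain ⟨k, rfl⟩ : ∃ k, t = k + 1 := ⟨t - 1, by omega⟩
          refine h ⟨_, mem_rng.mpr ⟨k, by omega, rfl⟩, ?_⟩
          simpa [pth, endp_cons, add_assoc] using h'
    · intro ω ω' h
      have : ω ∈ S n ↔ ω' ∈ S n := by
        simp only [hS, Set.mem_ofPred_eq]
        refine forall_congr' fun t => forall_congr' fun _ => forall_congr' fun ht => ?_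
        rw [h t ht]
      by_cases hm : ω ∈ S n
      · rw [Set.indicator_of_mem hm, Set.indicator_of_mem (this.mp hm)]; rfl
      · rw [Set.indicator_of_notMem hm, Set.indicator_of_notMem (fun h => hm (this.mpr h))]
  refine tendsto_nhds_unique h1 ?_
  simp only [h2]
  exact tendsto_const_nhds.sub (av_tendsto fun e => hh_tendsto A (x + vec e))

variable {Pw : Zd d → Measure (ℕ → Zd d)} (hPw : IsSRWFamily d Pw)
include hPw

lemma capacity_eq (A : Finset (Zd d)) : capacity Pw A = cp A := by
  unfold capacity cp
  apply Finset.sum_congr rfl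
  intro a ha
  rw [equil, if_pos (by exact_mod_cast ha), noRet_eq (hPw a), ee, if_pos ha]

lemma walkRange_pth (l : List (Stp d)) : walkRange (pth 0 l) 0 l.length = rng l := by
  ext z
  simp [walkRange, mem_rng, pth]

def cT (d : ℕ) [Fact (4 ≤ d)] (T : ℕ) : ℝ := Ex (d := d) T fun l => cp (rng l)
def vT (d : ℕ) [Fact (4 ≤ d)] (T : ℕ) : ℝ := Vr (d := d) T fun l => cp (rng l)

lemma walkRange_congr {T : ℕ} {ω ω' : ℕ → Zd d} (h : ∀ t ≤ T, ω t = ω' t) :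
    walkRange ω 0 T = walkRange ω' 0 T := by
  unfold walkRange
  apply Finset.image_congr
  intro t ht
  simp at ht
  exact h t ht

lemma cap_meas (T : ℕ) : Measurable fun ω : ℕ → Zd d => cp (walkRange ω 0 T) := by
  have h : (fun ω : ℕ → Zd d => cp (walkRange ω 0 T)) =
      (fun f : Fin (T + 1) → Zd d => cp (Finset.univ.image f)) ∘ fun ω t => ω t := by
    ext ω
    simp only [Function.comp]
    congr 1
    ext z
    simp only [walkRange, Finset.mem_image, Finset.mem_Icc, Finset.mem_univ, true_and]
    constructor
    · rintro ⟨t, ht, rfl⟩; exact ⟨⟨t, by omega⟩, rfl⟩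
    · rintro ⟨t, rfl⟩; exact ⟨t, by omega, rfl⟩
  rw [h]
  exact (measurable_of_countable _).comp (measurable_pi_lambda _ fun t => measurable_pi_apply _)

lemma capExpect_eq (T : ℕ) : capExpect Pw T = cT d T := by
  unfold capExpect cT
  simp only [capacity_eq hPw]
  rw [int_eq (hPw 0) T]
  · apply Ex_congr
    intro l hl
    rw [← hl, walkRange_pth hPw]
  · intro ω ω' h; rw [walkRange_congr hPw h]

lemma variance_eq' (T : ℕ) : variance (fun ω => capacity Pw (walkRange ω 0 T)) (Pw 0) = vT d T := by
  simp only [capacity_eq hPw]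
  rw [variance_eq_integral (cap_meas hPw T).aemeasurable]
  have h := capExpect_eq hPw T
  unfold capExpect at h
  simp only [capacity_eq hPw] at h
  rw [h, int_eq (hPw 0) T]
  · rw [vT, Vr_eq]
    apply Ex_congr
    intro l hl
    rw [← hl, walkRange_pth hPw]; simp only [hl]; rfl
  · intro ω ω' h; rw [walkRange_congr hPw h]

lemma cheb (T : ℕ) (a : ℝ) (ha : 0 < a) :
    ((Pw 0) {ω | a < |capacity Pw (walkRange ω 0 T) - cT d T|}).toReal ≤ vT d T / a ^ 2 := by
  have := (hPw 0).1
  have hm : MemLp (fun ω => capacity Pw (walkRange ω 0 T)) 2 (Pw 0) := by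
    simp only [capacity_eq hPw]
    refine MemLp.of_bound (cap_meas hPw T).aestronglyMeasurable (T + 1) (Eventually.of_forall fun ω => ?_)
    rw [Real.norm_of_nonneg (cp_nonneg _)]
    refine (cp_le_card _).trans ?_
    have : (walkRange ω 0 T).card ≤ T + 1 := by
      unfold walkRange
      refine Finset.card_image_le.trans ?_
      simp
    exact_mod_cast this
  have h := meas_ge_le_variance_div_sq hm ha
  rw [variance_eq' hPw, show (∫ ω, capacity Pw (walkRange ω 0 T) ∂(Pw 0)) = cT d T from capExpect_eq hPw T] at h
  refine ENNReal.toReal_le_of_le_ofReal (div_nonneg (Vr_nonneg _ _) (sq_nonneg _))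
    (le_trans (measure_mono fun ω hω => ?_) h)
  have hω' : a < |capacity Pw (walkRange ω 0 T) - cT d T| := hω
  exact hω'.le
end Layer0b


section Gen
variable {d : ℕ} [Fact (4 ≤ d)]

lemma Ex_pair {M i u : ℕ} (h : i + u ≤ M) (H : Zd d → Zd d → ℝ) :
    Ex M (fun l => H (endp (l.take i)) (endp (l.take (i + u)))) =
      Ex i fun a => Ex u fun b => H (endp a) (endp a + endp b) := by
  have e : (fun l : List (Stp d) => H (endp (l.take i)) (endp (l.take (i + u)))) =
      fun l => (fun m : List (Stp d) => H (endp (m.take i)) (endp m)) (l.take (i + u)) := by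
    funext l; simp [List.take_take]
  rw [e, Ex_take h (fun m : List (Stp d) => H (endp (m.take i)) (endp m)), Ex_append]
  apply Ex_congr; intro a ha
  apply Ex_congr; intro b hb
  rw [endp_take_append_left _ _ _ (by omega), endp_append, List.take_of_length_le (by omega)]

lemma Ex_two (u v : ℕ) (F : Zd d → ℝ) (x : Zd d) :
    Ex u (fun b => Ex v fun b' => F (x + endp b - endp b')) = Ex (u + v) fun l => F (x + endp l) := by
  rw [Ex_append]
  apply Ex_congr; intro a _
  rw [← Ex_flip]
  apply Ex_congr; intro b _
  rw [endp_flip, endp_append]; congr 1; abel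

lemma cp_append (a b : List (Stp d)) :
    cp (rng (a ++ b)) = cp (rng a) + cp (rng b) - ch (rng (rv a)) (rng b) := by
  rw [rng_append, rng_rv a, ← sh_union, cp_sh, cp_sh, ch]; ring

lemma cp_rv (a : List (Stp d)) : cp (rng (rv a)) = cp (rng a) := by
  rw [rng_rv a, cp_sh]

lemma cT_subadd (m n : ℕ) : cT d (m + n) ≤ cT d m + cT d n := by
  unfold cT
  rw [Ex_append, ← Ex_const (d := d) m (Ex n _), ← Ex_add]
  refine Ex_mono fun a _ => ?_
  rw [← Ex_const (d := d) n (cp (rng a)), ← Ex_add]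
  refine Ex_mono fun b _ => ?_
  rw [cp_append]; linarith [ch_nonneg (rng (rv a)) (rng b)]

lemma cT_mono : Monotone (cT d) := by
  intro m n h
  obtain ⟨k, rfl⟩ := Nat.exists_eq_add_of_le h
  unfold cT
  rw [Ex_append]
  refine Ex_mono fun a _ => ?_
  rw [← Ex_const (d := d) k (cp (rng a))]
  refine Ex_mono fun b _ => ?_
  rw [rng_append]; exact cp_mono Finset.subset_union_left

lemma cT_nonneg (n : ℕ) : 0 ≤ cT d n := Ex_nonneg fun _ _ => cp_nonneg _

lemma cT_le (n : ℕ) : cT d n ≤ n + 1 := by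
  refine Ex_le_const fun l hl => (cp_le_card _).trans ?_
  have := rng_card_le l
  rw [hl] at this; exact_mod_cast this

lemma Ex_G_diff {M i j : ℕ} (hi : i ≤ M) (hj : j ≤ M) :
    Ex (d := d) M (fun l => G (endp (l.take i) - endp (l.take j))) = Gt (j - i + (i - j)) (0 : Zd d) := by
  rcases le_total i j with h | h
  · obtain ⟨u, rfl⟩ := Nat.exists_eq_add_of_le h
    rw [Ex_pair hj (fun x y => G (x - y))]
    simp only [sub_add_cancel_left]
    rw [Ex_const]
    have := Ex_Gt' (d := d) u 0 0
    simp only [zero_sub, zero_add] at this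
    rw [this]; congr 1; omega
  · obtain ⟨u, rfl⟩ := Nat.exists_eq_add_of_le h
    rw [Ex_pair hi (fun x y => G (y - x))]
    simp only [add_sub_cancel_left]
    rw [Ex_const]
    have := Ex_Gt (d := d) u 0 0
    simp only [zero_add] at this
    rw [this]; congr 1; omega

/-- the energy of the walk -/
def enT (d : ℕ) [Fact (4 ≤ d)] (T : ℕ) : ℝ := G (0 : Zd d) + 2 * ∑ u ∈ Finset.range T, Gt (u + 1) (0 : Zd d)

lemma enT_pos (T : ℕ) : 0 < enT d T := by
  have := G_zero_ge (d := d)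
  have : 0 ≤ ∑ u ∈ Finset.range T, Gt (u + 1) (0 : Zd d) := Finset.sum_nonneg fun _ _ => Gt_nonneg _ _
  unfold enT; linarith

lemma row_sum_le (f : ℕ → ℝ) (hf : ∀ n, 0 ≤ f n) (T i : ℕ) (hi : i ≤ T) :
    ∑ j ∈ Finset.range (T + 1), f (j - i + (i - j)) ≤ f 0 + 2 * ∑ u ∈ Finset.range T, f (u + 1) := by
  have e : T + 1 = (i + 1) + (T - i) := by omega
  rw [e, Finset.sum_range_add, Finset.sum_range_succ]
  have h1 : ∑ j ∈ Finset.range i, f (j - i + (i - j)) ≤ ∑ u ∈ Finset.range T, f (u + 1) := by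
    rw [← Finset.sum_range_reflect]
    refine le_trans (Finset.sum_le_sum fun j hj => ?_) (Finset.sum_le_sum_of_subset_of_nonneg
      (Finset.range_mono hi) fun _ _ _ => hf _)
    rw [Finset.mem_range] at hj
    exact le_of_eq (congrArg f (by omega))
  have h2 : ∑ j ∈ Finset.range (T - i), f (i + 1 + j - i + (i - (i + 1 + j))) ≤ ∑ u ∈ Finset.range T, f (u + 1) := by
    refine le_trans (Finset.sum_le_sum fun j hj => ?_) (Finset.sum_le_sum_of_subset_of_nonneg
      (Finset.range_mono (Nat.sub_le T i)) fun _ _ _ => hf _)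
    exact le_of_eq (congrArg f (by omega))
  simp only [Nat.sub_self, add_zero] at *
  linarith

lemma cT_lower (T : ℕ) : ((T : ℝ) + 1) / enT d T ≤ cT d T := by
  set S := ∑ i ∈ Finset.range (T + 1), ∑ j ∈ Finset.range (T + 1), Gt (j - i + (i - j)) (0 : Zd d) with hS
  have hSle : S ≤ (T + 1) * enT d T := by
    have : S ≤ ∑ i ∈ Finset.range (T + 1), enT d T := Finset.sum_le_sum fun i hi =>
      row_sum_le (fun n => Gt n (0 : Zd d)) (fun n => Gt_nonneg _ _) T i (by simpa [Nat.lt_succ_iff] using hi)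
    simpa using this
  have key : ∀ r : ℝ, 2 * r * (T + 1) - r ^ 2 * S ≤ cT d T := by
    intro r
    have h : Ex (d := d) T (fun l => 2 * r * (T + 1) - r ^ 2 * ∑ i ∈ Finset.range (T + 1),
        ∑ j ∈ Finset.range (T + 1), G (endp (l.take i) - endp (l.take j))) ≤ cT d T := by
      refine Ex_mono fun l hl => ?_
      have := cp_energy (Finset.range (T + 1)) (fun i => endp (l.take i)) (rng l)
        (fun i hi => mem_rng.mpr ⟨i, by rw [hl]; simpa [Nat.lt_succ_iff] using hi, rfl⟩) r
      simpa using this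
    rw [Ex_sub, Ex_const, Ex_mul_left, Ex_sum] at h
    simp only [Ex_sum] at h
    convert h using 3
    refine Finset.sum_congr rfl fun i hi => Finset.sum_congr rfl fun j hj => ?_
    rw [Finset.mem_range] at hi hj
    exact (Ex_G_diff (by omega) (by omega)).symm
  have h := key (1 / enT d T)
  have hp := enT_pos (d := d) T
  have h3 : (1 / enT d T) ^ 2 * S ≤ (1 / enT d T) ^ 2 * ((T + 1) * enT d T) :=
    mul_le_mul_of_nonneg_left hSle (sq_nonneg _)
  have h4 : (1 / enT d T) ^ 2 * ((T + 1) * enT d T) = (T + 1) / enT d T := by field_simp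
  have h5 : 2 * (1 / enT d T) * ((T : ℝ) + 1) = 2 * ((T + 1) / enT d T) := by ring
  linarith

lemma cT_pos (T : ℕ) : 0 < cT d T :=
  lt_of_lt_of_le (div_pos (by positivity) (enT_pos T)) (cT_lower T)

/-! second moment expansion -/
lemma tel_sum (a D : ℕ → ℝ) (h0 : a 0 = D 0) (T : ℕ) (h : ∀ n < T, a (n + 1) = a n + D (n + 1)) :
    a T = ∑ n ∈ Finset.range (T + 1), D n := by
  induction T with
  | zero => simp [h0]
  | succ T ih =>
    rw [Finset.sum_range_succ, ← ih fun n hn => h n (by omega)]; exact h T (by omega)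

lemma tel_sq (a D : ℕ → ℝ) (h0 : a 0 = D 0) (T : ℕ) (h : ∀ n < T, a (n + 1) = a n + D (n + 1)) :
    a T ^ 2 = ∑ n ∈ Finset.range (T + 1), (D n ^ 2 + 2 * (D n * (a T - a n))) := by
  induction T with
  | zero => simp [h0]
  | succ T ih =>
    rw [Finset.sum_range_succ]
    have i1 := ih fun n hn => h n (by omega)
    have i2 := tel_sum a D h0 T fun n hn => h n (by omega)
    have e : ∑ n ∈ Finset.range (T + 1), (D n ^ 2 + 2 * (D n * (a (T + 1) - a n))) =
        ∑ n ∈ Finset.range (T + 1), (D n ^ 2 + 2 * (D n * (a T - a n))) + 2 * D (T + 1) *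
          ∑ n ∈ Finset.range (T + 1), D n := by
      rw [Finset.mul_sum, ← Finset.sum_add_distrib]
      apply Finset.sum_congr rfl; intro n _
      rw [h T (by omega)]; ring
    rw [e, ← i1, ← i2, h T (by omega)]; ring

/-- increment of capacity -/
def dl (l : List (Stp d)) : ℝ := cp (rng l) - cp (trng l)

lemma dl_nonneg (l : List (Stp d)) : 0 ≤ dl l := by
  have := cp_mono (trng_subset_rng l); unfold dl; linarith

lemma cp_singleton_le (x : Zd d) : cp {x} ≤ 1 := by simpa using cp_le_card ({x} : Finset (Zd d))

lemma dl_eq (l : List (Stp d)) : dl l = cp {(0 : Zd d)} - ch {0} (trng l) := by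
  unfold dl ch
  rw [rng_eq_insert, Finset.insert_eq]; ring

lemma dl_le_one (l : List (Stp d)) : dl l ≤ 1 := by
  rw [dl_eq]; linarith [cp_singleton_le (0 : Zd d), ch_nonneg {0} (trng l)]

lemma cp_empty : cp (∅ : Finset (Zd d)) = 0 := by simp [cp]

lemma trng_nil' : trng ([] : List (Stp d)) = ∅ := by simp [trng]

lemma drop_tel (l : List (Stp d)) (n : ℕ) (h : n < l.length) :
    cp (rng (l.drop (l.length - (n + 1)))) = cp (rng (l.drop (l.length - n))) + dl (l.drop (l.length - (n + 1))) := by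
  have e : l.drop (l.length - (n + 1)) = l[l.length - (n + 1)] :: l.drop (l.length - n) := by
    rw [List.drop_eq_getElem_cons (by omega)]
    congr 2; omega
  unfold dl
  rw [e, trng_cons, cp_sh]; ring

lemma Ex_drop_one {T n : ℕ} (h : n ≤ T) (F : List (Stp d) → ℝ) :
    Ex T (fun l => F (l.drop (T - n))) = Ex n F := by
  obtain ⟨k, rfl⟩ := Nat.exists_eq_add_of_le' h
  rw [Ex_append]
  rw [← Ex_const (d := d) k (Ex n F)]
  refine Ex_congr fun a ha => Ex_congr fun b hb => ?_
  rw [List.drop_left' (by omega)]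

/-- mean increment -/
def dT (d : ℕ) [Fact (4 ≤ d)] (n : ℕ) : ℝ := Ex (d := d) n dl

lemma dT_zero : cT d 0 = dT d 0 := by simp [cT, dT, dl, trng_nil', cp_empty]

lemma dT_succ (n : ℕ) : cT d (n + 1) = cT d n + dT d (n + 1) := by
  have : dT d (n + 1) = cT d (n + 1) - Ex (n + 1) (fun l : List (Stp d) => cp (trng l)) := by
    unfold dT cT dl; rw [Ex_sub]
  have h2 : Ex (n + 1) (fun l : List (Stp d) => cp (trng l)) = cT d n := by
    rw [Ex_succ]
    simp only [trng_cons, cp_sh]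
    exact av_const _
  linarith

lemma dT_nonneg (n : ℕ) : 0 ≤ dT d n := Ex_nonneg fun l _ => dl_nonneg l

/-- the cross term -/
def crT (d : ℕ) [Fact (4 ≤ d)] (m n : ℕ) : ℝ :=
  Ex (d := d) m fun a => Ex n fun b => dl b * ch (rng a) (rng b)

def chT (d : ℕ) [Fact (4 ≤ d)] (m n : ℕ) : ℝ :=
  Ex (d := d) m fun a => Ex n fun b => ch (rng a) (rng b)

lemma cT_add (m n : ℕ) : cT d (m + n) = cT d m + cT d n - chT d m n := by
  have : chT d m n = Ex (d := d) m fun a => Ex n fun b => ch (rng (rv a)) (rng b) :=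
    (Ex_rv m fun a => Ex n fun b => ch (rng a) (rng b)).symm
  rw [this]
  unfold cT
  rw [Ex_append]
  simp only [cp_append, Ex_sub, Ex_add, Ex_const]

lemma sq_expand (T : ℕ) : Ex (d := d) T (fun l => cp (rng l) ^ 2) =
    ∑ n ∈ Finset.range (T + 1), (Ex (d := d) n (fun l => dl l ^ 2) +
      2 * (dT d n * cT d (T - n) - crT d (T - n) n)) := by
  have h : Ex (d := d) T (fun l => cp (rng l) ^ 2) = Ex (d := d) T (fun l => ∑ n ∈ Finset.range (T + 1),
      (dl (l.drop (T - n)) ^ 2 + 2 * (dl (l.drop (T - n)) * (cp (rng l) - cp (rng (l.drop (T - n))))))) := by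
    refine Ex_congr fun l hl => ?_
    have := tel_sq (fun n => cp (rng (l.drop (T - n)))) (fun n => dl (l.drop (T - n))) ?_ T ?_
    · simpa using this
    · simp [← hl, dl, trng_nil', cp_empty]
    · intro n hn
      rw [← hl]; exact drop_tel l n (by omega)
  rw [h, Ex_sum]
  apply Finset.sum_congr rfl
  intro n hn
  have hn' : n ≤ T := by simpa [Nat.lt_succ_iff] using hn
  rw [Ex_add, Ex_drop_one hn' (fun l => dl l ^ 2), Ex_mul_left]
  congr 2
  obtain ⟨k, rfl⟩ := Nat.exists_eq_add_of_le' hn'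
  rw [Nat.add_sub_cancel, Ex_append]
  have e1 : Ex (d := d) k (fun a => Ex n fun b => dl ((a ++ b).drop k) *
      (cp (rng (a ++ b)) - cp (rng ((a ++ b).drop k)))) =
      Ex (d := d) k (fun a => Ex n fun b => dl b * cp (rng (rv a)) - dl b * ch (rng (rv a)) (rng b)) := by
    refine Ex_congr fun a ha => Ex_congr fun b hb => ?_
    rw [List.drop_left' ha, cp_append, cp_rv]; ring
  rw [e1, Ex_rv k fun a => Ex n fun b => dl b * cp (rng a) - dl b * ch (rng a) (rng b)]
  simp only [Ex_sub, Ex_mul_right, Ex_mul_left]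
  rfl

lemma second_moment (T : ℕ) : Ex (d := d) T (fun l => cp (rng l) ^ 2) ≤ (2 + 1 / cT d 0) * cT d T ^ 2 := by
  rw [sq_expand]
  have h1 : ∑ n ∈ Finset.range (T + 1), (Ex (d := d) n (fun l => dl l ^ 2) +
      2 * (dT d n * cT d (T - n) - crT d (T - n) n)) ≤ ∑ n ∈ Finset.range (T + 1), dT d n * (1 + 2 * cT d T) := by
    refine Finset.sum_le_sum fun n hn => ?_
    have a1 : Ex (d := d) n (fun l => dl l ^ 2) ≤ dT d n :=
      Ex_mono fun l _ => by nlinarith [dl_nonneg l, dl_le_one l]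
    have a2 : 0 ≤ crT d (T - n) n := Ex_nonneg fun a _ => Ex_nonneg fun b _ =>
      mul_nonneg (dl_nonneg b) (ch_nonneg _ _)
    have a3 : cT d (T - n) ≤ cT d T := cT_mono (Nat.sub_le _ _)
    nlinarith [dT_nonneg (d := d) n]
  rw [← Finset.sum_mul, ← tel_sum (cT d) (dT d) dT_zero T fun n _ => dT_succ n] at h1
  have h2 : cT d T ≤ 1 / cT d 0 * cT d T ^ 2 := by
    have := cT_mono (d := d) (Nat.zero_le T)
    have p := cT_pos (d := d) 0
    rw [div_mul_eq_mul_div, one_mul, le_div_iff₀ p]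
    nlinarith [cT_nonneg (d := d) T]
  linarith

/-- covariance term -/
def wT (d : ℕ) [Fact (4 ≤ d)] (m n : ℕ) : ℝ := dT d n * chT d m n - crT d m n

lemma vT_le (T : ℕ) : vT d T ≤ (T + 1) + 2 * ∑ n ∈ Finset.range (T + 1), wT d (T - n) n := by
  have h1 := tel_sq (cT d) (dT d) dT_zero T fun n _ => dT_succ n
  have h2 : vT d T = Ex (d := d) T (fun l => cp (rng l) ^ 2) - cT d T ^ 2 := rfl
  rw [h2, sq_expand, h1, ← Finset.sum_sub_distrib, Finset.mul_sum]
  have : ((T : ℝ) + 1) = ∑ n ∈ Finset.range (T + 1), (1 : ℝ) := by simp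
  rw [this, ← Finset.sum_add_distrib]
  refine Finset.sum_le_sum fun n hn => ?_
  have hn' : n ≤ T := by simpa [Nat.lt_succ_iff] using hn
  have a1 : Ex (d := d) n (fun l => dl l ^ 2) ≤ 1 :=
    Ex_le_const fun l _ => by nlinarith [dl_nonneg l, dl_le_one l]
  have a4 := cT_add (d := d) (T - n) n
  rw [Nat.sub_add_cancel hn'] at a4
  rw [a4]
  unfold wT
  nlinarith [sq_nonneg (dT d n)]

def ch2 (d : ℕ) [Fact (4 ≤ d)] (m n : ℕ) : ℝ :=
  Ex (d := d) m fun a => Ex n fun b => ch (rng a) (rng b) ^ 2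

lemma vT_split (m n : ℕ) : vT d (m + n) ≤ 3 / 2 * (vT d m + vT d n) + 3 * ch2 d m n := by
  have h0 : ch2 d m n = Ex (d := d) m fun a => Ex n fun b => ch (rng (rv a)) (rng b) ^ 2 :=
    (Ex_rv m fun a => Ex n fun b => ch (rng a) (rng b) ^ 2).symm
  refine (Vr_le_sq_sub (m + n) _ (cT d m + cT d n)).trans ?_
  rw [Ex_append, h0]
  have hm : vT d m = Ex (d := d) m fun a => (cp (rng a) - cT d m) ^ 2 := Vr_eq m _
  have hn : vT d n = Ex (d := d) n fun a => (cp (rng a) - cT d n) ^ 2 := Vr_eq n _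
  have z : Ex (d := d) n (fun b => cp (rng b) - cT d n) = 0 := by
    rw [Ex_sub, Ex_const]; exact sub_self _
  have hs : Ex (d := d) m (fun a => Ex n fun b =>
      (3 / 2 * ((cp (rng a) - cT d m) ^ 2 + (cp (rng b) - cT d n) ^ 2)
        + (3 * (cp (rng a) - cT d m)) * (cp (rng b) - cT d n)) + 3 * ch (rng (rv a)) (rng b) ^ 2) =
      3 / 2 * (vT d m + vT d n) + 3 * Ex (d := d) m fun a => Ex n fun b => ch (rng (rv a)) (rng b) ^ 2 := by
    simp only [Ex_add, Ex_mul_left, Ex_const, z, mul_zero, add_zero]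
    rw [← hm, ← hn]
  rw [← hs]
  refine Ex_mono fun a _ => Ex_mono fun b _ => ?_
  rw [cp_append]
  nlinarith [sq_nonneg (cp (rng a) - cT d m + (cp (rng b) - cT d n) + 2 * ch (rng (rv a)) (rng b))]

lemma vT_nonneg (n : ℕ) : 0 ≤ vT d n := Vr_nonneg _ _

/-! two walk lemma -/
lemma sq_pairs (N : ℕ) (a : ℕ → ℕ → ℝ) (ha : ∀ i j, 0 ≤ a i j) :
    ∑ i ∈ Finset.range (N + 1), ∑ j ∈ Finset.range (N + 1), a i j ≤
      ∑ i ∈ Finset.range (N + 1), ∑ u ∈ Finset.range (N + 1), (a i (i + u) + a (i + u) i) := by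
  have key : ∀ b : ℕ → ℕ → ℝ, (∀ i j, 0 ≤ b i j) → ∀ i, 
      ∑ j ∈ Finset.range (N + 1), (if i ≤ j then b i j else 0) ≤ ∑ u ∈ Finset.range (N + 1), b i (i + u) := by
    intro b hb i
    rw [← Finset.sum_filter]
    have : ∑ j ∈ (Finset.range (N + 1)).filter (fun j => i ≤ j), b i j =
        ∑ u ∈ ((Finset.range (N + 1)).filter (fun j => i ≤ j)).image (fun j => j - i), b i (i + u) := by
      rw [Finset.sum_image]
      · apply Finset.sum_congr rfl; intro j hj
        rw [Finset.mem_filter] at hj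
        congr 1; omega
      · intro x hx y hy h
        simp at hx hy h; omega
    rw [this]
    refine Finset.sum_le_sum_of_subset_of_nonneg ?_ fun _ _ _ => hb _ _
    intro u hu
    simp at hu ⊢
    obtain ⟨j, hj, rfl⟩ := hu; omega
  simp only [Finset.sum_add_distrib]
  have k1 := Finset.sum_le_sum fun i (_ : i ∈ Finset.range (N + 1)) => key a ha i
  have k2 := Finset.sum_le_sum fun i (_ : i ∈ Finset.range (N + 1)) => key (fun i j => a j i) (fun i j => ha j i) i
  refine le_trans ?_ (add_le_add k1 k2)
  rw [Finset.sum_comm (f := fun i j => if i ≤ j then a j i else 0), ← Finset.sum_add_distrib]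
  refine Finset.sum_le_sum fun i _ => ?_
  rw [← Finset.sum_add_distrib]
  refine Finset.sum_le_sum fun j _ => ?_
  have := ha i j
  rcases le_total i j with h | h
  · rw [if_pos h]; split_ifs <;> linarith
  · rw [if_pos h]; split_ifs <;> linarith

section TW
variable (F : Zd d → ℝ) (f : ℕ → ℝ) (F0 : ∀ x, 0 ≤ F x) (Fn : ∀ x, F (-x) = F x)
  (hF : ∀ u x, Ex (d := d) u (fun l => F (x + endp l)) ≤ f u) (fa : Antitone f)
include F0 Fn hF fa

lemma tw_f0 (u : ℕ) : 0 ≤ f u := (Ex_nonneg fun l _ => F0 _).trans (hF u 0)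

lemma tw_same (i u j v : ℕ) :
    Ex (d := d) i (fun a => Ex u fun b => Ex j fun a' => Ex v fun b' =>
      F (endp a - endp a') * F (endp a + endp b - (endp a' + endp b'))) ≤ f (i + j) * f (u + v) := by
  have h1 : ∀ a a' : List (Stp d), Ex u (fun b => Ex v fun b' =>
      F (endp a - endp a') * F (endp a + endp b - (endp a' + endp b'))) ≤ F (endp a - endp a') * f (u + v) := by
    intro a a'
    simp only [Ex_mul_left]
    refine mul_le_mul_of_nonneg_left ?_ (F0 _)
    refine le_trans (le_of_eq ?_) (hF (u + v) (endp a - endp a'))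
    rw [← Ex_two]
    refine Ex_congr fun b _ => Ex_congr fun b' _ => ?_
    congr 1; abel
  calc _ = Ex (d := d) i (fun a => Ex j fun a' => Ex u fun b => Ex v fun b' =>
      F (endp a - endp a') * F (endp a + endp b - (endp a' + endp b'))) :=
        Ex_congr fun a _ => Ex_swap _ _ _
    _ ≤ Ex (d := d) i (fun a => Ex j fun a' => F (endp a - endp a') * f (u + v)) :=
        Ex_mono fun a _ => Ex_mono fun a' _ => h1 a a'
    _ = Ex (d := d) i (fun a => Ex j fun a' => F (0 + endp a - endp a')) * f (u + v) := by
        simp only [Ex_mul_right, zero_add]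
    _ ≤ _ := by
        rw [Ex_two]
        exact mul_le_mul_of_nonneg_right (hF _ _) (tw_f0 F f F0 Fn hF fa _)

lemma tw_cross (i u j v : ℕ) :
    Ex (d := d) i (fun a => Ex u fun b => Ex j fun a' => Ex v fun b' =>
      F (endp a - (endp a' + endp b')) * F (endp a + endp b - endp a')) ≤ f (i + j) * f (max u v) := by
  have f0 := tw_f0 F f F0 Fn hF fa
  have hF' : ∀ u x, Ex (d := d) u (fun l => F (x - endp l)) ≤ f u := by
    intro u x
    refine le_trans (le_of_eq ?_) (hF u (-x))
    refine Ex_congr fun l _ => ?_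
    rw [← Fn]; congr 1; abel
  have z1 : Ex (d := d) i (fun a => Ex u fun b => Ex j fun a' => F (endp a + endp b - endp a')) ≤ f (i + j) := by
    have e : Ex (d := d) i (fun a => Ex u fun b => Ex j fun a' => F (endp a + endp b - endp a')) =
      Ex (d := d) i (fun a => Ex (u + j) fun b => F (endp a + endp b)) :=
        Ex_congr fun a _ => Ex_two u j F (endp a)
    have e2 : Ex (d := d) i (fun a => Ex (u + j) fun b => F (endp a + endp b)) = 
        Ex (d := d) (i + (u + j)) fun l => F (0 + endp l) := by
      rw [Ex_append]; simp only [endp_append, zero_add]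
    rw [e, e2]
    exact (hF _ _).trans (fa (by omega))
  have z2 : Ex (d := d) i (fun a => Ex j fun a' => Ex v fun b' => F (endp a - (endp a' + endp b'))) ≤ f (i + j) := by
    have e : Ex (d := d) i (fun a => Ex j fun a' => Ex v fun b' => F (endp a - (endp a' + endp b'))) =
        Ex (d := d) i (fun a => Ex (j + v) fun b => F (0 + endp a - endp b)) := by
      refine Ex_congr fun a _ => ?_
      rw [Ex_append]; simp only [endp_append, zero_add]
    rw [e, Ex_two]
    exact (hF _ _).trans (fa (by omega))
  rcases le_total u v with h | h
  · rw [max_eq_right h]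
    refine le_trans ?_ (mul_le_mul_of_nonneg_right z1 (f0 v))
    simp only [← Ex_mul_right]
    refine Ex_mono fun a _ => Ex_mono fun b _ => Ex_mono fun a' _ => ?_
    rw [Ex_mul_right, mul_comm]
    refine mul_le_mul_of_nonneg_left ?_ (F0 _)
    simp only [← sub_sub]; exact hF' _ _
  · rw [max_eq_left h]
    refine le_trans ?_ (mul_le_mul_of_nonneg_right z2 (f0 u))
    simp only [← Ex_mul_right]
    refine Ex_mono fun a _ => ?_
    rw [Ex_swap]
    refine Ex_mono fun a' _ => ?_
    rw [Ex_swap]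
    refine Ex_mono fun b' _ => ?_
    rw [Ex_mul_left]
    refine mul_le_mul_of_nonneg_left ?_ (F0 _)
    refine le_trans (le_of_eq (Ex_congr fun b _ => ?_)) (hF u (endp a - endp a'))
    congr 1; abel

lemma Ex_pair2 {M i u j v : ℕ} (h : i + u ≤ M) (h' : j + v ≤ M) (H : Zd d → Zd d → Zd d → Zd d → ℝ) :
    Ex M (fun l => Ex M fun l' => H (endp (l.take i)) (endp (l.take (i + u))) (endp (l'.take j)) (endp (l'.take (j + v)))) =
      Ex i fun a => Ex u fun b => Ex j fun a' => Ex v fun b' => H (endp a) (endp a + endp b) (endp a') (endp a' + endp b') := by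
  rw [Ex_pair h (fun x y => Ex M fun l' => H x y (endp (l'.take j)) (endp (l'.take (j + v))))]
  refine Ex_congr fun a _ => Ex_congr fun b _ => ?_
  rw [Ex_pair h' (fun x y => H (endp a) (endp a + endp b) x y)]

/-- second moment of interaction of two walks -/
lemma two_walk (K : ℝ) (hK : ∀ u v, f (max u v) ≤ K * f (u + v)) (N : ℕ) :
    Ex (d := d) (2 * N) (fun l => Ex (2 * N) fun l' => (∑ i ∈ Finset.range (N + 1), ∑ j ∈ Finset.range (N + 1),
      F (endp (l.take i) - endp (l'.take j))) ^ 2) ≤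
    2 * (1 + K) * (∑ u ∈ Finset.range (N + 1), ∑ v ∈ Finset.range (N + 1), f (u + v)) ^ 2 := by
  set R := Finset.range (N + 1) with hR
  have f0 := tw_f0 F f F0 Fn hF fa
  set M := 2 * N with hM
  have p1 : ∀ l l' : List (Stp d), (∑ i ∈ R, ∑ j ∈ R, F (endp (l.take i) - endp (l'.take j))) ^ 2 ≤
      ∑ i ∈ R, ∑ u ∈ R, ∑ j ∈ R, ∑ v ∈ R, 
      (2 * (F (endp (l.take i) - endp (l'.take j)) * F (endp (l.take (i + u)) - endp (l'.take (j + v)))) +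
       2 * (F (endp (l.take i) - endp (l'.take (j + v))) * F (endp (l.take (i + u)) - endp (l'.take j)))) := by
    intro l l'
    set Q := fun i j => F (endp (l.take i) - endp (l'.take j)) with hQ
    have Q0 : ∀ i j, 0 ≤ Q i j := fun i j => F0 _
    have e1 : (∑ i ∈ R, ∑ j ∈ R, Q i j) ^ 2 = ∑ i ∈ R, ∑ i' ∈ R, (∑ j ∈ R, Q i j) * ∑ j ∈ R, Q i' j := by
      rw [sq, Finset.sum_mul_sum]
    have s1 := sq_pairs N (fun i i' => (∑ j ∈ R, Q i j) * ∑ j ∈ R, Q i' j)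
      (fun i i' => mul_nonneg (Finset.sum_nonneg fun j _ => Q0 _ _) (Finset.sum_nonneg fun j _ => Q0 _ _))
    change (∑ i ∈ R, ∑ j ∈ R, Q i j) ^ 2 ≤ ∑ i ∈ R, ∑ u ∈ R, ∑ j ∈ R, ∑ v ∈ R,
      (2 * (Q i j * Q (i + u) (j + v)) + 2 * (Q i (j + v) * Q (i + u) j))
    rw [e1]
    refine s1.trans (Finset.sum_le_sum fun i _ => Finset.sum_le_sum fun u _ => ?_)
    have s2 := sq_pairs N (fun j j' => Q i j * Q (i + u) j') (fun _ _ => mul_nonneg (Q0 _ _) (Q0 _ _))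
    have e2 : (∑ j ∈ R, Q i j) * ∑ j ∈ R, Q (i + u) j + (∑ j ∈ R, Q (i + u) j) * ∑ j ∈ R, Q i j =
      2 * ∑ j ∈ R, ∑ j' ∈ R, Q i j * Q (i + u) j' := by
      rw [← Finset.sum_mul_sum]; ring
    rw [e2]
    refine (mul_le_mul_of_nonneg_left s2 (by norm_num)).trans (le_of_eq ?_)
    rw [Finset.mul_sum]
    refine Finset.sum_congr rfl fun j _ => ?_
    rw [Finset.mul_sum]
    refine Finset.sum_congr rfl fun v _ => ?_
    ring
  refine (Ex_mono fun l _ => Ex_mono fun l' _ => p1 l l').trans ?_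
  simp only [Ex_sum, Ex_add, Ex_mul_left]
  have p2 : ∀ i ∈ R, ∀ u ∈ R, ∀ j ∈ R, ∀ v ∈ R,
      2 * Ex M (fun l : List (Stp d) => Ex M fun l' => F (endp (l.take i) - endp (l'.take j)) * F (endp (l.take (i + u)) - endp (l'.take (j + v)))) +
      2 * Ex M (fun l : List (Stp d) => Ex M fun l' => F (endp (l.take i) - endp (l'.take (j + v))) * F (endp (l.take (i + u)) - endp (l'.take j))) ≤
      2 * (f (i + j) * f (u + v)) + 2 * (f (i + j) * (K * f (u + v))) := by
    intro i hi u hu j hj v hv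
    rw [hR, Finset.mem_range] at hi hu hj hv
    rw [Ex_pair2 F f F0 Fn hF fa (by omega) (by omega) (fun x y z w => F (x - z) * F (y - w)),
      Ex_pair2 F f F0 Fn hF fa (by omega) (by omega) (fun x y z w => F (x - w) * F (y - z))]
    have a1 := tw_same F f F0 Fn hF fa i u j v
    have a2 := tw_cross F f F0 Fn hF fa i u j v
    have a3 := mul_le_mul_of_nonneg_left (hK u v) (f0 (i + j))
    linarith
  refine (Finset.sum_le_sum fun i hi => Finset.sum_le_sum fun u hu => Finset.sum_le_sum fun j hj =>
    Finset.sum_le_sum fun v hv => p2 i hi u hu j hj v hv).trans (le_of_eq ?_)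
  have : ∀ i u j v, 2 * (f (i + j) * f (u + v)) + 2 * (f (i + j) * (K * f (u + v))) =
      f (i + j) * (2 * (1 + K) * f (u + v)) := by intros; ring
  simp only [this]
  simp only [← Finset.mul_sum, ← Finset.sum_mul]
  ring
end TW
end Gen


section Sums
lemma rp_pos (i : ℕ) (s : ℝ) : 0 < ((i : ℝ) + 1) ^ s := Real.rpow_pos_of_pos (by positivity) _

lemma rp_anti {s : ℝ} (hs : 0 ≤ s) {i j : ℕ} (h : i ≤ j) : ((j : ℝ) + 1) ^ (-s) ≤ ((i : ℝ) + 1) ^ (-s) :=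
  Real.rpow_le_rpow_of_nonpos (by positivity) (by have : (i : ℝ) ≤ j := by exact_mod_cast h
                                                  linarith) (by linarith)

lemma sum_half (n : ℕ) : ∑ i ∈ Finset.range n, ((i : ℝ) + 1) ^ (-(1 / 2) : ℝ) ≤ 2 * (n : ℝ) ^ (1 / 2 : ℝ) := by
  have e : ∀ i : ℕ, ((i : ℝ) + 1) ^ (-(1 / 2) : ℝ) = 1 / √((i : ℝ) + 1) := by
    intro i; rw [Real.rpow_neg (by positivity), ← Real.sqrt_eq_rpow, one_div]
  simp only [e]
  rw [← Real.sqrt_eq_rpow]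
  induction n with
  | zero => simp
  | succ n ih =>
    rw [Finset.sum_range_succ]
    have h0 : (0 : ℝ) ≤ n := by positivity
    have h1 := Real.sq_sqrt h0
    have h2 := Real.sq_sqrt (by positivity : (0 : ℝ) ≤ n + 1)
    have p : 0 < √((n : ℝ) + 1) := Real.sqrt_pos.mpr (by positivity)
    have q := Real.sqrt_nonneg (n : ℝ)
    push_cast
    have : 1 / √((n : ℝ) + 1) ≤ 2 * √((n : ℝ) + 1) - 2 * √(n : ℝ) := by
      rw [div_le_iff₀ p]
      nlinarith [sq_nonneg (√((n : ℝ) + 1) - √(n : ℝ))]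
    linarith

lemma range_add_le (f : ℕ → ℝ) (hf : ∀ i, 0 ≤ f i) (k n : ℕ) :
    ∑ i ∈ Finset.range n, f i ≤ ∑ i ∈ Finset.range k, f i + ∑ i ∈ Finset.range n, f (k + i) := by
  rw [← Finset.sum_range_add]
  exact Finset.sum_le_sum_of_subset_of_nonneg (Finset.range_mono (by omega)) fun _ _ _ => hf _

lemma rp_mul (k : ℕ) (a b c : ℝ) (h : a + b = c) : ((k : ℝ) + 1) ^ a * ((k : ℝ) + 1) ^ b = ((k : ℝ) + 1) ^ c := by
  rw [← Real.rpow_add (by positivity), h]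

lemma sum_S2 : ∃ C : ℝ, 0 < C ∧ ∀ n k : ℕ, ∑ i ∈ Finset.range n,
    ((i : ℝ) + 1) ^ (-(1 / 2) : ℝ) * (((k + i : ℕ) : ℝ) + 1) ^ (-(3 / 2) : ℝ) ≤ C * ((k : ℝ) + 1) ^ (-1 : ℝ) := by
  obtain ⟨C, hC, h⟩ := tail_sum_le 2 (by norm_num)
  refine ⟨2 + C, by positivity, fun n k => ?_⟩
  refine (range_add_le _ (fun i => mul_nonneg (rp_pos _ _).le (rp_pos _ _).le) (k + 1) n).trans ?_
  rw [add_mul]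
  refine add_le_add ?_ ?_
  · calc _ ≤ ∑ i ∈ Finset.range (k + 1), ((i : ℝ) + 1) ^ (-(1 / 2) : ℝ) * ((k : ℝ) + 1) ^ (-(3 / 2) : ℝ) :=
          Finset.sum_le_sum fun i _ => mul_le_mul_of_nonneg_left (rp_anti (by norm_num) (by omega)) (rp_pos _ _).le
      _ ≤ 2 * ((k : ℝ) + 1) ^ (1 / 2 : ℝ) * ((k : ℝ) + 1) ^ (-(3 / 2) : ℝ) := by
          rw [← Finset.sum_mul]
          have := sum_half (k + 1)
          push_cast at this
          exact mul_le_mul_of_nonneg_right this (rp_pos _ _).le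
      _ = _ := by rw [mul_assoc, rp_mul k _ _ (-1) (by norm_num)]
  · calc _ ≤ ∑ i ∈ Finset.range n, ((((k + i : ℕ) : ℝ)) + 1) ^ (-2 : ℝ) := by
          refine Finset.sum_le_sum fun i _ => ?_
          rw [← rp_mul (k + i) (-(1 / 2)) (-(3 / 2)) (-2) (by norm_num)]
          exact mul_le_mul (rp_anti (by norm_num) (by omega)) (rp_anti (by norm_num) (by omega)) (rp_pos _ _).le (rp_pos _ _).le
      _ ≤ C * ((k : ℝ) + 1) ^ (1 - 2 : ℝ) := h n k
      _ = _ := by norm_num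

lemma dsum32 : ∃ C : ℝ, 0 < C ∧ ∀ N : ℕ, ∑ u ∈ Finset.range (N + 1), ∑ v ∈ Finset.range (N + 1),
    (((u + v : ℕ) : ℝ) + 1) ^ (-(3 / 2) : ℝ) ≤ C * ((N : ℝ) + 1) ^ (1 / 2 : ℝ) := by
  obtain ⟨C, hC, h⟩ := tail_sum_le (3 / 2) (by norm_num)
  refine ⟨C * 2, by positivity, fun N => ?_⟩
  calc _ ≤ ∑ u ∈ Finset.range (N + 1), C * ((u : ℝ) + 1) ^ (-(1 / 2) : ℝ) :=
        Finset.sum_le_sum fun u _ => by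
          have := h (N + 1) u
          norm_num at this ⊢; exact this
    _ ≤ C * (2 * ((N : ℝ) + 1) ^ (1 / 2 : ℝ)) := by
        rw [← Finset.mul_sum]
        have := sum_half (N + 1)
        push_cast at this
        exact mul_le_mul_of_nonneg_left this hC.le
    _ = _ := by ring

lemma powK (s : ℝ) (hs : 0 ≤ s) (u v : ℕ) :
    (((max u v : ℕ) : ℝ) + 1) ^ (-s) ≤ 2 ^ s * (((u + v : ℕ) : ℝ) + 1) ^ (-s) := by
  have h : (((u + v : ℕ) : ℝ) + 1) / 2 ≤ ((max u v : ℕ) : ℝ) + 1 := by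
    have : u + v ≤ 2 * max u v := by omega
    have : ((u + v : ℕ) : ℝ) ≤ 2 * ((max u v : ℕ) : ℝ) := by exact_mod_cast this
    linarith
  calc (((max u v : ℕ) : ℝ) + 1) ^ (-s) ≤ ((((u + v : ℕ) : ℝ) + 1) / 2) ^ (-s) :=
        Real.rpow_le_rpow_of_nonpos (by positivity) h (by linarith)
    _ = _ := by
        rw [Real.div_rpow (by positivity) (by norm_num), Real.rpow_neg (by norm_num : (0:ℝ) ≤ 2), div_inv_eq_mul, mul_comm]

lemma harm_le (n : ℕ) : ∑ i ∈ Finset.range n, ((i : ℝ) + 1) ^ (-1 : ℝ) ≤ 1 + Real.log (n + 1) := by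
  have e : ∀ i : ℕ, ((i : ℝ) + 1) ^ (-1 : ℝ) = ((i : ℝ) + 1)⁻¹ := fun i => Real.rpow_neg_one _
  simp only [e]
  have h := harmonic_le_one_add_log n
  have h2 : ((harmonic n : ℚ) : ℝ) = ∑ i ∈ Finset.range n, ((i : ℝ) + 1)⁻¹ := by
    rw [harmonic]; push_cast; rfl
  rw [h2] at h
  refine h.trans ?_
  rcases Nat.eq_zero_or_pos n with rfl | hn
  · simp
  · gcongr; linarith
end Sums

section Qb
variable {d : ℕ} [Fact (4 ≤ d)]

/-- finite box -/
def Qb (d : ℕ) (M : ℕ) : Finset (Zd d) := Fintype.piFinset fun _ => Finset.Icc (-(M : ℤ)) M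

lemma endp_abs (l : List (Stp d)) (i : Fin d) : |endp l i| ≤ l.length := by
  induction l with
  | nil => simp [endp]
  | cons e l ih =>
    rw [endp_cons]
    have : |vec e i| ≤ 1 := by
      rcases e with ⟨j, b⟩
      by_cases h : i = j
      · subst h; cases b <;> simp [vec]
      · simp [vec, h]
    have h2 := abs_add_le (vec e i) (endp l i)
    simp only [Pi.add_apply, List.length_cons]
    push_cast; linarith

lemma endp_mem_Qb {l : List (Stp d)} {M : ℕ} (h : l.length ≤ M) : endp l ∈ Qb d M := by
  rw [Qb, Fintype.mem_piFinset]
  intro i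
  have := abs_le.mp (endp_abs l i)
  have hM : (l.length : ℤ) ≤ M := by exact_mod_cast h
  rw [Finset.mem_Icc]; constructor <;> linarith [this.1, this.2]

lemma rng_sub_Qb {l : List (Stp d)} {M : ℕ} (h : l.length ≤ M) : rng l ⊆ Qb d M := by
  intro z hz
  obtain ⟨k, hk, rfl⟩ := mem_rng.mp hz
  exact endp_mem_Qb (by simp; omega)

lemma Ex_sumQ {s M : ℕ} (h : s ≤ M) (F : Zd d → ℝ) :
    Ex s (fun l => F (endp l)) = ∑ a ∈ Qb d M, pk s a * F a := by
  have := Ex_endp_eq_sum s (Qb d M) (fun y => if y ∈ Qb d M then F y else 0) (fun y hy => if_neg hy) 0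
  simp only [zero_add, sub_zero] at this
  rw [Finset.sum_congr rfl (fun a ha => by rw [if_pos ha])] at this
  rw [← this]
  refine Ex_congr fun l hl => ?_
  rw [if_pos (endp_mem_Qb (by omega))]

lemma sumQ_le (M t : ℕ) (F : Zd d → ℝ) (F0 : ∀ x, 0 ≤ F x) :
    ∑ a ∈ Qb d M, pk t a * F a ≤ Ex t (fun l => F (endp l)) := by
  rw [Ex_sumQ (le_max_right M t)]
  refine Finset.sum_le_sum_of_subset_of_nonneg ?_ fun a _ _ => mul_nonneg (pk_nonneg _ _) (F0 _)
  intro x hx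
  rw [Qb, Fintype.mem_piFinset] at hx ⊢
  intro i
  have := hx i
  rw [Finset.mem_Icc] at this ⊢
  have h : (M : ℤ) ≤ (max M t : ℕ) := by exact_mod_cast le_max_left M t
  constructor <;> linarith [this.1, this.2]
end Qb

section ch
variable {d : ℕ} [Fact (4 ≤ d)]
lemma KK_le (A B : Finset (Zd d)) : KK A B ≤ ∑ a ∈ A, ∑ b ∈ B, G (a - b) := by
  unfold KK
  refine Finset.sum_le_sum fun a _ => ?_
  have := hh_le_G B a
  nlinarith [ee_nonneg A a, ee_le_one A a, hh_nonneg B a]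

lemma ch_le_GG (A B : Finset (Zd d)) : ch A B ≤ 2 * ∑ a ∈ A, ∑ b ∈ B, G (a - b) :=
  (ch_le_two_KK A B).trans (mul_le_mul_of_nonneg_left (KK_le A B) (by norm_num))

lemma sum_rng_le' (l : List (Stp d)) {n : ℕ} (h : l.length = n) (f : Zd d → ℝ) (hf : ∀ x, 0 ≤ f x) :
    ∑ x ∈ rng l, f x ≤ ∑ k ∈ Finset.range (n + 1), f (endp (l.take k)) := by
  subst h; exact sum_rng_le l f hf

lemma GG_le {m n : ℕ} (a b : List (Stp d)) (ha : a.length = m) (hb : b.length = n) (F : Zd d → ℝ) (F0 : ∀ x, 0 ≤ F x) :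
    ∑ x ∈ rng a, ∑ y ∈ rng b, F (x - y) ≤
      ∑ i ∈ Finset.range (m + 1), ∑ j ∈ Finset.range (n + 1), F (endp (a.take i) - endp (b.take j)) := by
  refine (sum_rng_le' a ha (fun x => ∑ y ∈ rng b, F (x - y)) fun x => Finset.sum_nonneg fun y _ => F0 _).trans ?_
  exact Finset.sum_le_sum fun i _ => sum_rng_le' b hb (fun y => F (endp (a.take i) - y)) fun y => F0 _

lemma rng_take_sub (l : List (Stp d)) (k : ℕ) : rng (l.take k) ⊆ rng l := by
  conv_rhs => rw [← List.take_append_drop k l, rng_append]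
  exact Finset.subset_union_left

lemma trng_take_sub (l : List (Stp d)) (k : ℕ) : trng (l.take k) ⊆ trng l := by
  conv_rhs => rw [← List.take_append_drop k l, trng_append]
  exact Finset.subset_union_left

lemma Ex2_take {m n M : ℕ} (hm : m ≤ M) (hn : n ≤ M) (H : List (Stp d) → List (Stp d) → ℝ) :
    Ex m (fun a => Ex n fun b => H a b) = Ex M fun a => Ex M fun b => H (a.take m) (b.take n) := by
  rw [← Ex_take hm]
  refine Ex_congr fun a _ => ?_
  rw [← Ex_take hn]

lemma ch2_mono {m n N : ℕ} (hm : m ≤ N) (hn : n ≤ N) : ch2 d m n ≤ ch2 d N N := by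
  unfold ch2
  rw [Ex2_take hm hn]
  refine Ex_mono fun a _ => Ex_mono fun b _ => ?_
  have h1 := ch_mono_left (rng_take_sub a m) (rng (b.take n))
  have h2 := ch_mono_right (rng a) (rng_take_sub b n)
  have := ch_nonneg (rng (a.take m)) (rng (b.take n))
  exact pow_le_pow_left₀ this (h1.trans h2) 2

/-- second moment of a double sum over ranges -/
lemma GG2_le (F : Zd d → ℝ) (f : ℕ → ℝ) (F0 : ∀ x, 0 ≤ F x) (Fn : ∀ x, F (-x) = F x)
  (hF : ∀ u x, Ex (d := d) u (fun l => F (x + endp l)) ≤ f u) (fa : Antitone f)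
   (K : ℝ) (hK : ∀ u v, f (max u v) ≤ K * f (u + v)) (N : ℕ) :
    Ex (d := d) N (fun a => Ex N fun b => (∑ i ∈ Finset.range (N + 1), ∑ j ∈ Finset.range (N + 1),
      F (endp (a.take i) - endp (b.take j))) ^ 2) ≤
    2 * (1 + K) * (∑ u ∈ Finset.range (N + 1), ∑ v ∈ Finset.range (N + 1), f (u + v)) ^ 2 := by
  refine le_trans (le_of_eq ?_) (two_walk F f F0 Fn hF fa K hK N)
  rw [Ex2_take (by omega : N ≤ 2 * N) (by omega : N ≤ 2 * N)]
  refine Ex_congr fun a _ => Ex_congr fun b _ => ?_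
  congr 1
  refine Finset.sum_congr rfl fun i hi => Finset.sum_congr rfl fun j hj => ?_
  rw [Finset.mem_range] at hi hj
  rw [List.take_take, List.take_take, min_eq_left (by omega), min_eq_left (by omega)]
end ch

section five
variable {d : ℕ} [Fact (4 ≤ d)] (h5 : 5 ≤ d)
include h5

lemma Gt32 : ∃ C : ℝ, 0 < C ∧ ∀ (w : ℕ) (x : Zd d), Gt w x ≤ C * ((w : ℝ) + 1) ^ (-(3 / 2) : ℝ) := by
  have h : (5 : ℝ) ≤ d := by exact_mod_cast h5
  obtain ⟨C, hC, H⟩ := Gt_bound d (5 / 2) (by norm_num) (by linarith)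
  refine ⟨C, hC, fun w x => (H w x).trans (le_of_eq ?_)⟩
  norm_num

lemma ch2_five : ∃ C : ℝ, 0 < C ∧ ∀ m n N : ℕ, m ≤ N → n ≤ N → ch2 d m n ≤ C * ((N : ℝ) + 1) := by
  obtain ⟨C, hC, H⟩ := Gt32 h5
  obtain ⟨D, hD, HD⟩ := dsum32
  refine ⟨4 * (2 * (1 + 2 ^ (3 / 2 : ℝ)) * (C * D) ^ 2), by positivity, fun m n N hm hn => (ch2_mono hm hn).trans ?_⟩
  have key := GG2_le (d := d) G (fun u => C * ((u : ℝ) + 1) ^ (-(3 / 2) : ℝ)) (fun x => Gt_nonneg 0 x) (Gt_neg 0)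
    (fun u x => by rw [Ex_Gt]; simpa using H u x)
    (fun i j h => mul_le_mul_of_nonneg_left (rp_anti (by norm_num) h) hC.le)
    (2 ^ (3 / 2 : ℝ)) (fun u v => by
      have := mul_le_mul_of_nonneg_left (powK (3 / 2) (by norm_num) u v) hC.le
      linarith) N
  have h1 : ch2 d N N ≤ 4 * Ex (d := d) N (fun a => Ex N fun b => (∑ i ∈ Finset.range (N + 1), ∑ j ∈ Finset.range (N + 1),
      G (endp (a.take i) - endp (b.take j))) ^ 2) := by
    unfold ch2
    simp only [← Ex_mul_left]
    refine Ex_mono fun a ha => Ex_mono fun b hb => ?_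
    have h2 := ch_le_GG (rng a) (rng b)
    have h3 := GG_le a b ha hb G (fun x => Gt_nonneg 0 x)
    have h4 := ch_nonneg (rng a) (rng b)
    nlinarith
  refine h1.trans ?_
  rw [mul_assoc 4]
  refine mul_le_mul_of_nonneg_left (key.trans ?_) (by norm_num)
  rw [mul_assoc (2 * (1 + (2:ℝ) ^ (3 / 2 : ℝ)))]
  refine mul_le_mul_of_nonneg_left ?_ (by positivity)
  simp only [← Finset.mul_sum]
  have h6 : (((N : ℝ) + 1) ^ (1 / 2 : ℝ)) ^ 2 = (N : ℝ) + 1 := by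
    rw [← Real.rpow_natCast, ← Real.rpow_mul (by positivity)]; norm_num
  rw [mul_pow, mul_pow, mul_assoc, ← h6, ← mul_pow D]
  refine mul_le_mul_of_nonneg_left (pow_le_pow_left₀ ?_ (HD N) 2) (by positivity)
  exact Finset.sum_nonneg fun _ _ => Finset.sum_nonneg fun _ _ => (rp_pos _ _).le

/-- mean, `d ≥ 5` -/
lemma mean_five : ∃ e : ℝ, 0 < e ∧ Tendsto (fun T : ℕ => cT d T / T) atTop (𝓝 e) := by
  have hs : Subadditive (cT d) := fun m n => cT_subadd m n
  have hb : BddBelow (Set.range fun n : ℕ => cT d n / n) :=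
    ⟨0, by rintro _ ⟨n, rfl⟩; exact div_nonneg (cT_nonneg n) (by positivity)⟩
  refine ⟨hs.lim, ?_, hs.tendsto_lim hb⟩
  obtain ⟨C, hC, H⟩ := Gt32 h5
  obtain ⟨D, hD, HD⟩ := tail_sum_le (3 / 2) (by norm_num)
  set E := G (0 : Zd d) + 2 * (C * D) with hE
  have E0 : 0 < E := by have := G_zero_ge (d := d); positivity
  have hen : ∀ T, enT d T ≤ E := by
    intro T
    unfold enT
    have : ∑ u ∈ Finset.range T, Gt (u + 1) (0 : Zd d) ≤ C * D := by
      calc _ ≤ ∑ u ∈ Finset.range T, C * (((0 + u : ℕ) : ℝ) + 1) ^ (-(3 / 2) : ℝ) := by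
            refine Finset.sum_le_sum fun u _ => (H _ _).trans ?_
            exact mul_le_mul_of_nonneg_left (rp_anti (by norm_num) (by omega)) hC.le
        _ ≤ C * D := by
            rw [← Finset.mul_sum]
            refine mul_le_mul_of_nonneg_left ((HD T 0).trans ?_) hC.le
            simp
    linarith
  refine lt_of_lt_of_le (div_pos one_pos E0) (ge_of_tendsto (hs.tendsto_lim hb) ?_)
  filter_upwards [eventually_gt_atTop 0] with T hT
  have hT' : (0 : ℝ) < T := by exact_mod_cast hT
  rw [le_div_iff₀ hT']
  refine le_trans ?_ (cT_lower T)
  rw [div_mul_eq_mul_div, one_mul]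
  exact div_le_div₀ (by positivity) (by linarith) (enT_pos T) (hen T)

/-- truncated double Green function -/
def gN (N : ℕ) (x : Zd d) : ℝ := ∑ i ∈ Finset.range (N + 1), Gt i x

lemma gN_nonneg (N : ℕ) (x : Zd d) : 0 ≤ gN N x := Finset.sum_nonneg fun _ _ => Gt_nonneg _ _

lemma gN_sq : ∃ C : ℝ, 0 < C ∧ ∀ N k : ℕ, Ex (d := d) k (fun l => gN N (endp l) ^ 2) ≤ C * ((k : ℝ) + 1) ^ (-1 : ℝ) := by
  obtain ⟨C, hC, H⟩ := Gt32 h5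
  obtain ⟨D, hD, HD⟩ := tail_sum_le (3 / 2) (by norm_num)
  obtain ⟨E, hE, HE⟩ := sum_S2
  refine ⟨2 * C * D * C * E, by positivity, fun N k => ?_⟩
  have h1 : ∀ x : Zd d, gN N x ^ 2 ≤ ∑ i ∈ Finset.range (N + 1), 2 * C * D * ((i : ℝ) + 1) ^ (-(1 / 2) : ℝ) * Gt i x := by
    intro x
    have := sq_pairs N (fun i j => Gt i x * Gt j x) (fun i j => mul_nonneg (Gt_nonneg _ _) (Gt_nonneg _ _))
    rw [← Finset.sum_mul_sum, ← sq] at this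
    refine this.trans (Finset.sum_le_sum fun i _ => ?_)
    calc _ ≤ ∑ u ∈ Finset.range (N + 1), 2 * Gt i x * (C * (((i + u : ℕ) : ℝ) + 1) ^ (-(3 / 2) : ℝ)) := by
          refine Finset.sum_le_sum fun u _ => ?_
          nlinarith [H (i + u) x, Gt_nonneg i x]
      _ ≤ 2 * Gt i x * (C * (D * ((i : ℝ) + 1) ^ (-(1 / 2) : ℝ))) := by
          rw [← Finset.mul_sum, ← Finset.mul_sum]
          have := HD (N + 1) i
          norm_num at this
          refine mul_le_mul_of_nonneg_left (mul_le_mul_of_nonneg_left ?_ hC.le) (mul_nonneg (by norm_num) (Gt_nonneg _ _))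
          norm_num; exact this
      _ = _ := by ring
  calc _ ≤ Ex (d := d) k (fun l => ∑ i ∈ Finset.range (N + 1), 2 * C * D * ((i : ℝ) + 1) ^ (-(1 / 2) : ℝ) * Gt i (endp l)) :=
        Ex_mono fun l _ => h1 _
    _ = ∑ i ∈ Finset.range (N + 1), 2 * C * D * ((i : ℝ) + 1) ^ (-(1 / 2) : ℝ) * Gt (i + k) (0 : Zd d) := by
        rw [Ex_sum]
        refine Finset.sum_congr rfl fun i _ => ?_
        rw [Ex_mul_left]
        have := Ex_Gt (d := d) k i 0
        simp only [zero_add] at this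
        rw [this]
    _ ≤ ∑ i ∈ Finset.range (N + 1), 2 * C * D * C * (((i : ℝ) + 1) ^ (-(1 / 2) : ℝ) * (((k + i : ℕ) : ℝ) + 1) ^ (-(3 / 2) : ℝ)) := by
        refine Finset.sum_le_sum fun i _ => ?_
        have := H (i + k) 0
        rw [add_comm i k] at this ⊢
        have q := rp_pos i (-(1 / 2))
        calc _ ≤ 2 * C * D * ((i : ℝ) + 1) ^ (-(1 / 2) : ℝ) * (C * (((k + i : ℕ) : ℝ) + 1) ^ (-(3 / 2) : ℝ)) :=
              mul_le_mul_of_nonneg_left this (by positivity)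
          _ = _ := by ring
    _ ≤ _ := by
        rw [← Finset.mul_sum, mul_assoc _ E]
        exact mul_le_mul_of_nonneg_left (HE _ _) (by positivity)

lemma GgN : ∃ C : ℝ, 0 < C ∧ ∀ N s : ℕ, Ex (d := d) s (fun l => G (endp l) * gN N (endp l)) ≤ C * ((s : ℝ) + 1) ^ (-2 : ℝ) := by
  obtain ⟨C, hC, H⟩ := Gt32 h5
  have h5' : (5 : ℝ) ≤ d := by exact_mod_cast h5
  obtain ⟨B, hB, HB⟩ := pk_le d (5 / 2) (by norm_num) (by linarith)
  obtain ⟨D, hD, HD⟩ := tail_sum_le (3 / 2) (by norm_num)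
  have a1 : ∀ s j : ℕ, Ex (d := d) s (fun l => G (endp l) * Gt j (endp l)) ≤
      B * C * D * (((s : ℝ) + 1) ^ (-(5 / 2) : ℝ) * ((j : ℝ) + 1) ^ (-(1 / 2) : ℝ)) := by
    intro s j
    rw [Ex_sumQ le_rfl (fun x => G x * Gt j x)]
    have b1 : ∑ a ∈ Qb d s, G a * Gt j a ≤ C * (D * ((j : ℝ) + 1) ^ (-(1 / 2) : ℝ)) := by
      have hl : Tendsto (fun n => ∑ a ∈ Qb d s, (∑ t ∈ Finset.range n, pk (0 + t) a) * Gt j a) atTop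
          (𝓝 (∑ a ∈ Qb d s, G a * Gt j a)) :=
        tendsto_finsetSum _ fun a _ => ((Gt_hasSum 0 a).tendsto_sum_nat).mul_const _
      refine le_of_tendsto' hl fun n => ?_
      simp only [Finset.sum_mul, zero_add]
      rw [Finset.sum_comm]
      calc _ ≤ ∑ t ∈ Finset.range n, C * (((j + t : ℕ) : ℝ) + 1) ^ (-(3 / 2) : ℝ) := by
            refine Finset.sum_le_sum fun t _ => (sumQ_le s t (fun x => Gt j x) fun x => Gt_nonneg _ _).trans ?_
            have := Ex_Gt (d := d) t j 0
            simp only [zero_add] at this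
            rw [this]; exact H _ _
        _ ≤ _ := by
            rw [← Finset.mul_sum]
            have := HD n j
            norm_num at this
            refine mul_le_mul_of_nonneg_left ?_ hC.le
            norm_num; exact this
    calc _ ≤ ∑ a ∈ Qb d s, B * ((s : ℝ) + 1) ^ (-(5 / 2) : ℝ) * (G a * Gt j a) :=
          Finset.sum_le_sum fun a _ => mul_le_mul_of_nonneg_right (HB s a) (mul_nonneg (Gt_nonneg _ _) (Gt_nonneg _ _))
      _ ≤ B * ((s : ℝ) + 1) ^ (-(5 / 2) : ℝ) * (C * (D * ((j : ℝ) + 1) ^ (-(1 / 2) : ℝ))) := by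
          rw [← Finset.mul_sum]
          exact mul_le_mul_of_nonneg_left b1 (mul_nonneg hB.le (rp_pos _ _).le)
      _ = _ := by ring
  have a2 : ∀ s j : ℕ, Ex (d := d) s (fun l => G (endp l) * Gt j (endp l)) ≤
      C * C * (((s : ℝ) + 1) ^ (-(3 / 2) : ℝ) * ((j : ℝ) + 1) ^ (-(3 / 2) : ℝ)) := by
    intro s j
    calc _ ≤ Ex (d := d) s (fun l => G (endp l) * (C * ((j : ℝ) + 1) ^ (-(3 / 2) : ℝ))) :=
          Ex_mono fun l _ => mul_le_mul_of_nonneg_left (H _ _) (Gt_nonneg _ _)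
      _ ≤ (C * ((s : ℝ) + 1) ^ (-(3 / 2) : ℝ)) * (C * ((j : ℝ) + 1) ^ (-(3 / 2) : ℝ)) := by
          rw [Ex_mul_right]
          have := Ex_Gt (d := d) s 0 0
          simp only [zero_add] at this
          rw [this]
          exact mul_le_mul_of_nonneg_right (H _ _) (mul_nonneg hC.le (rp_pos _ _).le)
      _ = _ := by ring
  refine ⟨B * C * D * 2 + C * C * D, by positivity, fun N s => ?_⟩
  have e : Ex (d := d) s (fun l => G (endp l) * gN N (endp l)) =
      ∑ j ∈ Finset.range (N + 1), Ex (d := d) s (fun l => G (endp l) * Gt j (endp l)) := by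
    rw [← Ex_sum]; refine Ex_congr fun l _ => ?_
    rw [gN, Finset.mul_sum]
  rw [e]
  refine (range_add_le _ (fun j => Ex_nonneg fun l _ => mul_nonneg (Gt_nonneg _ _) (Gt_nonneg _ _)) (s + 1) _).trans ?_
  rw [add_mul]
  refine add_le_add ?_ ?_
  · refine (Finset.sum_le_sum fun j _ => a1 s j).trans ?_
    rw [← Finset.mul_sum, ← Finset.mul_sum, mul_assoc (B * C * D)]
    refine mul_le_mul_of_nonneg_left ?_ (by positivity)
    have := sum_half (s + 1)
    push_cast at this
    refine (mul_le_mul_of_nonneg_left this (rp_pos _ _).le).trans (le_of_eq ?_)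
    rw [mul_left_comm, rp_mul s _ _ (-2) (by norm_num)]
  · refine (Finset.sum_le_sum fun j _ => a2 s (s + 1 + j)).trans ?_
    rw [← Finset.mul_sum, ← Finset.mul_sum, mul_assoc (C * C)]
    refine mul_le_mul_of_nonneg_left ?_ (by positivity)
    have h7 : ∑ j ∈ Finset.range (N + 1), (((s + 1 + j : ℕ) : ℝ) + 1) ^ (-(3 / 2) : ℝ) ≤ D * ((s : ℝ) + 1) ^ (-(1 / 2) : ℝ) := by
      have := HD (N + 1) s
      refine le_trans (Finset.sum_le_sum fun j _ => rp_anti (by norm_num) (by omega : s + j ≤ s + 1 + j)) (this.trans (le_of_eq ?_))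
      norm_num
    refine (mul_le_mul_of_nonneg_left h7 (rp_pos _ _).le).trans (le_of_eq ?_)
    rw [mul_left_comm, rp_mul s _ _ (-2) (by norm_num)]
end five


section five8
variable {d : ℕ} [Fact (4 ≤ d)]

lemma sumTake (b : List (Stp d)) {n N : ℕ} (hn : n ≤ N) (hN : N ≤ b.length) (f : Zd d → ℝ) (hf : ∀ x, 0 ≤ f x) :
    ∑ y ∈ rng (b.take n), f y ≤ ∑ k ∈ Finset.range (N + 1), f (endp (b.take k)) := by
  refine (sum_rng_le' (n := n) _ (by simp; omega) f hf).trans ?_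
  have : ∀ k ∈ Finset.range (n + 1), f (endp ((b.take n).take k)) = f (endp (b.take k)) := by
    intro k hk
    rw [List.take_take, min_eq_left (by have := Finset.mem_range.mp hk; omega)]
  rw [Finset.sum_congr rfl this]
  exact Finset.sum_le_sum_of_subset_of_nonneg (Finset.range_mono (by omega)) fun _ _ _ => hf _

lemma trip_pt (a b : List (Stp d)) {m n N : ℕ} (hm : m ≤ N) (hn : n ≤ N) (ha : a.length = 2 * N) (hb : b.length = 2 * N) :
    ∑ y ∈ rng (b.take n), (∑ x ∈ rng (a.take m), G (x - y)) ^ 2 ≤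
    ∑ k ∈ Finset.range (N + 1), ∑ i ∈ Finset.range (N + 1), ∑ u ∈ Finset.range (N + 1),
      2 * (G (endp (a.take i) - endp (b.take k)) * G (endp (a.take (i + u)) - endp (b.take k))) := by
  refine (sumTake b hn (by omega) (fun y => (∑ x ∈ rng (a.take m), G (x - y)) ^ 2) fun _ => sq_nonneg _).trans ?_
  refine Finset.sum_le_sum fun k _ => ?_
  set y := endp (b.take k)
  have h1 := sumTake a hm (by omega) (fun x => G (x - y)) fun x => Gt_nonneg 0 _
  have h0 : 0 ≤ ∑ x ∈ rng (a.take m), G (x - y) := Finset.sum_nonneg fun _ _ => Gt_nonneg 0 _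
  refine (pow_le_pow_left₀ h0 h1 2).trans ?_
  rw [sq, Finset.sum_mul_sum]
  refine (sq_pairs N (fun i j => G (endp (a.take i) - y) * G (endp (a.take j) - y)) fun i j =>
    mul_nonneg (Gt_nonneg 0 _) (Gt_nonneg 0 _)).trans (le_of_eq ?_)
  refine Finset.sum_congr rfl fun i _ => Finset.sum_congr rfl fun u _ => by ring

lemma triple (h5 : 5 ≤ d) : ∃ C : ℝ, 0 < C ∧ ∀ N m n : ℕ, m ≤ N → n ≤ N →
    Ex (d := d) m (fun a => Ex n fun b => ∑ y ∈ rng b, (∑ x ∈ rng a, G (x - y)) ^ 2) ≤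
      C * (1 + Real.log (N + 1)) := by
  obtain ⟨C, hC, H⟩ := GgN h5
  obtain ⟨D, hD, HD⟩ := tail_sum_le 2 (by norm_num)
  refine ⟨2 * C * D * 2, by positivity, fun N m n hm hn => ?_⟩
  rw [Ex2_take (by omega : m ≤ 2 * N) (by omega : n ≤ 2 * N)]
  have e : ∀ k ∈ Finset.range (N + 1), ∀ i ∈ Finset.range (N + 1), ∀ u ∈ Finset.range (N + 1),
      Ex (d := d) (2 * N) (fun a => Ex (2 * N) fun b => 2 * (G (endp (a.take i) - endp (b.take k)) *
        G (endp (a.take (i + u)) - endp (b.take k)))) = 2 * Ex (d := d) (i + k) fun l => G (endp l) * Gt u (endp l) := by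
    intro k hk i hi u hu
    simp only [Finset.mem_range] at hk hi hu
    have := Ex_pair2 (d := d) (M := 2 * N) (i := i) (u := u) (j := k) (v := 0) (fun _ => 0) (fun _ => 0) (fun _ => le_rfl)
      (fun _ => rfl) (fun u x => (Ex_const u 0).le) antitone_const (by omega) (by omega)
      (fun x x' y _ => 2 * (G (x - y) * G (x' - y)))
    rw [this]
    simp only [Ex_mul_left, Ex_zero]
    congr 1
    have e2 := Ex_two (d := d) i k (fun z => G z * Gt u z) 0
    simp only [zero_add] at e2
    rw [← e2]
    refine Ex_congr fun a _ => ?_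
    rw [Ex_swap]
    refine Ex_congr fun b _ => ?_
    have := Ex_Gt (d := d) u 0 (endp a - endp b)
    rw [zero_add] at this
    rw [← this, Ex_mul_left]
    congr 1
    refine Ex_congr fun l _ => ?_
    show G _ = G _
    congr 1; abel
  calc _ ≤ Ex (d := d) (2 * N) (fun a => Ex (2 * N) fun b => ∑ k ∈ Finset.range (N + 1), ∑ i ∈ Finset.range (N + 1),
        ∑ u ∈ Finset.range (N + 1),
      2 * (G (endp (a.take i) - endp (b.take k)) * G (endp (a.take (i + u)) - endp (b.take k)))) :=
        Ex_mono fun a ha => Ex_mono fun b hb => trip_pt a b hm hn ha hb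
    _ = ∑ k ∈ Finset.range (N + 1), ∑ i ∈ Finset.range (N + 1), ∑ u ∈ Finset.range (N + 1),
        2 * Ex (i + k) (fun l => G (endp l) * Gt u (endp l : Zd d)) := by
        simp only [Ex_sum]
        exact Finset.sum_congr rfl fun k hk => Finset.sum_congr rfl fun i hi => Finset.sum_congr rfl fun u hu => e k hk i hi u hu
    _ = ∑ k ∈ Finset.range (N + 1), ∑ i ∈ Finset.range (N + 1),
        2 * Ex (i + k) (fun l => G (endp l) * gN N (endp l : Zd d)) := by
        refine Finset.sum_congr rfl fun k hk => Finset.sum_congr rfl fun i hi => ?_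
        rw [← Finset.mul_sum, ← Ex_sum]
        simp only [gN, Finset.mul_sum]
    _ ≤ ∑ k ∈ Finset.range (N + 1), ∑ i ∈ Finset.range (N + 1), 2 * (C * (((k + i : ℕ) : ℝ) + 1) ^ (-2 : ℝ)) := by
        refine Finset.sum_le_sum fun k hk => Finset.sum_le_sum fun i hi => ?_
        rw [add_comm k i]
        exact mul_le_mul_of_nonneg_left (H N (i + k)) (by norm_num)
    _ ≤ ∑ k ∈ Finset.range (N + 1), 2 * C * (D * ((k : ℝ) + 1) ^ (-1 : ℝ)) := by
        refine Finset.sum_le_sum fun k hk => ?_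
        have := HD (N + 1) k
        norm_num at this ⊢
        simp only [← mul_assoc]
        rw [← Finset.mul_sum, mul_assoc (2 * C)]
        exact mul_le_mul_of_nonneg_left this (by positivity)
    _ = 2 * C * D * ∑ k ∈ Finset.range (N + 1), ((k : ℝ) + 1) ^ (-1 : ℝ) := by
        rw [Finset.mul_sum]; exact Finset.sum_congr rfl fun k _ => by ring
    _ ≤ 2 * C * D * (1 + Real.log (((N + 1 : ℕ) : ℝ) + 1)) := mul_le_mul_of_nonneg_left (harm_le _) (by positivity)
    _ ≤ _ := by
        rw [mul_assoc (2 * C * D)]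
        refine mul_le_mul_of_nonneg_left ?_ (by positivity)
        have h1 : Real.log (((N + 1 : ℕ) : ℝ) + 1) ≤ Real.log (2 * ((N : ℝ) + 1)) :=
          Real.log_le_log (by positivity) (by push_cast; linarith [(Nat.cast_nonneg N : (0:ℝ) ≤ N)])
        rw [Real.log_mul (by norm_num) (by positivity)] at h1
        have h2 : Real.log 2 ≤ 1 := by linarith [Real.log_two_lt_d9]
        have h3 : 0 ≤ Real.log ((N : ℝ) + 1) := Real.log_nonneg (by linarith [(Nat.cast_nonneg N : (0:ℝ) ≤ N)])
        linarith

lemma zeta_le (h5 : 5 ≤ d) : ∃ C : ℝ, 0 < C ∧ ∀ N m n : ℕ, m ≤ N → n ≤ N →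
    Ex (d := d) m (fun a => Ex n fun b => ZZ (rng a) (rng b)) ≤ C * (1 + Real.log (N + 1)) := by
  obtain ⟨C, hC, H⟩ := triple h5
  refine ⟨2 * C, by positivity, fun N m n hm hn => ?_⟩
  have h1 := H N m n hm hn
  have h2 := H N n m hn hm
  rw [Ex_swap] at h2
  calc _ ≤ Ex (d := d) m (fun a => Ex n fun b => ∑ y ∈ rng b, (∑ x ∈ rng a, G (x - y)) ^ 2 +
        ∑ y ∈ rng a, (∑ x ∈ rng b, G (x - y)) ^ 2) := by
        refine Ex_mono fun a _ => Ex_mono fun b _ => (ZZ_le _ _).trans (le_of_eq ?_)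
        have key : ∀ A B : Finset (Zd d), ∑ a' ∈ A, ∑ b ∈ B, ∑ a ∈ A, G (a' - b) * G (b - a) =
            ∑ y ∈ B, (∑ x ∈ A, G (x - y)) ^ 2 := by
          intro A B
          rw [Finset.sum_comm]
          refine Finset.sum_congr rfl fun y _ => ?_
          rw [sq, Finset.sum_mul_sum]
          refine Finset.sum_congr rfl fun x _ => Finset.sum_congr rfl fun x' _ => ?_
          congr 1; exact Gt_sub_comm 0 _ _
        rw [key, key]
    _ ≤ _ := by
        simp only [Ex_add]
        linarith
end five8


section nine
variable {d : ℕ} [Fact (4 ≤ d)]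

def chi (l : List (Stp d)) : ℝ := ch {0} (trng l)

lemma chi_nonneg (l : List (Stp d)) : 0 ≤ chi l := ch_nonneg _ _
lemma dl_chi (l : List (Stp d)) : dl l = cp {(0 : Zd d)} - chi l := dl_eq l
lemma chi_le_one (l : List (Stp d)) : chi l ≤ 1 := by
  have := dl_nonneg l; rw [dl_chi] at this; linarith [cp_singleton_le (0 : Zd d)]
lemma chi_nil : chi ([] : List (Stp d)) = 0 := by
  simp [chi, trng_nil', ch, cp_empty]
lemma chi_take_mono (l : List (Stp d)) {k k' : ℕ} (h : k ≤ k') : chi (l.take k) ≤ chi (l.take k') := by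
  have : l.take k = (l.take k').take k := by rw [List.take_take, min_eq_left h]
  rw [this]; exact ch_mono_right _ (trng_take_sub _ _)

def eta (r : ℕ) (l : List (Stp d)) : ℝ := chi (l.take (r + 1)) - chi (l.take r)
lemma eta_nonneg (r : ℕ) (l : List (Stp d)) : 0 ≤ eta r l := sub_nonneg.mpr (chi_take_mono l (by omega))
lemma eta_sum (l : List (Stp d)) (n : ℕ) (h : l.length = n) : ∑ r ∈ Finset.range n, eta r l = chi l := by
  unfold eta
  rw [Finset.sum_range_sub (fun r => chi (l.take r))]
  simp [← h, chi_nil]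

lemma abel1 (c g : ℕ → ℝ) (n : ℕ) : ∑ r ∈ Finset.range n, (c (r + 1) - c r) * ∑ k ∈ Finset.range (r + 2), g k =
    ∑ k ∈ Finset.range (n + 1), g k * (c n - c (k - 1)) := by
  induction n with
  | zero => simp
  | succ n ih =>
    rw [Finset.sum_range_succ, ih, Finset.sum_range_succ (fun k => g k * (c (n + 1) - c (k - 1))) (n + 1)]
    have : ∑ k ∈ Finset.range (n + 1), g k * (c (n + 1) - c (k - 1)) =
      ∑ k ∈ Finset.range (n + 1), g k * (c n - c (k - 1)) + (c (n + 1) - c n) * ∑ k ∈ Finset.range (n + 1), g k := by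
      rw [Finset.mul_sum, ← Finset.sum_add_distrib]
      exact Finset.sum_congr rfl fun k _ => by ring
    rw [this, Finset.sum_range_succ g (n + 1)]
    simp only [Nat.add_sub_cancel]; ring

lemma Ex_ch_le (m : ℕ) (B : Finset (Zd d)) : Ex m (fun a => ch (rng a) B) ≤ 2 * ∑ y ∈ B, gN m y := by
  calc _ ≤ Ex m (fun a => 2 * ∑ y ∈ B, ∑ i ∈ Finset.range (m + 1), G (endp (a.take i) - y)) := by
        refine Ex_mono fun a ha => (ch_le_GG _ _).trans (mul_le_mul_of_nonneg_left ?_ (by norm_num))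
        rw [Finset.sum_comm]
        exact Finset.sum_le_sum fun y _ => sum_rng_le' a ha (fun x => G (x - y)) fun x => Gt_nonneg 0 _
    _ = _ := by
        rw [Ex_mul_left, Ex_sum]
        congr 1
        refine Finset.sum_congr rfl fun y _ => ?_
        rw [Ex_sum, gN]
        refine Finset.sum_congr rfl fun i hi => ?_
        have hi' := Finset.mem_range.mp hi
        rw [Ex_take (by omega : i ≤ m) (fun l => G (endp l - y))]
        simpa using Ex_Gt'' i 0 y

lemma chi_tail (b : List (Stp d)) {n k : ℕ} (hb : b.length = n) (hk : k ≤ n) :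
    chi b - chi (b.take (k - 1)) ≤ 2 * ∑ u ∈ Finset.range (n - k + 1), G (endp (b.take (k + u))) := by
  set p := k - 1 with hp
  have h1 : chi b ≤ chi (b.take p) + ch {0} (sh (endp (b.take p)) (trng (b.drop p))) := by
    unfold chi
    conv_lhs => rw [← List.take_append_drop p b, trng_append]
    exact ch_union_right _ _ _
  have h2 := ch_le_GG {(0 : Zd d)} (sh (endp (b.take p)) (trng (b.drop p)))
  rw [Finset.sum_singleton, sum_sh] at h2
  have h3 := sum_trng_le (b.drop p) (fun y => G (0 - (endp (b.take p) + y))) fun _ => Gt_nonneg 0 _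
  have h4 : ∑ j ∈ Finset.Icc 1 (b.drop p).length, G (0 - (endp (b.take p) + endp ((b.drop p).take j))) =
      ∑ j ∈ Finset.Icc 1 (n - p), G (endp (b.take (p + j))) := by
    rw [List.length_drop, hb]
    refine Finset.sum_congr rfl fun j _ => ?_
    rw [← endp_append, ← List.take_add, zero_sub]; exact Gt_neg 0 _
  have h5 : ∑ j ∈ Finset.Icc 1 (n - p), G (endp (b.take (p + j))) ≤
      ∑ u ∈ Finset.range (n - k + 1), G (endp (b.take (k + u))) := by
    rcases Nat.eq_zero_or_pos k with h | h
    · have : p = 0 := by omega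
      subst h; rw [this]
      refine Finset.sum_le_sum_of_subset_of_nonneg ?_ fun _ _ _ => Gt_nonneg 0 _
      intro j hj; simp at hj ⊢; omega
    · refine le_of_eq ?_
      refine Finset.sum_nbij' (fun j => j - 1) (fun u => u + 1) ?_ ?_ ?_ ?_ ?_
      · intro j hj; simp at hj ⊢; omega
      · intro j hj; simp at hj ⊢; omega
      · intro j hj; simp at hj ⊢; omega
      · intro j hj; simp
      · intro j hj; simp at hj
        congr 3; omega
  linarith

lemma gN_mono {m N : ℕ} (h : m ≤ N) (x : Zd d) : gN m x ≤ gN N x :=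
  Finset.sum_le_sum_of_subset_of_nonneg (Finset.range_mono (by omega)) fun _ _ _ => Gt_nonneg _ _
lemma gN_nn (m : ℕ) (x : Zd d) : 0 ≤ gN m x := Finset.sum_nonneg fun _ _ => Gt_nonneg _ _

lemma log_succ_le (N : ℕ) : 1 + Real.log (((N + 1 : ℕ) : ℝ) + 1) ≤ 2 * (1 + Real.log (N + 1)) := by
  have h1 : Real.log (((N + 1 : ℕ) : ℝ) + 1) ≤ Real.log (2 * ((N : ℝ) + 1)) :=
    Real.log_le_log (by positivity) (by push_cast; linarith [(Nat.cast_nonneg N : (0:ℝ) ≤ N)])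
  rw [Real.log_mul (by norm_num) (by positivity)] at h1
  have h2 : Real.log 2 ≤ 1 := by linarith [Real.log_two_lt_d9]
  have h3 : 0 ≤ Real.log ((N : ℝ) + 1) := Real.log_nonneg (by linarith [(Nat.cast_nonneg N : (0:ℝ) ≤ N)])
  linarith

lemma part1 (h5 : 5 ≤ d) : ∃ C : ℝ, 0 < C ∧ ∀ N m n : ℕ, m ≤ N → n ≤ N →
    ∑ r ∈ Finset.range n, Ex (d := d) m (fun a => Ex n fun b => eta r b * ch (rng a) (rng (b.take (r + 1)))) ≤
      C * (1 + Real.log (N + 1)) := by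
  obtain ⟨C, hC, H⟩ := gN_sq h5
  refine ⟨4 * C * 2, by positivity, fun N m n hm hn => ?_⟩
  calc _ = Ex (d := d) n fun b => ∑ r ∈ Finset.range n, eta r b * Ex m fun a => ch (rng a) (rng (b.take (r + 1))) := by
        rw [Ex_sum]
        refine Finset.sum_congr rfl fun r _ => ?_
        rw [Ex_swap]
        exact Ex_congr fun b _ => Ex_mul_left _ _ _
    _ ≤ Ex n fun b => ∑ k ∈ Finset.range (n + 1), ∑ u ∈ Finset.range (n - k + 1),
        4 * (gN m (endp (b.take k)) * G (endp (b.take (k + u)))) := by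
        refine Ex_mono fun b hb => ?_
        calc _ ≤ ∑ r ∈ Finset.range n, eta r b * (2 * ∑ k ∈ Finset.range (r + 2), gN m (endp (b.take k))) := by
              refine Finset.sum_le_sum fun r hr => mul_le_mul_of_nonneg_left ?_ (eta_nonneg r b)
              refine (Ex_ch_le _ _).trans (mul_le_mul_of_nonneg_left ?_ (by norm_num))
              have hr' := Finset.mem_range.mp hr
              exact sumTake b le_rfl (by omega) (gN m) (gN_nn m)
          _ = 2 * ∑ k ∈ Finset.range (n + 1), gN m (endp (b.take k)) * (chi (b.take n) - chi (b.take (k - 1))) := by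
              rw [← abel1 (fun r => chi (b.take r)) (fun k => gN m (endp (b.take k))), Finset.mul_sum]
              exact Finset.sum_congr rfl fun r _ => by unfold eta; ring
          _ ≤ 2 * ∑ k ∈ Finset.range (n + 1), gN m (endp (b.take k)) *
                (2 * ∑ u ∈ Finset.range (n - k + 1), G (endp (b.take (k + u)))) := by
              refine mul_le_mul_of_nonneg_left (Finset.sum_le_sum fun k hk => ?_) (by norm_num)
              refine mul_le_mul_of_nonneg_left ?_ (gN_nn _ _)
              have hk' := Finset.mem_range.mp hk
              have := chi_tail b hb (by omega : k ≤ n)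
              rwa [List.take_of_length_le (by omega : b.length ≤ n)]
          _ = _ := by
              rw [Finset.mul_sum]
              refine Finset.sum_congr rfl fun k _ => ?_
              rw [Finset.mul_sum, Finset.mul_sum, Finset.mul_sum]
              exact Finset.sum_congr rfl fun u _ => by ring
    _ = ∑ k ∈ Finset.range (n + 1), ∑ u ∈ Finset.range (n - k + 1),
        4 * Ex (d := d) k (fun l => gN m (endp l) * Gt u (endp l)) := by
        simp only [Ex_sum, Ex_mul_left]
        refine Finset.sum_congr rfl fun k hk => Finset.sum_congr rfl fun u hu => ?_
        simp only [Finset.mem_range] at hk hu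
        have := Ex_pair (d := d) (by omega : k + u ≤ n) (fun x y => gN m x * G y)
        rw [this]
        congr 1
        refine Ex_congr fun l _ => ?_
        rw [Ex_mul_left]
        congr 1
        simpa using Ex_Gt (d := d) u 0 (endp l)
    _ ≤ ∑ k ∈ Finset.range (n + 1), 4 * Ex (d := d) k (fun l => gN N (endp l) ^ 2) := by
        refine Finset.sum_le_sum fun k hk => ?_
        rw [← Finset.mul_sum, ← Ex_sum]
        refine mul_le_mul_of_nonneg_left (Ex_mono fun l _ => ?_) (by norm_num)
        rw [← Finset.mul_sum, sq]
        refine mul_le_mul (gN_mono hm _) ?_ (Finset.sum_nonneg fun _ _ => Gt_nonneg _ _) (gN_nn _ _)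
        exact gN_mono (by omega : n - k ≤ N) _
    _ ≤ ∑ k ∈ Finset.range (n + 1), 4 * (C * ((k : ℝ) + 1) ^ (-1 : ℝ)) :=
        Finset.sum_le_sum fun k hk => mul_le_mul_of_nonneg_left (H N k) (by norm_num)
    _ ≤ ∑ k ∈ Finset.range (N + 1), 4 * (C * ((k : ℝ) + 1) ^ (-1 : ℝ)) :=
        Finset.sum_le_sum_of_subset_of_nonneg (Finset.range_mono (by omega)) fun k _ _ => by
          have := rp_pos k (-1); positivity
    _ = 4 * C * ∑ k ∈ Finset.range (N + 1), ((k : ℝ) + 1) ^ (-1 : ℝ) := by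
        rw [Finset.mul_sum]; exact Finset.sum_congr rfl fun k _ => by ring
    _ ≤ 4 * C * (1 + Real.log (((N + 1 : ℕ) : ℝ) + 1)) := mul_le_mul_of_nonneg_left (harm_le _) (by positivity)
    _ ≤ _ := by
        rw [mul_assoc (4 * C)]
        exact mul_le_mul_of_nonneg_left (log_succ_le N) (by positivity)
end nine


section ten
variable {d : ℕ} [Fact (4 ≤ d)]

def Psi (m n : ℕ) (x : Zd d) : ℝ := Ex m fun a => Ex n fun b => ch (rng a) (sh x (rng b))
def kap (m n : ℕ) (x : Zd d) : ℝ := Ex m fun a => Ex n fun b => KK (rng a) (sh x (rng b))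

lemma kap_nonneg (m n : ℕ) (x : Zd d) : 0 ≤ kap m n x :=
  Ex_nonneg fun _ _ => Ex_nonneg fun _ _ => KK_nonneg _ _
lemma Psi_le_kap (m n : ℕ) (x : Zd d) : Psi m n x ≤ 2 * kap m n x := by
  unfold Psi kap
  simp only [← Ex_mul_left]
  exact Ex_mono fun a _ => Ex_mono fun b _ => ch_le_two_KK _ _
lemma Psi_ge_kap (m n : ℕ) : 2 * kap m n (0 : Zd d) - Ex (d := d) m (fun a => Ex n fun b => ZZ (rng a) (rng b)) ≤ Psi m n (0 : Zd d) := by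
  unfold Psi kap
  simp only [← Ex_mul_left, ← Ex_sub, sh_zero]
  exact Ex_mono fun a _ => Ex_mono fun b _ => ch_ge _ _
lemma Psi_mono (m : ℕ) {n n' : ℕ} (h : n ≤ n') : Psi m n (0 : Zd d) ≤ Psi m n' (0 : Zd d) := by
  unfold Psi
  refine Ex_mono fun a _ => ?_
  rw [← Ex_take h]
  refine Ex_mono fun b _ => ?_
  rw [sh_zero, sh_zero]
  exact ch_mono_right _ (rng_take_sub _ _)

lemma wT_eq (m n : ℕ) : wT d m n = Ex (d := d) m (fun a => Ex n fun b => chi b * ch (rng a) (rng b)) -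
    Ex (d := d) n chi * Psi m n (0 : Zd d) := by
  unfold wT crT
  have h1 : dT d n = cp {(0 : Zd d)} - Ex (d := d) n chi := by
    unfold dT
    rw [Ex_congr (g := fun l => cp {(0 : Zd d)} - chi l) fun l _ => dl_chi l, Ex_sub, Ex_const]
  have h2 : chT d m n = Psi m n (0 : Zd d) := by
    unfold chT Psi; simp only [sh_zero]
  have h3 : (Ex (d := d) m fun a => Ex n fun b => dl b * ch (rng a) (rng b)) =
      cp {(0 : Zd d)} * chT d m n - Ex (d := d) m (fun a => Ex n fun b => chi b * ch (rng a) (rng b)) := by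
    unfold chT
    simp only [← Ex_mul_left, ← Ex_sub]
    exact Ex_congr fun a _ => Ex_congr fun b _ => by rw [dl_chi]; ring
  rw [h3, h1, h2]; ring

lemma eta_take (r : ℕ) (l : List (Stp d)) : eta r (l.take (r + 1)) = eta r l := by
  unfold eta; rw [List.take_take, List.take_take]; simp

lemma eta_app (r : ℕ) (u v : List (Stp d)) (h : u.length = r + 1) : eta r (u ++ v) = eta r u := by
  rw [← eta_take r (u ++ v), List.take_append_of_le_length (by omega), eta_take]

lemma eta_step (m n r : ℕ) (h : r < n) :
    Ex (d := d) m (fun a => Ex n fun b => eta r b * ch (rng a) (rng b)) ≤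
      Ex (d := d) m (fun a => Ex n fun b => eta r b * ch (rng a) (rng (b.take (r + 1)))) +
      Ex (d := d) (r + 1) fun u => eta r u * Psi m (n - (r + 1)) (endp u) := by
  obtain ⟨q, rfl⟩ := Nat.exists_eq_add_of_lt h
  have hq : r + q + 1 - (r + 1) = q := by omega
  rw [hq, show r + q + 1 = (r + 1) + q by omega]
  have e3 : (Ex (d := d) (r + 1) fun u => eta r u * Psi m q (endp u)) = Ex (d := d) (r + 1) fun u => Ex q fun v => Ex m fun a =>
      eta r u * ch (rng a) (sh (endp u) (rng v)) := by
    refine Ex_congr fun u _ => ?_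
    unfold Psi; rw [Ex_swap]; simp only [Ex_mul_left]
  rw [e3, Ex_swap, Ex_swap m, Ex_append (r + 1) q, Ex_append (r + 1) q, ← Ex_add]
  refine Ex_mono fun u hu => ?_
  rw [← Ex_add]
  refine Ex_mono fun v hv => ?_
  rw [← Ex_add]
  refine Ex_mono fun a ha => ?_
  rw [eta_app r u v hu, ← mul_add, List.take_append_of_le_length (by omega), List.take_of_length_le (by omega), rng_append]
  exact mul_le_mul_of_nonneg_left (ch_union_right _ _ _) (eta_nonneg _ _)

lemma eta_total (n : ℕ) : ∑ r ∈ Finset.range n, Ex (d := d) (r + 1) (eta r) ≤ 1 := by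
  have : ∑ r ∈ Finset.range n, Ex (d := d) (r + 1) (eta r) = Ex (d := d) n chi := by
    rw [Ex_congr (g := fun l => ∑ r ∈ Finset.range n, eta r l) fun l hl => (eta_sum l n hl).symm, Ex_sum]
    refine Finset.sum_congr rfl fun r hr => ?_
    have := Finset.mem_range.mp hr
    rw [← Ex_take (by omega : r + 1 ≤ n)]
    exact Ex_congr fun l _ => eta_take r l
  rw [this]; exact Ex_le_const fun l _ => chi_le_one l

lemma wT_bound (h5 : 5 ≤ d) : ∃ C : ℝ, 0 < C ∧ ∀ N m n : ℕ, m ≤ N → n ≤ N →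
    wT d m n ≤ C * (1 + Real.log (N + 1)) + 2 * ∑ r ∈ Finset.range n, Ex (d := d) (r + 1) fun u =>
      eta r u * (kap m (n - (r + 1)) (endp u) - kap m (n - (r + 1)) (0 : Zd d)) := by
  obtain ⟨C1, hC1, H1⟩ := part1 h5
  obtain ⟨C2, hC2, H2⟩ := zeta_le h5
  refine ⟨C1 + C2, by positivity, fun N m n hm hn => ?_⟩
  rw [wT_eq]
  have hlog : 0 ≤ 1 + Real.log ((N : ℝ) + 1) := by
    have : 0 ≤ Real.log ((N : ℝ) + 1) := Real.log_nonneg (by linarith [(Nat.cast_nonneg N : (0:ℝ) ≤ N)])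
    linarith
  set L := 1 + Real.log ((N : ℝ) + 1)
  have e1 : Ex (d := d) m (fun a => Ex n fun b => chi b * ch (rng a) (rng b)) =
      ∑ r ∈ Finset.range n, Ex (d := d) m (fun a => Ex n fun b => eta r b * ch (rng a) (rng b)) := by
    simp only [← Ex_sum]
    refine Ex_congr fun a _ => Ex_congr fun b hb => ?_
    rw [← eta_sum b n hb, Finset.sum_mul]
  have e2 : Ex (d := d) n chi = ∑ r ∈ Finset.range n, Ex (d := d) (r + 1) (eta r) := by
    rw [Ex_congr (g := fun l => ∑ r ∈ Finset.range n, eta r l) fun l hl => (eta_sum l n hl).symm, Ex_sum]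
    refine Finset.sum_congr rfl fun r hr => ?_
    have := Finset.mem_range.mp hr
    rw [← Ex_take (by omega : r + 1 ≤ n)]
    exact Ex_congr fun l _ => (eta_take r l).symm
  rw [e1, e2, Finset.sum_mul, ← Finset.sum_sub_distrib]
  have step : ∀ r ∈ Finset.range n, Ex (d := d) m (fun a => Ex n fun b => eta r b * ch (rng a) (rng b)) -
      Ex (d := d) (r + 1) (eta r) * Psi m n (0 : Zd d) ≤
      Ex (d := d) m (fun a => Ex n fun b => eta r b * ch (rng a) (rng (b.take (r + 1)))) +
      (Ex (d := d) (r + 1) (eta r) * (C2 * L) + 2 * Ex (d := d) (r + 1) fun u =>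
      eta r u * (kap m (n - (r + 1)) (endp u) - kap m (n - (r + 1)) (0 : Zd d))) := by
    intro r hr
    have hr' := Finset.mem_range.mp hr
    have s1 := eta_step (d := d) m n r hr'
    have s2 : Psi m (n - (r + 1)) (0 : Zd d) ≤ Psi m n (0 : Zd d) := Psi_mono m (by omega)
    have s3 := Psi_ge_kap (d := d) m (n - (r + 1))
    have s4 := H2 N m (n - (r + 1)) hm (by omega)
    have s5 : Ex (d := d) (r + 1) (fun u => eta r u * Psi m (n - (r + 1)) (endp u)) - Ex (d := d) (r + 1) (eta r) * Psi m n (0 : Zd d)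
        ≤ Ex (d := d) (r + 1) (eta r) * (C2 * L) + 2 * Ex (d := d) (r + 1) fun u =>
      eta r u * (kap m (n - (r + 1)) (endp u) - kap m (n - (r + 1)) (0 : Zd d)) := by
      rw [← Ex_mul_right, ← Ex_mul_right, ← Ex_mul_left, ← Ex_sub, ← Ex_add]
      refine Ex_mono fun u _ => ?_
      have := Psi_le_kap m (n - (r + 1)) (endp u)
      nlinarith [eta_nonneg r u]
    linarith
  refine (Finset.sum_le_sum step).trans ?_
  rw [Finset.sum_add_distrib, Finset.sum_add_distrib, ← Finset.sum_mul, ← Finset.mul_sum]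
  have t1 := H1 N m n hm hn
  have t2 := mul_le_mul_of_nonneg_right (eta_total (d := d) n) (mul_nonneg hC2.le hlog)
  linarith

def eb (m : ℕ) (x : Zd d) : ℝ := Ex m fun l => ee (rng l) x

lemma kap_quad {m n M : ℕ} (hm : m ≤ M) (hn : n ≤ M) (x : Zd d) : kap m n x =
    ∑ a ∈ Qb d M, ∑ b ∈ Qb d M, eb m a * eb n b * G (a - b - x) := by
  unfold kap
  have h : ∀ a b : List (Stp d), a.length = m → b.length = n → KK (rng a) (sh x (rng b)) =
      ∑ p ∈ Qb d M, ∑ q ∈ Qb d M, ee (rng a) p * ee (rng b) q * G (p - q - x) := by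
    intro a b ha hb
    rw [KK_eq, Finset.sum_subset (rng_sub_Qb (by omega : a.length ≤ M))
      (fun p _ hp => Finset.sum_eq_zero fun q _ => by rw [ee_off hp]; ring)]
    refine Finset.sum_congr rfl fun p _ => ?_
    rw [sum_sh, Finset.sum_subset (rng_sub_Qb (by omega : b.length ≤ M))
      (fun q _ hq => by rw [ee_sh, add_sub_cancel_left, ee_off hq]; ring)]
    refine Finset.sum_congr rfl fun q _ => ?_
    rw [ee_sh, add_sub_cancel_left]
    congr 2; abel
  rw [Ex_congr fun a ha => Ex_congr fun b hb => h a b ha hb]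
  simp only [Ex_sum, Ex_mul_right, Ex_mul_left]
  rfl

lemma psd (M : ℕ) (lam : ℝ) (x : Zd d) : ∑ m ∈ Finset.range (M + 1), ∑ n ∈ Finset.range (M + 1),
    lam ^ m * lam ^ n * (kap m n x - kap m n (0 : Zd d)) ≤ 0 := by
  have key : ∀ y : Zd d, ∑ m ∈ Finset.range (M + 1), ∑ n ∈ Finset.range (M + 1), lam ^ m * lam ^ n * kap m n y =
      ∑ a ∈ Qb d M, ∑ b ∈ Qb d M, (∑ m ∈ Finset.range (M + 1), lam ^ m * eb m a) *
        (∑ n ∈ Finset.range (M + 1), lam ^ n * eb n b) * G (a - b - y) := by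
    intro y
    have : ∀ m ∈ Finset.range (M + 1), ∀ n ∈ Finset.range (M + 1), lam ^ m * lam ^ n * kap m n y =
        ∑ a ∈ Qb d M, ∑ b ∈ Qb d M, (lam ^ m * eb m a) * (lam ^ n * eb n b) * G (a - b - y) := by
      intro m hm n hn
      simp only [Finset.mem_range] at hm hn
      rw [kap_quad (by omega : m ≤ M) (by omega : n ≤ M), Finset.mul_sum]
      refine Finset.sum_congr rfl fun a _ => ?_
      rw [Finset.mul_sum]
      exact Finset.sum_congr rfl fun b _ => by ring
    rw [Finset.sum_congr rfl fun m hm => Finset.sum_congr rfl fun n hn => this m hm n hn]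
    simp only [Finset.sum_mul_sum, Finset.sum_mul]
    rw [Finset.sum_congr rfl fun m _ => Finset.sum_comm, Finset.sum_comm]
    refine Finset.sum_congr rfl fun a _ => ?_
    rw [Finset.sum_congr rfl fun m _ => Finset.sum_comm, Finset.sum_comm]
    refine Finset.sum_congr rfl fun b _ => Finset.sum_congr rfl fun m _ => ?_
    rw [Finset.mul_sum, Finset.sum_mul]
  simp only [mul_sub, Finset.sum_sub_distrib]
  rw [key, key, sub_nonpos]
  have := G_quad_shift (Qb d M) (fun a => ∑ m ∈ Finset.range (M + 1), lam ^ m * eb m a) x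
  simpa using this
end ten


section eleven
lemma range_ite {m K : ℕ} (h : m ≤ K) (f : ℕ → ℝ) :
    ∑ q ∈ Finset.range m, f q = ∑ q ∈ Finset.range K, if q < m then f q else 0 := by
  rw [← Finset.sum_filter]
  refine Finset.sum_congr ?_ fun _ _ => rfl
  ext q; simp; omega

lemma tri1 (f : ℕ → ℕ → ℝ) (M : ℕ) : ∑ T ∈ Finset.range (M + 1), ∑ n ∈ Finset.range (T + 1), f (T - n) n =
    ∑ n ∈ Finset.range (M + 1), ∑ m ∈ Finset.range (M + 1 - n), f m n := by
  rw [Finset.sum_comm' (s' := fun n => Finset.Ico n (M + 1)) (t' := Finset.range (M + 1))]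
  · refine Finset.sum_congr rfl fun n _ => ?_
    rw [Finset.sum_Ico_eq_sum_range]
    exact Finset.sum_congr rfl fun m _ => by rw [Nat.add_sub_cancel_left]
  · intro x y; simp; omega

lemma tri2 (g : ℕ → ℕ → ℝ) (K : ℕ) : ∑ n ∈ Finset.range K, ∑ r ∈ Finset.range n, g n r =
    ∑ r ∈ Finset.range K, ∑ q ∈ Finset.range (K - (r + 1)), g (r + 1 + q) r := by
  rw [Finset.sum_comm' (s' := fun r => Finset.Ico (r + 1) K) (t' := Finset.range K)]
  · refine Finset.sum_congr rfl fun n _ => ?_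
    rw [Finset.sum_Ico_eq_sum_range]
  · intro x y; simp; omega

lemma tri3 (h : ℕ → ℕ → ℕ → ℝ) (M : ℕ) :
    ∑ T ∈ Finset.range (M + 1), ∑ n ∈ Finset.range (T + 1), ∑ r ∈ Finset.range n, h (T - n) r (n - (r + 1)) =
    ∑ r ∈ Finset.range (M + 1), ∑ q ∈ Finset.range (M + 1), ∑ m ∈ Finset.range (M + 1),
      if m + q + (r + 1) ≤ M then h m r q else 0 := by
  rw [tri1 (fun m n => ∑ r ∈ Finset.range n, h m r (n - (r + 1)))]
  rw [Finset.sum_congr rfl fun n _ => Finset.sum_comm]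
  rw [tri2 (fun n r => ∑ m ∈ Finset.range (M + 1 - n), h m r (n - (r + 1)))]
  refine Finset.sum_congr rfl fun r _ => ?_
  rw [range_ite (by omega : M + 1 - (r + 1) ≤ M + 1)]
  refine Finset.sum_congr rfl fun q _ => ?_
  split_ifs with hq
  · rw [range_ite (by omega : M + 1 - (r + 1 + q) ≤ M + 1)]
    refine Finset.sum_congr rfl fun m _ => ?_
    rw [Nat.add_sub_cancel_left]
    congr 1
    simp only [eq_iff_iff]; omega
  · refine (Finset.sum_eq_zero fun m _ => if_neg ?_).symm
    omega

lemma geo1 {lam : ℝ} (h0 : 0 ≤ lam) (h1 : lam < 1) (K : ℕ) :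
    ∑ T ∈ Finset.range K, lam ^ T * ((T : ℝ) + 1) ≤ 1 / (1 - lam) ^ 2 := by
  have := hasSum_choose_mul_geometric_of_norm_lt_one 1 (r := lam) (by rwa [Real.norm_of_nonneg h0])
  refine le_trans (le_of_eq ?_) (sum_le_hasSum (Finset.range K) (fun i _ => by positivity) this)
  refine Finset.sum_congr rfl fun T _ => ?_
  simp [mul_comm]

lemma geo2 {lam : ℝ} (h0 : 0 ≤ lam) (h1 : lam < 1) (K : ℕ) :
    ∑ T ∈ Finset.range K, lam ^ T * (((T : ℝ) + 1) * T) ≤ 2 / (1 - lam) ^ 3 := by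
  have := (hasSum_choose_mul_geometric_of_norm_lt_one 2 (r := lam) (by rwa [Real.norm_of_nonneg h0])).mul_left 2
  have h : ∑ T ∈ Finset.range K, 2 * (((T + 2).choose 2 : ℝ) * lam ^ T) ≤ 2 * (1 / (1 - lam) ^ (2 + 1)) :=
    sum_le_hasSum (Finset.range K) (f := fun T : ℕ => 2 * (((T + 2).choose 2 : ℝ) * lam ^ T)) (fun i _ => by positivity) this
  rw [mul_one_div] at h
  refine le_trans (Finset.sum_le_sum fun T _ => ?_) h
  rw [Nat.cast_choose_two]
  have h2 : (0:ℝ) ≤ lam ^ T := by positivity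
  push_cast
  nlinarith [mul_nonneg h2 (Nat.cast_nonneg T : (0:ℝ) ≤ T)]

variable {d : ℕ} [Fact (4 ≤ d)]

lemma kap_le {m n M : ℕ} (hm : m ≤ M) (hn : n ≤ M) : kap m n (0 : Zd d) ≤ ((M : ℝ) + 1) ^ 2 * G (0 : Zd d) := by
  unfold kap
  refine Ex_le_const fun a ha => Ex_le_const fun b hb => ?_
  rw [sh_zero]
  refine (KK_le _ _).trans ?_
  have h0 : 0 ≤ G (0 : Zd d) := Gt_nonneg 0 _
  calc _ ≤ ∑ x ∈ rng a, ∑ y ∈ rng b, G (0 : Zd d) := Finset.sum_le_sum fun x _ => Finset.sum_le_sum fun y _ => G_le _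
    _ = ((rng a).card * (rng b).card : ℝ) * G (0 : Zd d) := by simp; ring
    _ ≤ _ := by
      refine mul_le_mul_of_nonneg_right ?_ h0
      have h1 : ((rng a).card : ℝ) ≤ M + 1 := by exact_mod_cast (rng_card_le a).trans (by omega)
      have h2 : ((rng b).card : ℝ) ≤ M + 1 := by exact_mod_cast (rng_card_le b).trans (by omega)
      rw [sq]; gcongr

lemma trunc (M : ℕ) {lam : ℝ} (h0 : 0 ≤ lam) (h1 : lam ≤ 1) :
    ∑ T ∈ Finset.range (M + 1), ∑ n ∈ Finset.range (T + 1), ∑ r ∈ Finset.range n, lam ^ T *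
      Ex (d := d) (r + 1) (fun u => eta r u * (kap (T - n) (n - (r + 1)) (endp u) - kap (T - n) (n - (r + 1)) (0 : Zd d))) ≤
    lam ^ M * (((M : ℝ) + 1) ^ 4 * G (0 : Zd d)) := by
  set E := lam ^ M * (((M : ℝ) + 1) ^ 4 * G (0 : Zd d)) with hE
  have hG : 0 ≤ G (0 : Zd d) := Gt_nonneg 0 _
  have hE0 : 0 ≤ E := by positivity
  have e1 : ∀ T ∈ Finset.range (M + 1), ∀ n ∈ Finset.range (T + 1), ∀ r ∈ Finset.range n, lam ^ T *
      Ex (d := d) (r + 1) (fun u => eta r u * (kap (T - n) (n - (r + 1)) (endp u) - kap (T - n) (n - (r + 1)) (0 : Zd d))) =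
      (fun m r q => lam ^ (m + q + (r + 1)) * Ex (d := d) (r + 1) (fun u => eta r u * (kap m q (endp u) - kap m q (0 : Zd d))))
        (T - n) r (n - (r + 1)) := by
    intro T hT n hn r hr
    simp only [Finset.mem_range] at hT hn hr
    simp only
    congr 2; omega
  rw [Finset.sum_congr rfl fun T hT => Finset.sum_congr rfl fun n hn => Finset.sum_congr rfl fun r hr => e1 T hT n hn r hr]
  refine (le_of_eq (tri3 (fun m r q => lam ^ (m + q + (r + 1)) * Ex (d := d) (r + 1) (fun u => eta r u * (kap m q (endp u) - kap m q (0 : Zd d)))) M)).trans ?_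
  have e2 : ∀ r ∈ Finset.range (M + 1), ∑ q ∈ Finset.range (M + 1), ∑ m ∈ Finset.range (M + 1),
      (if m + q + (r + 1) ≤ M then lam ^ (m + q + (r + 1)) * Ex (d := d) (r + 1) (fun u => eta r u *
        (kap m q (endp u) - kap m q (0 : Zd d))) else 0) ≤ E * Ex (d := d) (r + 1) (eta r) := by
    intro r _
    have e3 : ∀ q m : ℕ, (if m + q + (r + 1) ≤ M then lam ^ (m + q + (r + 1)) * Ex (d := d) (r + 1) (fun u => eta r u *
        (kap m q (endp u) - kap m q (0 : Zd d))) else 0) = Ex (d := d) (r + 1) fun u => eta r u *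
        (if m + q + (r + 1) ≤ M then lam ^ (m + q + (r + 1)) * (kap m q (endp u) - kap m q (0 : Zd d)) else 0) := by
      intro q m
      split_ifs
      · rw [← Ex_mul_left]; exact Ex_congr fun u _ => by ring
      · simp only [mul_zero]; rw [Ex_const]
    simp only [e3, ← Ex_sum]; rw [← Ex_mul_left]
    refine Ex_mono fun u _ => ?_
    simp only [← Finset.mul_sum]
    rw [mul_comm E]
    refine mul_le_mul_of_nonneg_left ?_ (eta_nonneg _ _)
    have hp := psd (d := d) M lam (endp u)
    rw [Finset.sum_comm] at hp
    calc _ ≤ ∑ q ∈ Finset.range (M + 1), ∑ m ∈ Finset.range (M + 1),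
          (lam ^ (r + 1) * (lam ^ m * lam ^ q * (kap m q (endp u) - kap m q (0 : Zd d))) +
            lam ^ M * (((M : ℝ) + 1) ^ 2 * G (0 : Zd d))) := by
          refine Finset.sum_le_sum fun q hq => Finset.sum_le_sum fun m hm => ?_
          simp only [Finset.mem_range] at hq hm
          split_ifs with h
          · rw [pow_add, pow_add]
            have : 0 ≤ lam ^ M * (((M : ℝ) + 1) ^ 2 * G (0 : Zd d)) := by positivity
            nlinarith
          · have k1 := kap_le (d := d) (by omega : m ≤ M) (by omega : q ≤ M)
            have k2 := kap_nonneg m q (endp u)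
            have k3 : lam ^ (r + 1) * (lam ^ m * lam ^ q) ≤ lam ^ M := by
              rw [← pow_add, ← pow_add]; exact pow_le_pow_of_le_one h0 h1 (by omega)
            have k4 : 0 ≤ lam ^ (r + 1) * (lam ^ m * lam ^ q) := by positivity
            have k5 := kap_nonneg m q (0 : Zd d)
            have k6 : lam ^ (r + 1) * (lam ^ m * lam ^ q) * kap m q (0 : Zd d) ≤ lam ^ M * (((M : ℝ) + 1) ^ 2 * G (0 : Zd d)) :=
              mul_le_mul k3 k1 k5 (by positivity)
            nlinarith [mul_nonneg k4 k2]
      _ = lam ^ (r + 1) * (∑ q ∈ Finset.range (M + 1), ∑ m ∈ Finset.range (M + 1),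
            (lam ^ m * lam ^ q * (kap m q (endp u) - kap m q (0 : Zd d)))) + E := by
          simp only [Finset.sum_add_distrib, ← Finset.mul_sum]
          simp only [Finset.sum_const, Finset.card_range, nsmul_eq_mul, hE]
          push_cast; ring
      _ ≤ E := by
          have := mul_nonpos_of_nonneg_of_nonpos (pow_nonneg h0 (r + 1)) hp
          linarith
  refine (Finset.sum_le_sum e2).trans ?_
  rw [← Finset.mul_sum]
  have := mul_le_mul_of_nonneg_left (eta_total (d := d) (M + 1)) hE0
  linarith

lemma weighted (h5 : 5 ≤ d) : ∃ C : ℝ, 0 < C ∧ ∀ (M : ℕ) (lam : ℝ), 0 ≤ lam → lam ≤ 1 →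
    ∑ T ∈ Finset.range (M + 1), lam ^ T * vT d T ≤
      ∑ T ∈ Finset.range (M + 1), lam ^ T * (((T : ℝ) + 1) * (C * (1 + Real.log (T + 1)))) +
      4 * (lam ^ M * (((M : ℝ) + 1) ^ 4 * G (0 : Zd d))) := by
  obtain ⟨C, hC, H⟩ := wT_bound h5
  refine ⟨1 + 2 * C, by positivity, fun M lam h0 h1 => ?_⟩
  have h2 := trunc (d := d) M h0 h1
  have h3 : ∀ T ∈ Finset.range (M + 1), lam ^ T * vT d T ≤
      lam ^ T * (((T : ℝ) + 1) * ((1 + 2 * C) * (1 + Real.log (T + 1)))) +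
      4 * ∑ n ∈ Finset.range (T + 1), ∑ r ∈ Finset.range n, lam ^ T *
      Ex (d := d) (r + 1) (fun u => eta r u * (kap (T - n) (n - (r + 1)) (endp u) - kap (T - n) (n - (r + 1)) (0 : Zd d))) := by
    intro T _
    have a1 := vT_le (d := d) T
    have a2 : ∑ n ∈ Finset.range (T + 1), wT d (T - n) n ≤ ∑ n ∈ Finset.range (T + 1),
        (C * (1 + Real.log (T + 1)) + 2 * ∑ r ∈ Finset.range n, Ex (d := d) (r + 1) (fun u => eta r u *
          (kap (T - n) (n - (r + 1)) (endp u) - kap (T - n) (n - (r + 1)) (0 : Zd d)))) :=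
      Finset.sum_le_sum fun n hn => H T (T - n) n (by omega) (by have := Finset.mem_range.mp hn; omega)
    rw [Finset.sum_add_distrib, ← Finset.mul_sum, ← Finset.mul_sum _ _ (2:ℝ)] at a2
    set S := ∑ n ∈ Finset.range (T + 1), ∑ r ∈ Finset.range n,
      Ex (d := d) (r + 1) (fun u => eta r u * (kap (T - n) (n - (r + 1)) (endp u) - kap (T - n) (n - (r + 1)) (0 : Zd d))) with hS
    rw [Finset.sum_const, Finset.card_range, nsmul_eq_mul] at a2
    push_cast at a2
    have hl : 0 ≤ Real.log ((T : ℝ) + 1) := Real.log_nonneg (by linarith [(Nat.cast_nonneg T : (0:ℝ) ≤ T)])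
    have hT : (0:ℝ) ≤ T := Nat.cast_nonneg T
    simp only [← Finset.mul_sum]
    rw [← hS]
    have a3 : vT d T ≤ ((T : ℝ) + 1) * ((1 + 2 * C) * (1 + Real.log (T + 1))) + 4 * S := by
      have a5 : vT d T ≤ (T + 1) + 2 * ((T + 1) * (C * (1 + Real.log (T + 1))) + 2 * S) := by linarith
      nlinarith [mul_nonneg hT hl]
    have := mul_le_mul_of_nonneg_left a3 (pow_nonneg h0 T)
    linarith
  refine (Finset.sum_le_sum h3).trans ?_
  rw [Finset.sum_add_distrib, ← Finset.mul_sum]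
  linarith

lemma var_sum (h5 : 5 ≤ d) : ∃ C : ℝ, 0 < C ∧ ∀ N : ℕ, 1 ≤ N →
    ∑ T ∈ Finset.range (N + 1), vT d T ≤ C * (((N : ℝ) + 1) ^ 2 * (1 + Real.log (N + 1))) := by
  obtain ⟨C, hC, H⟩ := weighted h5
  refine ⟨Real.exp 1 * (3 * C + 4), by positivity, fun N hN => ?_⟩
  have hN' : (1 : ℝ) ≤ N := by exact_mod_cast hN
  set lam : ℝ := N / (N + 1) with hlam
  have h0 : 0 ≤ lam := by positivity
  have h1 : lam < 1 := by rw [hlam, div_lt_one (by positivity)]; linarith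
  have hs : 1 - lam = 1 / (N + 1) := by rw [hlam]; field_simp; ring
  have hL : 0 ≤ Real.log ((N : ℝ) + 1) := Real.log_nonneg (by linarith)
  -- truncation
  obtain ⟨M, hMN, hM⟩ : ∃ M, N ≤ M ∧ lam ^ M * (((M : ℝ) + 1) ^ 4 * G (0 : Zd d)) ≤ 1 := by
    have t1 : Tendsto (fun M : ℕ => (M : ℝ) ^ 4 * lam ^ M) atTop (𝓝 0) :=
      tendsto_pow_const_mul_const_pow_of_abs_lt_one 4 (by rwa [abs_of_nonneg h0])
    have t2 := (t1.const_mul (2 ^ 4 * G (0 : Zd d))).eventually (gt_mem_nhds (by simp : (2 ^ 4 * G (0 : Zd d)) * 0 < 1))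
    obtain ⟨M, hM1, hM2⟩ := (t2.and (eventually_ge_atTop N)).exists
    refine ⟨M, hM2, le_trans ?_ hM1.le⟩
    have : (M : ℝ) + 1 ≤ 2 * M := by
      have : (N : ℝ) ≤ M := by exact_mod_cast hM2
      linarith
    have hG : 0 ≤ G (0 : Zd d) := Gt_nonneg 0 _
    calc _ ≤ lam ^ M * ((2 * (M : ℝ)) ^ 4 * G (0 : Zd d)) := by gcongr
      _ = _ := by ring
  have hlow : ∀ T ∈ Finset.range (N + 1), Real.exp (-1) * vT d T ≤ lam ^ T * vT d T := by
    intro T hT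
    refine mul_le_mul_of_nonneg_right ?_ (vT_nonneg T)
    have hT' := Finset.mem_range.mp hT
    refine le_trans ?_ (pow_le_pow_of_le_one h0 h1.le (by omega : T ≤ N))
    have : Real.exp (-(1 / N)) ≤ lam := by
      rw [Real.exp_neg, hlam, inv_eq_one_div, div_le_div_iff₀ (Real.exp_pos _) (by positivity)]
      have := Real.add_one_le_exp (1 / (N : ℝ))
      have h2 : (N : ℝ) * (1 / N + 1) = N + 1 := by field_simp; ring
      nlinarith
    calc Real.exp (-1) = Real.exp (-(1 / N)) ^ N := by
          rw [← Real.exp_nat_mul]; congr 1; field_simp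
      _ ≤ _ := pow_le_pow_left₀ (Real.exp_pos _).le this N
  have hup := H M lam h0 h1.le
  have hlog : ∀ T : ℕ, Real.log ((T : ℝ) + 1) ≤ Real.log (N + 1) + T / (N + 1) := by
    intro T
    have : Real.log (((T : ℝ) + 1) / (N + 1)) ≤ ((T : ℝ) + 1) / (N + 1) - 1 := Real.log_le_sub_one_of_pos (by positivity)
    rw [Real.log_div (by positivity) (by positivity)] at this
    have h2 : ((T : ℝ) + 1) / (N + 1) - 1 ≤ T / (N + 1) := by
      rw [add_div]
      have : 1 / ((N : ℝ) + 1) ≤ 1 := by rw [div_le_one (by positivity)]; linarith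
      linarith
    linarith
  have g1 := geo1 h0 h1 (M + 1)
  have g2 := geo2 h0 h1 (M + 1)
  rw [hs] at g1 g2
  have g1' : ∑ T ∈ Finset.range (M + 1), lam ^ T * ((T : ℝ) + 1) ≤ ((N : ℝ) + 1) ^ 2 := by
    refine g1.trans (le_of_eq ?_); field_simp
  have g2' : ∑ T ∈ Finset.range (M + 1), lam ^ T * (((T : ℝ) + 1) * T) ≤ 2 * ((N : ℝ) + 1) ^ 3 := by
    refine g2.trans (le_of_eq ?_); field_simp
  have hb : ∑ T ∈ Finset.range (M + 1), lam ^ T * (((T : ℝ) + 1) * (C * (1 + Real.log (T + 1)))) ≤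
      C * (1 + Real.log (N + 1)) * ((N : ℝ) + 1) ^ 2 + C / (N + 1) * (2 * ((N : ℝ) + 1) ^ 3) := by
    calc _ ≤ ∑ T ∈ Finset.range (M + 1), (C * (1 + Real.log (N + 1)) * (lam ^ T * ((T : ℝ) + 1)) +
          C / (N + 1) * (lam ^ T * (((T : ℝ) + 1) * T))) := by
          refine Finset.sum_le_sum fun T _ => ?_
          calc _ ≤ lam ^ T * (((T : ℝ) + 1) * (C * (1 + (Real.log (N + 1) + T / (N + 1))))) := by
                have := hlog T
                gcongr
            _ = _ := by field_simp; ring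
      _ ≤ _ := by
          rw [Finset.sum_add_distrib, ← Finset.mul_sum, ← Finset.mul_sum]
          gcongr
  have hsub : ∑ T ∈ Finset.range (N + 1), lam ^ T * vT d T ≤ ∑ T ∈ Finset.range (M + 1), lam ^ T * vT d T :=
    Finset.sum_le_sum_of_subset_of_nonneg (Finset.range_mono (by omega)) fun T _ _ =>
      mul_nonneg (pow_nonneg h0 T) (vT_nonneg T)
  have hfin : Real.exp (-1) * ∑ T ∈ Finset.range (N + 1), vT d T ≤ (3 * C + 4) * (((N : ℝ) + 1) ^ 2 * (1 + Real.log (N + 1))) := by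
    rw [Finset.mul_sum]
    refine (Finset.sum_le_sum hlow).trans ?_
    have e : C / ((N : ℝ) + 1) * (2 * ((N : ℝ) + 1) ^ 3) = 2 * C * ((N : ℝ) + 1) ^ 2 := by field_simp
    rw [e] at hb
    have q1 : (1 : ℝ) ≤ ((N : ℝ) + 1) ^ 2 := by nlinarith
    have q2 := mul_nonneg (mul_nonneg hC.le hL) (sq_nonneg ((N : ℝ) + 1))
    have q3 := mul_nonneg hL (sq_nonneg ((N : ℝ) + 1))
    nlinarith
  have : Real.exp 1 * Real.exp (-1) = 1 := by rw [← Real.exp_add]; simp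
  calc _ = Real.exp 1 * (Real.exp (-1) * ∑ T ∈ Finset.range (N + 1), vT d T) := by rw [← mul_assoc, this, one_mul]
    _ ≤ Real.exp 1 * ((3 * C + 4) * (((N : ℝ) + 1) ^ 2 * (1 + Real.log (N + 1)))) := by gcongr
    _ = _ := by ring

lemma var_five (h5 : 5 ≤ d) : ∃ C : ℝ, 0 < C ∧ ∀ N : ℕ, 1 ≤ N →
    vT d N ≤ C * (((N : ℝ) + 1) * (1 + Real.log (N + 1))) := by
  obtain ⟨C, hC, H⟩ := var_sum h5
  obtain ⟨D, hD, HD⟩ := ch2_five h5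
  refine ⟨3 * C + 3 * D, by positivity, fun N hN => ?_⟩
  have h := H N hN
  have hL : 0 ≤ Real.log ((N : ℝ) + 1) := Real.log_nonneg (by linarith [(Nat.cast_nonneg N : (0:ℝ) ≤ N)])
  have hrev : ∑ T ∈ Finset.range (N + 1), vT d (N - T) = ∑ T ∈ Finset.range (N + 1), vT d T := by
    have := Finset.sum_range_reflect (fun T => vT d T) (N + 1)
    simpa using this
  obtain ⟨t, ht, htl⟩ : ∃ t ∈ Finset.range (N + 1), vT d t + vT d (N - t) ≤ 2 * C * (((N : ℝ) + 1) * (1 + Real.log (N + 1))) := by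
    refine Finset.exists_le_of_sum_le (by simp) ?_
    rw [Finset.sum_add_distrib, hrev]
    simp only [Finset.sum_const, Finset.card_range, nsmul_eq_mul]
    push_cast
    nlinarith
  have ht' : t ≤ N := by have := Finset.mem_range.mp ht; omega
  have hsp := vT_split (d := d) t (N - t)
  rw [Nat.add_sub_cancel' ht'] at hsp
  have hc := HD t (N - t) N ht' (by omega)
  have q : (0 : ℝ) ≤ ((N : ℝ) + 1) * Real.log (N + 1) := by positivity
  have := mul_nonneg hD.le q
  nlinarith
end eleven


/-! ### Kernel facts in dimension four -/
instance fact44 : Fact (4 ≤ 4) := ⟨le_rfl⟩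

lemma FI4 : ∃ C : ℝ, 0 < C ∧ ∀ n : ℕ, FI (d := 4) (fun θ => |ph θ| ^ n) ≤ C / ((n : ℝ) + 1) ^ 2 := by
  obtain ⟨C, hC, H⟩ := FI_pow_le 4
  refine ⟨C, hC, fun n => (H n).trans (le_of_eq ?_)⟩
  have : (-(((4 : ℕ) : ℝ) / 2) : ℝ) = -((2 : ℕ) : ℝ) := by norm_num
  rw [this, Real.rpow_neg (by positivity), Real.rpow_natCast]
  rfl

lemma pow_one_sub_le {y : ℝ} (h0 : 0 ≤ y) (h1 : y ≤ 1) (m : ℕ) : y ^ m * (1 - y) ≤ 1 / ((m : ℝ) + 1) := by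
  rw [le_div_iff₀ (by positivity)]
  have h := geom_sum_mul_neg y (m + 1)
  have h2 : ((m : ℝ) + 1) * y ^ m ≤ ∑ i ∈ Finset.range (m + 1), y ^ i := by
    have : ∑ i ∈ Finset.range (m + 1), y ^ m ≤ ∑ i ∈ Finset.range (m + 1), y ^ i :=
      Finset.sum_le_sum fun i hi => pow_le_pow_of_le_one h0 h1 (by have := Finset.mem_range.mp hi; omega)
    simpa using this
  have h3 := mul_le_mul_of_nonneg_right h2 (by linarith : 0 ≤ 1 - y)
  have h4 : 0 ≤ y ^ (m + 1) := by positivity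
  nlinarith

/-- `y^j (1-y) ≤ C y^{j/2}/(j+1)` -/
lemma pow_one_sub_le' {y : ℝ} (h0 : 0 ≤ y) (h1 : y ≤ 1) (j : ℕ) :
    y ^ j * (1 - y) ≤ y ^ (j / 2) * (2 / ((j : ℝ) + 1)) := by
  have e : y ^ j * (1 - y) = y ^ (j / 2) * (y ^ (j - j / 2) * (1 - y)) := by
    rw [← mul_assoc, ← pow_add]; congr 2; omega
  rw [e]
  refine mul_le_mul_of_nonneg_left ((pow_one_sub_le h0 h1 _).trans ?_) (by positivity)
  rw [div_le_div_iff₀ (by positivity) (by positivity)]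
  have : ((j : ℝ)) ≤ 2 * ((j - j / 2 : ℕ) : ℝ) := by
    have : j ≤ 2 * (j - j / 2) := by omega
    exact_mod_cast this
  linarith

lemma ph_cont4 : Continuous (ph (d := 4)) := by unfold ph; fun_prop

lemma cos_grad (a b lam : ℝ) (hl : 0 < lam) : |Real.cos (a + b) - Real.cos a| ≤ 1 / lam + lam * (1 - Real.cos b) := by
  rw [Real.cos_sub_cos]
  have h1 : (a + b - a) / 2 = b / 2 := by ring
  have hc : 1 - Real.cos b = 2 * Real.sin (b / 2) ^ 2 := by
    
    have h2 := Real.cos_two_mul (b / 2)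
    rw [mul_div_cancel₀ b two_ne_zero] at h2
    have h3 := Real.sin_sq_add_cos_sq (b / 2); linarith
  rw [h1, hc, abs_mul, abs_mul, abs_neg, abs_two]
  have h2 := Real.abs_sin_le_one ((a + b + a) / 2)
  have h4 := abs_nonneg (Real.sin (b / 2))
  rw [← sq_abs]
  set s := |Real.sin (b / 2)|
  have h5 : 2 * s ≤ 1 / lam + lam * s ^ 2 := by
    have : 1 / lam + lam * s ^ 2 - 2 * s = (1 - lam * s) ^ 2 / lam := by field_simp; ring
    have h6 : 0 ≤ (1 - lam * s) ^ 2 / lam := by positivity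
    linarith
  have h7 : 0 ≤ lam * s ^ 2 := by positivity
  nlinarith

lemma one_sub_cos_le (θ : Fin 4 → ℝ) (i : Fin 4) : 1 - Real.cos (θ i) ≤ 4 * (1 - ph θ) := by
  have : 4 * (1 - ph θ) = ∑ i, (1 - Real.cos (θ i)) := by
    rw [Finset.sum_sub_distrib]; unfold ph; simp; ring
  rw [this]
  exact Finset.single_le_sum (f := fun i => 1 - Real.cos (θ i)) (fun i _ => by linarith [Real.cos_le_one (θ i)]) (Finset.mem_univ i)

lemma FI_even_pow (k : ℕ) : FI (d := 4) (fun θ => (ph θ ^ 2) ^ k) = FI (d := 4) (fun θ => |ph θ| ^ (2 * k)) := by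
  congr 1; funext θ; rw [pow_mul, sq_abs]

lemma dt_cont4 (x : Zd 4) : Continuous (fun θ : Fin 4 → ℝ => dt θ x) := by unfold dt; fun_prop

lemma rk_grad : ∃ C : ℝ, 0 < C ∧ ∀ (j : ℕ) (x : Zd 4) (e : Stp 4),
    |(pk (2 * j) (x - vec e) + pk (2 * j + 1) (x - vec e)) - (pk (2 * j) x + pk (2 * j + 1) x)| ≤
      C * ((j : ℝ) + 1) ^ (-(5 / 2) : ℝ) := by
  obtain ⟨C, hC, H⟩ := FI4
  refine ⟨2 * C + 16 * 2 * C, by positivity, fun j x e => ?_⟩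
  set lam : ℝ := √((j : ℝ) + 1) with hlam
  have hl : 0 < lam := Real.sqrt_pos.mpr (by positivity)
  have hl2 : lam ^ 2 = (j : ℝ) + 1 := Real.sq_sqrt (by positivity)
  have c1 := ph_cont4
  have c2 := dt_cont4 x
  have c3 := dt_cont4 (x - vec e)
  have key : ∀ θ : Fin 4 → ℝ, |Real.cos (dt θ (x - vec e)) - Real.cos (dt θ x)| ≤ 1 / lam + lam * (4 * (1 - ph θ)) := by
    intro θ
    rw [dt_sub_vec, sub_eq_add_neg]
    refine (cos_grad _ _ lam hl).trans ?_
    have := one_sub_cos_le θ e.1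
    split_ifs <;> simp only [Real.cos_neg, neg_neg] <;> gcongr
  have hph : ∀ θ : Fin 4 → ℝ, -1 ≤ ph θ ∧ ph θ ≤ 1 := fun θ => abs_le.mp (abs_ph_le θ)
  have pt : ∀ θ : Fin 4 → ℝ, |(ph θ ^ (2 * j) + ph θ ^ (2 * j + 1)) * (Real.cos (dt θ (x - vec e)) - Real.cos (dt θ x))| ≤
      2 / lam * (ph θ ^ 2) ^ j + 4 * lam * (2 / ((j : ℝ) + 1)) * (ph θ ^ 2) ^ (j / 2) := by
    intro θ
    obtain ⟨h1, h2⟩ := hph θ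
    have e1 : ph θ ^ (2 * j) + ph θ ^ (2 * j + 1) = (ph θ ^ 2) ^ j * (1 + ph θ) := by rw [pow_succ, pow_mul]; ring
    have e2 : 0 ≤ (ph θ ^ 2) ^ j := by positivity
    rw [e1, abs_mul, abs_of_nonneg (mul_nonneg e2 (by linarith))]
    have y1 : ph θ ^ 2 ≤ 1 := by nlinarith
    have e3 := pow_one_sub_le' (sq_nonneg (ph θ)) y1 j
    calc _ ≤ (ph θ ^ 2) ^ j * (1 + ph θ) * (1 / lam + lam * (4 * (1 - ph θ))) :=
          mul_le_mul_of_nonneg_left (key θ) (mul_nonneg e2 (by linarith))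
      _ = (ph θ ^ 2) ^ j * (1 + ph θ) * (1 / lam) + 4 * lam * ((ph θ ^ 2) ^ j * (1 - ph θ ^ 2)) := by ring
      _ ≤ (ph θ ^ 2) ^ j * 2 * (1 / lam) + 4 * lam * ((ph θ ^ 2) ^ (j / 2) * (2 / ((j : ℝ) + 1))) := by
          gcongr; linarith
      _ = _ := by ring
  have eq : (pk (2 * j) (x - vec e) + pk (2 * j + 1) (x - vec e)) - (pk (2 * j) x + pk (2 * j + 1) x) =
      FI fun θ => (ph θ ^ (2 * j) + ph θ ^ (2 * j + 1)) * (Real.cos (dt θ (x - vec e)) - Real.cos (dt θ x)) := by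
    simp only [pk_fourier]
    rw [← FI_add (by fun_prop) (by fun_prop), ← FI_add (by fun_prop) (by fun_prop), ← FI_sub (by fun_prop) (by fun_prop)]
    congr 1; funext θ; ring
  have bd : |(pk (2 * j) (x - vec e) + pk (2 * j + 1) (x - vec e)) - (pk (2 * j) x + pk (2 * j + 1) x)| ≤
      FI (d := 4) fun θ => 2 / lam * (ph θ ^ 2) ^ j + 4 * lam * (2 / ((j : ℝ) + 1)) * (ph θ ^ 2) ^ (j / 2) := by
    rw [eq, abs_le]
    constructor
    · rw [neg_le_iff_add_nonneg, ← FI_add (by fun_prop) (by fun_prop)]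
      exact FI_nonneg fun θ => by have := (abs_le.mp (pt θ)).1; linarith
    · exact FI_mono (by fun_prop) (by fun_prop) fun θ => (abs_le.mp (pt θ)).2
  refine bd.trans ?_
  rw [FI_add (by fun_prop) (by fun_prop), FI_mul_left, FI_mul_left, FI_even_pow, FI_even_pow]
  have b1 := H (2 * j)
  have b2 := H (2 * (j / 2))
  have rp : ((j : ℝ) + 1) ^ (-(5 / 2) : ℝ) = 1 / (lam * ((j : ℝ) + 1) ^ 2) := by
    rw [hlam, Real.sqrt_eq_rpow, show ((j : ℝ) + 1) ^ 2 = ((j : ℝ) + 1) ^ (2 : ℝ) by norm_cast, ← Real.rpow_add (by positivity),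
      Real.rpow_neg (by positivity), one_div]
    norm_num
  have b1' : FI (d := 4) (fun θ => |ph θ| ^ (2 * j)) ≤ C / ((j : ℝ) + 1) ^ 2 := by
    refine b1.trans ?_
    gcongr; linarith [(Nat.cast_nonneg j : (0:ℝ) ≤ j)]
  have b2' : FI (d := 4) (fun θ => |ph θ| ^ (2 * (j / 2))) ≤ 4 * C / ((j : ℝ) + 1) ^ 2 := by
    refine b2.trans ?_
    rw [div_le_div_iff₀ (by positivity) (by positivity)]
    have : (j : ℝ) + 1 ≤ 2 * (((2 * (j / 2) : ℕ) : ℝ) + 1) := by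
      have : j + 1 ≤ 2 * (2 * (j / 2) + 1) := by omega
      exact_mod_cast this
    have h2 : ((j : ℝ) + 1) ^ 2 ≤ (2 * (((2 * (j / 2) : ℕ) : ℝ) + 1)) ^ 2 := by gcongr
    nlinarith
  calc _ ≤ 2 / lam * (C / ((j : ℝ) + 1) ^ 2) + 4 * lam * (2 / ((j : ℝ) + 1)) * (4 * C / ((j : ℝ) + 1) ^ 2) := by gcongr
    _ = _ := by
      rw [rp, ← hl2]; field_simp; ring

lemma Gt_grad_even : ∃ C : ℝ, 0 < C ∧ ∀ (k : ℕ) (x : Zd 4) (e : Stp 4),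
    |Gt (2 * k) (x - vec e) - Gt (2 * k) x| ≤ C * ((k : ℝ) + 1) ^ (-(3 / 2) : ℝ) := by
  obtain ⟨C, hC, H⟩ := rk_grad
  obtain ⟨C', hC', H'⟩ := tail_sum_le (5 / 2) (by norm_num)
  refine ⟨C * C', by positivity, fun k x e => ?_⟩
  have t : ∀ y : Zd 4, Tendsto (fun n => Gt (2 * k) y - Gt (2 * k + 2 * n) y) atTop (𝓝 (Gt (2 * k) y)) := by
    intro y
    have : Tendsto (fun n : ℕ => 2 * k + 2 * n) atTop atTop := tendsto_atTop_mono (fun n => by simp only [id]; omega) tendsto_id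
    simpa using ((Gt_tendsto y).comp this).const_sub (Gt (2 * k) y)
  have t2 := ((t (x - vec e)).sub (t x)).abs
  refine le_of_tendsto' t2 fun n => ?_
  have s : ∀ y : Zd 4, Gt (2 * k) y - Gt (2 * k + 2 * n) y = ∑ j ∈ Finset.range n, (pk (2 * (k + j)) y + pk (2 * (k + j) + 1) y) := by
    intro y
    induction n with
    | zero => simp
    | succ n ih =>
      rw [Finset.sum_range_succ, ← ih]
      have h1 := Gt_succ (2 * k + 2 * n) y
      have h2 := Gt_succ (2 * k + 2 * n + 1) y
      rw [show 2 * k + 2 * (n + 1) = 2 * k + 2 * n + 1 + 1 by ring, show 2 * (k + n) = 2 * k + 2 * n by ring]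
      linarith
  rw [s, s, ← Finset.sum_sub_distrib]
  refine (Finset.abs_sum_le_sum_abs _ _).trans ((Finset.sum_le_sum fun j _ => H (k + j) x e).trans ?_)
  rw [← Finset.mul_sum, mul_assoc]
  have := H' n k
  rw [show (1 - 5 / 2 : ℝ) = -(3 / 2) by norm_num] at this
  gcongr

lemma Gt_grad1 : ∃ C : ℝ, 0 < C ∧ ∀ (w : ℕ) (x : Zd 4) (e : Stp 4),
    |Gt w (x - vec e) - Gt w x| ≤ C * ((w : ℝ) + 1) ^ (-(3 / 2) : ℝ) := by
  obtain ⟨C, hC, H⟩ := Gt_grad_even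
  have cv : ∀ w k : ℕ, w ≤ 2 * k + 1 → C * ((k : ℝ) + 1) ^ (-(3 / 2) : ℝ) ≤ C * 2 ^ (3 / 2 : ℝ) * ((w : ℝ) + 1) ^ (-(3 / 2) : ℝ) := by
    intro w k h
    rw [mul_assoc]
    refine mul_le_mul_of_nonneg_left ?_ hC.le
    have h2 : ((w : ℝ) + 1) / 2 ≤ (k : ℝ) + 1 := by
      have : ((w : ℝ)) ≤ 2 * k + 1 := by exact_mod_cast h
      linarith
    refine (Real.rpow_le_rpow_of_nonpos (by positivity) h2 (by norm_num)).trans (le_of_eq ?_)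
    rw [Real.div_rpow (by positivity) (by norm_num), Real.rpow_neg (by norm_num : (0:ℝ) ≤ 2), div_inv_eq_mul, mul_comm]
  refine ⟨C * 2 ^ (3 / 2 : ℝ), by positivity, fun w x e => ?_⟩
  obtain ⟨k, hk | hk⟩ := w.even_or_odd'
  · subst hk; exact (H k x e).trans (cv _ _ (by omega))
  · subst hk
    refine le_trans ?_ (cv _ k (le_refl _))
    rw [← Ex_Gt 1 (2 * k), ← Ex_Gt 1 (2 * k), ← Ex_sub]
    refine (abs_Ex_le _ _).trans (Ex_le_const fun l _ => ?_)
    have := H k (x + endp l) e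
    rwa [add_sub_right_comm] at this

/-- Lipschitz bound along a walk. -/
lemma Gt_lip : ∃ C : ℝ, 0 < C ∧ ∀ (w : ℕ) (x : Zd 4) (l : List (Stp 4)),
    |Gt w (x + endp l) - Gt w x| ≤ l.length * (C * ((w : ℝ) + 1) ^ (-(3 / 2) : ℝ)) := by
  obtain ⟨C, hC, H⟩ := Gt_grad1
  refine ⟨C, hC, fun w x l => ?_⟩
  induction l generalizing x with
  | nil => simp
  | cons e l ih =>
    have h1 := ih (x + vec e)
    have h2 := H w (x + vec e) e
    rw [add_sub_cancel_right, abs_sub_comm] at h2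
    rw [endp_cons, ← add_assoc, List.length_cons]
    push_cast
    have := abs_sub_le (Gt w (x + vec e + endp l)) (Gt w (x + vec e)) (Gt w x)
    linarith


lemma one_sub_cos_lim (t : ℝ) : Tendsto (fun n : ℕ => (n : ℝ) * (1 - Real.cos ((√(n : ℝ))⁻¹ * t))) atTop (𝓝 (t ^ 2 / 2)) := by
  have h0 : Tendsto (fun n : ℕ => (√(n : ℝ))⁻¹ * t / 2) atTop (𝓝 0) := by
    have : Tendsto (fun n : ℕ => (√(n : ℝ))⁻¹) atTop (𝓝 0) :=
      tendsto_inv_atTop_zero.comp (Real.tendsto_sqrt_atTop.comp tendsto_natCast_atTop_atTop)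
    simpa using (this.mul_const t).div_const 2
  have h1 : Tendsto (fun n : ℕ => t ^ 2 / 2 * Real.sinc ((√(n : ℝ))⁻¹ * t / 2) ^ 2) atTop (𝓝 (t ^ 2 / 2)) := by
    have := ((Real.continuous_sinc.tendsto 0).comp h0).pow 2 |>.const_mul (t ^ 2 / 2)
    simpa [Real.sinc_zero] using this
  refine h1.congr' ?_
  filter_upwards [eventually_gt_atTop 0] with n hn
  have hn' : (0 : ℝ) < n := by exact_mod_cast hn
  have hs : 0 < √(n : ℝ) := Real.sqrt_pos.mpr hn'
  have hs2 : √(n : ℝ) ^ 2 = n := Real.sq_sqrt hn'.le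
  have hc : 1 - Real.cos ((√(n : ℝ))⁻¹ * t) = 2 * Real.sin ((√(n : ℝ))⁻¹ * t / 2) ^ 2 := by
    have h2 := Real.cos_two_mul ((√(n : ℝ))⁻¹ * t / 2)
    rw [mul_div_cancel₀ _ two_ne_zero] at h2
    have h3 := Real.sin_sq_add_cos_sq ((√(n : ℝ))⁻¹ * t / 2); linarith
  rw [hc]
  by_cases ht : t = 0
  · subst ht; simp
  · rw [Real.sinc_of_ne_zero (by positivity)]
    set s := Real.sin ((√(n : ℝ))⁻¹ * t / 2)
    field_simp
    rw [hs2]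

lemma ph_one_sub (θ : Fin 4 → ℝ) : 1 - ph θ = (∑ i, (1 - Real.cos (θ i))) / 4 := by
  rw [Finset.sum_sub_distrib]; unfold ph; simp; ring

lemma ph_lim (θ : Fin 4 → ℝ) : Tendsto (fun n : ℕ => (n : ℝ) * (1 - ph ((√(n : ℝ))⁻¹ • θ))) atTop (𝓝 ((∑ i, θ i ^ 2 / 2) / 4)) := by
  have := (tendsto_finsetSum Finset.univ fun i _ => one_sub_cos_lim (θ i)).div_const 4
  refine this.congr fun n => ?_
  rw [ph_one_sub, ← Finset.mul_sum]
  simp [mul_div_assoc]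

def gk (n : ℕ) (θ : Fin 4 → ℝ) : ℝ := (max (ph θ) 0 ^ 2) ^ n * (1 + ph θ)

lemma gk_cont (n : ℕ) : Continuous (gk n) := by have := ph_cont4; unfold gk; fun_prop

lemma gk_lim (θ : Fin 4 → ℝ) : Tendsto (fun n : ℕ => (box 4).indicator (gk n) ((√(n : ℝ))⁻¹ • θ)) atTop
    (𝓝 (2 * ∏ i, Real.exp (-(1 / 4) * θ i ^ 2))) := by
  have h0 : Tendsto (fun n : ℕ => (√(n : ℝ))⁻¹) atTop (𝓝 0) :=
      tendsto_inv_atTop_zero.comp (Real.tendsto_sqrt_atTop.comp tendsto_natCast_atTop_atTop)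
  have h1 : Tendsto (fun n : ℕ => (√(n : ℝ))⁻¹ • θ) atTop (𝓝 0) := by simpa using h0.smul_const θ
  have h2 : Tendsto (fun n : ℕ => ph ((√(n : ℝ))⁻¹ • θ)) atTop (𝓝 1) := by
    have := (ph_cont4.tendsto 0).comp h1
    have e : ph (0 : Fin 4 → ℝ) = 1 := by simp [ph]
    rwa [e] at this
  have h3 := Real.tendsto_one_add_pow_exp_of_tendsto (g := fun n : ℕ => ph ((√(n : ℝ))⁻¹ • θ) ^ 2 - 1)
    (t := -((∑ i, θ i ^ 2 / 2) / 4) * (1 + 1)) (by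
      refine ((ph_lim θ).neg.mul (h2.const_add 1)).congr fun n => ?_
      ring)
  have h4 := h3.mul (h2.const_add 1)
  have e : Real.exp (-((∑ i, θ i ^ 2 / 2) / 4) * (1 + 1)) * (1 + 1) = 2 * ∏ i, Real.exp (-(1 / 4) * θ i ^ 2) := by
    rw [← Real.exp_sum, ← Finset.mul_sum, ← Finset.sum_div]
    rw [show -((∑ i, θ i ^ 2) / 2 / 4) * (1 + 1) = -(1 / 4) * ∑ i, θ i ^ 2 by ring]
    ring
  rw [e] at h4
  refine h4.congr' ?_
  have hb : box 4 ∈ 𝓝 (0 : Fin 4 → ℝ) := by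
    refine set_pi_mem_nhds Set.finite_univ fun i _ => Ioc_mem_nhds ?_ ?_
    · simp [Real.pi_pos]
    · simp [Real.pi_pos]
  filter_upwards [h1.eventually hb, h2.eventually (lt_mem_nhds (by norm_num : (0:ℝ) < 1))] with n hn hp
  rw [Set.indicator_of_mem hn, gk, max_eq_left (le_of_lt hp)]
  ring

lemma gk_bound (n : ℕ) (hn : 0 < n) (θ : Fin 4 → ℝ) :
    ‖(box 4).indicator (gk n) ((√(n : ℝ))⁻¹ • θ)‖ ≤ 2 * ∏ i, Real.exp (-(1 / Real.pi ^ 2) * θ i ^ 2) := by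
  by_cases hb : (√(n : ℝ))⁻¹ • θ ∈ box 4
  · rw [Set.indicator_of_mem hb, gk]
    set ψ := (√(n : ℝ))⁻¹ • θ with hψ
    have h1 := abs_le.mp (abs_ph_le ψ)
    have h2 : 0 ≤ (max (ph ψ) 0 ^ 2) ^ n := by positivity
    rw [Real.norm_of_nonneg (mul_nonneg h2 (by linarith)), mul_comm]
    refine mul_le_mul (by linarith) ?_ h2 (by norm_num)
    have hn' : (0 : ℝ) < n := by exact_mod_cast hn
    have hs2 : √(n : ℝ) ^ 2 = n := Real.sq_sqrt hn'.le
    have h3 : 1 - ph ψ ≥ (∑ i, 2 / Real.pi ^ 2 * ψ i ^ 2) / 4 := by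
      rw [ph_one_sub]
      refine div_le_div_of_nonneg_right (Finset.sum_le_sum fun i _ => ?_) (by norm_num)
      have : |ψ i| ≤ Real.pi := by
        have := hb i (Set.mem_univ i)
        exact abs_le.mpr ⟨this.1.le, this.2⟩
      linarith [Real.cos_le_one_sub_mul_cos_sq this]
    have h4 : max (ph ψ) 0 ≤ Real.exp (-((∑ i, 2 / Real.pi ^ 2 * ψ i ^ 2) / 4)) := by
      refine max_le ?_ (Real.exp_pos _).le
      have := Real.add_one_le_exp (-((∑ i, 2 / Real.pi ^ 2 * ψ i ^ 2) / 4))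
      linarith
    calc (max (ph ψ) 0 ^ 2) ^ n ≤ (Real.exp (-((∑ i, 2 / Real.pi ^ 2 * ψ i ^ 2) / 4)) ^ 2) ^ n := by gcongr
      _ = _ := by
        rw [← Real.exp_nat_mul, ← Real.exp_nat_mul, ← Real.exp_sum]
        congr 1
        simp only [← Finset.mul_sum, hψ, Pi.smul_apply, smul_eq_mul, mul_pow, inv_pow, hs2]
        push_cast; field_simp; ring
  · rw [Set.indicator_of_notMem hb]; simp; positivity

lemma gauss_int {c : ℝ} (hc : 0 < c) : Integrable (fun θ : Fin 4 → ℝ => 2 * ∏ i, Real.exp (-c * θ i ^ 2)) :=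
  (Integrable.fintype_prod (f := fun _ (v : ℝ) => Real.exp (-c * v ^ 2)) fun _ => integrable_exp_neg_mul_sq hc).const_mul 2

lemma gk_int_lim : ∃ κ : ℝ, 0 < κ ∧ Tendsto (fun n : ℕ => (n : ℝ) ^ 2 * FI (d := 4) (gk n)) atTop (𝓝 κ) := by
  refine ⟨(∫ θ : Fin 4 → ℝ, 2 * ∏ i, Real.exp (-(1 / 4) * θ i ^ 2)) / (2 * Real.pi) ^ 4, ?_, ?_⟩
  · refine div_pos ?_ (by positivity)
    rw [integral_const_mul, integral_fintype_prod_volume_eq_pow (fun v : ℝ => Real.exp (-(1 / 4) * v ^ 2)), integral_gaussian]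
    positivity
  · have h := tendsto_integral_of_dominated_convergence (μ := (volume : Measure (Fin 4 → ℝ)))
      (F := fun (n : ℕ) θ => (box 4).indicator (gk (n + 1)) ((√((n + 1 : ℕ) : ℝ))⁻¹ • θ))
      (f := fun θ => 2 * ∏ i, Real.exp (-(1 / 4) * θ i ^ 2))
      (fun θ => 2 * ∏ i, Real.exp (-(1 / Real.pi ^ 2) * θ i ^ 2))
      (fun n => ?_) (gauss_int (by positivity)) (fun n => ae_of_all _ fun θ => gk_bound (n + 1) (by omega) θ)
      (ae_of_all _ fun θ => (tendsto_add_atTop_iff_nat 1).mpr (gk_lim θ))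
    · have h2 := (tendsto_add_atTop_iff_nat 1 (f := fun n : ℕ => ∫ θ, (box 4).indicator (gk n) ((√(n : ℝ))⁻¹ • θ))).mp h
      refine (h2.div_const ((2 * Real.pi) ^ 4)).congr' ?_
      filter_upwards [eventually_gt_atTop 0] with n hn
      have hn' : (0 : ℝ) < n := by exact_mod_cast hn
      have hs2 : √(n : ℝ) ^ 2 = n := Real.sq_sqrt hn'.le
      rw [Measure.integral_comp_smul volume ((box 4).indicator (gk n)), integral_indicator box_meas]
      unfold FI
      rw [Module.finrank_fin_fun, inv_pow, inv_inv, show √(n : ℝ) ^ 4 = (√(n : ℝ) ^ 2) ^ 2 by ring, hs2, abs_of_nonneg (by positivity),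
        smul_eq_mul, mul_div_assoc]
    · refine (Measurable.aestronglyMeasurable ?_)
      exact ((gk_cont _).measurable.indicator box_meas).comp (measurable_const_smul _)

lemma rk_lim : ∃ κ : ℝ, 0 < κ ∧ Tendsto (fun n : ℕ => (n : ℝ) ^ 2 * (pk (2 * n) (0 : Zd 4) + pk (2 * n + 1) (0 : Zd 4))) atTop (𝓝 κ) := by
  obtain ⟨κ, hκ, h⟩ := gk_int_lim
  obtain ⟨C, hC, H⟩ := FI4
  refine ⟨κ, hκ, ?_⟩
  have c1 := ph_cont4
  set f : ℕ → (Fin 4 → ℝ) → ℝ := fun n θ => (ph θ ^ 2) ^ n * (1 + ph θ) with hf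
  have cf : ∀ n, Continuous (f n) := fun n => by simp only [hf]; fun_prop
  have e : ∀ n, pk (2 * n) (0 : Zd 4) + pk (2 * n + 1) (0 : Zd 4) = FI (gk n) + FI (fun θ => f n θ - gk n θ) := by
    intro n
    rw [FI_sub (cf n) (gk_cont n), pk_fourier, pk_fourier, ← FI_add]
    · simp only [dt, hf, Pi.zero_apply, Int.cast_zero, mul_zero, Finset.sum_const_zero, Real.cos_zero, mul_one]
      rw [add_sub_cancel]
      congr 1; funext θ; rw [pow_succ, pow_mul]; ring
    · simp only [dt]; fun_prop
    · simp only [dt]; fun_prop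
  simp only [e, mul_add]
  rw [← add_zero κ]
  refine h.add ?_
  have pt : ∀ n θ, 0 ≤ f n θ - gk n θ ∧ f n θ - gk n θ ≤ (2 / ((n : ℝ) + 1)) * (ph θ ^ 2) ^ (n / 2) := by
    intro n θ
    have h1 := abs_le.mp (abs_ph_le θ)
    rcases le_total 0 (ph θ) with hp | hp
    · have : f n θ - gk n θ = 0 := by simp only [hf, gk, max_eq_left hp, sub_self]
      rw [this]; exact ⟨le_rfl, by positivity⟩
    · by_cases hn : n = 0
      · subst hn
        have : f 0 θ - gk 0 θ = 0 := by simp [hf, gk]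
        rw [this]; exact ⟨le_rfl, by positivity⟩
      have : f n θ - gk n θ = (ph θ ^ 2) ^ n * (1 + ph θ) := by simp [hf, gk, max_eq_right hp, hn]
      rw [this]
      have h2 : 0 ≤ (ph θ ^ 2) ^ n := by positivity
      refine ⟨mul_nonneg h2 (by linarith), ?_⟩
      have h3 := pow_one_sub_le' (sq_nonneg (ph θ)) (by nlinarith) n
      have h4 : (ph θ ^ 2) ^ n * (1 + ph θ) ≤ (ph θ ^ 2) ^ n * (1 - ph θ ^ 2) := mul_le_mul_of_nonneg_left (by nlinarith) h2
      linarith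
  have ub : ∀ n : ℕ, (n : ℝ) ^ 2 * FI (fun θ => f n θ - gk n θ) ≤ 8 * C / ((n : ℝ) + 1) := by
    intro n
    have a : FI (fun θ => f n θ - gk n θ) ≤ (2 / ((n : ℝ) + 1)) * FI (d := 4) (fun θ => (ph θ ^ 2) ^ (n / 2)) := by
      rw [← FI_mul_left]
      exact FI_mono ((cf n).sub (gk_cont n)) (by fun_prop) fun θ => (pt n θ).2
    rw [FI_even_pow] at a
    have b := H (2 * (n / 2))
    have b2 : ((n : ℝ)) ≤ 2 * (((2 * (n / 2) : ℕ) : ℝ) + 1) := by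
      have : n ≤ 2 * (2 * (n / 2) + 1) := by omega
      exact_mod_cast this
    set m := ((2 * (n / 2) : ℕ) : ℝ)
    have hm : 0 ≤ m := Nat.cast_nonneg _
    calc _ ≤ (n : ℝ) ^ 2 * ((2 / ((n : ℝ) + 1)) * (C / (m + 1) ^ 2)) := by
          refine mul_le_mul_of_nonneg_left (a.trans ?_) (by positivity)
          gcongr
      _ ≤ (2 * (m + 1)) ^ 2 * ((2 / ((n : ℝ) + 1)) * (C / (m + 1) ^ 2)) := by gcongr
      _ = _ := by field_simp; ring
  refine squeeze_zero (fun n => mul_nonneg (by positivity) (FI_nonneg fun θ => (pt n θ).1)) ub ?_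
  have := tendsto_one_div_add_atTop_nhds_zero_nat (𝕜 := ℝ) |>.const_mul (8 * C)
  simpa [div_eq_mul_inv] using this


lemma anti_lim_nonneg {a : ℕ → ℝ} {N : ℕ} (h : ∀ n ≥ N, a (n + 1) ≤ a n) (h0 : Tendsto a atTop (𝓝 0)) : ∀ n ≥ N, 0 ≤ a n := by
  intro n hn
  refine le_of_tendsto h0 ?_
  filter_upwards [eventually_ge_atTop n] with m hm
  induction m, hm using Nat.le_induction with
  | base => exact le_rfl
  | succ m hm ih => exact (h m (by omega)).trans ih

lemma stolz {f : ℕ → ℝ} {r : ℕ → ℝ} {κ : ℝ} (hf : ∀ n, f n - f (n + 1) = r n) (f0 : Tendsto f atTop (𝓝 0))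
    (hr : Tendsto (fun n : ℕ => (n : ℝ) ^ 2 * r n) atTop (𝓝 κ)) : Tendsto (fun n : ℕ => (n : ℝ) * f n) atTop (𝓝 κ) := by
  have g0 : Tendsto (fun n : ℕ => 1 / (n : ℝ)) atTop (𝓝 0) := tendsto_one_div_atTop_nhds_zero_nat
  have hr' : Tendsto (fun n : ℕ => (n : ℝ) * (n + 1) * r n) atTop (𝓝 κ) := by
    have h1 : Tendsto (fun n : ℕ => (n : ℝ) ^ 2 * r n * (1 + 1 / (n : ℝ))) atTop (𝓝 κ) := by
      have := hr.mul (g0.const_add 1); simpa using this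
    refine h1.congr' ?_
    filter_upwards [eventually_gt_atTop 0] with n hn
    have hn' : (n : ℝ) ≠ 0 := by positivity
    field_simp
  have gd : ∀ n : ℕ, 0 < n → 1 / (n : ℝ) - 1 / ((n + 1 : ℕ) : ℝ) = 1 / ((n : ℝ) * (n + 1)) := by
    intro n hn
    have hn' : (0 : ℝ) < n := by exact_mod_cast hn
    push_cast; field_simp; ring
  rw [Metric.tendsto_atTop]
  intro ε hε
  have hr2 := Metric.tendsto_atTop.mp hr' (ε / 2) (by positivity)
  obtain ⟨N, hN⟩ := hr2
  refine ⟨N + 1, fun n hn => ?_⟩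
  have key : ∀ n ≥ N + 1, (κ - ε / 2) * (1 / ((n : ℝ) * (n + 1))) ≤ r n ∧ r n ≤ (κ + ε / 2) * (1 / ((n : ℝ) * (n + 1))) := by
    intro n hn
    have hn' : (0 : ℝ) < n := by exact_mod_cast (by omega : 0 < n)
    have := hN n (by omega)
    rw [Real.dist_eq, abs_lt] at this
    rw [mul_one_div, mul_one_div, div_le_iff₀ (by positivity), le_div_iff₀ (by positivity)]
    constructor <;> linarith [this.1, this.2]
  have low := anti_lim_nonneg (a := fun n => f n - (κ - ε / 2) * (1 / (n : ℝ))) (N := N + 1) (by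
    intro n hn
    have h1 := gd n (by omega)
    have h2 := (key n hn).1
    have h3 := hf n
    rw [← h1] at h2
    linarith) (by simpa using f0.sub (g0.const_mul (κ - ε / 2))) n hn
  have up := anti_lim_nonneg (a := fun n => (κ + ε / 2) * (1 / (n : ℝ)) - f n) (N := N + 1) (by
    intro n hn
    have h1 := gd n (by omega)
    have h2 := (key n hn).2
    have h3 := hf n
    rw [← h1] at h2
    linarith) (by simpa using (g0.const_mul (κ + ε / 2)).sub f0) n hn
  have hn' : (0 : ℝ) < n := by exact_mod_cast (by omega : 0 < n)
  have l2 := mul_le_mul_of_nonneg_left (sub_nonneg.mp low) hn'.le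
  have u2 := mul_le_mul_of_nonneg_left (sub_nonneg.mp up) hn'.le
  have e1 : (n : ℝ) * ((κ - ε / 2) * (1 / n)) = κ - ε / 2 := by field_simp
  have e2 : (n : ℝ) * ((κ + ε / 2) * (1 / n)) = κ + ε / 2 := by field_simp
  rw [Real.dist_eq, abs_lt]
  constructor <;> linarith

lemma Gt4_lim : ∃ κ : ℝ, 0 < κ ∧ Tendsto (fun i : ℕ => (i : ℝ) * Gt i (0 : Zd 4)) atTop (𝓝 κ) := by
  obtain ⟨κ, hκ, h⟩ := rk_lim
  have t2 : Tendsto (fun n : ℕ => 2 * n) atTop atTop := tendsto_atTop_mono (fun n => by simp only [id]; omega) tendsto_id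
  have f0 : Tendsto (fun n : ℕ => Gt (2 * n) (0 : Zd 4)) atTop (𝓝 0) := (Gt_tendsto (0 : Zd 4)).comp t2
  have h1 := stolz (f := fun n => Gt (2 * n) (0 : Zd 4)) (fun n => by
    have a1 := Gt_succ (2 * n) (0 : Zd 4)
    have a2 := Gt_succ (2 * n + 1) (0 : Zd 4)
    rw [show 2 * (n + 1) = 2 * n + 1 + 1 by ring, a1, a2, ← add_assoc, add_sub_cancel_right]) f0 h
  have d1 : Tendsto (fun i : ℕ => i / 2) atTop atTop :=
    tendsto_atTop_atTop.mpr fun b => ⟨2 * b, fun a ha => by omega⟩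
  have d2 : Tendsto (fun i : ℕ => (i + 1) / 2) atTop atTop :=
    tendsto_atTop_atTop.mpr fun b => ⟨2 * b, fun a ha => by omega⟩
  have up := ((h1.comp d1).const_mul 2).add (f0.comp d1)
  have lo := ((h1.comp d2).const_mul 2).sub (f0.comp d2)
  rw [add_zero] at up
  rw [sub_zero] at lo
  refine ⟨2 * κ, by positivity, tendsto_of_tendsto_of_tendsto_of_le_of_le lo up (fun i => ?_) (fun i => ?_)⟩
  · simp only [Function.comp]
    have g := Gt_anti (by omega : i ≤ 2 * ((i + 1) / 2)) (0 : Zd 4)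
    have g0 := Gt_nonneg (2 * ((i + 1) / 2)) (0 : Zd 4)
    have : 2 * (((i + 1) / 2 : ℕ) : ℝ) ≤ i + 1 := by exact_mod_cast (by omega : 2 * ((i + 1) / 2) ≤ i + 1)
    have hi : (0:ℝ) ≤ i := Nat.cast_nonneg i
    nlinarith
  · simp only [Function.comp]
    have g := Gt_anti (by omega : 2 * (i / 2) ≤ i) (0 : Zd 4)
    have g0 := Gt_nonneg (2 * (i / 2)) (0 : Zd 4)
    have : (i : ℝ) ≤ 2 * ((i / 2 : ℕ) : ℝ) + 1 := by exact_mod_cast (by omega : i ≤ 2 * (i / 2) + 1)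
    have hi : (0:ℝ) ≤ i := Nat.cast_nonneg i
    nlinarith

lemma harm_log_lim : Tendsto (fun n : ℕ => (∑ i ∈ Finset.range n, 1 / ((i : ℝ) + 1)) / Real.log n) atTop (𝓝 1) := by
  have h := Real.tendsto_harmonic_sub_log
  have hl : Tendsto (fun n : ℕ => Real.log n) atTop atTop := Real.tendsto_log_atTop.comp tendsto_natCast_atTop_atTop
  have h2 := (h.div_atTop hl).add_const 1
  rw [zero_add] at h2
  refine h2.congr' ?_
  filter_upwards [hl.eventually_gt_atTop 0] with n hn
  have : (∑ i ∈ Finset.range n, 1 / ((i : ℝ) + 1)) = ((harmonic n : ℚ) : ℝ) := by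
    unfold harmonic; push_cast; simp
  rw [← this]
  field_simp
  ring

lemma enT4_lim {κ : ℝ} (hG : Tendsto (fun i : ℕ => (i : ℝ) * Gt i (0 : Zd 4)) atTop (𝓝 κ)) :
    Tendsto (fun T : ℕ => enT 4 T / Real.log T) atTop (𝓝 (2 * κ)) := by
  have hl : Tendsto (fun n : ℕ => Real.log n) atTop atTop := Real.tendsto_log_atTop.comp tendsto_natCast_atTop_atTop
  have o1 : (fun u : ℕ => Gt (u + 1) (0 : Zd 4) - κ * (1 / ((u : ℝ) + 1))) =o[atTop] fun u : ℕ => 1 / ((u : ℝ) + 1) := by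
    rw [Asymptotics.isLittleO_iff_tendsto (fun u hu => by have : (0:ℝ) < 1 / ((u : ℝ) + 1) := by positivity
                                                          linarith)]
    have := ((tendsto_add_atTop_iff_nat 1).mpr hG).sub_const κ
    rw [sub_self] at this
    refine this.congr fun u => ?_
    push_cast; field_simp
  have o2 := o1.sum_range (fun u => by positivity) Real.tendsto_sum_range_one_div_nat_succ_atTop
  have pos : ∀ᶠ n : ℕ in atTop, (0:ℝ) < ∑ i ∈ Finset.range n, 1 / ((i : ℝ) + 1) :=
    Real.tendsto_sum_range_one_div_nat_succ_atTop.eventually_gt_atTop 0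
  have o3 := (o2.tendsto_div_nhds_zero).mul harm_log_lim
  rw [zero_mul] at o3
  have o4 := ((o3.add (harm_log_lim.const_mul κ)).const_mul 2).add ((tendsto_const_nhds (x := G (0 : Zd 4))).div_atTop hl)
  simp only [zero_add, mul_one, add_zero] at o4
  refine o4.congr' ?_
  filter_upwards [pos, hl.eventually_gt_atTop 0] with n hn hln
  rw [Finset.sum_sub_distrib, ← Finset.mul_sum, enT]
  set S := ∑ i ∈ Finset.range n, 1 / ((i : ℝ) + 1)
  field_simp
  ring

/-! ### Variance of truncated Green sums -/
lemma av_sq_le (f : Stp 4 → ℝ) (c γ : ℝ) (h : ∀ e, |f e - c| ≤ γ) : av (fun e => f e ^ 2) ≤ av f ^ 2 + γ ^ 2 := by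
  have h1 : av (fun e => (f e - c) ^ 2) ≤ γ ^ 2 := by
    refine (av_mono (g := fun _ => γ ^ 2) fun e => ?_).trans (le_of_eq (av_const _))
    exact sq_le_sq' (abs_le.mp (h e)).1 (abs_le.mp (h e)).2
  have h2 : av (fun e => (f e - c) ^ 2) = av (fun e => f e ^ 2) - 2 * c * av f + c ^ 2 := by
    rw [← av_mul_left, ← av_sub, ← av_const (d := 4) (c ^ 2), ← av_add]
    congr 1; funext e; ring
  nlinarith [sq_nonneg (av f - c)]

lemma Gt_var : ∃ C : ℝ, 0 < C ∧ ∀ (n b : ℕ) (x : Zd 4), Ex n (fun l => Gt b (x + endp l) ^ 2) ≤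
    Gt (b + n) x ^ 2 + n * (C * ((b : ℝ) + 1) ^ (-(3 / 2) : ℝ)) ^ 2 := by
  obtain ⟨C, hC, H⟩ := Gt_lip
  refine ⟨C, hC, fun n b => ?_⟩
  induction n with
  | zero => intro x; simp [Ex_zero]
  | succ n ih =>
    intro x
    rw [Ex_succ]
    have e1 : ∀ e : Stp 4, Ex n (fun l => Gt b (x + endp (e :: l)) ^ 2) ≤ Gt (b + n) (x + vec e) ^ 2 +
        n * (C * ((b : ℝ) + 1) ^ (-(3 / 2) : ℝ)) ^ 2 := by
      intro e
      have := ih (x + vec e)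
      simpa only [endp_cons, add_assoc] using this
    refine (av_mono e1).trans ?_
    rw [av_add, av_const]
    have e2 := av_sq_le (fun e => Gt (b + n) (x + vec e)) (Gt (b + n) x) (C * ((b : ℝ) + 1) ^ (-(3 / 2) : ℝ)) (fun e => by
      have := H (b + n) x [e]
      simp only [endp_cons, endp_nil, add_zero, List.length_singleton, Nat.cast_one, one_mul] at this
      refine this.trans ?_
      have := rp_anti (s := 3 / 2) (by norm_num) (Nat.le_add_right b n)
      gcongr)
    have e3 : av (fun e => Gt (b + n) (x + vec e)) = Gt (b + (n + 1)) x := by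
      have := Ex_Gt 1 (b + n) x
      rw [Ex_succ] at this
      simpa only [Ex_zero, endp_cons, endp_nil, add_zero, add_assoc] using this
    rw [e3] at e2
    push_cast
    linarith

lemma Gt_cov : ∃ C : ℝ, 0 < C ∧ ∀ (n b : ℕ) (F : Zd 4 → ℝ) (s : ℝ), (∀ x, 0 ≤ F x) → (∀ x, F x ≤ s) →
    Ex n (fun l => F (endp l) * Gt b (endp l)) ≤ Ex n (fun l => F (endp l)) * Gt (b + n) (0 : Zd 4) +
      s * (√n * (C * ((b : ℝ) + 1) ^ (-(3 / 2) : ℝ))) := by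
  obtain ⟨C, hC, H⟩ := Gt_var
  refine ⟨C, hC, fun n b F s h0 hs => ?_⟩
  have hs0 : 0 ≤ s := (h0 0).trans (hs 0)
  set m := Gt (b + n) (0 : Zd 4)
  set γ := C * ((b : ℝ) + 1) ^ (-(3 / 2) : ℝ)
  have hγ : 0 ≤ γ := by positivity
  have hm : Ex (d := 4) n (fun l => Gt b (endp l)) = m := by
    have := Ex_Gt n b (0 : Zd 4); simpa only [zero_add] using this
  have h1 : Ex (d := 4) n (fun l => |Gt b (endp l) - m|) ≤ √n * γ := by
    refine abs_le_of_sq_le_sq' (b := √n * γ) ?_ (by positivity) |>.2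
    refine (Ex_sq_le _ _).trans ?_
    have e : Ex (d := 4) n (fun l => |Gt b (endp l) - m| ^ 2) = Ex (d := 4) n (fun l => Gt b (endp l) ^ 2) - m ^ 2 := by
      have e1 : Ex (d := 4) n (fun l => |Gt b (endp l) - m| ^ 2) = Ex (d := 4) n (fun l => Gt b (endp l) ^ 2 - 2 * m * Gt b (endp l) + m ^ 2) :=
        Ex_congr fun l _ => by rw [sq_abs]; ring
      rw [e1, Ex_add, Ex_sub, Ex_mul_left, hm, Ex_const]; ring
    rw [e]
    have := H n b 0
    simp only [zero_add] at this
    rw [mul_pow, Real.sq_sqrt (Nat.cast_nonneg n)]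
    linarith
  have h2 : Ex n (fun l => F (endp l) * Gt b (endp l)) ≤ Ex n (fun l => F (endp l) * m + s * |Gt b (endp l) - m|) := by
    refine Ex_mono fun l _ => ?_
    have a1 := le_abs_self (Gt b (endp l) - m)
    have a2 := mul_le_mul_of_nonneg_left a1 (h0 (endp l))
    have a3 := mul_le_mul_of_nonneg_right (hs (endp l)) (abs_nonneg (Gt b (endp l) - m))
    linarith
  rw [Ex_add, Ex_mul_right, Ex_mul_left] at h2
  have := mul_le_mul_of_nonneg_left h1 hs0
  linarith


def qg (K w j : ℕ) (x : Zd 4) : ℝ := Gt (w + j / K) x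
def qm (K w j : ℕ) : ℝ := Gt (w + j / K + (j + 1)) (0 : Zd 4)
def Qs (K w M : ℕ) (l : List (Stp 4)) : ℝ := ∑ j ∈ Finset.range M, qg K w j (endp (l.take (j + 1)))
def mq (K w M : ℕ) : ℝ := ∑ j ∈ Finset.range M, qm K w j

lemma Q_mean (K w M : ℕ) : Ex M (Qs K w M) = mq K w M := by
  unfold Qs mq
  rw [Ex_sum]
  refine Finset.sum_congr rfl fun j hj => ?_
  have hj' := Finset.mem_range.mp hj
  rw [Ex_take (by omega : j + 1 ≤ M) (fun l => qg K w j (endp l))]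
  have := Ex_Gt (j + 1) (w + j / K) (0 : Zd 4)
  simpa only [zero_add, qg, qm] using this

lemma Gt4_bound : ∃ C : ℝ, 0 < C ∧ ∀ (w : ℕ) (x : Zd 4), Gt w x ≤ C * ((w : ℝ) + 1) ^ (-1 : ℝ) := by
  obtain ⟨C, hC, H⟩ := Gt_bound 4 2 (by norm_num) (by norm_num)
  refine ⟨C, hC, fun w x => ?_⟩
  have := H w x
  norm_num at this ⊢
  exact this

lemma divK {K : ℕ} (hK : 1 ≤ K) {j a : ℕ} (h : j / K ≤ a) (s : ℝ) (hs : 0 ≤ s) :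
    ((a : ℝ) + 1) ^ (-s) ≤ (K : ℝ) ^ s * ((j : ℝ) + 1) ^ (-s) := by
  have hK' : (0 : ℝ) < K := by exact_mod_cast hK
  have h1 : ((j : ℝ) + 1) / K ≤ (a : ℝ) + 1 := by
    rw [div_le_iff₀ hK']
    have : j + 1 ≤ (a + 1) * K := by
      have h2 := Nat.lt_div_mul_add hK (a := j)
      have h3 := Nat.mul_le_mul_right K h
      nlinarith
    exact_mod_cast this
  refine (Real.rpow_le_rpow_of_nonpos (by positivity) h1 (by linarith)).trans (le_of_eq ?_)
  rw [Real.div_rpow (by positivity) hK'.le, Real.rpow_neg hK'.le, div_inv_eq_mul, mul_comm]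

lemma q_cov (K : ℕ) (hK : 1 ≤ K) : ∃ C : ℝ, 0 < C ∧ ∀ w M i u : ℕ, i + u < M →
    Ex (d := 4) M (fun l => qg K w i (endp (l.take (i + 1))) * qg K w (i + u) (endp (l.take (i + u + 1)))) ≤
      qm K w i * qm K w (i + u) + C * (((i : ℝ) + 1) ^ (-(1 / 2) : ℝ) * (((i + u : ℕ) : ℝ) + 1) ^ (-(3 / 2) : ℝ)) := by
  obtain ⟨C, hC, H⟩ := Gt_cov
  obtain ⟨D, hD, HD⟩ := Gt4_bound
  have hK' : (0 : ℝ) < K := by exact_mod_cast hK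
  refine ⟨D * (K : ℝ) ^ (1 : ℝ) * (C * (K : ℝ) ^ (3 / 2 : ℝ)), by positivity, fun w M i u h => ?_⟩
  have e1 := Ex_pair (M := M) (i := i + 1) (u := u) (by omega) (fun x y => qg K w i x * qg K w (i + u) y)
  have e2 : i + 1 + u = i + u + 1 := by ring
  rw [e2] at e1
  rw [e1]
  have e3 : ∀ a : List (Stp 4), Ex u (fun b => qg K w i (endp a) * qg K w (i + u) (endp a + endp b)) =
      qg K w i (endp a) * Gt (w + (i + u) / K + u) (endp a) := by
    intro a
    rw [Ex_mul_left]; congr 1; exact Ex_Gt u _ _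
  simp only [e3]
  have h1 := H (i + 1) (w + (i + u) / K + u) (qg K w i) (D * (K : ℝ) ^ (1 : ℝ) * ((i : ℝ) + 1) ^ (-1 : ℝ)) (fun x => Gt_nonneg _ _)
    (fun x => (HD _ x).trans (by
      rw [mul_assoc]; exact mul_le_mul_of_nonneg_left (divK hK (by omega) 1 (by norm_num)) hD.le))
  refine h1.trans (add_le_add (le_of_eq ?_) ?_)
  · congr 1
    · have := Ex_Gt (i + 1) (w + i / K) (0 : Zd 4)
      simpa only [zero_add, qg, qm] using this
    · unfold qm; congr 1; ring
  · have d2 := divK hK (by omega : (i + u) / K ≤ w + (i + u) / K + u) (3 / 2) (by norm_num)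
    calc _ ≤ D * (K : ℝ) ^ (1 : ℝ) * ((i : ℝ) + 1) ^ (-1 : ℝ) * (√((i + 1 : ℕ) : ℝ) * (C * ((K : ℝ) ^ (3 / 2 : ℝ) * (((i + u : ℕ) : ℝ) + 1) ^ (-(3 / 2) : ℝ)))) := by gcongr
      _ = _ := by
        have := rp_mul i (-1) (1 / 2) (-(1 / 2)) (by norm_num)
        rw [← this, Real.sqrt_eq_rpow]
        push_cast
        ring

lemma Q_var (K : ℕ) (hK : 1 ≤ K) : ∃ C : ℝ, 0 < C ∧ ∀ w M : ℕ,
    Ex M (fun l => (Qs K w M l - mq K w M) ^ 2) ≤ C * (1 + Real.log (M + 1)) := by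
  obtain ⟨C, hC, H⟩ := q_cov K hK
  obtain ⟨D, hD, HD⟩ := tail_sum_le (3 / 2) (by norm_num)
  refine ⟨2 * (C * D), by positivity, fun w M => ?_⟩
  have e0 : Ex M (fun l => (Qs K w M l - mq K w M) ^ 2) = Ex M (fun l => Qs K w M l ^ 2) - mq K w M ^ 2 := by
    have e1 : Ex M (fun l => (Qs K w M l - mq K w M) ^ 2) = Ex M (fun l => Qs K w M l ^ 2 - 2 * mq K w M * Qs K w M l + mq K w M ^ 2) :=
      Ex_congr fun l _ => by ring
    rw [e1, Ex_add, Ex_sub, Ex_mul_left, Q_mean, Ex_const]; ring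
  rw [e0]
  set b : ℕ → ℕ → ℝ := fun i j => C * (((min i j : ℕ) : ℝ) + 1) ^ (-(1 / 2) : ℝ) * (((max i j : ℕ) : ℝ) + 1) ^ (-(3 / 2) : ℝ) with hb
  have b0 : ∀ i j, 0 ≤ b i j := fun i j => by simp only [hb]; positivity
  have bs : ∀ i j, b i j = b j i := fun i j => by simp only [hb, min_comm i j, max_comm i j]
  have key : ∀ i j, i < M → j < M → Ex (d := 4) M (fun l => qg K w i (endp (l.take (i + 1))) * qg K w j (endp (l.take (j + 1)))) ≤
      qm K w i * qm K w j + b i j := by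
    have k1 : ∀ i j, i ≤ j → j < M → Ex (d := 4) M (fun l => qg K w i (endp (l.take (i + 1))) * qg K w j (endp (l.take (j + 1)))) ≤
      qm K w i * qm K w j + b i j := by
      intro i j hij hj
      obtain ⟨u, rfl⟩ := Nat.exists_eq_add_of_le hij
      refine (H w M i u hj).trans (le_of_eq ?_)
      simp only [hb, min_eq_left hij, max_eq_right hij, mul_assoc]
    intro i j hi hj
    rcases le_total i j with h | h
    · exact k1 i j h hj
    · have := k1 j i h hi
      rw [bs, mul_comm (qm K w i)]
      refine le_trans (le_of_eq ?_) this
      exact Ex_congr fun l _ => mul_comm _ _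
  have s1 : Ex M (fun l => Qs K w M l ^ 2) - mq K w M ^ 2 ≤ ∑ i ∈ Finset.range M, ∑ j ∈ Finset.range M, b i j := by
    simp only [sq, Qs, mq, Finset.sum_mul_sum]
    rw [Ex_sum, ← Finset.sum_sub_distrib]
    refine Finset.sum_le_sum fun i hi => ?_
    rw [Ex_sum, ← Finset.sum_sub_distrib]
    refine Finset.sum_le_sum fun j hj => ?_
    have := key i j (Finset.mem_range.mp hi) (Finset.mem_range.mp hj)
    linarith
  refine s1.trans ?_
  rcases M with _ | N
  · simp; positivity
  refine (sq_pairs N b b0).trans ?_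
  have s2 : ∀ i ∈ Finset.range (N + 1), ∑ u ∈ Finset.range (N + 1), (b i (i + u) + b (i + u) i) ≤ 2 * (C * D) * ((i : ℝ) + 1) ^ (-1 : ℝ) := by
    intro i _
    have : ∀ u, b i (i + u) + b (i + u) i = 2 * C * ((i : ℝ) + 1) ^ (-(1 / 2) : ℝ) * (((i + u : ℕ) : ℝ) + 1) ^ (-(3 / 2) : ℝ) := by
      intro u
      rw [bs (i + u) i]
      simp only [hb, min_eq_left (Nat.le_add_right i u), max_eq_right (Nat.le_add_right i u)]
      ring
    simp only [this, ← Finset.mul_sum]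
    have h2 := HD (N + 1) i
    rw [show (1 - 3 / 2 : ℝ) = -(1 / 2) by norm_num] at h2
    rw [← rp_mul i (-(1 / 2)) (-(1 / 2)) (-1) (by norm_num)]
    calc _ ≤ 2 * C * ((i : ℝ) + 1) ^ (-(1 / 2) : ℝ) * (D * ((i : ℝ) + 1) ^ (-(1 / 2) : ℝ)) := by gcongr
      _ = _ := by ring
  refine (Finset.sum_le_sum s2).trans ?_
  rw [← Finset.mul_sum]
  have := harm_le (N + 1)
  gcongr

/-- probability that the truncated Green sum is atypically small -/
lemma Q_cheb (K w M : ℕ) (V a : ℝ) (hV : Ex M (fun l => (Qs K w M l - mq K w M) ^ 2) ≤ V) (ha : 0 < a) :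
    Ex M (fun l => if Qs K w M l < mq K w M - a then (1:ℝ) else 0) ≤ V / a ^ 2 := by
  rw [le_div_iff₀ (by positivity), ← Ex_mul_right]
  refine le_trans (Ex_mono fun l _ => ?_) hV
  split_ifs with h
  · rw [one_mul]; nlinarith
  · rw [zero_mul]; positivity


lemma take_rv {d : ℕ} (p : List (Stp d)) (j : ℕ) :
    endp p + endp ((rv p).take j) = endp (p.take (p.length - j)) := by
  have h1 : (rv p).take j = rv (p.drop (p.length - j)) := by
    simp [rv, List.take_reverse]
  have h2 : endp p = endp (p.take (p.length - j)) + endp (p.drop (p.length - j)) := by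
    rw [← endp_append, List.take_append_drop]
  rw [h1, endp_rv, h2]; abel

lemma cp_le_of_sum {d : ℕ} [Fact (4 ≤ d)] (A : Finset (Zd d)) (N : ℕ) (X : ℕ → Zd d) (c : ℝ) (hc : 0 < c)
    (h : ∀ y ∈ A, c ≤ ∑ t ∈ Finset.range N, G (y - X t)) : cp A ≤ N / c := by
  rw [le_div_iff₀ hc]
  calc cp A * c = ∑ y ∈ A, ee A y * c := by rw [cp, Finset.sum_mul]
    _ ≤ ∑ y ∈ A, ee A y * ∑ t ∈ Finset.range N, G (y - X t) :=
        Finset.sum_le_sum fun y hy => mul_le_mul_of_nonneg_left (h y hy) (ee_nonneg _ _)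
    _ = ∑ t ∈ Finset.range N, hh A (X t) := by
        simp only [Finset.mul_sum]
        rw [Finset.sum_comm]
        refine Finset.sum_congr rfl fun t _ => ?_
        rw [hh_rep]
        refine Finset.sum_congr rfl fun y _ => ?_
        rw [mul_comm]; unfold G; rw [Gt_sub_comm]
    _ ≤ ∑ t ∈ Finset.range N, (1:ℝ) := Finset.sum_le_sum fun t _ => hh_le_one _ _
    _ = N := by simp

lemma cp_good_bad {d : ℕ} [Fact (4 ≤ d)] {ι : Type*} (s : Finset ι) (A : ι → Finset (Zd d)) (B : Finset (Zd d)) :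
    cp (B ∪ s.biUnion A) ≤ cp B + ∑ i ∈ s, cp (A i) := by
  induction s using Finset.induction_on with
  | empty => simp
  | insert a s ha ih =>
    rw [Finset.biUnion_insert, Finset.sum_insert ha,
      show B ∪ (A a ∪ s.biUnion A) = (B ∪ s.biUnion A) ∪ A a by
        rw [Finset.union_comm (A a), ← Finset.union_assoc]]
    have := cp_union_le (B ∪ s.biUnion A) (A a)
    linarith

lemma sum_times {d : ℕ} (p b s : List (Stp d)) (M : ℕ) (hp : M ≤ p.length) (hs : M ≤ s.length) (F : Zd d → ℝ)
    (hF : ∀ x, 0 ≤ F x) :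
    ∑ j ∈ Finset.range M, F (endp p + endp ((rv p).take (j + 1))) +
      ∑ j ∈ Finset.range M, F (endp p + endp b + endp (s.take (j + 1))) ≤
    ∑ t ∈ Finset.range ((p ++ (b ++ s)).length + 1), F (endp ((p ++ (b ++ s)).take t)) := by
  have e : (p ++ (b ++ s)).length + 1 = p.length + ((b.length + 1) + s.length) := by simp; omega
  rw [e, Finset.sum_range_add, Finset.sum_range_add]
  refine add_le_add ?_ ?_
  · rw [← Finset.sum_range_reflect _ p.length]
    calc _ ≤ ∑ j ∈ Finset.range p.length, F (endp p + endp ((rv p).take (j + 1))) :=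
        Finset.sum_le_sum_of_subset_of_nonneg (Finset.range_mono hp) fun _ _ _ => hF _
      _ ≤ _ := by
        refine Finset.sum_le_sum fun j hj => ?_
        rw [take_rv, endp_take_append_left _ _ _ (by omega), Nat.sub_sub, Nat.add_comm 1 j]
  · have h0 : 0 ≤ ∑ x ∈ Finset.range (b.length + 1), F (endp ((p ++ (b ++ s)).take (p.length + x))) :=
      Finset.sum_nonneg fun _ _ => hF _
    refine le_trans ?_ (le_add_of_nonneg_left h0)
    calc _ ≤ ∑ j ∈ Finset.range s.length, F (endp p + endp b + endp (s.take (j + 1))) :=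
        Finset.sum_le_sum_of_subset_of_nonneg (Finset.range_mono hs) fun _ _ _ => hF _
      _ ≤ _ := by
        refine Finset.sum_le_sum fun j hj => ?_
        have : (p ++ (b ++ s)).take (p.length + (b.length + 1 + j)) = p ++ (b ++ s.take (j + 1)) := by
          rw [List.take_length_add_append, show b.length + 1 + j = b.length + (j + 1) by omega,
            List.take_length_add_append]
        rw [this, endp_append, endp_append, add_assoc]

/-- the cost of moving within a block -/
def Gam (C : ℝ) (K w' M : ℕ) : ℝ := ∑ j ∈ Finset.range M, C * (((w' + j / K : ℕ) : ℝ) + 1) ^ (-(3/2) : ℝ)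

lemma good_block (C : ℝ) (hC : 0 < C) (hL : ∀ w x (l : List (Stp 4)), |Gt w (x + endp l) - Gt w x| ≤
      l.length * (C * ((w : ℝ) + 1) ^ (-(3/2) : ℝ))) (K w' M : ℕ) (m : ℝ) (p b s : List (Stp 4))
    (hp : M ≤ p.length) (hs : M ≤ s.length)
    (h1 : m ≤ Qs K w' M (rv p)) (h2 : m ≤ Qs K w' M s) (y : Zd 4) (hy : y ∈ sh (endp p) (rng b)) :
    2 * m - 2 * (b.length * Gam C K w' M) ≤
      ∑ t ∈ Finset.range ((p ++ (b ++ s)).length + 1), G (y - endp ((p ++ (b ++ s)).take t)) := by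
  simp only [sh, Finset.mem_image] at hy
  obtain ⟨z, hz, rfl⟩ := hy
  obtain ⟨k, hk, rfl⟩ := mem_rng.1 hz
  refine le_trans ?_ (sum_times p b s M hp hs (fun x => G (endp p + endp (b.take k) - x)) fun _ => Gt_nonneg _ _)
  have key : ∀ (a : ℕ) (x : Zd 4) (l : List (Stp 4)), l.length ≤ b.length →
      Gt a x - b.length * (C * ((a : ℝ) + 1) ^ (-(3/2) : ℝ)) ≤ Gt a (x + endp l) := by
    intro a x l hl
    have h := (abs_le.1 (hL a x l)).1
    have h' : (l.length : ℝ) * (C * ((a : ℝ) + 1) ^ (-(3/2) : ℝ)) ≤ b.length * (C * ((a : ℝ) + 1) ^ (-(3/2) : ℝ)) := by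
      have : (l.length : ℝ) ≤ b.length := by exact_mod_cast hl
      gcongr
    linarith
  have a1 : m - b.length * Gam C K w' M ≤
      ∑ j ∈ Finset.range M, G (endp p + endp (b.take k) - (endp p + endp ((rv p).take (j + 1)))) := by
    have : Qs K w' M (rv p) - b.length * Gam C K w' M ≤
      ∑ j ∈ Finset.range M, G (endp p + endp (b.take k) - (endp p + endp ((rv p).take (j + 1)))) := by
      rw [Qs, Gam, Finset.mul_sum, ← Finset.sum_sub_distrib]
      refine Finset.sum_le_sum fun j _ => ?_
      refine (key (w' + j / K) _ (rv (b.take k)) (by simp [length_rv])).trans ?_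
      rw [endp_rv, ← Gt_neg]
      refine (Gt_anti (Nat.zero_le _) _).trans (le_of_eq ?_)
      congr 1; abel
    linarith
  have a2 : m - b.length * Gam C K w' M ≤
      ∑ j ∈ Finset.range M, G (endp p + endp (b.take k) - (endp p + endp b + endp (s.take (j + 1)))) := by
    have : Qs K w' M s - b.length * Gam C K w' M ≤
      ∑ j ∈ Finset.range M, G (endp p + endp (b.take k) - (endp p + endp b + endp (s.take (j + 1)))) := by
      rw [Qs, Gam, Finset.mul_sum, ← Finset.sum_sub_distrib]
      refine Finset.sum_le_sum fun j _ => ?_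
      refine (key (w' + j / K) _ (b.drop k) (by simp)).trans ?_
      rw [← Gt_neg]
      refine (Gt_anti (Nat.zero_le _) _).trans (le_of_eq ?_)
      have h2 : endp b = endp (b.take k) + endp (b.drop k) := by
        rw [← endp_append, List.take_append_drop]
      congr 1; rw [h2]; abel
    linarith
  linarith

lemma cover {d : ℕ} (l : List (Stp d)) (M w q : ℕ) (hq : 1 ≤ q) :
    sh (endp (l.take M)) (rng ((l.drop M).take (w * q))) ⊆
      (Finset.range q).biUnion fun i => sh (endp (l.take (M + w * i))) (rng ((l.drop (M + w * i)).take w)) := by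
  induction q, hq using Nat.le_induction with
  | base => simp
  | succ q hq ih =>
    rw [Finset.range_add_one, Finset.biUnion_insert, Nat.mul_succ, List.take_add, rng_append, sh_union, sh_sh, ← endp_append,
      ← List.take_add, List.drop_drop, Finset.union_comm]
    exact Finset.union_subset_union le_rfl ih

lemma Qs_take (K w M : ℕ) (l : List (Stp 4)) : Qs K w M (l.take M) = Qs K w M l := by
  refine Finset.sum_congr rfl fun j hj => ?_
  rw [List.take_take, min_eq_left (Finset.mem_range.1 hj)]

/-- bad indicator -/
def bd (K w M : ℕ) (m : ℝ) (l : List (Stp 4)) : ℝ := if Qs K w M l < m then 1 else 0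

lemma bd_nonneg (K w M : ℕ) (m : ℝ) (l : List (Stp 4)) : 0 ≤ bd K w M m l := by
  unfold bd; split_ifs <;> norm_num

lemma bd_Ex (K w M : ℕ) (m : ℝ) {n : ℕ} (h : M ≤ n) : Ex n (bd K w M m) = Ex M (bd K w M m) := by
  rw [← Ex_take h]
  congr 1; ext l; simp only [bd, Qs_take]

lemma Ex_bad (K w' M w m' n : ℕ) (m : ℝ) (hm : M ≤ m') (hn : M ≤ n) :
    Ex (d := 4) (m' + (w + n)) (fun l => (bd K w' M m (rv (l.take m')) + bd K w' M m (l.drop (m' + w))) *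
      cp (rng ((l.drop m').take w))) = 2 * Ex M (bd K w' M m) * cT 4 w := by
  rw [Ex_append]
  have : ∀ l1 : List (Stp 4), l1.length = m' → Ex (w + n) (fun l2 =>
      (bd K w' M m (rv ((l1 ++ l2).take m')) + bd K w' M m ((l1 ++ l2).drop (m' + w))) *
      cp (rng (((l1 ++ l2).drop m').take w))) = bd K w' M m (rv l1) * cT 4 w + Ex M (bd K w' M m) * cT 4 w := by
    intro l1 h1
    rw [Ex_append]
    rw [Ex_congr (g := fun l2 => bd K w' M m (rv l1) * cp (rng l2) + Ex M (bd K w' M m) * cp (rng l2))]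
    · rw [Ex_add, Ex_mul_left, Ex_mul_left]; rfl
    · intro l2 h2
      rw [← bd_Ex K w' M m hn, ← add_mul, ← Ex_const (d := 4) n (bd K w' M m (rv l1)), ← Ex_add, ← Ex_mul_right]
      refine Ex_congr fun l3 _ => ?_
      have e1 : (l1 ++ (l2 ++ l3)).take m' = l1 := by simp [← h1]
      have e2 : (l1 ++ (l2 ++ l3)).drop (m' + w) = l3 := by
        rw [← List.drop_drop]; simp [← h1, ← h2]
      have e3 : ((l1 ++ (l2 ++ l3)).drop m').take w = l2 := by simp [← h1, ← h2]
      rw [e1, e2, e3]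
  rw [Ex_congr this, Ex_add, Ex_mul_right, Ex_const, Ex_rv m' (bd K w' M m), bd_Ex K w' M m hm]; ring

lemma mean_step (C : ℝ) (hC : 0 < C) (hL : ∀ w x (l : List (Stp 4)), |Gt w (x + endp l) - Gt w x| ≤
      l.length * (C * ((w : ℝ) + 1) ^ (-(3/2) : ℝ))) (K w' M w q : ℕ) (hq : 1 ≤ q) (V a D : ℝ)
    (hV : Ex M (fun l => (Qs K w' M l - mq K w' M) ^ 2) ≤ V) (ha : 0 < a) (hD0 : 0 < D)
    (hD : D ≤ 2 * (mq K w' M - a) - 2 * (w * Gam C K w' M)) :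
    cT 4 (w * q) ≤ (w * q + 2 * M + 1) / D + q * (2 * (V / a ^ 2) * cT 4 w) := by
  set m := mq K w' M - a with hm
  set N := M + (w * q + M) with hN
  have e1 : cT 4 (w * q) = Ex (d := 4) N (fun l => cp (sh (endp (l.take M)) (rng ((l.drop M).take (w * q))))) := by
    simp only [cp_sh]
    rw [hN, Ex_append]
    rw [Ex_congr (g := fun _ => cT 4 (w * q)), Ex_const]
    intro l1 h1
    rw [cT, ← Ex_take (d := 4) (show w * q ≤ w * q + M by omega)]
    refine Ex_congr fun l2 _ => ?_
    simp [← h1]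
  have pt : ∀ l : List (Stp 4), l.length = N → cp (sh (endp (l.take M)) (rng ((l.drop M).take (w * q)))) ≤
      (w * q + 2 * M + 1) / D + ∑ i ∈ Finset.range q, (bd K w' M m (rv (l.take (M + w * i))) +
        bd K w' M m (l.drop (M + w * i + w))) * cp (rng ((l.drop (M + w * i)).take w)) := by
    intro l hl
    have hlen : ∀ i < q, M + w * i + w + M ≤ l.length := by
      intro i hi
      have : w * (i + 1) ≤ w * q := Nat.mul_le_mul le_rfl hi
      rw [hl, hN]; rw [Nat.mul_succ] at this; omega
    set A : ℕ → Finset (Zd 4) := fun i => sh (endp (l.take (M + w * i))) (rng ((l.drop (M + w * i)).take w)) with hA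
    set gd : ℕ → Prop := fun i => m ≤ Qs K w' M (rv (l.take (M + w * i))) ∧ m ≤ Qs K w' M (l.drop (M + w * i + w)) with hgd
    set S1 := (Finset.range q).filter gd
    set S2 := (Finset.range q).filter fun i => ¬ gd i
    have c1 := cp_mono (cover l M w q hq)
    have c2 : (Finset.range q).biUnion A = S1.biUnion A ∪ S2.biUnion A := by
      rw [← Finset.union_biUnion, Finset.filter_union_filter_not_eq]
    have c3 := cp_good_bad S2 A (S1.biUnion A)
    rw [← c2] at c3
    have c4 : cp (S1.biUnion A) ≤ (w * q + 2 * M + 1) / D := by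
      have := cp_le_of_sum (S1.biUnion A) (l.length + 1) (fun t => endp (l.take t)) D hD0 (by
        intro y hy
        obtain ⟨i, hi, hy⟩ := Finset.mem_biUnion.1 hy
        obtain ⟨hi, hg⟩ := Finset.mem_filter.1 hi
        have hi := hlen i (Finset.mem_range.1 hi)
        have := good_block C hC hL K w' M m (l.take (M + w * i)) ((l.drop (M + w * i)).take w) (l.drop (M + w * i + w))
          (by simp; omega) (by simp; omega) hg.1 hg.2 y hy
        have e : l.take (M + w * i) ++ ((l.drop (M + w * i)).take w ++ l.drop (M + w * i + w)) = l := by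
          rw [show l.drop (M + w * i + w) = (l.drop (M + w * i)).drop w by rw [List.drop_drop], List.take_append_drop, List.take_append_drop]
        rw [e] at this
        refine le_trans (hD.trans ?_) this
        have h' : ((l.drop (M + w * i)).take w).length = w := by simp; omega
        rw [h'])
      refine this.trans (le_of_eq ?_)
      rw [hl, hN]; push_cast; ring
    have c5 : ∑ i ∈ S2, cp (A i) ≤ ∑ i ∈ Finset.range q, (bd K w' M m (rv (l.take (M + w * i))) +
        bd K w' M m (l.drop (M + w * i + w))) * cp (rng ((l.drop (M + w * i)).take w)) := by
      rw [Finset.sum_filter]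
      refine Finset.sum_le_sum fun i _ => ?_
      have n1 := bd_nonneg K w' M m (rv (l.take (M + w * i)))
      have n2 := bd_nonneg K w' M m (l.drop (M + w * i + w))
      have n3 := cp_nonneg (rng ((l.drop (M + w * i)).take w))
      split_ifs with h
      · exact mul_nonneg (add_nonneg n1 n2) n3
      · simp only [hA, cp_sh]
        refine le_mul_of_one_le_left n3 ?_
        replace h := not_and_or.1 h
        rw [not_le, not_le] at h
        rcases h with h | h
        · have : bd K w' M m (rv (l.take (M + w * i))) = 1 := by simp [bd, h]
          linarith
        · have : bd K w' M m (l.drop (M + w * i + w)) = 1 := by simp [bd, h]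
          linarith
    linarith
  rw [e1]
  refine (Ex_mono pt).trans ?_
  rw [Ex_add, Ex_const, Ex_sum]
  gcongr
  have : ∀ i ∈ Finset.range q, Ex (d := 4) N (fun l => (bd K w' M m (rv (l.take (M + w * i))) +
        bd K w' M m (l.drop (M + w * i + w))) * cp (rng ((l.drop (M + w * i)).take w))) ≤ 2 * (V / a ^ 2) * cT 4 w := by
    intro i hi
    have : w * (i + 1) ≤ w * q := Nat.mul_le_mul le_rfl (Finset.mem_range.1 hi)
    rw [Nat.mul_succ] at this
    have e : N = (M + w * i) + (w + (w * q - w * i - w + M)) := by omega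
    rw [e, Ex_bad K w' M w _ _ m (by omega) (by omega)]
    have := Q_cheb K w' M V a hV ha
    have c := cT_nonneg (d := 4) w
    gcongr
    exact this
  refine (Finset.sum_le_sum this).trans (le_of_eq ?_)
  simp


lemma log_inc (w M : ℕ) : Real.log ((w : ℝ) + M + 1) - Real.log ((w : ℝ) + 1) ≤
    ∑ j ∈ Finset.range M, 1 / ((w : ℝ) + j + 1) := by
  induction M with
  | zero => simp
  | succ M ih =>
    rw [Finset.sum_range_succ]
    have hx : (0:ℝ) < (w : ℝ) + M + 1 := by positivity
    have : Real.log ((w : ℝ) + (M + 1 : ℕ) + 1) - Real.log ((w : ℝ) + M + 1) ≤ 1 / ((w : ℝ) + M + 1) := by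
      rw [← Real.log_div (by positivity) hx.ne']
      refine (Real.log_le_sub_one_of_pos (by positivity)).trans (le_of_eq ?_)
      push_cast; field_simp; ring
    linarith

lemma mq_lower {κ : ℝ} (hκ : 0 < κ) (hG : Tendsto (fun i : ℕ => (i : ℝ) * Gt i (0 : Zd 4)) atTop (𝓝 κ))
    {r : ℝ} (hr0 : 0 < r) (hr : r < κ) : ∃ i0 : ℕ, ∀ K : ℕ, 1 ≤ K → ∀ w ≥ i0, ∀ M : ℕ,
      r * (1 - 1 / K) * (Real.log ((w : ℝ) + M + 1) - Real.log ((w : ℝ) + 1)) ≤ mq K w M := by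
  obtain ⟨i0, hi0⟩ := eventually_atTop.1 (hG.eventually (lt_mem_nhds hr))
  refine ⟨i0, fun K hK w hw M => ?_⟩
  have hK' : (1:ℝ) ≤ K := by exact_mod_cast hK
  have hk1 : (0:ℝ) ≤ 1 - 1 / K := by
    rw [sub_nonneg, div_le_one (by positivity)]; exact hK'
  refine (mul_le_mul_of_nonneg_left (log_inc w M) (by positivity)).trans ?_
  rw [Finset.mul_sum, mq]
  refine Finset.sum_le_sum fun j _ => ?_
  have h := (hi0 (w + j / K + (j + 1)) (by generalize j / K = t; omega)).le
  have hp : (0:ℝ) < ((w + j / K + (j + 1) : ℕ) : ℝ) := by positivity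
  have h2 : r / ((w + j / K + (j + 1) : ℕ) : ℝ) ≤ qm K w j := by
    rw [div_le_iff₀ hp, qm, mul_comm]; exact h
  refine le_trans ?_ h2
  rw [mul_assoc, div_eq_mul_one_div r]
  refine mul_le_mul_of_nonneg_left ?_ hr0.le
  rw [mul_one_div, div_le_div_iff₀ (by positivity) hp, one_mul]
  have hdiv : ((j / K : ℕ) : ℝ) ≤ j / K := Nat.cast_div_le
  have e : (j : ℝ) / K = 1 / K * j := by ring
  set z : ℝ := 1 / K
  have hz : 0 ≤ z := by positivity
  push_cast
  have : (1 - z) * ((w : ℝ) + ((j / K : ℕ) : ℝ) + (j + 1)) ≤ (1 - z) * (w + z * j + (j + 1)) := by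
    refine mul_le_mul_of_nonneg_left ?_ hk1
    linarith
  refine this.trans ?_
  have hw0 : (0:ℝ) ≤ w := by positivity
  have hj0 : (0:ℝ) ≤ j := by positivity
  nlinarith [mul_nonneg hz hw0, mul_nonneg hz hj0, mul_nonneg (mul_nonneg hz hz) hj0]

lemma Gam_bound (C : ℝ) (hC : 0 < C) (K : ℕ) (hK : 1 ≤ K) : ∃ C' : ℝ, 0 < C' ∧ ∀ w M : ℕ,
    Gam C K w M ≤ C' * ((w : ℝ) + 1) ^ (-(1/2) : ℝ) := by
  obtain ⟨C1, h1, ht⟩ := tail_sum_le (3/2) (by norm_num)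
  have hK' : (0:ℝ) < K := by exact_mod_cast hK
  refine ⟨C * ((K:ℝ) ^ (3/2 : ℝ) * C1), by positivity, fun w M => ?_⟩
  have h := ht M w
  rw [show (1:ℝ) - 3/2 = -(1/2) by norm_num] at h
  have : Gam C K w M ≤ C * ((K:ℝ) ^ (3/2 : ℝ) * ∑ t ∈ Finset.range M, (((w + t : ℕ) : ℝ) + 1) ^ (-(3/2) : ℝ)) := by
    rw [Gam, ← Finset.mul_sum]
    refine mul_le_mul_of_nonneg_left ?_ hC.le
    rw [Finset.mul_sum]
    refine Finset.sum_le_sum fun j _ => ?_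
    refine divK hK ?_ (3/2) (by norm_num)
    rw [Nat.div_le_iff_le_mul_add_pred (by omega)]
    have : w * 1 ≤ K * w := by rw [mul_comm]; exact Nat.mul_le_mul hK le_rfl
    have h3 := Nat.div_add_mod j K
    have h4 := Nat.mod_lt j (show 0 < K by omega)
    have h5 : K * (w + j / K) = K * w + K * (j / K) := by ring
    omega
  refine this.trans ?_
  rw [mul_assoc, mul_assoc]
  gcongr

/-- crude upper bound for the mean -/
lemma mean4_crude {κ : ℝ} (hκ : 0 < κ) (hG : Tendsto (fun i : ℕ => (i : ℝ) * Gt i (0 : Zd 4)) atTop (𝓝 κ)) :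
    ∃ A : ℝ, 0 < A ∧ ∀ᶠ T : ℕ in atTop, cT 4 T ≤ A * T / Real.log T := by
  obtain ⟨C, hC, hL⟩ := Gt_lip
  obtain ⟨i0, hi0⟩ := mq_lower hκ hG (r := κ / 2) (by positivity) (by linarith)
  obtain ⟨C', hC', hGam⟩ := Gam_bound C hC 2 (by norm_num)
  obtain ⟨CV, hCV, hV⟩ := Q_var 2 (by norm_num)
  set c : ℝ := κ / 8 with hc
  have hc0 : 0 < c := by positivity
  refine ⟨4 / c + 2 * (CV * 3 * 16 / c ^ 2) * 2, by positivity, ?_⟩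
  have hlog : Tendsto (fun T : ℕ => Real.log (T : ℝ)) atTop atTop :=
    Real.tendsto_log_atTop.comp tendsto_natCast_atTop_atTop
  filter_upwards [eventually_ge_atTop 1, hlog.eventually_ge_atTop (max 1 (max (2 * Real.log ((i0:ℝ) + 1)) (4 * C' / c)))] with T hT hTL
  set L := Real.log (T : ℝ)
  have hL1 : 1 ≤ L := (le_max_left _ _).trans hTL
  have hL2 : 2 * Real.log ((i0:ℝ) + 1) ≤ L := ((le_max_left _ _).trans (le_max_right _ _)).trans hTL
  have hL3 : 4 * C' / c ≤ L := ((le_max_right _ _).trans (le_max_right _ _)).trans hTL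
  have hT1 : (1:ℝ) ≤ T := by exact_mod_cast hT
  set m := mq 2 i0 T with hm
  have hm1 : c * L ≤ m := by
    refine le_trans ?_ (hi0 2 (by norm_num) i0 le_rfl T)
    have h1 : L ≤ Real.log ((i0 : ℝ) + T + 1) := Real.log_le_log (by positivity) (by linarith [show (0:ℝ) ≤ i0 by positivity])
    have : L / 2 ≤ Real.log ((i0 : ℝ) + T + 1) - Real.log ((i0:ℝ) + 1) := by linarith
    have e : c * L = κ / 2 * (1 - 1 / (2:ℕ)) * (L / 2) := by rw [hc]; norm_num; ring
    rw [e]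
    have : (0:ℝ) ≤ κ / 2 * (1 - 1 / (2:ℕ)) := by norm_num; positivity
    gcongr
  have hm0 : 0 < m := lt_of_lt_of_le (by positivity) hm1
  have hg : Gam C 2 i0 T ≤ C' := by
    refine (hGam i0 T).trans ?_
    have : ((i0 : ℝ) + 1) ^ (-(1/2) : ℝ) ≤ 1 := Real.rpow_le_one_of_one_le_of_nonpos (by linarith [show (0:ℝ) ≤ i0 by positivity]) (by norm_num)
    nlinarith
  have hm2 : 4 * C' ≤ m := by
    rw [div_le_iff₀ hc0] at hL3; linarith
  have st := mean_step C hC hL 2 i0 T 1 T hT _ (m / 4) m (hV i0 T) (by positivity) hm0 (by rw [← hm]; push_cast; linarith)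
  rw [one_mul] at st
  refine st.trans ?_
  have c1 : cT 4 1 ≤ 2 := by have := cT_le (d := 4) 1; norm_num at this; exact this
  have hlog2 : 1 + Real.log ((T:ℝ) + 1) ≤ 3 * L := by
    have : Real.log ((T:ℝ) + 1) ≤ Real.log (2 * T) := Real.log_le_log (by positivity) (by linarith)
    rw [Real.log_mul (by norm_num) (by positivity)] at this
    have h2 := Real.log_two_lt_d9
    linarith
  have hlog3 : 0 ≤ 1 + Real.log ((T:ℝ) + 1) := by
    have := Real.log_nonneg (show (1:ℝ) ≤ (T:ℝ) + 1 by linarith); linarith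
  have t1 : (((1:ℕ):ℝ) * T + 2 * T + 1) / m ≤ 4 / c * (T / L) := by
    calc (((1:ℕ):ℝ) * T + 2 * T + 1) / m ≤ (4 * T) / (c * L) := by
          gcongr; push_cast; linarith
      _ = _ := by field_simp
  have t2 : (T:ℝ) * (2 * (CV * (1 + Real.log ((T:ℝ) + 1)) / (m / 4) ^ 2) * cT 4 1) ≤ 2 * (CV * 3 * 16 / c ^ 2) * 2 * (T / L) := by
    calc (T:ℝ) * (2 * (CV * (1 + Real.log ((T:ℝ) + 1)) / (m / 4) ^ 2) * cT 4 1)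
        ≤ (T:ℝ) * (2 * (CV * (3 * L) / (c * L / 4) ^ 2) * 2) := by
          have c0 := cT_nonneg (d := 4) 1
          gcongr
      _ = _ := by field_simp; ring
  calc _ ≤ _ := add_le_add t1 t2
    _ = _ := by ring

set_option maxHeartbeats 2000000 in
lemma mean4_pass {κ A : ℝ} (hκ : 0 < κ) (hG : Tendsto (fun i : ℕ => (i : ℝ) * Gt i (0 : Zd 4)) atTop (𝓝 κ))
    (hA : 0 < A) (hcr : ∀ᶠ T : ℕ in atTop, cT 4 T ≤ A * T / Real.log T) (K : ℕ) (hK : 2 ≤ K) :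
    ∀ᶠ T : ℕ in atTop, cT 4 T ≤ ((1 + 4 / K) / (2 * κ * (1 - 1 / K) ^ 5) + 1 / K) * (T / Real.log T) := by
  obtain ⟨C, hC, hL⟩ := Gt_lip
  have hK2 : (2:ℝ) ≤ K := by exact_mod_cast hK
  have hK0 : (0:ℝ) < K := by linarith
  set z : ℝ := 1 / K with hz
  have hz0 : 0 < z := by positivity
  have hz1 : z ≤ 1 / 2 := by rw [hz]; gcongr
  have hr : κ * (1 - z) < κ := by nlinarith
  have hr0 : 0 < κ * (1 - z) := by apply mul_pos hκ; linarith
  obtain ⟨i0, hi0⟩ := mq_lower hκ hG hr0 hr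
  obtain ⟨C', hC', hGam⟩ := Gam_bound C hC K (by omega)
  obtain ⟨CV, hCV, hV⟩ := Q_var K (by omega)
  obtain ⟨w0, hw0⟩ := eventually_atTop.1 hcr
  set c : ℝ := κ * (1 - z) ^ 3 with hc
  have h1z : 0 < 1 - z := by linarith
  have hc0 : 0 < c := by positivity
  set E2 : ℝ := 2 * (3 * CV / (z * c) ^ 2) * (2 * A * (16 * K)) with hE2
  have hE20 : 0 < E2 := by positivity
  have hlog : Tendsto (fun T : ℕ => Real.log (T : ℝ)) atTop atTop :=
    Real.tendsto_log_atTop.comp tendsto_natCast_atTop_atTop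
  filter_upwards [eventually_ge_atTop 1, hlog.eventually_ge_atTop 1, hlog.eventually_ge_atTop (2 * Real.log (17 * K) * K),
    hlog.eventually_ge_atTop (16 * K * ((i0:ℝ) + w0)),
    hlog.eventually_ge_atTop (C' / (c * (1 - z) * z)), hlog.eventually_ge_atTop (E2 * K)] with T hT hL1 hL2 hL3 hL4 hL5
  set L := Real.log (T : ℝ)
  have hL0 : 0 < L := by linarith
  have hT1 : (1:ℝ) ≤ T := by exact_mod_cast hT
  have hTe : (T:ℝ) = Real.exp L := (Real.exp_log (by linarith)).symm
  set x := Real.exp (L / (16 * K)) with hx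
  have hx1 : 1 ≤ x := Real.one_le_exp (by positivity)
  set w := ⌈x⌉₊ with hw
  have hwx : x ≤ w := Nat.le_ceil x
  have hwx2 : (w:ℝ) ≤ 2 * x := by
    have := Nat.ceil_lt_add_one (show 0 ≤ x by linarith); linarith
  have hw1 : 1 ≤ w := by
    have : (1:ℝ) ≤ w := hx1.trans hwx
    exact_mod_cast this
  have hwi : ((i0:ℝ) + w0) ≤ w := by
    refine le_trans ?_ hwx
    have h1 := Real.add_one_le_exp (L / (16 * K))
    have : ((i0:ℝ) + w0) ≤ L / (16 * K) := by rw [le_div_iff₀ (by positivity)]; linarith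
    linarith
  have hwi' : i0 + w0 ≤ w := by exact_mod_cast hwi
  have hlogK : 0 < Real.log (17 * K) := Real.log_pos (by linarith)
  have hlogK2 : Real.log (17 * K) * K ≤ L / 2 := by linarith
  have hlogK3 : Real.log (17 * K) ≤ L / 2 / K := by rw [le_div_iff₀ hK0]; exact hlogK2
  have hlogK4 : Real.log (17 * K) ≤ L / 4 := by
    refine hlogK3.trans ?_
    rw [div_le_iff₀ hK0]; nlinarith
  -- w is small
  have hwT : (w:ℝ) ≤ T * z := by
    have : 2 * x * K ≤ T := by
      rw [hTe, hx]
      have h2K : 2 * (K:ℝ) ≤ Real.exp (L / 4) := by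
        calc 2 * (K:ℝ) ≤ 17 * K := by linarith
          _ = Real.exp (Real.log (17 * K)) := (Real.exp_log (by positivity)).symm
          _ ≤ _ := Real.exp_le_exp.2 hlogK4
      have h16 : L / (16 * K) ≤ L / 4 := by gcongr; linarith
      calc 2 * Real.exp (L / (16 * K)) * K = Real.exp (L / (16 * K)) * (2 * K) := by ring
        _ ≤ Real.exp (L / 4) * Real.exp (L / 4) := by gcongr
        _ = Real.exp (L / 2) := by rw [← Real.exp_add]; ring_nf
        _ ≤ _ := Real.exp_le_exp.2 (by linarith)
    rw [hz, mul_one_div, le_div_iff₀ hK0]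
    nlinarith
  have hwlog : L / (16 * K) ≤ Real.log w := by
    rw [Real.le_log_iff_exp_le (by linarith)]; exact hwx
  have hcw : cT 4 w ≤ A * (16 * K) * w / L := by
    refine (hw0 w (by omega)).trans ?_
    calc A * w / Real.log w ≤ A * w / (L / (16 * K)) := by gcongr
      _ = _ := by field_simp
  set q := T / w + 1 with hq
  have hwq1 : T ≤ w * q := by
    have h1 := Nat.div_add_mod T w
    have h2 := Nat.mod_lt T (show 0 < w by omega)
    rw [hq, Nat.mul_succ]; omega
  have hwq2 : (w:ℝ) * q ≤ T + w := by
    have : w * q ≤ T + w := by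
      rw [hq, Nat.mul_succ]; have := Nat.mul_div_le T w; omega
    exact_mod_cast this
  set M := T / K with hM
  have hM1 : (M:ℝ) ≤ T * z := by rw [hz, mul_one_div]; exact Nat.cast_div_le
  have hM2 : (T:ℝ) / K ≤ M + 1 := by
    rw [div_le_iff₀ hK0]
    have h1 := Nat.lt_mul_div_succ T (show 0 < K by omega)
    have : (T:ℝ) < K * ((M:ℝ) + 1) := by exact_mod_cast h1
    linarith
  set W := w ^ 4 with hW
  have hwW : w ≤ W := Nat.le_self_pow (by norm_num) w
  -- lower bound on m
  set m := mq K W M with hm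
  have hm1 : c * L ≤ m := by
    refine le_trans ?_ (hi0 K (by omega) W (by omega) M)
    have hW1 : (W:ℝ) + 1 ≤ 17 * Real.exp (L / (4 * K)) := by
      have e : Real.exp (L / (4 * K)) = x ^ 4 := by
        rw [hx, ← Real.exp_nat_mul]; congr 1; push_cast; field_simp; norm_num
      rw [e, hW]; push_cast
      have h1 : (w:ℝ) ^ 4 ≤ (2 * x) ^ 4 := by gcongr
      have h2 : 1 ≤ x ^ 4 := one_le_pow₀ hx1
      nlinarith
    have h1 : Real.log ((W:ℝ) + 1) ≤ Real.log 17 + L / (4 * K) := by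
      refine (Real.log_le_log (by positivity) hW1).trans ?_
      rw [Real.log_mul (by norm_num) (Real.exp_pos _).ne', Real.log_exp]
    have h2 : L - Real.log K ≤ Real.log ((W:ℝ) + M + 1) := by
      rw [← Real.log_div (by positivity) hK0.ne']
      refine Real.log_le_log (by positivity) ?_
      have : (0:ℝ) ≤ W := by positivity
      linarith
    have h3 : Real.log (17 * K) = Real.log 17 + Real.log K := Real.log_mul (by norm_num) hK0.ne'
    have h4 : (1 - z) * L ≤ Real.log ((W:ℝ) + M + 1) - Real.log ((W:ℝ) + 1) := by
      have e1 : L / (4 * K) = z * L / 4 := by rw [hz]; field_simp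
      have e2 : L / 2 / K = z * L / 2 := by rw [hz]; field_simp
      have : 0 ≤ z * L := by positivity
      have e3 : (1 - z) * L = L - z * L := by ring
      linarith
    have e : c * L = κ * (1 - z) * (1 - z) * ((1 - z) * L) := by rw [hc]; ring
    rw [e]
    gcongr
  have hm0 : 0 < m := lt_of_lt_of_le (by positivity) hm1
  have hg : w * Gam C K W M ≤ C' := by
    have h1 : ((W : ℝ) + 1) ^ (-(1/2) : ℝ) ≤ 1 / w := by
      have hw00 : (0:ℝ) < w := by linarith
      calc ((W : ℝ) + 1) ^ (-(1/2) : ℝ) ≤ ((w:ℝ) ^ (2:ℝ)) ^ (-(1/2) : ℝ) := by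
            refine Real.rpow_le_rpow_of_nonpos (by positivity) ?_ (by norm_num)
            rw [hW]; push_cast
            have : (w:ℝ) ^ (2:ℝ) = (w:ℝ) ^ 2 := by norm_cast
            rw [this]
            have : (w:ℝ) ^ 2 ≤ (w:ℝ) ^ 4 := pow_le_pow_right₀ (by linarith) (by norm_num)
            linarith
        _ = 1 / w := by rw [← Real.rpow_mul hw00.le]; norm_num; rw [Real.rpow_neg_one]
    have hw00 : (0:ℝ) < w := by linarith
    calc w * Gam C K W M ≤ w * (C' * (1 / w)) := by
          gcongr
          exact (hGam W M).trans (by gcongr)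
      _ = C' := by field_simp
  have hC'm : C' ≤ z * (1 - z) * m := by
    rw [div_le_iff₀ (by positivity)] at hL4
    have : z * (1 - z) * (c * L) ≤ z * (1 - z) * m := by gcongr
    linarith
  have hD : 2 * (1 - z) ^ 2 * m ≤ 2 * (m - z * m) - 2 * (w * Gam C K W M) := by
    have e : 2 * (m - z * m) - 2 * (1 - z) ^ 2 * m = 2 * (z * (1 - z) * m) := by ring
    linarith
  have st := mean_step C hC hL K W M w q (Nat.le_add_left 1 _) _ (z * m) (2 * (1 - z) ^ 2 * m) (hV W M) (by positivity) (by positivity) hD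
  refine (cT_mono hwq1).trans (st.trans ?_)
  have hlog2 : 1 + Real.log ((M:ℝ) + 1) ≤ 3 * L := by
    have hMT : (M:ℝ) ≤ T := by
      refine hM1.trans ?_
      nlinarith
    have : Real.log ((M:ℝ) + 1) ≤ Real.log (2 * T) := Real.log_le_log (by positivity) (by linarith)
    rw [Real.log_mul (by norm_num) (by positivity)] at this
    have h2 := Real.log_two_lt_d9
    linarith
  have hlog3 : 0 ≤ 1 + Real.log ((M:ℝ) + 1) := by
    have := Real.log_nonneg (show (1:ℝ) ≤ (M:ℝ) + 1 by linarith [show (0:ℝ) ≤ M by positivity]); linarith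
  have t1 : ((w:ℝ) * q + 2 * M + 1) / (2 * (1 - z) ^ 2 * m) ≤ (1 + 4 / K) / (2 * κ * (1 - z) ^ 5) * (T / L) := by
    have hTz : 1 ≤ T * z := le_trans (by exact_mod_cast hw1) hwT
    calc ((w:ℝ) * q + 2 * M + 1) / (2 * (1 - z) ^ 2 * m) ≤ (T * (1 + 4 * z)) / (2 * (1 - z) ^ 2 * (c * L)) := by
          gcongr
          linarith
      _ = _ := by rw [hc, show 4 / (K:ℝ) = 4 * z by rw [hz]; ring]; field_simp
  have t2 : (q:ℝ) * (2 * (CV * (1 + Real.log ((M:ℝ) + 1)) / (z * m) ^ 2) * cT 4 w) ≤ z * (T / L) := by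
    have hqw : (q:ℝ) * w ≤ 2 * T := by
      have : T * z ≤ T := by nlinarith
      linarith
    have cw0 := cT_nonneg (d := 4) w
    calc (q:ℝ) * (2 * (CV * (1 + Real.log ((M:ℝ) + 1)) / (z * m) ^ 2) * cT 4 w)
        ≤ (q:ℝ) * (2 * (CV * (3 * L) / (z * (c * L)) ^ 2) * (A * (16 * K) * w / L)) := by gcongr
      _ = 2 * (CV * (3 * L) / (z * (c * L)) ^ 2) * (A * (16 * K) / L) * (q * w) := by ring
      _ ≤ 2 * (CV * (3 * L) / (z * (c * L)) ^ 2) * (A * (16 * K) / L) * (2 * T) := by gcongr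
      _ = E2 / L * (T / L) := by rw [hE2]; field_simp
      _ ≤ z * (T / L) := by
        gcongr
        rw [div_le_iff₀ hL0, hz]
        rw [one_div_mul_eq_div, le_div_iff₀ hK0]; exact hL5
  calc _ ≤ _ := add_le_add t1 t2
    _ = _ := by ring

lemma mean_four : ∃ e : ℝ, 0 < e ∧ Tendsto (fun T : ℕ => cT 4 T * Real.log T / T) atTop (𝓝 e) := by
  obtain ⟨κ, hκ, hG⟩ := Gt4_lim
  obtain ⟨A, hA, hcr⟩ := mean4_crude hκ hG
  refine ⟨1 / (2 * κ), by positivity, ?_⟩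
  have hlog : Tendsto (fun T : ℕ => Real.log (T : ℝ)) atTop atTop :=
    Real.tendsto_log_atTop.comp tendsto_natCast_atTop_atTop
  rw [tendsto_order]
  constructor
  · intro a ha
    have h := (enT4_lim hG).inv₀ (by positivity)
    rw [← one_div] at h
    filter_upwards [h.eventually (lt_mem_nhds ha), eventually_ge_atTop 1, hlog.eventually_ge_atTop 1] with T h1 hT hL
    refine h1.trans_le ?_
    have hT' : (1:ℝ) ≤ T := by exact_mod_cast hT
    have he := enT_pos (d := 4) T
    have hl := cT_lower (d := 4) T
    rw [inv_div, le_div_iff₀ (by positivity)]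
    calc Real.log T / enT 4 T * T = T / enT 4 T * Real.log T := by ring
      _ ≤ ((T:ℝ) + 1) / enT 4 T * Real.log T := by gcongr; linarith
      _ ≤ _ := by gcongr
  · intro a ha
    have hlim : Tendsto (fun K : ℕ => ((1 + 4 * (1 / (K:ℝ))) / (2 * κ * (1 - 1 / (K:ℝ)) ^ 5) + 1 / (K:ℝ))) atTop
        (𝓝 ((1 + 4 * 0) / (2 * κ * (1 - 0) ^ 5) + 0)) := by
      have h0 : Tendsto (fun K : ℕ => 1 / (K:ℝ)) atTop (𝓝 0) := tendsto_const_div_atTop_nhds_zero_nat 1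
      refine Tendsto.add (Tendsto.div ((h0.const_mul 4).const_add 1) (((h0.const_sub 1).pow 5).const_mul _) ?_) h0
      simp; exact hκ.ne'
    obtain ⟨K, hK1, hK2⟩ := ((hlim.eventually (gt_mem_nhds (by simpa using ha))).and (eventually_ge_atTop 2)).exists
    filter_upwards [mean4_pass hκ hG hA hcr K hK2, eventually_ge_atTop 1, hlog.eventually_ge_atTop 1] with T h1 hT hL
    refine lt_of_le_of_lt ?_ hK1
    have hT' : (1:ℝ) ≤ T := by exact_mod_cast hT
    rw [div_le_iff₀ (by positivity)]
    calc cT 4 T * Real.log T ≤ _ := mul_le_mul_of_nonneg_right h1 (by linarith)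
      _ = _ := by field_simp


lemma sum_biUnion_le' {ι α : Type*} [DecidableEq α] (s : Finset ι) (A : ι → Finset α) (f : α → ℝ) (hf : ∀ x, 0 ≤ f x) :
    ∑ a ∈ s.biUnion A, f a ≤ ∑ i ∈ s, ∑ a ∈ A i, f a := by
  classical
  induction s using Finset.induction_on with
  | empty => simp
  | insert a s ha ih =>
    rw [Finset.biUnion_insert, Finset.sum_insert ha]
    have := Finset.sum_union_inter (s₁ := A a) (s₂ := s.biUnion A) (f := f)
    have h0 : 0 ≤ ∑ x ∈ A a ∩ s.biUnion A, f x := Finset.sum_nonneg fun _ _ => hf _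
    linarith

section dec
variable {d : ℕ} [Fact (4 ≤ d)]

/-- block sums weighted with block capacities -/
def Sb (w q : ℕ) (φ : Zd d → ℝ) (l : List (Stp d)) : ℝ :=
  ∑ i ∈ Finset.range q, cp (rng ((l.drop (w * i)).take w)) * φ (endp (l.take (w * i)))

/-- plain block sums -/
def Ub (w q : ℕ) (φ : Zd d → ℝ) (l : List (Stp d)) : ℝ :=
  ∑ i ∈ Finset.range q, φ (endp (l.take (w * i)))

lemma Sb_cons (w q : ℕ) (φ : Zd d → ℝ) (b l : List (Stp d)) (hb : b.length = w) :
    Sb w (q + 1) φ (b ++ l) = cp (rng b) * φ 0 + Sb w q (fun x => φ (endp b + x)) l := by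
  rw [Sb, Finset.sum_range_succ', add_comm]
  congr 1
  · simp [← hb]
  · refine Finset.sum_congr rfl fun i _ => ?_
    rw [show w * (i + 1) = b.length + w * i by rw [hb]; ring, List.take_length_add_append, endp_append,
      List.drop_length_add_append]

lemma Ub_cons (w q : ℕ) (φ : Zd d → ℝ) (b l : List (Stp d)) (hb : b.length = w) :
    Ub w (q + 1) φ (b ++ l) = φ 0 + Ub w q (fun x => φ (endp b + x)) l := by
  rw [Ub, Finset.sum_range_succ', add_comm]
  congr 1
  · refine Finset.sum_congr rfl fun i _ => ?_
    rw [show w * (i + 1) = b.length + w * i by rw [hb]; ring, List.take_length_add_append, endp_append]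

lemma Ub_nonneg (w q : ℕ) (φ : Zd d → ℝ) (hφ : ∀ x, 0 ≤ φ x) (l : List (Stp d)) : 0 ≤ Ub w q φ l :=
  Finset.sum_nonneg fun _ _ => hφ _

lemma Sb_mean (w q : ℕ) (φ : Zd d → ℝ) : Ex (w * q) (Sb w q φ) = cT d w * Ex (w * q) (Ub w q φ) := by
  induction q generalizing φ with
  | zero => simp [Ex, Sb, Ub]
  | succ q ih =>
    rw [show w * (q + 1) = w + w * q by ring, Ex_append, Ex_append]
    rw [Ex_congr (g := fun b => cp (rng b) * φ 0 + cT d w * Ex (w * q) (Ub w q (fun x => φ (endp b + x))))]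
    · rw [Ex_congr (f := fun l1 => Ex (w * q) fun l2 => Ub w (q + 1) φ (l1 ++ l2))
        (g := fun b => φ 0 + Ex (w * q) (Ub w q (fun x => φ (endp b + x))))]
      · rw [Ex_add, Ex_add, Ex_mul_right, Ex_mul_left, Ex_const]
        rw [← cT]; ring
      · intro b hb
        rw [Ex_congr fun l _ => Ub_cons w q φ b l hb, Ex_add, Ex_const]
    · intro b hb
      rw [Ex_congr fun l _ => Sb_cons w q φ b l hb, Ex_add, Ex_const]
      congr 1
      exact ih _

lemma decouple (w q : ℕ) (φ : Zd d → ℝ) (g K2 : ℝ) (hg : 0 ≤ g) (hφ : ∀ x, 0 ≤ φ x)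
    (hv : ∀ x (b : List (Stp d)), b.length ≤ w → φ (x + endp b) ≤ φ x + g)
    (hK : 1 ≤ K2) (hK2 : Ex (d := d) w (fun l => cp (rng l) ^ 2) ≤ K2 * cT d w ^ 2) :
    Ex (w * q) (fun l => Sb w q φ l ^ 2) ≤ K2 * cT d w ^ 2 * Ex (w * q) (fun l => Ub w q (fun x => φ x + 2 * g) l ^ 2) := by
  have hc := cT_nonneg (d := d) w
  set c := cT d w with hcdef
  induction q generalizing φ with
  | zero => simp [Ex, Sb, Ub]
  | succ q ih =>
    rw [show w * (q + 1) = w + w * q by ring, Ex_append, Ex_append, ← Ex_mul_left]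
    set φb : List (Stp d) → Zd d → ℝ := fun b x => φ (endp b + x) with hφb
    set P : List (Stp d) → List (Stp d) → ℝ := fun b l => Ub w q (fun x => φb b x + 2 * g) l with hP
    have P0 : ∀ b l, 0 ≤ P b l := fun b l => Ub_nonneg _ _ _ (fun x => add_nonneg (hφ _) (by linarith)) _
    -- third term
    have t3 : ∀ b : List (Stp d), Ex (w * q) (fun l => Sb w q (φb b) l ^ 2) ≤ K2 * c ^ 2 * Ex (w * q) (fun l => P b l ^ 2) := by
      intro b
      exact ih (φb b) (fun x => hφ _) (fun x b' hb' => by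
        have := hv (endp b + x) b' hb'
        simpa only [hφb, add_assoc] using this)
    -- second term
    set R : ℝ := Ex (w * q) (fun l => Ub w q (fun x => φ x + g) l) with hR
    have t2 : ∀ b : List (Stp d), b.length = w → Ex (w * q) (fun l => Sb w q (φb b) l) ≤ c * R := by
      intro b hb
      have := Sb_mean w q (φb b)
      refine this.le.trans (mul_le_mul_of_nonneg_left (Ex_mono fun l _ => ?_) hc)
      refine Finset.sum_le_sum fun i _ => ?_
      have := hv (endp (l.take (w * i))) b hb.le
      rw [add_comm] at this
      exact this
    have t2' : ∀ b : List (Stp d), b.length = w → R ≤ Ex (w * q) (fun l => P b l) := by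
      intro b hb
      refine Ex_mono fun l _ => Finset.sum_le_sum fun i _ => ?_
      have := hv (endp b + endp (l.take (w * i))) (rv b) (by rw [length_rv]; exact hb.le)
      rw [endp_rv, show endp b + endp (l.take (w * i)) + -endp b = endp (l.take (w * i)) by abel] at this
      simp only [hφb]; linarith
    have R0 : 0 ≤ R := Ex_nonneg fun l _ => Ub_nonneg _ _ _ (fun x => add_nonneg (hφ _) hg) _
    have lhs : Ex w (fun b => Ex (w * q) fun l => Sb w (q + 1) φ (b ++ l) ^ 2) ≤
        Ex w (fun b => cp (rng b) ^ 2 * φ 0 ^ 2 + (cp (rng b) * (2 * φ 0 * (c * R)) + K2 * c ^ 2 * Ex (w * q) (fun l => P b l ^ 2))) := by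
      refine Ex_mono fun b hb => ?_
      rw [Ex_congr (g := fun l => cp (rng b) ^ 2 * φ 0 ^ 2 + (cp (rng b) * (2 * φ 0) * Sb w q (φb b) l + Sb w q (φb b) l ^ 2))]
      · rw [Ex_add, Ex_add, Ex_const, Ex_mul_left]
        have h1 := t3 b
        have h2 := mul_le_mul_of_nonneg_left (t2 b hb) (show 0 ≤ cp (rng b) * (2 * φ 0) from
          mul_nonneg (cp_nonneg _) (by linarith [hφ 0]))
        linarith
      · intro l _
        rw [Sb_cons w q φ b l hb]; ring
    refine lhs.trans ?_
    rw [Ex_add, Ex_add, Ex_mul_right, Ex_mul_right]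
    have rhs : ∀ b : List (Stp d), b.length = w → K2 * c ^ 2 * φ 0 ^ 2 + (c * (2 * φ 0 * (c * R)) + K2 * c ^ 2 * Ex (w * q) (fun l => P b l ^ 2))
        ≤ K2 * c ^ 2 * Ex (w * q) fun l => Ub w (q + 1) (fun x => φ x + 2 * g) (b ++ l) ^ 2 := by
      intro b hb
      have h1 : Ex (w * q) (fun l => φ 0 ^ 2 + (2 * φ 0 * P b l + P b l ^ 2)) ≤
          Ex (w * q) fun l => Ub w (q + 1) (fun x => φ x + 2 * g) (b ++ l) ^ 2 := by
        refine Ex_mono fun l _ => ?_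
        rw [Ub_cons w q _ b l hb]
        have p0 := P0 b l
        have f0 := hφ 0
        calc φ 0 ^ 2 + (2 * φ 0 * P b l + P b l ^ 2) = (φ 0 + P b l) ^ 2 := by ring
          _ ≤ (φ 0 + 2 * g + P b l) ^ 2 := by gcongr; linarith
          _ = _ := rfl
      rw [Ex_add, Ex_add, Ex_const, Ex_mul_left] at h1
      refine le_trans ?_ (mul_le_mul_of_nonneg_left h1 (by positivity))
      have h2 := t2' b hb
      have f0 := hφ 0
      have h3 : c * (2 * φ 0 * (c * R)) ≤ K2 * c ^ 2 * (2 * φ 0 * Ex (w * q) (fun l => P b l)) := by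
        calc c * (2 * φ 0 * (c * R)) = 1 * c ^ 2 * (2 * φ 0 * R) := by ring
          _ ≤ _ := by gcongr
      nlinarith
    have r2 := Ex_mono rhs
    rw [Ex_add, Ex_add, Ex_const, Ex_const] at r2
    refine le_trans ?_ r2
    have : Ex (d := d) w (fun l => cp (rng l) ^ 2) * φ 0 ^ 2 ≤ K2 * c ^ 2 * φ 0 ^ 2 := by gcongr
    have e : Ex (d := d) w (fun l => cp (rng l)) = c := rfl
    rw [e]
    linarith

/-- equilibrium sums are dominated by block sums -/
lemma ee_blocks (w q : ℕ) (hq : 1 ≤ q) (φ : Zd d → ℝ) (g : ℝ) (hφ : ∀ x, 0 ≤ φ x)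
    (hv : ∀ x (b : List (Stp d)), b.length ≤ w → φ (x + endp b) ≤ φ x + g) (l : List (Stp d)) (hl : l.length = w * q) :
    ∑ a ∈ rng l, ee (rng l) a * φ a ≤ Sb w q (fun x => φ x + g) l := by
  set A : ℕ → Finset (Zd d) := fun i => sh (endp (l.take (0 + w * i))) (rng ((l.drop (0 + w * i)).take w)) with hA
  have hcov : rng l ⊆ (Finset.range q).biUnion A := by
    have := cover l 0 w q hq
    rw [← hl] at this
    simpa [sh_zero, hA] using this
  have hsub : ∀ i < q, A i ⊆ rng l := by
    intro i hi
    have e : l = l.take (0 + w * i) ++ ((l.drop (0 + w * i)).take w ++ (l.drop (0 + w * i)).drop w) := by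
      rw [List.take_append_drop, List.take_append_drop]
    rw [e, rng_append, rng_append, sh_union]
    simp only [hA]
    exact Finset.subset_union_left.trans Finset.subset_union_right
  calc ∑ a ∈ rng l, ee (rng l) a * φ a ≤ ∑ a ∈ (Finset.range q).biUnion A, ee (rng l) a * φ a :=
        Finset.sum_le_sum_of_subset_of_nonneg hcov fun _ _ _ => mul_nonneg (ee_nonneg _ _) (hφ _)
    _ ≤ ∑ i ∈ Finset.range q, ∑ a ∈ A i, ee (rng l) a * φ a :=
        sum_biUnion_le' _ _ _ fun _ => mul_nonneg (ee_nonneg _ _) (hφ _)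
    _ ≤ ∑ i ∈ Finset.range q, ∑ a ∈ A i, ee (A i) a * (φ (endp (l.take (w * i))) + g) := by
        refine Finset.sum_le_sum fun i hi => Finset.sum_le_sum fun a ha => ?_
        refine mul_le_mul (ee_anti (hsub i (Finset.mem_range.1 hi)) ha) ?_ (hφ _) (ee_nonneg _ _)
        simp only [hA, sh, Finset.mem_image, zero_add] at ha
        obtain ⟨z, hz, rfl⟩ := ha
        obtain ⟨k, hk, rfl⟩ := mem_rng.1 hz
        exact hv _ _ (by simp)
    _ = _ := by
        refine Finset.sum_congr rfl fun i _ => ?_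
        rw [← Finset.sum_mul]
        congr 1
        change cp (A i) = _
        simp only [hA, cp_sh, zero_add]
end dec


section far
variable {d : ℕ} [Fact (4 ≤ d)] (w q : ℕ) (H : Zd d → ℝ) (g : ℝ) (hg : 0 ≤ g) (H0 : ∀ x, 0 ≤ H x) (Hn : ∀ x, H (-x) = H x)
  (hv : ∀ x (b : List (Stp d)), b.length ≤ w → H (x + endp b) ≤ H x + g)
include hg H0 Hn hv

lemma far_var1 (c : ℝ) (y x : Zd d) (b : List (Stp d)) (hb : b.length ≤ w) : H (x + endp b - y) + c ≤ H (x - y) + c + g := by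
  have := hv (x - y) b hb
  rw [show x + endp b - y = x - y + endp b by abel]; linarith

lemma far_var2 (c : ℝ) (x y : Zd d) (b : List (Stp d)) (hb : b.length ≤ w) : H (x - (y + endp b)) + c ≤ H (x - y) + c + g := by
  have := hv (y - x) b hb
  rw [show x - (y + endp b) = -(y - x + endp b) by abel, Hn, show x - y = -(y - x) by abel, Hn (y - x)]; linarith

lemma far_pt (hq : 1 ≤ q) (l l' : List (Stp d)) (hl : l.length = w * q) (hl' : l'.length = w * q) :
    ∑ a ∈ rng l, ee (rng l) a * ∑ b ∈ rng l', ee (rng l') b * H (a - b) ≤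
      Sb w q (fun x => Sb w q (fun y => H (x - y) + 2 * g) l') l := by
  have h1 : ∀ a, ∑ b ∈ rng l', ee (rng l') b * H (a - b) ≤ Sb w q (fun y => H (a - y) + g) l' := by
    intro a
    refine ee_blocks w q hq (fun y => H (a - y)) g (fun _ => H0 _) (fun x b hb => ?_) l' hl'
    simpa using far_var2 w H g hg H0 Hn hv 0 a x b hb
  set a' : ℕ → ℝ := fun i => cp (rng ((l'.drop (w * i)).take w)) with ha'
  have a0 : ∀ i, 0 ≤ a' i := fun i => cp_nonneg _
  have h2 := ee_blocks w q hq (fun a => Sb w q (fun y => H (a - y) + g) l') (Sb w q (fun _ => g) l')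
    (fun x => Finset.sum_nonneg fun i _ => mul_nonneg (a0 i) (add_nonneg (H0 _) hg)) (fun x b hb => by
      rw [Sb, Sb, Sb, ← Finset.sum_add_distrib]
      refine Finset.sum_le_sum fun i _ => ?_
      rw [← mul_add]
      exact mul_le_mul_of_nonneg_left (far_var1 w H g hg H0 Hn hv _ _ _ _ hb) (a0 i)) l hl
  refine (Finset.sum_le_sum fun a _ => mul_le_mul_of_nonneg_left (h1 a) (ee_nonneg _ _)).trans (h2.trans (le_of_eq ?_))
  congr 1; ext x
  rw [Sb, Sb, Sb, ← Finset.sum_add_distrib]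
  refine Finset.sum_congr rfl fun i _ => ?_
  ring

lemma far_sq (K2 : ℝ) (hK : 1 ≤ K2) (hK2 : Ex (d := d) w (fun l => cp (rng l) ^ 2) ≤ K2 * cT d w ^ 2) :
    Ex (w * q) (fun l => Ex (w * q) fun l' => Sb w q (fun x => Sb w q (fun y => H (x - y) + 2 * g) l') l ^ 2) ≤
      (K2 * cT d w ^ 2) ^ 2 * Ex (w * q) (fun l => Ex (w * q) fun l' => Ub w q (fun x => Ub w q (fun y => H (x - y) + 6 * g) l') l ^ 2) := by
  have step1 : ∀ l' : List (Stp d), Ex (w * q) (fun l => Sb w q (fun x => Sb w q (fun y => H (x - y) + 2 * g) l') l ^ 2) ≤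
      K2 * cT d w ^ 2 * Ex (w * q) (fun l => Sb w q (fun y => Ub w q (fun x => H (x - y) + 4 * g) l) l' ^ 2) := by
    intro l'
    have a0 : ∀ i, 0 ≤ cp (rng ((l'.drop (w * i)).take w)) := fun i => cp_nonneg _
    have := decouple w q (fun x => Sb w q (fun y => H (x - y) + 2 * g) l') (Sb w q (fun _ => g) l') K2
      (Finset.sum_nonneg fun i _ => mul_nonneg (a0 i) hg)
      (fun x => Finset.sum_nonneg fun i _ => mul_nonneg (a0 i) (add_nonneg (H0 _) (by linarith))) (fun x b hb => by
      rw [Sb, Sb, Sb, ← Finset.sum_add_distrib]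
      refine Finset.sum_le_sum fun i _ => ?_
      rw [← mul_add]
      exact mul_le_mul_of_nonneg_left (far_var1 w H g hg H0 Hn hv _ _ _ _ hb) (a0 i)) hK hK2
    refine this.trans (le_of_eq ?_)
    congr 2; ext l; congr 1
    simp only [Ub, Sb, Finset.mul_sum, ← Finset.sum_add_distrib]
    rw [Finset.sum_comm]
    refine Finset.sum_congr rfl fun i _ => Finset.sum_congr rfl fun j _ => ?_
    ring
  have step2 : ∀ l : List (Stp d), Ex (w * q) (fun l' => Sb w q (fun y => Ub w q (fun x => H (x - y) + 4 * g) l) l' ^ 2) ≤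
      K2 * cT d w ^ 2 * Ex (w * q) (fun l' => Ub w q (fun x => Ub w q (fun y => H (x - y) + 6 * g) l') l ^ 2) := by
    intro l
    have := decouple w q (fun y => Ub w q (fun x => H (x - y) + 4 * g) l) (Ub w q (fun _ => g) l) K2
      (Finset.sum_nonneg fun i _ => hg)
      (fun x => Finset.sum_nonneg fun i _ => (add_nonneg (H0 _) (by linarith))) (fun x b hb => by
      rw [Ub, Ub, Ub, ← Finset.sum_add_distrib]
      refine Finset.sum_le_sum fun i _ => ?_
      exact far_var2 w H g hg H0 Hn hv _ _ _ _ hb) hK hK2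
    refine this.trans (le_of_eq ?_)
    congr 2; ext l'; congr 1
    simp only [Ub, Finset.mul_sum, ← Finset.sum_add_distrib]
    rw [Finset.sum_comm]
    refine Finset.sum_congr rfl fun i _ => Finset.sum_congr rfl fun j _ => ?_
    ring
  have k0 : 0 ≤ K2 * cT d w ^ 2 := by positivity
  rw [Ex_swap]
  refine (Ex_mono fun l' _ => step1 l').trans ?_
  rw [Ex_mul_left, Ex_swap]
  refine (mul_le_mul_of_nonneg_left (Ex_mono fun l _ => step2 l) k0).trans (le_of_eq ?_)
  rw [Ex_mul_left]; ring

omit hg H0 Hn hv in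
lemma Ub_pts (φ : Zd d → ℝ) (gφ : ℝ) (hvφ : ∀ x (b : List (Stp d)), b.length ≤ w → φ (x + endp b) ≤ φ x + gφ) (l : List (Stp d)) :
    w * Ub w q φ l ≤ ∑ k ∈ Finset.range (w * q), (φ (endp (l.take k)) + gφ) := by
  induction q with
  | zero => simp [Ub]
  | succ q ih =>
    rw [Nat.mul_succ, Finset.sum_range_add, Ub, Finset.sum_range_succ, mul_add]
    refine add_le_add ih ?_
    calc (w:ℝ) * φ (endp (l.take (w * q))) = ∑ k ∈ Finset.range w, φ (endp (l.take (w * q))) := by simp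
      _ ≤ _ := by
        refine Finset.sum_le_sum fun k hk => ?_
        have hk := Finset.mem_range.1 hk
        have := hvφ (endp (l.take (w * q + k))) (rv ((l.drop (w * q)).take k)) (by rw [length_rv]; simp; omega)
        rw [endp_rv, List.take_add, endp_append, add_neg_cancel_right] at this
        rw [List.take_add, endp_append]; exact this

lemma Ub2_pts (l l' : List (Stp d)) :
    (w:ℝ) ^ 2 * Ub w q (fun x => Ub w q (fun y => H (x - y) + 6 * g) l') l ≤
      ∑ k ∈ Finset.range (w * q), ∑ m ∈ Finset.range (w * q), (H (endp (l.take k) - endp (l'.take m)) + 8 * g) := by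
  have h1 : (w:ℝ) * Ub w q (fun x => Ub w q (fun y => H (x - y) + 6 * g) l') l ≤
      Ub w q (fun x => ∑ m ∈ Finset.range (w * q), (H (x - endp (l'.take m)) + 7 * g)) l := by
    rw [Ub, Finset.mul_sum]
    refine Finset.sum_le_sum fun i _ => ?_
    refine (Ub_pts w q _ g (fun x b hb => far_var2 w H g hg H0 Hn hv (6 * g) _ x b hb) l').trans (le_of_eq ?_)
    refine Finset.sum_congr rfl fun m _ => ?_
    ring
  have h2 := Ub_pts w q (fun x => ∑ m ∈ Finset.range (w * q), (H (x - endp (l'.take m)) + 7 * g))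
    (∑ m ∈ Finset.range (w * q), g) (fun x b hb => by
      rw [← Finset.sum_add_distrib]
      exact Finset.sum_le_sum fun m _ => far_var1 w H g hg H0 Hn hv _ _ _ _ hb) l
  calc (w:ℝ) ^ 2 * Ub w q (fun x => Ub w q (fun y => H (x - y) + 6 * g) l') l
      = w * (w * Ub w q (fun x => Ub w q (fun y => H (x - y) + 6 * g) l') l) := by ring
    _ ≤ w * Ub w q (fun x => ∑ m ∈ Finset.range (w * q), (H (x - endp (l'.take m)) + 7 * g)) l := by gcongr
    _ ≤ _ := h2
    _ = _ := by
      refine Finset.sum_congr rfl fun k _ => ?_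
      rw [← Finset.sum_add_distrib]
      refine Finset.sum_congr rfl fun m _ => ?_
      ring

lemma far_main (hq : 1 ≤ q) (K2 S : ℝ) (hK : 1 ≤ K2) (hK2 : Ex (d := d) w (fun l => cp (rng l) ^ 2) ≤ K2 * cT d w ^ 2)
    (hS : Ex (d := d) (w * q) (fun l => Ex (w * q) fun l' => (∑ i ∈ Finset.range (w * q + 1), ∑ j ∈ Finset.range (w * q + 1),
      H (endp (l.take i) - endp (l'.take j))) ^ 2) ≤ S) :
    (w:ℝ) ^ 4 * Ex (d := d) (w * q) (fun l => Ex (w * q) fun l' =>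
      (∑ a ∈ rng l, ee (rng l) a * ∑ b ∈ rng l', ee (rng l') b * H (a - b)) ^ 2) ≤
    (K2 * cT d w ^ 2) ^ 2 * (2 * S + 2 * (8 * g * ((w:ℝ) * q) ^ 2) ^ 2) := by
  have h1 : Ex (d := d) (w * q) (fun l => Ex (w * q) fun l' =>
      (∑ a ∈ rng l, ee (rng l) a * ∑ b ∈ rng l', ee (rng l') b * H (a - b)) ^ 2) ≤
      Ex (w * q) (fun l => Ex (w * q) fun l' => Sb w q (fun x => Sb w q (fun y => H (x - y) + 2 * g) l') l ^ 2) := by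
    refine Ex_mono fun l hl => Ex_mono fun l' hl' => ?_
    refine pow_le_pow_left₀ (Finset.sum_nonneg fun a _ => mul_nonneg (ee_nonneg _ _)
      (Finset.sum_nonneg fun b _ => mul_nonneg (ee_nonneg _ _) (H0 _))) (far_pt w q H g hg H0 Hn hv hq l l' hl hl') 2
  have h2 := h1.trans (far_sq w q H g hg H0 Hn hv K2 hK hK2)
  have h3 : (w:ℝ) ^ 4 * Ex (w * q) (fun l => Ex (w * q) fun l' => Ub w q (fun x => Ub w q (fun y => H (x - y) + 6 * g) l') l ^ 2) ≤
      2 * S + 2 * (8 * g * ((w:ℝ) * q) ^ 2) ^ 2 := by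
    rw [← Ex_mul_left]
    have : ∀ l l' : List (Stp d), (w:ℝ) ^ 4 * Ub w q (fun x => Ub w q (fun y => H (x - y) + 6 * g) l') l ^ 2 ≤
        2 * (∑ i ∈ Finset.range (w * q + 1), ∑ j ∈ Finset.range (w * q + 1),
      H (endp (l.take i) - endp (l'.take j))) ^ 2 + 2 * (8 * g * ((w:ℝ) * q) ^ 2) ^ 2 := by
      intro l l'
      have a := Ub2_pts w q H g hg H0 Hn hv l l'
      have a0 : 0 ≤ (w:ℝ) ^ 2 * Ub w q (fun x => Ub w q (fun y => H (x - y) + 6 * g) l') l :=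
        mul_nonneg (by positivity) (Ub_nonneg _ _ _ (fun x => Ub_nonneg _ _ _ (fun y => add_nonneg (H0 _) (by linarith)) _) _)
      set X := ∑ i ∈ Finset.range (w * q + 1), ∑ j ∈ Finset.range (w * q + 1), H (endp (l.take i) - endp (l'.take j)) with hX
      have b : ∑ k ∈ Finset.range (w * q), ∑ m ∈ Finset.range (w * q), (H (endp (l.take k) - endp (l'.take m)) + 8 * g) ≤
          X + 8 * g * ((w:ℝ) * q) ^ 2 := by
        simp only [Finset.sum_add_distrib]
        refine add_le_add ?_ (le_of_eq ?_)
        · rw [hX]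
          refine (Finset.sum_le_sum fun k _ => Finset.sum_le_sum_of_subset_of_nonneg (Finset.range_mono (Nat.le_succ _)) fun _ _ _ => H0 _).trans ?_
          exact Finset.sum_le_sum_of_subset_of_nonneg (Finset.range_mono (Nat.le_succ _)) fun _ _ _ => Finset.sum_nonneg fun _ _ => H0 _
        · simp; ring
      have c := pow_le_pow_left₀ a0 (a.trans b) 2
      calc _ = ((w:ℝ) ^ 2 * Ub w q (fun x => Ub w q (fun y => H (x - y) + 6 * g) l') l) ^ 2 := by ring
        _ ≤ _ := c
        _ ≤ _ := by nlinarith [sq_nonneg (X - 8 * g * ((w:ℝ) * q) ^ 2)]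
    refine (Ex_mono (g := fun l => 2 * Ex (w * q) (fun l' => (∑ i ∈ Finset.range (w * q + 1), ∑ j ∈ Finset.range (w * q + 1),
      H (endp (l.take i) - endp (l'.take j))) ^ 2) + 2 * (8 * g * ((w:ℝ) * q) ^ 2) ^ 2) fun l _ => ?_).trans ?_
    · rw [← Ex_mul_left, ← Ex_mul_left]
      refine (Ex_mono fun l' _ => this l l').trans ?_
      rw [Ex_add, Ex_const]
    · rw [Ex_add, Ex_const, Ex_mul_left]; linarith
  have k0 : 0 ≤ (K2 * cT d w ^ 2) ^ 2 := by positivity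
  calc _ ≤ (w:ℝ) ^ 4 * ((K2 * cT d w ^ 2) ^ 2 * Ex (w * q) (fun l => Ex (w * q) fun l' => Ub w q (fun x => Ub w q (fun y => H (x - y) + 6 * g) l') l ^ 2)) := by gcongr
    _ = (K2 * cT d w ^ 2) ^ 2 * ((w:ℝ) ^ 4 * Ex (w * q) (fun l => Ex (w * q) fun l' => Ub w q (fun x => Ub w q (fun y => H (x - y) + 6 * g) l') l ^ 2)) := by ring
    _ ≤ _ := by gcongr
end far


lemma dsum1 (N : ℕ) : ∑ u ∈ Finset.range (N + 1), ∑ v ∈ Finset.range (N + 1),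
    (((u + v : ℕ) : ℝ) + 1) ^ (-1 : ℝ) ≤ 4 * ((N : ℝ) + 1) := by
  have h1 : ∀ u v : ℕ, (((u + v : ℕ) : ℝ) + 1) ^ (-1 : ℝ) ≤ ((u : ℝ) + 1) ^ (-(1 / 2) : ℝ) * ((v : ℝ) + 1) ^ (-(1 / 2) : ℝ) := by
    intro u v
    rw [← rp_mul (u + v) (-(1 / 2)) (-(1 / 2)) (-1) (by norm_num)]
    exact mul_le_mul (rp_anti (by norm_num) (by omega)) (rp_anti (by norm_num) (by omega)) (rp_pos _ _).le (rp_pos _ _).le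
  have h2 := sum_half (N + 1)
  have h0 : 0 ≤ ∑ i ∈ Finset.range (N + 1), ((i : ℝ) + 1) ^ (-(1 / 2) : ℝ) := Finset.sum_nonneg fun _ _ => (rp_pos _ _).le
  calc _ ≤ ∑ u ∈ Finset.range (N + 1), ∑ v ∈ Finset.range (N + 1), ((u : ℝ) + 1) ^ (-(1 / 2) : ℝ) * ((v : ℝ) + 1) ^ (-(1 / 2) : ℝ) :=
        Finset.sum_le_sum fun u _ => Finset.sum_le_sum fun v _ => h1 u v
    _ = (∑ i ∈ Finset.range (N + 1), ((i : ℝ) + 1) ^ (-(1 / 2) : ℝ)) ^ 2 := by rw [sq, Finset.sum_mul_sum]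
    _ ≤ (2 * ((N + 1 : ℕ) : ℝ) ^ (1 / 2 : ℝ)) ^ 2 := pow_le_pow_left₀ h0 h2 2
    _ = _ := by
        rw [mul_pow, ← Real.rpow_natCast (((N + 1 : ℕ) : ℝ) ^ (1 / 2 : ℝ)), ← Real.rpow_mul (by positivity)]
        push_cast; norm_num

/-- truncated Green function -/
def Fn4 (w : ℕ) (x : Zd 4) : ℝ := ∑ t ∈ Finset.range w, pk t x

lemma Fn4_nonneg (w : ℕ) (x : Zd 4) : 0 ≤ Fn4 w x := Finset.sum_nonneg fun _ _ => pk_nonneg _ _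

lemma G_Fn4 (w : ℕ) (x : Zd 4) : G x = Fn4 w x + Gt w x := by
  have := Gt_split 0 w x
  simpa [Fn4] using this

lemma near_S : ∃ C : ℝ, 0 < C ∧ ∀ w N : ℕ, Ex (d := 4) N (fun a => Ex N fun b =>
    (∑ i ∈ Finset.range (N + 1), ∑ j ∈ Finset.range (N + 1), Fn4 w (endp (a.take i) - endp (b.take j))) ^ 2)
      ≤ C * (w * ((N : ℝ) + 1)) := by
  obtain ⟨C, hC, H⟩ := pk_le 4 2 (by norm_num) (by norm_num)
  obtain ⟨D, hD, HD⟩ := dsum32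
  refine ⟨2 * (1 + 2 ^ (3 / 2 : ℝ)) * (C * 2 * D) ^ 2, by positivity, fun w N => ?_⟩
  have hw0 : (0 : ℝ) ≤ C * (2 * (w : ℝ) ^ (1 / 2 : ℝ)) := by positivity
  have key := GG2_le (d := 4) (Fn4 w) (fun u => C * (2 * (w : ℝ) ^ (1 / 2 : ℝ)) * ((u : ℝ) + 1) ^ (-(3 / 2) : ℝ))
    (Fn4_nonneg w) (fun x => by simp only [Fn4, pk_neg])
    (fun u x => by
      unfold Fn4
      rw [Ex_sum]
      simp only [pk_CK]
      calc _ ≤ ∑ t ∈ Finset.range w, C * (((u : ℝ) + 1) ^ (-(3 / 2) : ℝ)) * ((t : ℝ) + 1) ^ (-(1 / 2) : ℝ) := by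
            refine Finset.sum_le_sum fun t _ => (H _ _).trans ?_
            rw [mul_assoc]
            refine mul_le_mul_of_nonneg_left ?_ hC.le
            rw [← rp_mul (u + t) (-(3 / 2)) (-(1 / 2)) (-2) (by norm_num)]
            exact mul_le_mul (rp_anti (by norm_num) (by omega)) (rp_anti (by norm_num) (by omega)) (rp_pos _ _).le (rp_pos _ _).le
        _ ≤ C * (((u : ℝ) + 1) ^ (-(3 / 2) : ℝ)) * (2 * (w : ℝ) ^ (1 / 2 : ℝ)) := by
            rw [← Finset.mul_sum]
            exact mul_le_mul_of_nonneg_left (sum_half w) (mul_nonneg hC.le (rp_pos _ _).le)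
        _ = _ := by ring)
    (fun i j h => mul_le_mul_of_nonneg_left (rp_anti (by norm_num) h) hw0)
    (2 ^ (3 / 2 : ℝ)) (fun u v => by
      have := mul_le_mul_of_nonneg_left (powK (3 / 2) (by norm_num) u v) hw0
      linarith) N
  refine key.trans ?_
  rw [mul_assoc (2 * (1 + (2:ℝ) ^ (3 / 2 : ℝ)))]
  refine mul_le_mul_of_nonneg_left ?_ (by positivity)
  simp only [← Finset.mul_sum]
  have h6 : (((N : ℝ) + 1) ^ (1 / 2 : ℝ)) ^ 2 = (N : ℝ) + 1 := by
    rw [← Real.rpow_natCast, ← Real.rpow_mul (by positivity)]; norm_num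
  have h7 : ((w : ℝ) ^ (1 / 2 : ℝ)) ^ 2 = (w : ℝ) := by
    rw [← Real.rpow_natCast, ← Real.rpow_mul (by positivity)]; norm_num
  calc _ ≤ (C * (2 * (w : ℝ) ^ (1 / 2 : ℝ)) * (D * ((N : ℝ) + 1) ^ (1 / 2 : ℝ))) ^ 2 := by
        refine pow_le_pow_left₀ ?_ (mul_le_mul_of_nonneg_left (HD N) hw0) 2
        exact mul_nonneg hw0 (Finset.sum_nonneg fun _ _ => Finset.sum_nonneg fun _ _ => (rp_pos _ _).le)
    _ = (C * 2 * D) ^ 2 * (((w : ℝ) ^ (1 / 2 : ℝ)) ^ 2 * (((N : ℝ) + 1) ^ (1 / 2 : ℝ)) ^ 2) := by ring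
    _ = _ := by rw [h6, h7]

lemma far_S : ∃ C : ℝ, 0 < C ∧ ∀ w N : ℕ, Ex (d := 4) N (fun a => Ex N fun b =>
    (∑ i ∈ Finset.range (N + 1), ∑ j ∈ Finset.range (N + 1), Gt w (endp (a.take i) - endp (b.take j))) ^ 2)
      ≤ C * ((N : ℝ) + 1) ^ 2 := by
  obtain ⟨C, hC, H⟩ := Gt4_bound
  refine ⟨2 * (1 + 2 ^ (1 : ℝ)) * (C * 4) ^ 2, by positivity, fun w N => ?_⟩
  have key := GG2_le (d := 4) (Gt w) (fun u => C * ((u : ℝ) + 1) ^ (-1 : ℝ))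
    (Gt_nonneg w) (Gt_neg w)
    (fun u x => by
      rw [Ex_Gt]
      refine (Gt_anti (show u ≤ w + u by omega) x).trans (H u x))
    (fun i j h => mul_le_mul_of_nonneg_left (rp_anti (by norm_num) h) hC.le)
    (2 ^ (1 : ℝ)) (fun u v => by
      have := mul_le_mul_of_nonneg_left (powK 1 (by norm_num) u v) hC.le
      linarith) N
  refine key.trans ?_
  rw [mul_assoc (2 * (1 + (2:ℝ) ^ (1 : ℝ)))]
  refine mul_le_mul_of_nonneg_left ?_ (by positivity)
  simp only [← Finset.mul_sum]
  rw [← mul_pow, mul_assoc C]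
  refine pow_le_pow_left₀ ?_ (mul_le_mul_of_nonneg_left (dsum1 N) hC.le) 2
  exact mul_nonneg hC.le (Finset.sum_nonneg fun _ _ => Finset.sum_nonneg fun _ _ => (rp_pos _ _).le)

lemma ch2_split (w N : ℕ) : ch2 4 N N ≤ 8 * Ex (d := 4) N (fun a => Ex N fun b =>
      (∑ i ∈ Finset.range (N + 1), ∑ j ∈ Finset.range (N + 1), Fn4 w (endp (a.take i) - endp (b.take j))) ^ 2)
    + 8 * Ex (d := 4) N (fun l => Ex N fun l' =>
      (∑ a ∈ rng l, ee (rng l) a * ∑ b ∈ rng l', ee (rng l') b * Gt w (a - b)) ^ 2) := by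
  unfold ch2
  simp only [← Ex_mul_left]
  rw [← Ex_add]
  refine Ex_mono fun a ha => ?_
  rw [← Ex_add]
  refine Ex_mono fun b hb => ?_
  set X := ∑ i ∈ Finset.range (N + 1), ∑ j ∈ Finset.range (N + 1), Fn4 w (endp (a.take i) - endp (b.take j)) with hX
  set Y := ∑ x ∈ rng a, ee (rng a) x * ∑ y ∈ rng b, ee (rng b) y * Gt w (x - y) with hY
  have h1 : KK (rng a) (rng b) ≤ X + Y := by
    rw [KK_eq]
    have h3 := GG_le a b ha hb (Fn4 w) (Fn4_nonneg w)
    refine le_trans ?_ (add_le_add_left h3 Y)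
    rw [hY]
    simp only [Finset.mul_sum]
    rw [← Finset.sum_add_distrib]
    refine Finset.sum_le_sum fun x _ => ?_
    rw [← Finset.sum_add_distrib]
    refine Finset.sum_le_sum fun y _ => ?_
    rw [G_Fn4 w]
    have e1 := ee_nonneg (rng a) x
    have e2 := ee_nonneg (rng b) y
    have e3 := ee_le_one (rng a) x
    have e4 := ee_le_one (rng b) y
    have e5 : ee (rng a) x * ee (rng b) y ≤ 1 := mul_le_one₀ e3 e2 e4
    nlinarith [Fn4_nonneg w (x - y)]
  have h2 := ch_le_two_KK (rng a) (rng b)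
  have h4 := ch_nonneg (rng a) (rng b)
  have h5 : ch (rng a) (rng b) ^ 2 ≤ (2 * (X + Y)) ^ 2 := pow_le_pow_left₀ h4 (by linarith) 2
  nlinarith [sq_nonneg (X - Y)]


lemma log4_le : ∀ᶠ b : ℕ in atTop, (Real.log b) ^ 4 ≤ (b : ℝ) := by
  have h := (Real.isLittleO_pow_log_id_atTop (n := 4)).bound (c := 1) one_pos
  have h2 := tendsto_natCast_atTop_atTop (R := ℝ) |>.eventually h
  filter_upwards [h2] with b hb
  simp only [Real.norm_eq_abs, id] at hb
  rw [one_mul, abs_of_nonneg (by positivity), abs_of_nonneg (by positivity)] at hb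
  exact hb

lemma crude4 : ∃ A : ℝ, 0 < A ∧ ∀ᶠ T : ℕ in atTop, cT 4 T * Real.log T ≤ A * T := by
  obtain ⟨e, he, h⟩ := mean_four
  refine ⟨e + 1, by linarith, ?_⟩
  filter_upwards [h.eventually (gt_mem_nhds (show e < e + 1 by linarith)), eventually_gt_atTop 0] with T hT h0
  have : (0 : ℝ) < T := by exact_mod_cast h0
  rw [div_lt_iff₀ this] at hT
  exact hT.le

lemma ch2_pow : ∃ C : ℝ, 0 < C ∧ ∀ᶠ b : ℕ in atTop, ch2 4 (b ^ 8) (b ^ 8) * (Real.log b) ^ 4 ≤ C * (((b ^ 8 : ℕ) : ℝ)) ^ 2 := by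
  obtain ⟨C1, h1, L1⟩ := Gt_lip
  obtain ⟨C2, h2, L2⟩ := far_S
  obtain ⟨C3, h3, L3⟩ := near_S
  obtain ⟨A, hA, LA⟩ := crude4
  set K2 : ℝ := 2 + 1 / cT 4 0 with hK2
  have K21 : 1 ≤ K2 := by
    have := one_div_pos.2 (cT_pos (d := 4) 0)
    linarith
  refine ⟨8 * (2 * C3) + 8 * (K2 ^ 2 * A ^ 4 * (8 * C2 + 128 * C1 ^ 2)), by positivity, ?_⟩
  filter_upwards [LA, log4_le, eventually_ge_atTop 1] with b hA4 hlog hb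
  have hbR : (1 : ℝ) ≤ b := by exact_mod_cast hb
  have hb0 : (0 : ℝ) < b := by linarith
  have hL : 0 ≤ Real.log b := Real.log_nonneg hbR
  have eN : b * b ^ 7 = b ^ 8 := by ring
  have hN1 : (1 : ℝ) ≤ (b : ℝ) ^ 8 := one_le_pow₀ hbR
  set g : ℝ := b * (C1 * (((b ^ 7 : ℕ) : ℝ) + 1) ^ (-(3 / 2) : ℝ)) with hg
  have g0 : 0 ≤ g := by positivity
  have gle : g * ((b : ℝ) ^ 8) ≤ C1 := by
    have e1 : (((b ^ 7 : ℕ) : ℝ) + 1) ^ (-(3 / 2) : ℝ) ≤ ((b : ℝ) ^ 6) ^ (-(3 / 2) : ℝ) := by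
      refine Real.rpow_le_rpow_of_nonpos (by positivity) ?_ (by norm_num)
      push_cast
      nlinarith [pow_pos hb0 6, pow_le_pow_right₀ hbR (show 6 ≤ 7 by norm_num)]
    have e2 : ((b : ℝ) ^ 6) ^ (-(3 / 2) : ℝ) = ((b : ℝ) ^ 9)⁻¹ := by
      rw [← Real.rpow_natCast, ← Real.rpow_natCast, ← Real.rpow_mul hb0.le, ← Real.rpow_neg hb0.le]
      norm_num
    rw [e2] at e1
    calc g * (b : ℝ) ^ 8 ≤ b * (C1 * ((b : ℝ) ^ 9)⁻¹) * (b : ℝ) ^ 8 := by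
          rw [hg]; gcongr
      _ = C1 := by field_simp
  have far := far_main (d := 4) b (b ^ 7) (Gt (b ^ 7)) g g0 (Gt_nonneg _) (Gt_neg _)
    (fun x l hl => by
      have := (abs_le.1 (L1 (b ^ 7) x l)).2
      have hl' : (l.length : ℝ) ≤ b := by exact_mod_cast hl
      have q : (0 : ℝ) ≤ C1 * (((b ^ 7 : ℕ) : ℝ) + 1) ^ (-(3 / 2) : ℝ) := by positivity
      have := mul_le_mul_of_nonneg_right hl' q
      linarith)
    (Nat.one_le_pow _ _ hb) K2 (C2 * (((b ^ 8 : ℕ) : ℝ) + 1) ^ 2) K21 (second_moment b)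
    (by rw [eN]; exact L2 _ _)
  rw [eN] at far
  have near := L3 (b ^ 7) (b ^ 8)
  have sp := ch2_split (b ^ 7) (b ^ 8)
  set X := Ex (d := 4) (b ^ 8) (fun a => Ex (b ^ 8) fun c =>
      (∑ i ∈ Finset.range (b ^ 8 + 1), ∑ j ∈ Finset.range (b ^ 8 + 1), Fn4 (b ^ 7) (endp (a.take i) - endp (c.take j))) ^ 2)
  set Y := Ex (d := 4) (b ^ 8) (fun l => Ex (b ^ 8) fun l' =>
      (∑ a ∈ rng l, ee (rng l) a * ∑ c ∈ rng l', ee (rng l') c * Gt (b ^ 7) (a - c)) ^ 2)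
  push_cast at near far ⊢
  have c0 := cT_nonneg (d := 4) b
  set c := cT 4 b
  set L := Real.log b
  have nX : X * L ^ 4 ≤ 2 * C3 * ((b : ℝ) ^ 8) ^ 2 := by
    calc X * L ^ 4 ≤ (C3 * ((b : ℝ) ^ 7 * ((b : ℝ) ^ 8 + 1))) * b := by
          refine mul_le_mul near hlog (by positivity) (by positivity)
      _ ≤ (C3 * ((b : ℝ) ^ 7 * (2 * (b : ℝ) ^ 8))) * b := by gcongr; linarith
      _ = _ := by ring
  have nY : Y * L ^ 4 ≤ K2 ^ 2 * A ^ 4 * (8 * C2 + 128 * C1 ^ 2) * ((b : ℝ) ^ 8) ^ 2 := by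
    have e1 : (b : ℝ) ^ 4 * Y ≤ (K2 * c ^ 2) ^ 2 * ((8 * C2 + 128 * C1 ^ 2) * ((b : ℝ) ^ 8) ^ 2) := by
      refine far.trans (mul_le_mul_of_nonneg_left ?_ (by positivity))
      have f1 : 8 * g * ((b : ℝ) * (b : ℝ) ^ 7) ^ 2 ≤ 8 * C1 * (b : ℝ) ^ 8 := by
        calc 8 * g * ((b : ℝ) * (b : ℝ) ^ 7) ^ 2 = 8 * (g * (b : ℝ) ^ 8) * (b : ℝ) ^ 8 := by ring
          _ ≤ _ := by gcongr
      have f2 : (8 * g * ((b : ℝ) * (b : ℝ) ^ 7) ^ 2) ^ 2 ≤ (8 * C1 * (b : ℝ) ^ 8) ^ 2 :=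
        pow_le_pow_left₀ (by positivity) f1 2
      have f3 : ((b : ℝ) ^ 8 + 1) ^ 2 ≤ (2 * (b : ℝ) ^ 8) ^ 2 := pow_le_pow_left₀ (by positivity) (by linarith) 2
      nlinarith
    have e2 : (c * L) ^ 4 ≤ (A * b) ^ 4 := pow_le_pow_left₀ (by positivity) hA4 4
    have e3 : (b : ℝ) ^ 4 * (Y * L ^ 4) ≤ (b : ℝ) ^ 4 * (K2 ^ 2 * A ^ 4 * (8 * C2 + 128 * C1 ^ 2) * ((b : ℝ) ^ 8) ^ 2) := by
      calc (b : ℝ) ^ 4 * (Y * L ^ 4) = (b : ℝ) ^ 4 * Y * L ^ 4 := by ring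
        _ ≤ (K2 * c ^ 2) ^ 2 * ((8 * C2 + 128 * C1 ^ 2) * ((b : ℝ) ^ 8) ^ 2) * L ^ 4 := by gcongr
        _ = K2 ^ 2 * (8 * C2 + 128 * C1 ^ 2) * ((b : ℝ) ^ 8) ^ 2 * (c * L) ^ 4 := by ring
        _ ≤ K2 ^ 2 * (8 * C2 + 128 * C1 ^ 2) * ((b : ℝ) ^ 8) ^ 2 * (A * b) ^ 4 := by gcongr
        _ = _ := by ring
    exact le_of_mul_le_mul_left e3 (by positivity)
  have := mul_le_mul_of_nonneg_right sp (show 0 ≤ L ^ 4 by positivity)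
  nlinarith

lemma ch2_four : ∃ D : ℝ, 0 < D ∧ ∀ᶠ n : ℕ in atTop, ch2 4 n n * (Real.log n) ^ 4 ≤ D * (n : ℝ) ^ 2 := by
  obtain ⟨C, hC, h⟩ := ch2_pow
  refine ⟨8 ^ 4 * C * 256 ^ 2, by positivity, ?_⟩
  obtain ⟨b0, hb0⟩ := eventually_atTop.1 h
  filter_upwards [eventually_ge_atTop ((b0 + 1) ^ 8), eventually_ge_atTop 1] with n hn hn1
  have hex : ∃ b : ℕ, n ≤ b ^ 8 := ⟨n, Nat.le_self_pow (by norm_num) n⟩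
  set b := Nat.find hex with hbdef
  have hb : n ≤ b ^ 8 := Nat.find_spec hex
  have hbb : b0 + 1 ≤ b := by
    by_contra hlt
    have : b ^ 8 < (b0 + 1) ^ 8 := Nat.pow_lt_pow_left (by omega) (by norm_num)
    omega
  have hb1 : b ^ 8 ≤ 256 * n := by
    have hmin : ¬ n ≤ (b - 1) ^ 8 := Nat.find_min hex (by omega)
    rcases Nat.lt_or_ge b 2 with h2 | h2
    · have : b = 1 := by omega
      rw [this]; omega
    · have : b ^ 8 ≤ (2 * (b - 1)) ^ 8 := Nat.pow_le_pow_left (by omega) 8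
      rw [mul_pow] at this
      norm_num at this
      omega
  have key := hb0 b (by omega)
  have hnR : (1 : ℝ) ≤ n := by exact_mod_cast hn1
  have hbR : (n : ℝ) ≤ (b : ℝ) ^ 8 := by exact_mod_cast hb
  have l1 : Real.log n ≤ 8 * Real.log b := by
    have := Real.log_le_log (by linarith) hbR
    rw [Real.log_pow] at this
    exact_mod_cast this
  have hch := ch2_mono (d := 4) hb hb
  have hch0 : 0 ≤ ch2 4 (b ^ 8) (b ^ 8) := Ex_nonneg fun _ _ => Ex_nonneg fun _ _ => sq_nonneg _
  have hln : 0 ≤ Real.log n := Real.log_nonneg hnR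
  have hb1R : ((b ^ 8 : ℕ) : ℝ) ≤ 256 * n := by exact_mod_cast hb1
  calc ch2 4 n n * Real.log n ^ 4 ≤ ch2 4 (b ^ 8) (b ^ 8) * (8 * Real.log b) ^ 4 := by gcongr
    _ = 8 ^ 4 * (ch2 4 (b ^ 8) (b ^ 8) * Real.log b ^ 4) := by ring
    _ ≤ 8 ^ 4 * (C * ((b ^ 8 : ℕ) : ℝ) ^ 2) := by gcongr
    _ ≤ 8 ^ 4 * (C * (256 * (n : ℝ)) ^ 2) := by gcongr
    _ = _ := by ring


lemma var_four : ∃ C : ℝ, 0 < C ∧ ∀ T : ℕ, vT 4 T * (Real.log T) ^ 4 ≤ C * (T : ℝ) ^ 2 := by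
  obtain ⟨D, hD, hch⟩ := ch2_four
  have hlog : ∀ᶠ T : ℕ in atTop, 100 * Real.log 3 ≤ Real.log T :=
    (Real.tendsto_log_atTop.comp tendsto_natCast_atTop_atTop).eventually_ge_atTop _
  obtain ⟨T0, hT0⟩ := eventually_atTop.1 (hch.and (hlog.and (eventually_ge_atTop 10)))
  set B := ∑ T ∈ Finset.range T0, vT 4 T * (Real.log T) ^ 4 with hB
  have tm : ∀ T : ℕ, 0 ≤ vT 4 T * (Real.log T) ^ 4 := fun T =>
    mul_nonneg (vT_nonneg T) (by positivity)
  have B0 : 0 ≤ B := Finset.sum_nonneg fun T _ => tm T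
  refine ⟨24 * D + B, by linarith, fun T => ?_⟩
  induction T using Nat.strong_induction_on with
  | _ T ih =>
    rcases Nat.lt_or_ge T T0 with hT | hT
    · rcases Nat.eq_zero_or_pos T with h0 | h0
      · subst h0; simp
      · have h1 : (1 : ℝ) ≤ T := by exact_mod_cast h0
        have h2 : vT 4 T * (Real.log T) ^ 4 ≤ B :=
          Finset.single_le_sum (f := fun T : ℕ => vT 4 T * (Real.log T) ^ 4) (fun i _ => tm i) (Finset.mem_range.2 hT)
        have : (1 : ℝ) ≤ (T : ℝ) ^ 2 := one_le_pow₀ h1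
        nlinarith
    · obtain ⟨c1, c2, c3⟩ := hT0 T hT
      set m := T / 2 with hm
      set n := T - T / 2 with hn
      have hmn : m + n = T := by omega
      have im := ih m (by omega)
      have iN := ih n (by omega)
      have sp := vT_split (d := 4) m n
      rw [hmn] at sp
      have cm := ch2_mono (d := 4) (show m ≤ T by omega) (show n ≤ T by omega)
      set L := Real.log T with hL
      have l3 : 0 < Real.log 3 := Real.log_pos (by norm_num)
      have hTR : (10 : ℝ) ≤ T := by exact_mod_cast c3
      have lk : ∀ k : ℕ, T ≤ 3 * k → 0.99 * L ≤ Real.log k := by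
        intro k hk
        have hk' : (T : ℝ) ≤ 3 * k := by exact_mod_cast hk
        have hk0 : (0 : ℝ) < k := by linarith
        have := Real.log_le_log (by linarith) hk'
        rw [Real.log_mul (by norm_num) hk0.ne'] at this
        linarith
      have L0 : 0 ≤ L := by linarith
      have pm : (0.99 * L) ^ 4 ≤ Real.log m ^ 4 := pow_le_pow_left₀ (by positivity) (lk m (by omega)) 4
      have pn : (0.99 * L) ^ 4 ≤ Real.log n ^ 4 := pow_le_pow_left₀ (by positivity) (lk n (by omega)) 4
      have q1 := (mul_le_mul_of_nonneg_left pm (vT_nonneg (d := 4) m)).trans im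
      have q2 := (mul_le_mul_of_nonneg_left pn (vT_nonneg (d := 4) n)).trans iN
      have hmn2 : (m : ℝ) ^ 2 + (n : ℝ) ^ 2 ≤ 0.505 * (T : ℝ) ^ 2 := by
        have e1 : (m : ℝ) + n = T := by exact_mod_cast hmn
        have e2 : (n : ℝ) ≤ m + 1 := by exact_mod_cast (show n ≤ m + 1 by omega)
        have e3 : (m : ℝ) ≤ n := by exact_mod_cast (show m ≤ n by omega)
        nlinarith
      set C := 24 * D + B with hC
      have C0 : 0 ≤ C := by linarith
      set L4 := L ^ 4 with hL4
      have hL40 : 0 ≤ L4 := by positivity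
      have q3 : (vT 4 m + vT 4 n) * L4 * 0.96 ≤ C * (0.505 * (T : ℝ) ^ 2) := by
        have e1 : (0.99 * L) ^ 4 = 0.99 ^ 4 * L4 := by rw [hL4]; ring
        rw [e1] at q1 q2
        have v0 : 0 ≤ (vT 4 m + vT 4 n) * L4 := mul_nonneg (add_nonneg (vT_nonneg m) (vT_nonneg n)) hL40
        have := mul_le_mul_of_nonneg_left hmn2 C0
        norm_num at *
        nlinarith
      have q4 : ch2 4 m n * L4 ≤ D * (T : ℝ) ^ 2 := (mul_le_mul_of_nonneg_right cm hL40).trans c1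
      have q5 := mul_le_mul_of_nonneg_right sp hL40
      have q6 : 0 ≤ B * (T : ℝ) ^ 2 := by positivity
      have q7 : 0 ≤ C * (T : ℝ) ^ 2 := by positivity
      have q8 : C * (T : ℝ) ^ 2 = 24 * (D * (T : ℝ) ^ 2) + B * (T : ℝ) ^ 2 := by rw [hC]; ring
      norm_num at q3
      nlinarith


section concl
variable {d : ℕ} [Fact (4 ≤ d)]

lemma concl {Pw : Zd d → Measure (ℕ → Zd d)} (hPw : IsSRWFamily d Pw) (ℓ ρ : ℕ → ℝ) (e C : ℝ) (he : 0 < e) (hC : 0 < C)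
    (hℓ : ∀ᶠ T in atTop, 0 < ℓ T) (hρ0 : ∀ᶠ T in atTop, 0 < ρ T) (hρ : Tendsto ρ atTop (𝓝 0))
    (hm : Tendsto (fun T : ℕ => cT d T * ℓ T / T) atTop (𝓝 e))
    (hv : ∀ᶠ T : ℕ in atTop, vT d T * ℓ T ^ 2 ≤ C * ρ T * (T : ℝ) ^ 2) :
    (∀ δ : ℝ, 0 < δ →
        Tendsto (fun T : ℕ =>
            ((Pw 0) {ω | δ <
              |capacity Pw (walkRange ω 0 T) * ℓ T / (T : ℝ) - e|}).toReal)
          atTop (𝓝 0)) ∧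
    (∀ δ : ℝ, 0 < δ → ∀ᶠ T : ℕ in atTop,
          ((Pw 0) {ω | δ * capExpect Pw T <
              |capacity Pw (walkRange ω 0 T) - capExpect Pw T|}).toReal <
            (4 * C / e ^ 2 + 1) / δ ^ 2 * ρ T) := by
  have : IsProbabilityMeasure (Pw 0) := (hPw 0).1
  refine ⟨fun δ hδ => ?_, fun δ hδ => ?_⟩
  · have hlim : Tendsto (fun T => 4 * C / δ ^ 2 * ρ T) atTop (𝓝 0) := by
      simpa using hρ.const_mul (4 * C / δ ^ 2)
    refine squeeze_zero' (Eventually.of_forall fun T => ENNReal.toReal_nonneg) ?_ hlim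
    have hm' := (Metric.tendsto_nhds.1 hm) (δ / 2) (by positivity)
    filter_upwards [hℓ, hv, hm', eventually_gt_atTop 0] with T h1 h2 h3 h4
    have hT : (0 : ℝ) < T := by exact_mod_cast h4
    rw [Real.dist_eq] at h3
    have ha : 0 < δ / 2 * (T / ℓ T) := by positivity
    have hsub : {ω | δ < |capacity Pw (walkRange ω 0 T) * ℓ T / (T : ℝ) - e|} ⊆
        {ω | δ / 2 * (T / ℓ T) < |capacity Pw (walkRange ω 0 T) - cT d T|} := by
      intro ω hω
      have hω' : δ < |capacity Pw (walkRange ω 0 T) * ℓ T / (T : ℝ) - e| := hω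
      show δ / 2 * (T / ℓ T) < |capacity Pw (walkRange ω 0 T) - cT d T|
      have e1 : capacity Pw (walkRange ω 0 T) * ℓ T / (T : ℝ) - e =
        (capacity Pw (walkRange ω 0 T) - cT d T) * (ℓ T / T) + (cT d T * ℓ T / T - e) := by ring
      have e2 := abs_add_le ((capacity Pw (walkRange ω 0 T) - cT d T) * (ℓ T / T)) (cT d T * ℓ T / T - e)
      rw [← e1, abs_mul, abs_of_pos (div_pos h1 hT)] at e2
      have e3 : δ / 2 < |capacity Pw (walkRange ω 0 T) - cT d T| * (ℓ T / T) := by linarith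
      have e4 : T / ℓ T * (ℓ T / T) = 1 := by field_simp
      have e5 : 0 < ℓ T / T := div_pos h1 hT
      refine lt_of_mul_lt_mul_right (a := ℓ T / T) ?_ e5.le
      rw [mul_assoc, e4, mul_one]
      exact e3
    refine (ENNReal.toReal_mono (measure_ne_top _ _) (measure_mono hsub)).trans ((cheb hPw T _ ha).trans ?_)
    rw [div_le_iff₀ (by positivity)]
    have : 4 * C / δ ^ 2 * ρ T * (δ / 2 * (T / ℓ T)) ^ 2 = C * ρ T * (T : ℝ) ^ 2 / ℓ T ^ 2 := by
      field_simp; ring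
    rw [this, le_div_iff₀ (by positivity)]
    exact h2
  · have hm' := hm.eventually (lt_mem_nhds (show e / 2 < e by linarith))
    filter_upwards [hℓ, hv, hm', eventually_gt_atTop 0, hρ0] with T h1 h2 h3 h4 h5
    have hT : (0 : ℝ) < T := by exact_mod_cast h4
    rw [capExpect_eq hPw]
    have hc := cT_pos (d := d) T
    refine (cheb hPw T _ (mul_pos hδ hc)).trans_lt ?_
    rw [lt_div_iff₀ hT] at h3
    rw [div_lt_iff₀ (by positivity)]
    have e1 : (4 * C / e ^ 2 + 1) / δ ^ 2 * ρ T * (δ * cT d T) ^ 2 = (4 * C / e ^ 2 + 1) * ρ T * cT d T ^ 2 := by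
      field_simp
    rw [e1]
    have e2 : (e / 2 * T) ^ 2 ≤ (cT d T * ℓ T) ^ 2 := pow_le_pow_left₀ (by positivity) h3.le 2
    have e3 : vT d T * ℓ T ^ 2 ≤ (4 * C / e ^ 2) * ρ T * cT d T ^ 2 * ℓ T ^ 2 := by
      calc _ ≤ C * ρ T * (T : ℝ) ^ 2 := h2
        _ = (4 * C / e ^ 2) * ρ T * (e / 2 * T) ^ 2 := by field_simp; ring
        _ ≤ (4 * C / e ^ 2) * ρ T * (cT d T * ℓ T) ^ 2 := by gcongr
        _ = _ := by ring
    have e4 := le_of_mul_le_mul_right e3 (by positivity)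
    have e5 : 0 < ρ T * cT d T ^ 2 := by positivity
    linarith
end concl

lemma logn_tendsto : Tendsto (fun T : ℕ => Real.log (T : ℝ)) atTop atTop :=
  Real.tendsto_log_atTop.comp tendsto_natCast_atTop_atTop

lemma log_div_tendsto : Tendsto (fun T : ℕ => Real.log (T : ℝ) / T) atTop (𝓝 0) := by
  have := (Real.isLittleO_log_id_atTop.tendsto_div_nhds_zero).comp (tendsto_natCast_atTop_atTop (R := ℝ))
  exact this

lemma mean_four' : ∃ e : ℝ, 0 < e ∧ Tendsto (fun T : ℕ => cT 4 T * (1 + Real.log T) / T) atTop (𝓝 e) := by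
  obtain ⟨e, he, h⟩ := mean_four
  refine ⟨e, he, ?_⟩
  have h1 : Tendsto (fun T : ℕ => 1 + (Real.log (T : ℝ))⁻¹) atTop (𝓝 1) := by
    simpa using (logn_tendsto.inv_tendsto_atTop).const_add 1
  have h2 := h.mul h1
  rw [mul_one] at h2
  refine h2.congr' ?_
  filter_upwards [logn_tendsto.eventually_gt_atTop 0, eventually_gt_atTop 0] with T hT h0
  have : (0 : ℝ) < T := by exact_mod_cast h0
  field_simp
  ring

lemma var_five' {d : ℕ} [Fact (4 ≤ d)] (h5 : 5 ≤ d) : ∃ C : ℝ, 0 < C ∧ ∀ᶠ T : ℕ in atTop, vT d T ≤ C * (T * Real.log T) := by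
  obtain ⟨C, hC, h⟩ := var_five h5
  refine ⟨C * 6, by positivity, ?_⟩
  filter_upwards [eventually_ge_atTop 3, logn_tendsto.eventually_ge_atTop 1] with T hT hl
  refine (h T (by omega)).trans ?_
  have hT' : (3 : ℝ) ≤ T := by exact_mod_cast hT
  have l1 : Real.log ((T : ℝ) + 1) ≤ 2 * Real.log T := by
    have : Real.log ((T : ℝ) + 1) ≤ Real.log ((T : ℝ) ^ 2) := Real.log_le_log (by positivity) (by nlinarith)
    rw [Real.log_pow] at this
    exact_mod_cast this
  have l2 : ((T : ℝ) + 1) * (1 + Real.log ((T : ℝ) + 1)) ≤ (2 * T) * (3 * Real.log T) := by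
    refine mul_le_mul (by linarith) (by linarith) ?_ (by positivity)
    have := Real.log_nonneg (show (1 : ℝ) ≤ T + 1 by linarith)
    linarith
  nlinarith

/-- **Proposition 2.2.** For `d ≥ 4`: (i) `E^0[cap(X[0,T])] = (1+o(1))·ε_d·T·(1+log T·1_{d=4})^{-1}`
with `ε_d ∈ (0,∞)`; (ii) `cap(X[0,T])·T^{-1}(1+log T·1_{d=4}) → ε_d` in probability;
(iii) a variance bound; (iv) a concentration bound. -/
theorem capacity_asymptotics
    (d : ℕ) (hd : 4 ≤ d)
    (Pw : Zd d → Measure (ℕ → Zd d)) (hPw : IsSRWFamily d Pw) :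
    ∃ εd : ℝ, 0 < εd ∧
      Tendsto (fun T : ℕ => capExpect Pw T * logFour d T / (T : ℝ)) atTop (𝓝 εd) ∧
      (∀ δ : ℝ, 0 < δ →
        Tendsto (fun T : ℕ =>
            ((Pw 0) {ω | δ <
              |capacity Pw (walkRange ω 0 T) * logFour d T / (T : ℝ) - εd|}).toReal)
          atTop (𝓝 0)) ∧
      ∃ C : ℝ, 0 < C ∧
        (∀ᶠ T : ℕ in atTop,
          variance (fun ω => capacity Pw (walkRange ω 0 T)) (Pw 0) <
            if d = 4 then C * (T : ℝ) ^ 2 / (Real.log T) ^ 4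
            else C * (T : ℝ) * Real.log T) ∧
        (∀ δ : ℝ, 0 < δ → ∀ᶠ T : ℕ in atTop,
          ((Pw 0) {ω | δ * capExpect Pw T <
              |capacity Pw (walkRange ω 0 T) - capExpect Pw T|}).toReal <
            if d = 4 then C / δ ^ 2 / (Real.log T) ^ 2
            else C / δ ^ 2 * Real.log T / (T : ℝ)) := by
  have : Fact (4 ≤ d) := ⟨hd⟩
  rcases Nat.eq_or_lt_of_le hd with h4 | h5
  · subst h4
    obtain ⟨e, he, hm⟩ := mean_four'
    obtain ⟨C, hC, hv⟩ := var_four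
    have hl : ∀ T : ℕ, logFour 4 T = 1 + Real.log T := fun T => by simp [logFour]
    have key := concl (d := 4) hPw (fun T => 1 + Real.log T) (fun T => 1 / (Real.log T) ^ 2) e (4 * C) he (by positivity)
      (by filter_upwards [logn_tendsto.eventually_gt_atTop 0] with T hT; linarith)
      (by filter_upwards [logn_tendsto.eventually_gt_atTop 0] with T hT; positivity)
      (by
        have := (logn_tendsto.inv_tendsto_atTop).pow 2
        simpa using this)
      hm
      (by
        filter_upwards [logn_tendsto.eventually_ge_atTop 1] with T hT
        have h0 : 0 < Real.log T := by linarith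
        have h1 : vT 4 T * (1 + Real.log T) ^ 2 ≤ vT 4 T * (2 * Real.log T) ^ 2 := by
          refine mul_le_mul_of_nonneg_left (pow_le_pow_left₀ (by linarith) (by linarith) 2) (vT_nonneg T)
        refine h1.trans ?_
        have h2 : 4 * C * (1 / Real.log T ^ 2) * (T : ℝ) ^ 2 = 4 * C * (T : ℝ) ^ 2 / Real.log T ^ 2 := by ring
        rw [h2, le_div_iff₀ (by positivity)]
        have h3 := hv T
        nlinarith)
    refine ⟨e, he, ?_, ?_, C + (4 * (4 * C) / e ^ 2 + 1), by positivity, ?_, ?_⟩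
    · simp only [hl, capExpect_eq hPw]; exact hm
    · simp only [hl]; exact key.1
    · filter_upwards [logn_tendsto.eventually_gt_atTop 0, eventually_gt_atTop 0] with T hT h0
      have hT0 : (0 : ℝ) < T := by exact_mod_cast h0
      rw [variance_eq' hPw, if_pos rfl, lt_div_iff₀ (by positivity)]
      refine (hv T).trans_lt ?_
      have : 0 < (4 * (4 * C) / e ^ 2 + 1) * (T : ℝ) ^ 2 := by positivity
      linarith
    · intro δ hδ
      filter_upwards [key.2 δ hδ, logn_tendsto.eventually_gt_atTop 0] with T hT h0
      rw [if_pos rfl]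
      refine hT.trans_le ?_
      rw [mul_one_div]
      exact div_le_div_of_nonneg_right (div_le_div_of_nonneg_right (by linarith) (by positivity)) (by positivity)
  · have h5' : 5 ≤ d := h5
    have hne : d ≠ 4 := by omega
    obtain ⟨e, he, hm⟩ := mean_five (d := d) h5'
    obtain ⟨C, hC, hv⟩ := var_five' (d := d) h5'
    have hl : ∀ T : ℕ, logFour d T = 1 := fun T => by simp [logFour, hne]
    have key := concl (d := d) hPw (fun T => 1) (fun T => Real.log T / T) e C he hC
      (Eventually.of_forall fun T => one_pos)
      (by
        filter_upwards [logn_tendsto.eventually_gt_atTop 0, eventually_gt_atTop 0] with T hT h0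
        have hT0 : (0 : ℝ) < T := by exact_mod_cast h0
        positivity)
      log_div_tendsto
      (by simpa using hm)
      (by
        filter_upwards [hv, eventually_gt_atTop 0] with T hT h0
        have hT0 : (0 : ℝ) < T := by exact_mod_cast h0
        have h2 : C * (Real.log T / T) * (T : ℝ) ^ 2 = C * (T * Real.log T) := by field_simp
        rw [h2]
        simpa using hT)
    refine ⟨e, he, ?_, ?_, C + (4 * C / e ^ 2 + 1), by positivity, ?_, ?_⟩
    · simp only [hl, capExpect_eq hPw, mul_one]; exact hm
    · simp only [hl]; exact key.1
    · filter_upwards [hv, logn_tendsto.eventually_gt_atTop 0, eventually_gt_atTop 0] with T h1 hT h0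
      have hT0 : (0 : ℝ) < T := by exact_mod_cast h0
      rw [variance_eq' hPw, if_neg hne]
      refine h1.trans_lt ?_
      have : 0 < (4 * C / e ^ 2 + 1) * (T * Real.log T) := by positivity
      linarith
    · intro δ hδ
      filter_upwards [key.2 δ hδ, logn_tendsto.eventually_gt_atTop 0] with T hT h0
      rw [if_neg hne]
      refine hT.trans_le ?_
      refine le_of_le_of_eq ?_ (mul_div_assoc _ _ _).symm
      exact mul_le_mul_of_nonneg_right (div_le_div_of_nonneg_right (by linarith) (by positivity))
        (div_nonneg h0.le (Nat.cast_nonneg _))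

end FRIPaper
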